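/- Let N and m be positive integers satisfying Condition (**). Then lim_{X→∞} (1/#N⁺(X,m,N)) Σ_{Δ ∈ N⁺(X,m,N)} h₃(Δ) = 4/3. -/

import Mathlib

open Filter IntermediateField

/-- A square root of the integer `m` in `ℂ`. -/
noncomputable def sqrtC (m : ℤ) : ℂ := (m : ℂ) ^ (2⁻¹ : ℂ)

/-- The quadratic field `ℚ(√m)`, realized as a subfield of `ℂ`. -/
noncomputable def quadField (m : ℤ) : IntermediateField ℚ ℂ := ℚ⟮sqrtC m⟯

/-- `h₃(Δ)`: the number of elements of order dividing `3` in the ideal class group of the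
quadratic field `ℚ(√Δ)` (for a fundamental discriminant `Δ`, this is the quadratic field
of discriminant `Δ`). -/
noncomputable def h3 (Δ : ℤ) : ℕ :=
  Nat.card {x : ClassGroup (NumberField.RingOfIntegers (quadField Δ)) // x ^ 3 = 1}

/-- An integer is a fundamental discriminant if it is the discriminant of a quadratic
number field: `Δ ≠ 1` and either `Δ` is square-free with `Δ ≡ 1 (mod 4)`, or `Δ = 4·m'`
with `m'` square-free and `m' ≡ 2` or `3 (mod 4)`. -/
def IsFundamentalDiscriminant (Δ : ℤ) : Prop :=
  Δ ≠ 1 ∧ ((Squarefree Δ ∧ Δ % 4 = 1) ∨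
    ∃ m' : ℤ, Δ = 4 * m' ∧ Squarefree m' ∧ (m' % 4 = 2 ∨ m' % 4 = 3))

/-- `Nplus X m N` is the set of fundamental discriminants `Δ` with `0 < Δ < X` and
`Δ ≡ m (mod N)`. -/
def Nplus (X : ℝ) (m N : ℕ) : Set ℤ :=
  {Δ : ℤ | 0 < Δ ∧ (Δ : ℝ) < X ∧ IsFundamentalDiscriminant Δ ∧ Δ ≡ (m : ℤ) [ZMOD (N : ℤ)]}

/-- Condition (**) on the positive integers `m` and `N`: every odd prime dividing both
`m` and `N` has `p² ∣ N` and `p² ∤ m`; and if `N` is even then either `4 ∣ N` and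
`m ≡ 1 (mod 4)`, or `16 ∣ N` and `m ≡ 8` or `12 (mod 16)`. -/
def CondStarStar (m N : ℕ) : Prop :=
  (∀ p : ℕ, p.Prime → Odd p → p ∣ m → p ∣ N → p ^ 2 ∣ N ∧ ¬ p ^ 2 ∣ m) ∧
    (2 ∣ N → (4 ∣ N ∧ m % 4 = 1) ∨ (16 ∣ N ∧ (m % 16 = 8 ∨ m % 16 = 12)))

namespace NH

/-- reduced discriminant of `a x³+3b x²y+3c xy²+d y³` -/
def D4 {R : Type*} [CommRing R] (f : Fin 4 → R) : R :=
  f 0 ^ 2 * f 3 ^ 2 - 6 * f 0 * f 1 * f 2 * f 3 - 3 * f 1 ^ 2 * f 2 ^ 2 + 4 * f 0 * f 2 ^ 3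
    + 4 * f 1 ^ 3 * f 3

/-- substitution `x ↦ p x + q y`, `y ↦ r x + s y` -/
def act {R : Type*} [CommRing R] (p q r s : R) (f : Fin 4 → R) : Fin 4 → R :=
  ![f 0 * p ^ 3 + 3 * f 1 * p ^ 2 * r + 3 * f 2 * p * r ^ 2 + f 3 * r ^ 3,
    f 0 * p ^ 2 * q + f 1 * (p ^ 2 * s + 2 * p * q * r) + f 2 * (2 * p * r * s + q * r ^ 2)
      + f 3 * r ^ 2 * s,
    f 0 * p * q ^ 2 + f 1 * (q ^ 2 * r + 2 * p * q * s) + f 2 * (2 * q * r * s + p * s ^ 2)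
      + f 3 * r * s ^ 2,
    f 0 * q ^ 3 + 3 * f 1 * q ^ 2 * s + 3 * f 2 * q * s ^ 2 + f 3 * s ^ 3]

theorem D4_act {R : Type*} [CommRing R] (p q r s : R) (f : Fin 4 → R) :
    D4 (act p q r s f) = (p * s - q * r) ^ 6 * D4 f := by
  simp [D4, act]; ring

theorem ext4 {R : Type*} {f g : Fin 4 → R} (h0 : f 0 = g 0) (h1 : f 1 = g 1) (h2 : f 2 = g 2)
    (h3 : f 3 = g 3) : f = g := by
  funext i; fin_cases i <;> assumption

theorem act_act {R : Type*} [CommRing R] (p q r s p' q' r' s' : R) (f : Fin 4 → R) :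
    act p' q' r' s' (act p q r s f) =
      act (p * p' + q * r') (p * q' + q * s') (r * p' + s * r') (r * q' + s * s') f := by
  apply ext4 <;> simp [act] <;> ring

theorem act_one {R : Type*} [CommRing R] (f : Fin 4 → R) : act 1 0 0 1 f = f := by
  apply ext4 <;> simp [act]

theorem act_neg_one {R : Type*} [CommRing R] (f : Fin 4 → R) : act (-1) 0 0 (-1) f = -f := by
  apply ext4 <;> simp [act] <;> ring

theorem D4_neg {R : Type*} [CommRing R] (f : Fin 4 → R) : D4 (-f) = D4 f := by
  simp [D4]; try ring

theorem act_inv {R : Type*} [CommRing R] {p q r s : R} (h : p * s - q * r = 1) (f : Fin 4 → R) :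
    act s (-q) (-r) p (act p q r s f) = f := by
  rw [act_act]
  have e1 : p * s + q * -r = 1 := by linear_combination h
  have e2 : p * -q + q * p = 0 := by ring
  have e3 : r * s + s * -r = 0 := by ring
  have e4 : r * -q + s * p = 1 := by linear_combination h
  rw [e1, e2, e3, e4, act_one]

/-- SL2(Z) equivalence -/
def Eqv (f g : Fin 4 → ℤ) : Prop := ∃ p q r s : ℤ, p * s - q * r = 1 ∧ g = act p q r s f

theorem Eqv.refl (f : Fin 4 → ℤ) : Eqv f f := ⟨1, 0, 0, 1, by norm_num, (act_one f).symm⟩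

theorem Eqv.symm {f g : Fin 4 → ℤ} (h : Eqv f g) : Eqv g f := by
  obtain ⟨p, q, r, s, h1, rfl⟩ := h
  exact ⟨s, -q, -r, p, by linear_combination h1, (act_inv h1 f).symm⟩

theorem Eqv.trans {f g h : Fin 4 → ℤ} (h1 : Eqv f g) (h2 : Eqv g h) : Eqv f h := by
  obtain ⟨p, q, r, s, e, rfl⟩ := h1
  obtain ⟨p', q', r', s', e', rfl⟩ := h2
  refine ⟨_, _, _, _, ?_, act_act _ _ _ _ _ _ _ _ f⟩
  linear_combination (p' * s' - q' * r') * e + e'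

theorem Eqv.neg (f : Fin 4 → ℤ) : Eqv f (-f) :=
  ⟨-1, 0, 0, -1, by norm_num, (act_neg_one f).symm⟩

theorem Eqv.D4_eq {f g : Fin 4 → ℤ} (h : Eqv f g) : D4 g = D4 f := by
  obtain ⟨p, q, r, s, e, rfl⟩ := h
  rw [D4_act, e]; ring

theorem D4_intCast (f : Fin 4 → ℤ) : ((D4 f : ℤ) : ℝ) = D4 (fun i => (f i : ℝ)) := by
  simp [D4]; try ring

/-- `(s x + r y)(x² + B xy + C y²)`, coordinates `v = (s, r, B, C)` -/
noncomputable def Phi (v : Fin 4 → ℝ) : Fin 4 → ℝ :=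
  ![v 0, (v 0 * v 2 + v 1) / 3, (v 0 * v 3 + v 1 * v 2) / 3, v 1 * v 3]

noncomputable def Res (v : Fin 4 → ℝ) : ℝ := v 0 ^ 2 * v 3 - v 0 * v 1 * v 2 + v 1 ^ 2

theorem D4_Phi (v : Fin 4 → ℝ) :
    27 * D4 (Phi v) = (4 * v 3 - v 2 ^ 2) * Res v ^ 2 := by
  simp [D4, Phi, Res]; ring

/-- reduced with parameters -/
def RedBy (f : Fin 4 → ℤ) (v : Fin 4 → ℝ) : Prop :=
  |v 2| ≤ 1 ∧ 1 ≤ v 3 ∧ (fun i => (f i : ℝ)) = Phi v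

def Red (f : Fin 4 → ℤ) : Prop := ∃ v, RedBy f v

theorem RedBy.eqs {f : Fin 4 → ℤ} {v : Fin 4 → ℝ} (h : RedBy f v) :
    (f 0 : ℝ) = v 0 ∧ 3 * (f 1 : ℝ) = v 0 * v 2 + v 1 ∧ 3 * (f 2 : ℝ) = v 0 * v 3 + v 1 * v 2 ∧
      (f 3 : ℝ) = v 1 * v 3 := by
  have := h.2.2
  have h0 := congrFun this 0
  have h1 := congrFun this 1
  have h2 := congrFun this 2
  have h3 := congrFun this 3
  simp [Phi] at h0 h1 h2 h3
  exact ⟨h0, by linarith, by linarith, h3⟩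

theorem RedBy.disc {f : Fin 4 → ℤ} {v : Fin 4 → ℝ} (h : RedBy f v) :
    27 * ((D4 f : ℤ) : ℝ) = (4 * v 3 - v 2 ^ 2) * Res v ^ 2 := by
  rw [D4_intCast, h.2.2, D4_Phi]

end NH

namespace NH

theorem exists_cubic_root (a b c d : ℝ) (ha : a ≠ 0) :
    ∃ x : ℝ, a * x ^ 3 + 3 * b * x ^ 2 + 3 * c * x + d = 0 := by
  wlog hpos : 0 < a generalizing a b c d
  · obtain ⟨x, hx⟩ := this (-a) (-b) (-c) (-d) (by simpa using ha)
      (by rcases lt_or_gt_of_ne ha with h | h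
          · linarith
          · exact absurd h hpos)
    exact ⟨x, by linarith⟩
  set R : ℝ := (3 * |b| + 3 * |c| + |d|) / a + 1 with hR
  have hR1 : 1 ≤ R := by
    have : 0 ≤ (3 * |b| + 3 * |c| + |d|) / a := by positivity
    linarith
  have haR : a * R = 3 * |b| + 3 * |c| + |d| + a := by rw [hR]; field_simp
  have hc : Continuous fun x : ℝ => a * x ^ 3 + 3 * b * x ^ 2 + 3 * c * x + d := by fun_prop
  have hR2 : R ≤ R ^ 2 := by nlinarith
  have k1 : -(|b| * R ^ 2) ≤ b * R ^ 2 ∧ b * R ^ 2 ≤ |b| * R ^ 2 := by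
    constructor <;> nlinarith [neg_abs_le b, le_abs_self b, sq_nonneg R]
  have k2 : -(|c| * R ^ 2) ≤ c * R ∧ c * R ≤ |c| * R ^ 2 := by
    have := abs_nonneg c
    constructor <;> nlinarith [neg_abs_le c, le_abs_self c]
  have k3 : -(|d| * R ^ 2) ≤ d ∧ d ≤ |d| * R ^ 2 := by
    have := abs_nonneg d
    constructor <;> nlinarith [neg_abs_le d, le_abs_self d]
  have e : a * R ^ 3 = (3 * |b| + 3 * |c| + |d| + a) * R ^ 2 := by rw [← haR]; ring
  have hu : 0 ≤ a * R ^ 3 + 3 * b * R ^ 2 + 3 * c * R + d := by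
    nlinarith [k1.1, k2.1, k3.1, mul_nonneg hpos.le (sq_nonneg R)]
  have hl : a * (-R) ^ 3 + 3 * b * (-R) ^ 2 + 3 * c * (-R) + d ≤ 0 := by
    have : a * (-R) ^ 3 = -(a * R ^ 3) := by ring
    rw [this, e]
    nlinarith [k1.2, k2.1, k3.2, mul_nonneg hpos.le (sq_nonneg R)]
  obtain ⟨x, -, hx⟩ := intermediate_value_Icc (by linarith : -R ≤ R) hc.continuousOn ⟨hl, hu⟩
  exact ⟨x, hx⟩

theorem exists_Phi (g : Fin 4 → ℝ) (h : 0 < D4 g) : ∃ v, g = Phi v ∧ v 2 ^ 2 < 4 * v 3 := by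
  have key : ∃ v, g = Phi v := by
    by_cases ha : g 0 = 0
    · have hb : g 1 ≠ 0 := by
        intro hb; simp [D4, ha, hb] at h
      refine ⟨![0, 3 * g 1, g 2 / g 1, g 3 / (3 * g 1)], ?_⟩
      apply ext4 <;> simp [Phi, ha] <;> field_simp
    · obtain ⟨x, hx⟩ := exists_cubic_root (g 0) (g 1) (g 2) (g 3) ha
      refine ⟨![g 0, -(g 0 * x), 3 * g 1 / g 0 + x, 3 * g 2 / g 0 + x * (3 * g 1 / g 0 + x)], ?_⟩
      apply ext4 <;> simp [Phi]
      · field_simp; ring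
      · field_simp; ring
      · field_simp; linear_combination hx
  obtain ⟨v, rfl⟩ := key
  refine ⟨v, rfl, ?_⟩
  have := D4_Phi v
  by_contra hcon
  push Not at hcon
  nlinarith [mul_nonneg (by linarith : 0 ≤ v 2 ^ 2 - 4 * v 3) (sq_nonneg (Res v))]

noncomputable def Qv (v : Fin 4 → ℝ) (x y : ℝ) : ℝ := x ^ 2 + v 2 * x * y + v 3 * y ^ 2

theorem Qv_pos {v : Fin 4 → ℝ} (hv : v 2 ^ 2 < 4 * v 3) {x y : ℝ} (h : x ≠ 0 ∨ y ≠ 0) :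
    0 < Qv v x y := by
  unfold Qv
  by_cases hy : y = 0
  · have : x ≠ 0 := by tauto
    subst hy; simp; positivity
  · have : 0 < y ^ 2 := by positivity
    nlinarith [sq_nonneg (2 * x + v 2 * y)]

noncomputable def actv (p q r s : ℝ) (v : Fin 4 → ℝ) : Fin 4 → ℝ :=
  ![Qv v p r * (v 0 * p + v 1 * r), Qv v p r * (v 0 * q + v 1 * s),
    (2 * p * q + v 2 * (p * s + q * r) + 2 * v 3 * r * s) / Qv v p r, Qv v q s / Qv v p r]

theorem act_Phi (p q r s : ℝ) (v : Fin 4 → ℝ) (hm : Qv v p r ≠ 0) :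
    act p q r s (Phi v) = Phi (actv p q r s v) := by
  apply ext4 <;> simp [Phi, act, actv] <;> field_simp <;> simp only [Qv] <;> ring

theorem actv_disc (p q r s : ℝ) (h : p * s - q * r = 1) (v : Fin 4 → ℝ) (hm : Qv v p r ≠ 0) :
    4 * actv p q r s v 3 - actv p q r s v 2 ^ 2 = (4 * v 3 - v 2 ^ 2) / Qv v p r ^ 2 := by
  have e : 4 * actv p q r s v 3 - actv p q r s v 2 ^ 2
      = (4 * v 3 - v 2 ^ 2) * (p * s - q * r) ^ 2 / Qv v p r ^ 2 := by
    simp [actv]; field_simp; simp only [Qv]; ring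
  rw [e, h]; ring

theorem Phi_inj {v w : Fin 4 → ℝ} (hv : v 2 ^ 2 < 4 * v 3) (hw : w 2 ^ 2 < 4 * w 3)
    (h0 : v 0 ≠ 0 ∨ v 1 ≠ 0) (h : Phi v = Phi w) : v = w := by
  have a0 := congrFun h 0
  have a1 := congrFun h 1
  have a2 := congrFun h 2
  have a3 := congrFun h 3
  simp [Phi] at a0 a1 a2 a3
  have b1 : v 0 * v 2 + v 1 = w 0 * w 2 + w 1 := by linarith
  have b2 : v 0 * v 3 + v 1 * v 2 = w 0 * w 3 + w 1 * w 2 := by linarith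
  clear a1 a2
  have e1 : v 1 = w 1 := by
    by_cases hs : v 0 = 0
    · rw [hs] at b1 a0; rw [← a0] at b1; linarith
    · have hp : 0 < v 1 ^ 2 - w 2 * v 1 * v 0 + w 3 * v 0 ^ 2 := by
        have : 0 < v 0 ^ 2 := by positivity
        nlinarith [sq_nonneg (2 * v 1 - w 2 * v 0)]
      have : (v 1 ^ 2 - w 2 * v 1 * v 0 + w 3 * v 0 ^ 2) * (w 1 - v 1) = 0 := by
        rw [← a0] at b1 b2
        linear_combination (-(v 1)^2) * b1 + v 0 * v 1 * b2 - v 0 ^ 2 * a3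
      rcases mul_eq_zero.1 this with h | h
      · linarith
      · linarith
  rw [← a0, ← e1] at b1 b2
  rw [← e1] at a3
  have e2 : v 2 = w 2 := by
    by_cases hs : v 0 = 0
    · have h1 : v 1 ≠ 0 := by tauto
      rw [hs] at b2
      apply mul_left_cancel₀ h1; linarith
    · apply mul_left_cancel₀ hs; linarith
  have e3 : v 3 = w 3 := by
    by_cases hs : v 0 = 0
    · have h1 : v 1 ≠ 0 := by tauto
      exact mul_left_cancel₀ h1 a3
    · rw [e2] at b2
      apply mul_left_cancel₀ hs; linarith
  exact ext4 a0 e1 e2 e3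

theorem act_intCast (p q r s : ℤ) (f : Fin 4 → ℤ) :
    (fun i => ((act p q r s f i : ℤ) : ℝ)) = act (p : ℝ) q r s (fun i => (f i : ℝ)) := by
  apply ext4 <;> simp [act]

theorem ne_zero_of_det {p q r s : ℤ} (h : p * s - q * r = 1) : (p : ℝ) ≠ 0 ∨ (r : ℝ) ≠ 0 := by
  by_contra hc
  push Not at hc
  obtain ⟨h1, h2⟩ := hc
  have h1 : p = 0 := by exact_mod_cast h1
  have h2 : r = 0 := by exact_mod_cast h2
  simp [h1, h2] at h

open UpperHalfPlane in
theorem exists_reduced_matrix (B C : ℝ) (h : B ^ 2 < 4 * C) :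
    ∃ p q r s : ℤ, p * s - q * r = 1 ∧
      |2 * (p : ℝ) * q + B * (p * s + q * r) + 2 * C * r * s| ≤ p ^ 2 + B * p * r + C * r ^ 2 ∧
      (p : ℝ) ^ 2 + B * p * r + C * r ^ 2 ≤ q ^ 2 + B * q * s + C * s ^ 2 := by
  set y := Real.sqrt (4 * C - B ^ 2) with hy
  have hy0 : 0 < y := Real.sqrt_pos.2 (by linarith)
  have hy2 : y ^ 2 = 4 * C - B ^ 2 := Real.sq_sqrt (by linarith)
  let τ : ℍ := ⟨⟨-B / 2, y / 2⟩, by simpa using hy0⟩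
  obtain ⟨g, hg⟩ := ModularGroup.exists_smul_mem_fd τ
  have hdet := g.det_coe
  rw [Matrix.det_fin_two] at hdet
  refine ⟨g 1 1, -g 0 1, -g 1 0, g 0 0, by linear_combination hdet, ?_⟩
  set a := g 0 0
  set b := g 0 1
  set c := g 1 0
  set d := g 1 1
  have hτre : τ.re = -B / 2 := rfl
  have hτim : τ.im = y / 2 := rfl
  have hden : ((c : ℂ) * τ + d) ≠ 0 := by
    have := UpperHalfPlane.denom_ne_zero (g : GL (Fin 2) ℝ) τ
    simpa [UpperHalfPlane.denom] using this
  have hw : ((g • τ : ℍ) : ℂ) * ((c : ℂ) * τ + d) = a * τ + b := by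
    rw [UpperHalfPlane.coe_specialLinearGroup_apply]
    simp only [algebraMap_int_eq, eq_intCast, Complex.ofReal_intCast]
    rw [div_mul_cancel₀ _ hden]
  obtain ⟨h1, h2⟩ := hg
  have h2' : |((g • τ : ℍ) : ℂ).re| ≤ 1 / 2 := h2
  generalize hwd : ((g • τ : ℍ) : ℂ) = w at *
  have hm : (d : ℝ) ^ 2 + B * d * (-c) + C * (-c) ^ 2 = Complex.normSq ((c : ℂ) * τ + d) := by
    rw [Complex.normSq_apply]
    simp [hτre, hτim]
    linear_combination (-(c : ℝ) ^ 2 / 4) * hy2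
  have hmpos := Complex.normSq_pos.2 hden
  have hn := congrArg Complex.normSq hw
  rw [Complex.normSq_mul] at hn
  have hn2 : Complex.normSq ((a : ℂ) * τ + b) = (-b : ℝ) ^ 2 + B * (-b) * a + C * a ^ 2 := by
    rw [Complex.normSq_apply]
    simp [hτre, hτim]
    linear_combination ((a : ℝ) ^ 2 / 4) * hy2
  have hre : w.re * Complex.normSq ((c : ℂ) * τ + d) =
      (((a : ℂ) * τ + b) * (starRingEnd ℂ) ((c : ℂ) * τ + d)).re := by
    rw [← hw, mul_assoc, Complex.mul_conj]
    simp [Complex.mul_re]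
  have hre2 : (((a : ℂ) * τ + b) * (starRingEnd ℂ) ((c : ℂ) * τ + d)).re =
      -(2 * (d : ℝ) * (-b) + B * (d * a + (-b) * (-c)) + 2 * C * (-c) * a) / 2 := by
    simp [Complex.mul_re, hτre, hτim]
    linear_combination ((a : ℝ) * c / 4) * hy2
  push_cast
  rw [hm]
  constructor
  · have : 2 * (d : ℝ) * (-b) + B * (d * a + (-b) * (-c)) + 2 * C * (-c) * a
      = -2 * w.re * Complex.normSq ((c : ℂ) * τ + d) := by linarith
    rw [this, abs_mul, abs_mul, abs_of_pos hmpos]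
    have : |(-2 : ℝ)| = 2 := by norm_num
    rw [this]
    nlinarith
  · rw [← hn2, ← hn]
    nlinarith

theorem exists_red (f : Fin 4 → ℤ) (h : 0 < D4 f) : ∃ g, Eqv f g ∧ Red g := by
  have h' : 0 < D4 (fun i => (f i : ℝ)) := by rw [← D4_intCast]; exact_mod_cast h
  obtain ⟨v, hv, hd⟩ := exists_Phi _ h'
  obtain ⟨p, q, r, s, hdet, h1, h2⟩ := exists_reduced_matrix (v 2) (v 3) hd
  have hm := Qv_pos hd (ne_zero_of_det hdet)
  refine ⟨act p q r s f, ⟨p, q, r, s, hdet, rfl⟩, actv p q r s v, ?_, ?_, ?_⟩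
  · simp only [actv, Matrix.cons_val]
    rw [abs_div, abs_of_pos hm, div_le_one hm]
    exact h1
  · simp only [actv, Matrix.cons_val]
    rw [le_div_iff₀ hm, one_mul]
    exact h2
  · rw [act_intCast, hv, act_Phi _ _ _ _ _ hm.ne']

end NH

namespace NH

theorem RedBy.sq_lt {f : Fin 4 → ℤ} {v : Fin 4 → ℝ} (h : RedBy f v) : v 2 ^ 2 < 4 * v 3 := by
  have h1 := h.1
  have h2 := h.2.1
  have : v 2 ^ 2 ≤ 1 := by rw [← sq_abs]; nlinarith [abs_nonneg (v 2)]
  linarith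

theorem RedBy.ne {f : Fin 4 → ℤ} {v : Fin 4 → ℝ} (h : RedBy f v) (hD : 0 < D4 f) :
    v 0 ≠ 0 ∨ v 1 ≠ 0 := by
  by_contra hc
  push Not at hc
  have e := h.disc
  simp [Res, hc.1, hc.2] at e
  omega

theorem int_quad_ge_one {x y : ℤ} (h : x ≠ 0 ∨ y ≠ 0) : 1 ≤ x ^ 2 - |x * y| + y ^ 2 := by
  rcases abs_cases (x * y) with ⟨e, _⟩ | ⟨e, _⟩ <;> rw [e] <;> by_contra hc <;> push Not at hc
  · have h1 : x ^ 2 - x * y + y ^ 2 ≤ 0 := by omega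
    have hx : x = 0 := by nlinarith [sq_nonneg (x - 2 * y), sq_nonneg x]
    have hy : y = 0 := by subst hx; nlinarith
    simp_all
  · have h1 : x ^ 2 + x * y + y ^ 2 ≤ 0 := by linarith
    have hx : x = 0 := by nlinarith [sq_nonneg (x + 2 * y), sq_nonneg x]
    have hy : y = 0 := by subst hx; nlinarith
    simp_all

theorem Qv_ge {v : Fin 4 → ℝ} (h1 : |v 2| ≤ 1) (x y : ℤ) :
    ((x ^ 2 - |x * y| + y ^ 2 : ℤ) : ℝ) + (v 3 - 1) * (y : ℝ) ^ 2 ≤ Qv v x y := by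
  have : -|(x : ℝ) * y| ≤ v 2 * x * y := by
    have h2 : |v 2 * (x * y)| ≤ 1 * |(x : ℝ) * y| := by
      rw [abs_mul]; exact mul_le_mul_of_nonneg_right h1 (abs_nonneg _)
    have := neg_abs_le (v 2 * (x * y))
    rw [mul_assoc]; linarith
  unfold Qv
  push_cast
  rw [abs_mul] at *
  linarith

theorem Qv_ge_one {v : Fin 4 → ℝ} (h1 : |v 2| ≤ 1) (h2 : 1 ≤ v 3) {x y : ℤ}
    (h : x ≠ 0 ∨ y ≠ 0) : 1 ≤ Qv v x y := by
  have := Qv_ge h1 x y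
  have h3 : (1 : ℝ) ≤ ((x ^ 2 - |x * y| + y ^ 2 : ℤ) : ℝ) := by exact_mod_cast int_quad_ge_one h
  nlinarith [mul_nonneg (sub_nonneg.2 h2) (sq_nonneg (y : ℝ))]

theorem det_ne {p q r s : ℤ} (h : p * s - q * r = 1) : p ≠ 0 ∨ r ≠ 0 := by
  by_contra hc
  push Not at hc
  simp [hc.1, hc.2] at h

theorem redBy_act {f : Fin 4 → ℤ} {v w : Fin 4 → ℝ} (hD : 0 < D4 f) (hf : RedBy f v)
    {p q r s : ℤ} (hdet : p * s - q * r = 1) (hg : RedBy (act p q r s f) w) :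
    w = actv p q r s v := by
  have hm := Qv_pos hf.sq_lt (ne_zero_of_det hdet)
  have hD' : 0 < D4 (act p q r s f) := by rw [D4_act, hdet]; simpa using hD
  refine Phi_inj hg.sq_lt ?_ (hg.ne hD') ?_
  · have := actv_disc (p : ℝ) q r s (by exact_mod_cast hdet) v hm.ne'
    have h2 : 0 < (4 * v 3 - v 2 ^ 2) / Qv v p r ^ 2 := by
      have := hf.sq_lt
      apply div_pos (by linarith) (by positivity)
    linarith
  · rw [← hg.2.2, act_intCast, hf.2.2, act_Phi _ _ _ _ _ hm.ne']

theorem Qv_le_one_of_red {f : Fin 4 → ℤ} {v w : Fin 4 → ℝ} (hD : 0 < D4 f) (hf : RedBy f v)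
    {p q r s : ℤ} (hdet : p * s - q * r = 1) (hg : RedBy (act p q r s f) w) :
    Qv v p r = 1 ∧ Qv w s (-r : ℤ) = 1 := by
  have hD' : 0 < D4 (act p q r s f) := by rw [D4_act, hdet]; simpa using hD
  have e1 := redBy_act hD hf hdet hg
  have hdet' : s * p - (-q) * (-r) = 1 := by linear_combination hdet
  have e2 := redBy_act hD' hg hdet' (w := v) (by rw [act_inv hdet]; exact hf)
  have m1 : 1 ≤ Qv v p r := Qv_ge_one hf.1 hf.2.1 (det_ne hdet)
  have m2 : 1 ≤ Qv w s (-r : ℤ) := Qv_ge_one hg.1 hg.2.1 (det_ne hdet')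
  have d1 := actv_disc (p : ℝ) q r s (by exact_mod_cast hdet) v (by positivity)
  have d2 := actv_disc (s : ℝ) (-q : ℤ) (-r : ℤ) p (by exact_mod_cast hdet') w (by positivity)
  rw [← e1] at d1
  rw [← e2] at d2
  have hv := hf.sq_lt
  have hw := hg.sq_lt
  rw [eq_div_iff (by positivity)] at d1 d2
  have hprod : (4 * w 3 - w 2 ^ 2) * ((Qv v p r) ^ 2 * (Qv w s (-r : ℤ)) ^ 2 - 1) = 0 := by
    rw [← d2] at d1
    have : (4 * v 3 - v 2 ^ 2) = (4 * w 3 - w 2 ^ 2) * Qv v p r ^ 2 := by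
      rw [← d1, d2]
    linear_combination d2 - (Qv w s (-r : ℤ)) ^ 2 * this
  have h0 : (Qv v p r) ^ 2 * (Qv w s (-r : ℤ)) ^ 2 = 1 := by
    rcases mul_eq_zero.1 hprod with h | h <;> linarith
  have h1 : (Qv v p r) * (Qv w s (-r : ℤ)) = 1 := by
    have : ((Qv v p r) * (Qv w s (-r : ℤ))) ^ 2 = 1 := by rw [mul_pow, h0]
    have hp : 0 ≤ (Qv v p r) * (Qv w s (-r : ℤ)) := by positivity
    exact (pow_eq_one_iff_of_nonneg hp two_ne_zero).1 this
  constructor <;> nlinarith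

theorem quad_small {x y : ℤ} (h : x ^ 2 - |x * y| + y ^ 2 ≤ 1) : |x| ≤ 1 ∧ |y| ≤ 1 := by
  rw [abs_le, abs_le]
  rcases abs_cases (x * y) with ⟨e, _⟩ | ⟨e, _⟩ <;> rw [e] at h <;> refine ⟨⟨?_, ?_⟩, ?_, ?_⟩ <;>
    by_contra hc <;> push Not at hc <;>
    nlinarith [sq_nonneg (x - 2 * y), sq_nonneg (x + 2 * y), sq_nonneg (2 * x - y),
      sq_nonneg (2 * x + y)]

theorem red_entries {f : Fin 4 → ℤ} {v w : Fin 4 → ℝ} (hD : 0 < D4 f) (hf : RedBy f v)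
    {p q r s : ℤ} (hdet : p * s - q * r = 1) (hg : RedBy (act p q r s f) w) :
    |p| ≤ 1 ∧ |q| ≤ 2 ∧ |r| ≤ 1 ∧ |s| ≤ 1 := by
  obtain ⟨h1, h2⟩ := Qv_le_one_of_red hD hf hdet hg
  have k1 := Qv_ge hf.1 p r
  have k2 := Qv_ge hg.1 s (-r)
  have hv3 := hf.2.1
  have hw3 := hg.2.1
  have a1 : p ^ 2 - |p * r| + r ^ 2 ≤ 1 := by
    have : ((p ^ 2 - |p * r| + r ^ 2 : ℤ) : ℝ) ≤ 1 := by
      nlinarith [mul_nonneg (sub_nonneg.2 hv3) (sq_nonneg (r : ℝ))]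
    exact_mod_cast this
  have a2 : s ^ 2 - |s * (-r)| + (-r) ^ 2 ≤ 1 := by
    have : ((s ^ 2 - |s * (-r)| + (-r) ^ 2 : ℤ) : ℝ) ≤ 1 := by
      nlinarith [mul_nonneg (sub_nonneg.2 hw3) (sq_nonneg ((-r : ℤ) : ℝ))]
    exact_mod_cast this
  obtain ⟨hp, hr⟩ := quad_small a1
  obtain ⟨hs, -⟩ := quad_small a2
  refine ⟨hp, ?_, hr, hs⟩
  by_cases hr0 : r = 0
  · subst hr0
    have e := congrFun (redBy_act hD hf hdet hg) 2
    simp only [actv, Matrix.cons_val] at e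
    rw [h1] at e
    have hps : (p : ℝ) * s = 1 := by have : p * s = 1 := by linarith
                                     exact_mod_cast this
    have : |2 * (p : ℝ) * q| ≤ 2 := by
      have : 2 * (p : ℝ) * q = w 2 - v 2 := by rw [e]; push_cast; linear_combination (-v 2) * hps
      rw [this]
      have := abs_sub (w 2) (v 2)
      linarith [hf.1, hg.1]
    have h3 : |2 * p * q| ≤ 2 := by exact_mod_cast this
    have hp1 : p = 1 ∨ p = -1 := Int.eq_one_or_neg_one_of_mul_eq_one (by linarith : p * s = 1)
    rcases hp1 with rfl | rfl <;> rw [abs_le] at * <;> omega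
  · rw [abs_le] at *
    have hr1 : r = 1 ∨ r = -1 := by omega
    have hs1 : s = 0 ∨ s = 1 ∨ s = -1 := by omega
    have hp1 : p = 0 ∨ p = 1 ∨ p = -1 := by omega
    rcases hr1 with rfl | rfl <;> rcases hs1 with rfl | rfl | rfl <;>
      rcases hp1 with rfl | rfl | rfl <;> omega

theorem red_interior {f : Fin 4 → ℤ} {v w : Fin 4 → ℝ} (hD : 0 < D4 f) (hf : RedBy f v)
    (hv2 : |v 2| < 1) (hv3 : 1 < v 3)
    {p q r s : ℤ} (hdet : p * s - q * r = 1) (hg : RedBy (act p q r s f) w) :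
    act p q r s f = f ∨ act p q r s f = -f := by
  obtain ⟨h1, h2⟩ := Qv_le_one_of_red hD hf hdet hg
  have k1 := Qv_ge hf.1 p r
  have hr0 : r = 0 := by
    by_contra hr
    have h3 : (1 : ℝ) ≤ ((p ^ 2 - |p * r| + r ^ 2 : ℤ) : ℝ) := by
      exact_mod_cast int_quad_ge_one (Or.inr hr)
    have : 0 < (r : ℝ) ^ 2 := by positivity
    nlinarith [mul_pos (sub_pos.2 hv3) this]
  subst hr0
  have e := congrFun (redBy_act hD hf hdet hg) 2
  simp only [actv, Matrix.cons_val] at e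
  rw [h1] at e
  have hps' : p * s = 1 := by linarith
  have hps : (p : ℝ) * s = 1 := by exact_mod_cast hps'
  have : |2 * (p : ℝ) * q| < 2 := by
    have : 2 * (p : ℝ) * q = w 2 - v 2 := by rw [e]; push_cast; linear_combination (-v 2) * hps
    rw [this]
    have := abs_sub (w 2) (v 2)
    linarith [hf.1, hg.1]
  have h3 : |2 * p * q| < 2 := by exact_mod_cast this
  have hp1 : p = 1 ∨ p = -1 := Int.eq_one_or_neg_one_of_mul_eq_one hps'
  rcases hp1 with rfl | rfl
  · have hs : s = 1 := by omega
    have hq : q = 0 := by rw [abs_lt] at h3; omega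
    subst hs hq
    left; exact act_one f
  · have hs : s = -1 := by omega
    have hq : q = 0 := by rw [abs_lt] at h3; omega
    subst hs hq
    right; exact act_neg_one f

/-- equivalent to a form with vanishing leading coefficient -/
def Triv (f : Fin 4 → ℤ) : Prop := ∃ g, Eqv f g ∧ g 0 = 0

theorem triv_of_zero (f : Fin 4 → ℤ) (x y : ℤ) (hxy : x ≠ 0 ∨ y ≠ 0)
    (h : f 0 * x ^ 3 + 3 * f 1 * x ^ 2 * y + 3 * f 2 * x * y ^ 2 + f 3 * y ^ 3 = 0) : Triv f := by
  obtain ⟨p, r, g, hg, hc, rfl, rfl⟩ : ∃ p r g : ℤ, g ≠ 0 ∧ IsCoprime p r ∧ x = p * g ∧ y = r * g := by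
    have hpos : 0 < Int.gcd x y := by
      rw [Int.gcd_pos_iff]; exact hxy
    obtain ⟨p, r, hcop, e1, e2⟩ := Int.exists_gcd_one hpos
    exact ⟨p, r, Int.gcd x y, by exact_mod_cast hpos.ne', Int.isCoprime_iff_gcd_eq_one.2 hcop, e1, e2⟩
  obtain ⟨u, w, huw⟩ := hc
  refine ⟨act p (-w) r u f, ⟨p, -w, r, u, by linear_combination huw, rfl⟩, ?_⟩
  simp only [act, Matrix.cons_val_zero]
  have : g ^ 3 * (f 0 * p ^ 3 + 3 * f 1 * p ^ 2 * r + 3 * f 2 * p * r ^ 2 + f 3 * r ^ 3) = 0 := by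
    linear_combination h
  rcases mul_eq_zero.1 this with h | h
  · exact absurd h (by positivity)
  · exact h

theorem triv_of_boundary {f : Fin 4 → ℤ} {v : Fin 4 → ℝ} (hD : 0 < D4 f) (hf : RedBy f v)
    (h : |v 2| = 1 ∨ v 3 = 1) : Triv f := by
  obtain ⟨e0, e1, e2, e3⟩ := hf.eqs
  have hρ : ∃ k : ℤ, v 1 = k := by
    rcases h with h | h
    · rcases eq_or_eq_neg_of_abs_eq h with h | h
      · exact ⟨3 * f 1 - f 0, by rw [h] at e1; push_cast; linarith⟩
      · exact ⟨3 * f 1 + f 0, by rw [h] at e1; push_cast; linarith⟩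
    · exact ⟨f 3, by rw [h] at e3; linarith⟩
  obtain ⟨k, hk⟩ := hρ
  refine triv_of_zero f (-k) (f 0) ?_ ?_
  · have := hf.ne hD
    rw [← e0, hk] at this
    rcases this with h | h
    · right; exact_mod_cast h
    · left
      have : k ≠ 0 := by exact_mod_cast h
      omega
  · have : ((f 0 * (-k) ^ 3 + 3 * f 1 * (-k) ^ 2 * f 0 + 3 * f 2 * (-k) * f 0 ^ 2
      + f 3 * f 0 ^ 3 : ℤ) : ℝ) = 0 := by
      push_cast
      rw [e3, ← hk]
      rw [← e0] at e1 e2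
      linear_combination (v 1 ^ 2 * f 0) * e1 - v 1 * f 0 ^ 2 * e2
    exact_mod_cast this

theorem red_unique {f g : Fin 4 → ℤ} (hD : 0 < D4 f) (hf : Red f) (hg : Red g) (h : Eqv f g)
    (ht : ¬ Triv f) : g = f ∨ g = -f := by
  obtain ⟨v, hv⟩ := hf
  obtain ⟨w, hw⟩ := hg
  obtain ⟨p, q, r, s, hdet, rfl⟩ := h
  refine red_interior hD hv ?_ ?_ hdet hw
  · exact lt_of_le_of_ne hv.1 fun h => ht (triv_of_boundary hD hv (Or.inl h))
  · exact lt_of_le_of_ne hv.2.1 fun h => ht (triv_of_boundary hD hv (Or.inr h.symm))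

/-- finite bound for the number of reduced forms in a class -/
theorem red_class_card (s : Finset (Fin 4 → ℤ)) (hD : ∀ f ∈ s, 0 < D4 f) (hr : ∀ f ∈ s, Red f)
    (he : ∀ f ∈ s, ∀ g ∈ s, Eqv f g) : s.card ≤ 625 := by
  classical
  rcases s.eq_empty_or_nonempty with rfl | ⟨f, hf⟩
  · simp
  let I : Finset ℤ := Finset.Icc (-2) 2
  let t : Finset (ℤ × ℤ × ℤ × ℤ) := I ×ˢ I ×ˢ I ×ˢ I
  have ht : t.card = 625 := by simp [t, I]
  rw [← ht]
  have hsub : s ⊆ t.image (fun m => act m.1 m.2.1 m.2.2.1 m.2.2.2 f) := by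
    intro g hg
    obtain ⟨p, q, r, u, hdet, rfl⟩ := he f hf g hg
    obtain ⟨v, hv⟩ := hr f hf
    obtain ⟨w, hw⟩ := hr _ hg
    obtain ⟨h1, h2, h3, h4⟩ := red_entries (hD f hf) hv hdet hw
    rw [Finset.mem_image]
    refine ⟨(p, q, r, u), ?_, rfl⟩
    rw [abs_le] at *
    simp only [t, I, Finset.mem_product, Finset.mem_Icc]
    omega
  exact (Finset.card_le_card hsub).trans Finset.card_image_le

end NH

namespace NH

/-- cubic covariant -/
def Ac {R : Type*} [CommRing R] (f : Fin 4 → R) : Fin 4 → R :=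
  ![-(f 0 ^ 2 * f 3 - 3 * f 0 * f 1 * f 2 + 2 * f 1 ^ 3),
    -(f 0 * f 1 * f 3 - 2 * f 0 * f 2 ^ 2 + f 1 ^ 2 * f 2),
    f 0 * f 2 * f 3 - 2 * f 1 ^ 2 * f 3 + f 1 * f 2 ^ 2,
    f 0 * f 3 ^ 2 - 3 * f 1 * f 2 * f 3 + 2 * f 2 ^ 3]

theorem Ac_act {R : Type*} [CommRing R] (p q r s : R) (f : Fin 4 → R) :
    Ac (act p q r s f) = (p * s - q * r) ^ 3 • act p q r s (Ac f) := by
  apply ext4 <;> simp [Ac, act] <;> ring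

theorem D4_Ac {R : Type*} [CommRing R] (f : Fin 4 → R) : D4 (Ac f) = D4 f ^ 3 := by
  simp [Ac, D4]; ring

/-- a quadratic order of discriminant `Δ` -/
structure QO (O : Type*) [CommRing O] (Δ : ℤ) where
  ω : O
  b : Module.Basis (Fin 2) ℤ O
  b0 : b 0 = 1
  b1 : b 1 = ω
  k : ℤ
  hk : Δ ^ 2 - Δ = 4 * k
  hω : ω ^ 2 = Δ * ω - k
  σ : O →+* O
  hσ : σ ω = Δ - ω

namespace QO

variable {O : Type*} [CommRing O] {Δ : ℤ} (q : QO O Δ)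

/-- the square root of `Δ` -/
def θ : O := 2 * q.ω - Δ

theorem θ_sq : q.θ ^ 2 = Δ := by
  have h1 := q.hω
  have h2 : ((Δ : O)) ^ 2 - Δ = 4 * (q.k : O) := by exact_mod_cast congrArg (Int.cast : ℤ → O) q.hk
  unfold θ
  linear_combination 4 * h1 + h2

theorem σ_θ : q.σ q.θ = - q.θ := by
  unfold θ; rw [map_sub, map_mul, q.hσ, map_ofNat, map_intCast]; ring

theorem σω2 : 2 * q.ω = Δ + q.θ := by unfold θ; ring

theorem rep (x : O) : x = (q.b.repr x 0 : ℤ) + (q.b.repr x 1 : ℤ) * q.ω := by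
  conv_lhs => rw [← q.b.sum_repr x]
  simp [Fin.sum_univ_two, q.b0, q.b1]

theorem ind {m n m' n' : ℤ} (h : (m : O) + n * q.ω = m' + n' * q.ω) : m = m' ∧ n = n' := by
  have key : ∀ m n : ℤ, q.b.repr ((m : O) + n * q.ω) = m • Finsupp.single 0 1 + n • Finsupp.single 1 1 := by
    intro m n
    have : (m : O) + n * q.ω = m • q.b 0 + n • q.b 1 := by simp [q.b0, q.b1]
    rw [this, map_add, map_smul, map_smul, q.b.repr_self, q.b.repr_self]
  have h2 := congrArg q.b.repr h
  rw [key, key] at h2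
  have a := DFunLike.congr_fun h2 0
  have b := DFunLike.congr_fun h2 1
  simp at a b
  exact ⟨a, b⟩

theorem indθ {m n m' n' : ℤ} (h : (m : O) + n * q.θ = m' + n' * q.θ) : m = m' ∧ n = n' := by
  have h' : ((m - n * Δ : ℤ) : O) + ((2 * n : ℤ) : O) * q.ω
      = ((m' - n' * Δ : ℤ) : O) + ((2 * n' : ℤ) : O) * q.ω := by
    push_cast; unfold θ at h; linear_combination h
  obtain ⟨h1, h2⟩ := q.ind h'
  have : n = n' := by omega
  subst this
  exact ⟨by linarith, rfl⟩

theorem nat_inj (q : QO O Δ) {m n : ℤ} (h : (m : O) = n) : m = n := by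
  apply (q.ind (m := m) (n := 0) (m' := n) (n' := 0) (by simpa using h)).1

/-- the form `f` is represented by the pair `(I, δ)` -/
def Rep (f : Fin 4 → ℤ) (I : Ideal O) (δ : O) : Prop :=
  ∃ α β : O, (∀ x, x ∈ I ↔ ∃ m n : ℤ, x = m * α + n * β) ∧
    2 * α ^ 3 = δ * (Ac f 0 + f 0 * q.θ) ∧ 2 * (α ^ 2 * β) = δ * (Ac f 1 + f 1 * q.θ) ∧
    2 * (α * β ^ 2) = δ * (Ac f 2 + f 2 * q.θ) ∧ 2 * β ^ 3 = δ * (Ac f 3 + f 3 * q.θ)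

variable [IsDomain O]

theorem θ_ne (hΔ : Δ ≠ 0) : q.θ ≠ 0 := by
  intro h
  have := q.θ_sq
  rw [h] at this
  exact hΔ (q.nat_inj (by simpa using this.symm))

theorem two_ne (q : QO O Δ) : (2 : O) ≠ 0 := by
  intro h
  have : (2 : ℤ) = 0 := q.nat_inj (by simpa using h)
  omega

theorem Ac_ne {f : Fin 4 → ℤ} (h : D4 f ≠ 0) : Ac f ≠ 0 := by
  intro h1
  have := D4_Ac f
  rw [h1] at this
  have h2 : D4 (0 : Fin 4 → ℤ) = 0 := by simp [D4]
  rw [h2] at this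
  exact h (pow_eq_zero_iff (by norm_num) |>.1 this.symm)

theorem rep_eqv {f g : Fin 4 → ℤ} {I : Ideal O} {δ : O} (hδ : δ ≠ 0) (hf : D4 f ≠ 0)
    (h1 : q.Rep f I δ) (h2 : q.Rep g I δ) (hI : ∀ α β : O, (∀ x, x ∈ I ↔ ∃ m n : ℤ, x = m * α + n * β) →
      ∀ m n : ℤ, m * α + n * β = 0 → m = 0 ∧ n = 0) : Eqv f g := by
  obtain ⟨α, β, hab, e0, e1, e2, e3⟩ := h1
  obtain ⟨α', β', hab', e0', e1', e2', e3'⟩ := h2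
  obtain ⟨p, r, hp⟩ := (hab α').1 ((hab' α').2 ⟨1, 0, by simp⟩)
  obtain ⟨u, s, hs⟩ := (hab β').1 ((hab' β').2 ⟨0, 1, by simp⟩)
  obtain ⟨p', r', hp'⟩ := (hab' α).1 ((hab α).2 ⟨1, 0, by simp⟩)
  obtain ⟨u', s', hs'⟩ := (hab' β).1 ((hab β).2 ⟨0, 1, by simp⟩)
  have k1 := hI α β hab (p' * p + r' * u - 1) (p' * r + r' * s) (by
    push_cast; linear_combination -hp' - p' * hp - r' * hs)
  have k2 := hI α β hab (u' * p + s' * u) (u' * r + s' * s - 1) (by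
    push_cast; linear_combination -hs' - u' * hp - s' * hs)
  have hdet : (p * s - u * r) * (p' * s' - u' * r') = 1 := by
    obtain ⟨a1, a2⟩ := k1
    obtain ⟨b1, b2⟩ := k2
    linear_combination (u' * r + s' * s) * a1 + b2 - (u' * p + s' * u) * a2
  have key : ∀ i, ((Ac g i : ℤ) : O) + (g i : ℤ) * q.θ
      = (act p u r s (Ac f) i : ℤ) + (act p u r s f i : ℤ) * q.θ := by
    intro i
    apply mul_left_cancel₀ hδ
    fin_cases i
    · simp only [Fin.zero_eta, Fin.mk_one, Fin.reduceFinMk]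
      rw [← e0', hp]; simp only [act, Matrix.cons_val]; push_cast
      linear_combination p ^ 3 * e0 + 3 * p ^ 2 * r * e1 + 3 * p * r ^ 2 * e2 + r ^ 3 * e3
    · simp only [Fin.zero_eta, Fin.mk_one, Fin.reduceFinMk]
      rw [← e1', hp, hs]; simp only [act, Matrix.cons_val]; push_cast
      linear_combination p ^ 2 * u * e0 + (p ^ 2 * s + 2 * p * u * r) * e1 + (2 * p * r * s + u * r ^ 2) * e2 + r ^ 2 * s * e3
    · simp only [Fin.zero_eta, Fin.mk_one, Fin.reduceFinMk]
      rw [← e2', hp, hs]; simp only [act, Matrix.cons_val]; push_cast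
      linear_combination p * u ^ 2 * e0 + (u ^ 2 * r + 2 * p * u * s) * e1 + (2 * u * r * s + p * s ^ 2) * e2 + r * s ^ 2 * e3
    · simp only [Fin.zero_eta, Fin.mk_one, Fin.reduceFinMk]
      rw [← e3', hs]; simp only [act, Matrix.cons_val]; push_cast
      linear_combination u ^ 3 * e0 + 3 * u ^ 2 * s * e1 + 3 * u * s ^ 2 * e2 + s ^ 3 * e3
  have hg : g = act p u r s f := funext fun i => (q.indθ (key i)).2
  have hA : Ac g = act p u r s (Ac f) := funext fun i => (q.indθ (key i)).1
  refine ⟨p, u, r, s, ?_, hg⟩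
  rcases Int.isUnit_iff.1 (IsUnit.of_mul_eq_one _ hdet) with h | h
  · exact h
  · exfalso
    rw [hg, Ac_act, h] at hA
    have h0 : act p u r s (Ac f) = 0 := by
      funext i
      have := congrFun hA i
      simp at this
      simp; omega
    have h1 : D4 (act p u r s (Ac f)) = 0 := by rw [h0]; simp [D4]
    rw [D4_act, h, D4_Ac] at h1
    simp at h1
    exact hf h1

theorem rep_of_eqv {f g : Fin 4 → ℤ} {I : Ideal O} {δ : O} (h : Eqv f g) (h1 : q.Rep f I δ) :
    q.Rep g I δ := by
  obtain ⟨p, u, r, s, hdet, rfl⟩ := h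
  obtain ⟨α, β, hab, e0, e1, e2, e3⟩ := h1
  have hd : (p : O) * s - u * r = 1 := by exact_mod_cast congrArg (Int.cast : ℤ → O) hdet
  refine ⟨p * α + r * β, u * α + s * β, ?_, ?_, ?_, ?_, ?_⟩
  · intro x
    rw [hab]
    constructor
    · rintro ⟨m, n, rfl⟩
      refine ⟨m * s - n * u, -m * r + n * p, ?_⟩
      push_cast
      linear_combination -(m * α + n * β) * hd
    · rintro ⟨m, n, rfl⟩
      exact ⟨m * p + n * u, m * r + n * s, by push_cast; ring⟩
  all_goals rw [Ac_act, hdet]; simp only [act, Matrix.cons_val, one_pow, one_smul]; push_cast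
  · linear_combination p ^ 3 * e0 + 3 * p ^ 2 * r * e1 + 3 * p * r ^ 2 * e2 + r ^ 3 * e3
  · linear_combination p ^ 2 * u * e0 + (p ^ 2 * s + 2 * p * u * r) * e1 + (2 * p * r * s + u * r ^ 2) * e2 + r ^ 2 * s * e3
  · linear_combination p * u ^ 2 * e0 + (u ^ 2 * r + 2 * p * u * s) * e1 + (2 * u * r * s + p * s ^ 2) * e2 + r * s ^ 2 * e3
  · linear_combination u ^ 3 * e0 + 3 * u ^ 2 * s * e1 + 3 * u * s ^ 2 * e2 + s ^ 3 * e3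

/-- same form, two pairs -/
theorem rep_rep {f : Fin 4 → ℤ} {I J : Ideal O} {δ ε : O} (hδ : δ ≠ 0) (hε : ε ≠ 0)
    (hf : D4 f ≠ 0)
    (h1 : q.Rep f I δ) (h2 : q.Rep f J ε) :
    ∃ x y : O, x ≠ 0 ∧ y ≠ 0 ∧ Ideal.span {x} * I = Ideal.span {y} * J ∧ x ^ 3 * δ = y ^ 3 * ε := by
  obtain ⟨α, β, hab, e0, e1, e2, e3⟩ := h1
  obtain ⟨α', β', hab', e0', e1', e2', e3'⟩ := h2
  have hz : ((Ac f 0 : ℤ) : O) + f 0 * q.θ ≠ 0 := by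
    intro h
    obtain ⟨h1, h2⟩ := q.indθ (m' := 0) (n' := 0) (by simpa using h)
    apply hf
    simp [Ac, h2] at h1
    simp [D4, h1, h2]
  have hα : α ≠ 0 := by
    rintro rfl
    have : δ * ((Ac f 0 : ℤ) + f 0 * q.θ) = 0 := by rw [← e0]; ring
    exact (mul_ne_zero hδ hz) this
  have hα' : α' ≠ 0 := by
    rintro rfl
    have : ε * ((Ac f 0 : ℤ) + f 0 * q.θ) = 0 := by rw [← e0']; ring
    exact (mul_ne_zero hε hz) this
  have hβ : α' * β = α * β' := by
    have : (4 * α ^ 2 * α' ^ 2) * (α' * β - α * β') = 0 := by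
      linear_combination 2 * α' ^ 3 * e1 + (δ * ((Ac f 1 : ℤ) + f 1 * q.θ)) * e0'
        - 2 * α ^ 3 * e1' - (ε * ((Ac f 1 : ℤ) + f 1 * q.θ)) * e0
    have h2 : (4 * α ^ 2 * α' ^ 2) ≠ 0 := by
      have : (4 : O) = 2 * 2 := by norm_num
      rw [this]
      simp [hα, hα', q.two_ne]
    rcases mul_eq_zero.1 this with h | h
    · exact absurd h h2
    · linear_combination h
  refine ⟨α', α, hα', hα, ?_, ?_⟩
  · ext x
    rw [Ideal.mem_span_singleton_mul, Ideal.mem_span_singleton_mul]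
    constructor
    · rintro ⟨z, hz, rfl⟩
      obtain ⟨m, n, rfl⟩ := (hab z).1 hz
      exact ⟨m * α' + n * β', (hab' _).2 ⟨m, n, rfl⟩, by linear_combination -n * hβ⟩
    · rintro ⟨z, hz, rfl⟩
      obtain ⟨m, n, rfl⟩ := (hab' z).1 hz
      exact ⟨m * α + n * β, (hab _).2 ⟨m, n, rfl⟩, by linear_combination n * hβ⟩
  · apply mul_left_cancel₀ hz
    apply mul_left_cancel₀ q.two_ne
    linear_combination -2 * α' ^ 3 * e0 + 2 * α ^ 3 * e0'

end QO
end NH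

namespace NH
namespace QO

variable {O : Type*} [CommRing O] {Δ : ℤ} (q : QO O Δ)

theorem repr0 (m n : ℤ) : q.b.repr ((m : O) + n * q.ω) 0 = m :=
  (q.ind (q.rep ((m : O) + n * q.ω))).1.symm

theorem repr1 (m n : ℤ) : q.b.repr ((m : O) + n * q.ω) 1 = n :=
  (q.ind (q.rep ((m : O) + n * q.ω))).2.symm

theorem norm_eq (x : O) : ((Algebra.norm ℤ x : ℤ) : O) = x * q.σ x := by
  set m := q.b.repr x 0 with hm
  set n := q.b.repr x 1 with hn
  have hx : x = (m : O) + n * q.ω := q.rep x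
  have h1 : x * q.ω = ((-n * q.k : ℤ) : O) + ((m + n * Δ : ℤ) : O) * q.ω := by
    push_cast; rw [hx]; linear_combination n * q.hω
  rw [Algebra.norm_eq_matrix_det q.b, Matrix.det_fin_two]
  simp only [Algebra.leftMulMatrix_eq_repr_mul, q.b0, q.b1, mul_one]
  rw [h1, repr0, repr1, ← hm, ← hn]
  push_cast
  rw [hx, map_add, map_mul, q.hσ, map_intCast, map_intCast]
  linear_combination n ^ 2 * q.hω

variable [IsDomain O]

theorem indep (q : QO O Δ) {I : Ideal O} (hI : I ≠ ⊥) (α β : O)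
    (h : ∀ x, x ∈ I ↔ ∃ m n : ℤ, x = m * α + n * β) (m n : ℤ) (h0 : m * α + n * β = 0) :
    m = 0 ∧ n = 0 := by
  obtain ⟨x, hx, hx0⟩ := Submodule.exists_mem_ne_zero_of_ne_bot hI
  obtain ⟨m1, n1, e1⟩ := (h x).1 hx
  obtain ⟨m2, n2, e2⟩ := (h (x * q.ω)).1 (I.mul_mem_right _ hx)
  have key : ∀ k l : ℤ, (l : O) * x = k * (x * q.ω) → k = 0 ∧ l = 0 := by
    intro k l hkl
    have : x * (l : O) = x * (k * q.ω) := by linear_combination hkl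
    have := mul_left_cancel₀ hx0 this
    have := q.ind (m := l) (n := 0) (m' := 0) (n' := k) (by simpa using this)
    exact ⟨this.2.symm, this.1⟩
  have hmm : ∀ z : ℤ, (z : O) * x = 0 → z = 0 := fun z hz => (key 0 z (by simpa using hz)).2
  constructor
  · by_contra hm
    have a1 : (m : O) * x = (m * n1 - m1 * n : ℤ) * β := by
      push_cast; linear_combination m * e1 + m1 * h0
    have a2 : (m : O) * (x * q.ω) = (m * n2 - m2 * n : ℤ) * β := by
      push_cast; linear_combination m * e2 + m2 * h0
    have := key (m * (m * n1 - m1 * n)) (m * (m * n2 - m2 * n)) (by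
      push_cast at *; linear_combination (m * n2 - m2 * n) * a1 - (m * n1 - m1 * n) * a2)
    have h1 : m * n1 - m1 * n = 0 := by simpa [hm] using this.1
    rw [h1] at a1
    exact hm (hmm m (by simpa using a1))
  · by_contra hm
    have a1 : (n : O) * x = (n * m1 - n1 * m : ℤ) * α := by
      push_cast; linear_combination n * e1 + n1 * h0
    have a2 : (n : O) * (x * q.ω) = (n * m2 - n2 * m : ℤ) * α := by
      push_cast; linear_combination n * e2 + n2 * h0
    have := key (n * (n * m1 - n1 * m)) (n * (n * m2 - n2 * m)) (by
      push_cast at *; linear_combination (n * m2 - n2 * m) * a1 - (n * m1 - n1 * m) * a2)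
    have h1 : n * m1 - n1 * m = 0 := by simpa [hm] using this.1
    rw [h1] at a1
    exact hm (hmm n (by simpa using a1))

theorem D4_pair {R : Type*} [CommRing R] (P Q α β α' β' : R) :
    D4 (act α β α' β' ![P, 0, 0, Q]) = (α * β' - β * α') ^ 6 * (P * Q) ^ 2 := by
  rw [D4_act]; simp [D4]; ring

theorem Ac_pair {R : Type*} [CommRing R] (P Q α β α' β' : R) :
    Ac (act α β α' β' ![P, 0, 0, Q]) =
      (-(P * Q) * (α * β' - β * α') ^ 3) • act α β α' β' ![P, 0, 0, -Q] := by
  apply ext4 <;> simp [Ac, act] <;> ring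

theorem D4_smul {R : Type*} [CommRing R] (t : R) (f : Fin 4 → R) : D4 (t • f) = t ^ 4 * D4 f := by
  simp [D4]; ring

theorem Ac_smul {R : Type*} [CommRing R] (t : R) (f : Fin 4 → R) : Ac (t • f) = t ^ 3 • Ac f := by
  apply ext4 <;> simp [Ac] <;> ring

theorem D4_cast {R : Type*} [CommRing R] (f : Fin 4 → ℤ) :
    ((D4 f : ℤ) : R) = D4 (fun i => (f i : R)) := by
  simp [D4]

theorem Ac_cast {R : Type*} [CommRing R] (f : Fin 4 → ℤ) (i : Fin 4) :
    ((Ac f i : ℤ) : R) = Ac (fun i => (f i : R)) i := by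
  fin_cases i <;> simp [Ac]

/-- from an oriented basis to a form -/
theorem exists_form_aux (hΔ : Δ ≠ 0) {I : Ideal O} {δ : O} (hδ : δ ≠ 0) (h : I ^ 3 = Ideal.span {δ})
    (α β : O) (hab : ∀ x, x ∈ I ↔ ∃ m n : ℤ, x = m * α + n * β)
    (hu : (α * q.σ β - β * q.σ α) ^ 3 = δ * q.σ δ * q.θ ^ 3) :
    ∃ f, D4 f = Δ ∧ q.Rep f I δ := by
  have hα : α ∈ I := (hab α).2 ⟨1, 0, by simp⟩
  have hβ : β ∈ I := (hab β).2 ⟨0, 1, by simp⟩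
  have hz : ∀ x y z, x ∈ I → y ∈ I → z ∈ I → ∃ w, x * y * z = δ * w := by
    intro x y z hx hy hz
    have : x * y * z ∈ I ^ 3 := by
      rw [pow_succ, pow_two]; exact Ideal.mul_mem_mul (Ideal.mul_mem_mul hx hy) hz
    rw [h, Ideal.mem_span_singleton] at this
    exact this
  obtain ⟨z0, e0⟩ := hz _ _ _ hα hα hα
  obtain ⟨z1, e1⟩ := hz _ _ _ hα hα hβ
  obtain ⟨z2, e2⟩ := hz _ _ _ hα hβ hβ
  obtain ⟨z3, e3⟩ := hz _ _ _ hβ hβ hβ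
  set z : Fin 4 → O := ![z0, z1, z2, z3] with hzd
  set f : Fin 4 → ℤ := fun i => q.b.repr (z i) 1 with hf
  set m : Fin 4 → ℤ := fun i => q.b.repr (z i) 0 with hm
  have hzi : ∀ i, z i = (m i : O) + f i * q.ω := fun i => q.rep (z i)
  have hsi : ∀ i, q.σ (z i) = (m i : O) + f i * (Δ - q.ω) := by
    intro i; rw [hzi, map_add, map_mul, q.hσ, map_intCast, map_intCast]
  have hdiff : ∀ i, z i - q.σ (z i) = f i * q.θ := by
    intro i; rw [hsi]; conv_lhs => rw [hzi i]
    unfold θ; ring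
  have hsum : ∀ i, z i + q.σ (z i) = (2 * m i + Δ * f i : ℤ) := by
    intro i; rw [hsi]; conv_lhs => rw [hzi i]
    push_cast; ring
  have hσδ : q.σ δ ≠ 0 := by
    intro h0
    have h1 := q.norm_eq δ
    rw [h0, mul_zero] at h1
    have h2 : (α * q.σ β - β * q.σ α) = 0 := by
      rw [h0] at hu; simpa using hu
    have i1 : q.σ (q.σ δ) = δ := by
      have := q.rep δ
      rw [this]
      simp only [map_add, map_mul, map_intCast, q.hσ, map_sub]; ring
    rw [h0, map_zero] at i1
    exact hδ i1.symm
  have hθ := q.θ_ne hΔ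
  set N := δ * q.σ δ with hN
  have hN0 : N ≠ 0 := mul_ne_zero hδ hσδ
  have s0 := congrArg q.σ e0
  have s1 := congrArg q.σ e1
  have s2 := congrArg q.σ e2
  have s3 := congrArg q.σ e3
  simp only [map_mul] at s0 s1 s2 s3
  have hF : (N * q.θ) • (fun i => (f i : O)) = act α β (q.σ α) (q.σ β) ![q.σ δ, 0, 0, -δ] := by
    have : (N * q.θ) • (fun i => (f i : O)) = fun i => N * (z i - q.σ (z i)) := by
      funext i; rw [hdiff]; simp; ring
    rw [this]
    apply ext4 <;> simp [act, hzd, hN]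
    · linear_combination -q.σ δ * e0 + δ * s0
    · linear_combination -q.σ δ * e1 + δ * s1
    · linear_combination -q.σ δ * e2 + δ * s2
    · linear_combination -q.σ δ * e3 + δ * s3
  have hS : N • (fun i => ((2 * m i + Δ * f i : ℤ) : O)) =
      act α β (q.σ α) (q.σ β) ![q.σ δ, 0, 0, - -δ] := by
    have : N • (fun i => ((2 * m i + Δ * f i : ℤ) : O)) = fun i => N * (z i + q.σ (z i)) := by
      funext i; rw [hsum]; simp
    rw [this]
    apply ext4 <;> simp [act, hzd, hN]
    · linear_combination -q.σ δ * e0 - δ * s0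
    · linear_combination -q.σ δ * e1 - δ * s1
    · linear_combination -q.σ δ * e2 - δ * s2
    · linear_combination -q.σ δ * e3 - δ * s3
  have hD : D4 f = Δ := by
    apply q.nat_inj
    have h1 := D4_pair (q.σ δ) (-δ) α β (q.σ α) (q.σ β)
    rw [← hF, D4_smul, ← D4_cast] at h1
    apply mul_left_cancel₀ (pow_ne_zero 4 (mul_ne_zero hN0 hθ))
    rw [h1]
    have : (α * q.σ β - β * q.σ α) ^ 6 = (N * q.θ ^ 3) ^ 2 := by rw [← hu]; ring
    rw [this, ← q.θ_sq, hN]; ring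
  have hA : ∀ i, Ac f i = 2 * m i + Δ * f i := by
    intro i
    apply q.nat_inj
    have h1 := Ac_pair (q.σ δ) (-δ) α β (q.σ α) (q.σ β)
    rw [← hF, Ac_smul, ← hS] at h1
    have h2 := congrFun h1 i
    simp only [Pi.smul_apply, smul_eq_mul, ← Ac_cast] at h2
    apply mul_left_cancel₀ (pow_ne_zero 3 (mul_ne_zero hN0 hθ))
    rw [h2, hu, hN]; ring
  refine ⟨f, hD, α, β, hab, ?_, ?_, ?_, ?_⟩
  · rw [hA 0]; have := hzi 0; simp [hzd] at this; unfold θ; push_cast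
    linear_combination 2 * e0 + 2 * δ * this
  · rw [hA 1]; have := hzi 1; simp [hzd] at this; unfold θ; push_cast
    linear_combination 2 * e1 + 2 * δ * this
  · rw [hA 2]; have := hzi 2; simp [hzd] at this; unfold θ; push_cast
    linear_combination 2 * e2 + 2 * δ * this
  · rw [hA 3]; have := hzi 3; simp [hzd] at this; unfold θ; push_cast
    linear_combination 2 * e3 + 2 * δ * this

theorem exists_form [IsDedekindDomain O] (hΔ : Δ ≠ 0) {I : Ideal O} {δ : O} (hδ : δ ≠ 0)
    (h : I ^ 3 = Ideal.span {δ}) : ∃ f, D4 f = Δ ∧ q.Rep f I δ := by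
  haveI : Module.Free ℤ O := Module.Free.of_basis q.b
  haveI : Module.Finite ℤ O := Module.Finite.of_basis q.b
  have hI : I ≠ ⊥ := by
    rintro rfl
    have : (⊥ : Ideal O) ^ 3 = ⊥ := by
      rw [← Ideal.zero_eq_bot]; simp
    rw [this] at h
    exact hδ (Ideal.span_singleton_eq_bot.1 h.symm)
  let bI := Ideal.selfBasis q.b I hI
  have hdet := Ideal.natAbs_det_basis_change q.b I bI
  set α : O := (bI 0 : O) with hα
  set β : O := (bI 1 : O) with hβ
  have hab : ∀ x, x ∈ I ↔ ∃ m n : ℤ, x = m * α + n * β := by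
    intro x
    constructor
    · intro hx
      have := bI.sum_repr ⟨x, hx⟩
      have := congrArg (Subtype.val) this
      simp only [Fin.sum_univ_two] at this
      refine ⟨bI.repr ⟨x, hx⟩ 0, bI.repr ⟨x, hx⟩ 1, ?_⟩
      refine this.symm.trans ?_; simp [hα, hβ]
    · rintro ⟨m, n, rfl⟩
      exact I.add_mem (I.mul_mem_left _ (bI 0).2) (I.mul_mem_left _ (bI 1).2)
  set e : ℤ := q.b.det (Subtype.val ∘ bI) with he
  have hu : α * q.σ β - β * q.σ α = -(e : O) * q.θ := by
    have : e = q.b.repr α 0 * q.b.repr β 1 - q.b.repr β 0 * q.b.repr α 1 := by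
      rw [he, Module.Basis.det_apply, Matrix.det_fin_two]
      simp [Module.Basis.toMatrix_apply, hα, hβ]
    rw [this]
    have ha := q.rep α
    have hb := q.rep β
    generalize q.b.repr α 0 = a0 at *
    generalize q.b.repr α 1 = a1 at *
    generalize q.b.repr β 0 = b0 at *
    generalize q.b.repr β 1 = b1 at *
    rw [ha, hb]
    simp only [map_add, map_mul, map_intCast, q.hσ]
    push_cast
    unfold θ; ring
  have hN : e.natAbs ^ 3 = (Algebra.norm ℤ δ).natAbs := by
    rw [hdet, ← map_pow, h, Ideal.absNorm_span_singleton]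
  rw [← Int.natAbs_pow, Int.natAbs_eq_natAbs_iff] at hN
  have hnorm := q.norm_eq δ
  rcases hN with hN | hN
  · apply q.exists_form_aux hΔ hδ h (-α) β
    · intro x
      rw [hab]
      constructor
      · rintro ⟨m, n, rfl⟩; exact ⟨-m, n, by push_cast; ring⟩
      · rintro ⟨m, n, rfl⟩; exact ⟨-m, n, by push_cast; ring⟩
    · rw [map_neg, ← hnorm, ← hN]
      have : -α * q.σ β - β * -q.σ α = e * q.θ := by linear_combination -hu
      rw [this]; push_cast; ring
  · apply q.exists_form_aux hΔ hδ h α β hab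
    rw [hu, ← hnorm]
    have : Algebra.norm ℤ δ = -e ^ 3 := by omega
    rw [this]; push_cast; ring

end QO
end NH

namespace NH

/-- primitivity of the Hessian -/
theorem hess_prim {Δ : ℤ} (hΔ : IsFundamentalDiscriminant Δ) {A B C : ℤ}
    (h : B ^ 2 - 4 * A * C = Δ) : ∃ x y z : ℤ, x * A + y * B + z * C = 1 := by
  by_contra hc
  have key : ∃ p : ℕ, p.Prime ∧ (p : ℤ) ∣ A ∧ (p : ℤ) ∣ B ∧ (p : ℤ) ∣ C := by
    set g := Int.gcd (Int.gcd A B) C with hg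
    have hg1 : g ≠ 1 := by
      intro hg1
      apply hc
      have e1 := Int.gcd_eq_gcd_ab A B
      have e2 := Int.gcd_eq_gcd_ab (Int.gcd A B) C
      rw [← hg, hg1] at e2
      refine ⟨Int.gcdA A B * Int.gcdA (Int.gcd A B) C, Int.gcdB A B * Int.gcdA (Int.gcd A B) C,
        Int.gcdB (Int.gcd A B) C, ?_⟩
      push_cast at e2
      rw [e2]
      linear_combination -(Int.gcdA (Int.gcd A B) C) * e1
    obtain ⟨p, hp, hpg⟩ := Nat.exists_prime_and_dvd hg1
    have hpg' : (p : ℤ) ∣ g := by exact_mod_cast hpg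
    have d1 : (p : ℤ) ∣ (Int.gcd A B : ℤ) := hpg'.trans (Int.gcd_dvd_left _ _)
    exact ⟨p, hp, d1.trans (Int.gcd_dvd_left _ _), d1.trans (Int.gcd_dvd_right _ _),
      hpg'.trans (Int.gcd_dvd_right _ _)⟩
  obtain ⟨p, hp, ⟨a, rfl⟩, ⟨b, rfl⟩, ⟨c, rfl⟩⟩ := key
  have e : Δ = (p * p) * (b ^ 2 - 4 * a * c) := by rw [← h]; ring
  have hpu : ¬ IsUnit (p : ℤ) := by
    rw [Int.isUnit_iff]
    have := hp.two_le
    omega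
  rcases hΔ.2 with ⟨hs, _⟩ | ⟨m, hm, hs, hm4⟩
  · exact hpu (hs p ⟨_, e⟩)
  · by_cases hp2 : p = 2
    · subst hp2
      have : m = b ^ 2 - 4 * a * c := by push_cast at e; linarith
      have hb : b ^ 2 % 4 = 0 ∨ b ^ 2 % 4 = 1 := by
        rcases Int.even_or_odd' b with ⟨k, rfl | rfl⟩
        · left; ring_nf; omega
        · right; ring_nf; omega
      have h4 : (4 * a * c) % 4 = 0 := by rw [mul_assoc]; omega
      omega
    · have hodd : IsCoprime ((p : ℤ) * p) 4 := by
        have h1 : IsCoprime (p : ℤ) 2 := by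
          have := (Nat.coprime_primes hp Nat.prime_two).2 hp2
          exact_mod_cast Nat.isCoprime_iff_coprime.2 this
        have h2 : IsCoprime (p : ℤ) 4 := by
          have : (4 : ℤ) = 2 * 2 := by norm_num
          rw [this]; exact h1.mul_right h1
        exact h2.mul_left h2
      have : ((p : ℤ) * p) ∣ 4 * m := ⟨_, by rw [← hm]; exact e⟩
      exact hpu (hs p (hodd.dvd_of_dvd_mul_left this))

theorem parity_aux : ∀ a b c d : ZMod 2,
    (∀ i, Ac ![a, b, c, d] i - D4 ![a, b, c, d] * ![a, b, c, d] i = 0) := by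
  decide

theorem parity (f : Fin 4 → ℤ) (i : Fin 4) : ∃ m : ℤ, Ac f i - D4 f * f i = 2 * m := by
  have h := parity_aux (f 0) (f 1) (f 2) (f 3) i
  have e : (![((f 0 : ℤ) : ZMod 2), f 1, f 2, f 3]) = fun i => (f i : ZMod 2) := by
    apply ext4 <;> simp
  rw [e, ← QO.Ac_cast, ← QO.D4_cast] at h
  have h2 : (((Ac f i - D4 f * f i : ℤ)) : ZMod 2) = 0 := by push_cast; exact h
  rw [ZMod.intCast_zmod_eq_zero_iff_dvd] at h2
  exact_mod_cast h2

namespace QO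

variable {O : Type*} [CommRing O] {Δ : ℤ} (q : QO O Δ) [IsDomain O]

theorem exists_pair (hΔ : IsFundamentalDiscriminant Δ) (f : Fin 4 → ℤ) (hf : D4 f = Δ) :
    ∃ (I : Ideal O) (δ : O), δ ≠ 0 ∧ I ^ 3 = Ideal.span {δ} ∧ q.Rep f I δ := by
  have hΔ0 : Δ ≠ 0 := by
    rintro rfl
    rcases hΔ.2 with ⟨h, _⟩ | ⟨m, hm, h, _⟩
    · exact not_squarefree_zero h
    · have : m = 0 := by omega
      exact not_squarefree_zero (this ▸ h)
  have hz : ∀ i, ∃ z : O, 2 * z = Ac f i + f i * q.θ := by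
    intro i
    obtain ⟨m, hm⟩ := parity f i
    refine ⟨m + f i * q.ω, ?_⟩
    have hm' : ((Ac f i : ℤ) : O) - Δ * f i = 2 * m := by rw [← hf]; exact_mod_cast congrArg (Int.cast : ℤ → O) hm
    unfold θ; linear_combination -hm'
  choose z hz using hz
  have hσ : ∀ i, 2 * q.σ (z i) = Ac f i - f i * q.θ := by
    intro i
    have := congrArg q.σ (hz i)
    simp only [map_mul, map_add, map_ofNat, map_intCast, q.σ_θ] at this
    rw [this]; ring
  have h2 := q.two_ne
  have h4 : (4 : O) ≠ 0 := by
    have : (4 : O) = 2 * 2 := by norm_num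
    rw [this]; exact mul_ne_zero h2 h2
  have hθ : q.θ ^ 2 = ((D4 f : ℤ) : O) := by rw [hf, q.θ_sq]
  have r0 := hz 0
  have r1 := hz 1
  have r2 := hz 2
  have r3 := hz 3
  have t0 := hσ 0
  have t1 := hσ 1
  have t2 := hσ 2
  have t3 := hσ 3
  generalize hz0 : z 0 = z0 at *
  generalize hz1 : z 1 = z1 at *
  generalize hz2 : z 2 = z2 at *
  generalize hz3 : z 3 = z3 at *
  generalize hs0 : q.σ z0 = s0 at *
  generalize hs1 : q.σ z1 = s1 at *
  generalize hs2 : q.σ z2 = s2 at *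
  generalize hs3 : q.σ z3 = s3 at *
  have hθne := q.θ_ne hΔ0
  have hind := @indθ O _ Δ q
  have hωθ := q.σω2
  generalize hθq : q.θ = θ at *
  have hz0ne : z0 ≠ 0 := by
    rintro rfl
    obtain ⟨k1, k2⟩ := hind (m := Ac f 0) (n := f 0) (m' := 0) (n' := 0) (by simpa using r0.symm)
    simp [Ac, k2] at k1
    apply hΔ0
    rw [← hf]; simp [D4, k1, k2]
  simp only [Ac, Matrix.cons_val] at r0 r1 r2 r3 t0 t1 t2 t3
  simp only [D4] at hθ
  push_cast at r0 r1 r2 r3 t0 t1 t2 t3 hθ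
  have hA : ∃ A : ℤ, A = f 1 ^ 2 - f 0 * f 2 := ⟨_, rfl⟩
  have hB : ∃ B : ℤ, B = f 0 * f 3 - f 1 * f 2 := ⟨_, rfl⟩
  have hC : ∃ C : ℤ, C = f 2 ^ 2 - f 1 * f 3 := ⟨_, rfl⟩
  obtain ⟨A, hA⟩ := hA
  obtain ⟨B, hB⟩ := hB
  obtain ⟨C, hC⟩ := hC
  have hdisc : B ^ 2 - 4 * A * C = Δ := by rw [← hf, hA, hB, hC]; simp only [D4]; ring
  obtain ⟨x, y, w, hxyz⟩ := hess_prim hΔ hdisc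
  have hAO : (A : O) = f 1 ^ 2 - f 0 * f 2 := by rw [hA]; push_cast; ring
  have hBO : (B : O) = f 0 * f 3 - f 1 * f 2 := by rw [hB]; push_cast; ring
  have hCO : (C : O) = f 2 ^ 2 - f 1 * f 3 := by rw [hC]; push_cast; ring
  have hΔO : ((Δ : ℤ) : O) = B ^ 2 - 4 * A * C := by rw [← hdisc]; push_cast; ring
  have hxO : (x : O) * A + y * B + w * C = 1 := by exact_mod_cast congrArg (Int.cast : ℤ → O) hxyz
  obtain ⟨e, he⟩ : ∃ e : ℤ, B ^ 2 - B = 2 * e := by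
    obtain ⟨e, he⟩ := Int.even_mul_pred_self B
    exact ⟨e, by linear_combination he⟩
  have heO : (B : O) ^ 2 - B = 2 * e := by exact_mod_cast congrArg (Int.cast : ℤ → O) he
  generalize (f 0 : O) = a at *
  generalize (f 1 : O) = b at *
  generalize (f 2 : O) = c at *
  generalize (f 3 : O) = d at *
  have hω2 := q.hω
  have p1 : z1 * z1 = z0 * z2 := by
    apply mul_left_cancel₀ h4
    linear_combination (2 * z1) * r1 + (-(a * b * d - 2 * a * c ^ 2 + b ^ 2 * c) + b * θ) * r1
      - (2 * z2) * r0 - (-(a ^ 2 * d - 3 * a * b * c + 2 * b ^ 3) + a * θ) * r2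
      + (b ^ 2 - a * c) * hθ
  have p2 : z1 * z2 = z0 * z3 := by
    apply mul_left_cancel₀ h4
    linear_combination (2 * z2) * r1 + (-(a * b * d - 2 * a * c ^ 2 + b ^ 2 * c) + b * θ) * r2
      - (2 * z3) * r0 - (-(a ^ 2 * d - 3 * a * b * c + 2 * b ^ 3) + a * θ) * r3
      + (b * c - a * d) * hθ
  have n0 : z0 * s0 = (A : O) ^ 3 := by
    apply mul_left_cancel₀ h4
    rw [hAO]
    linear_combination (2 * s0) * r0 + (-(a ^ 2 * d - 3 * a * b * c + 2 * b ^ 3) + a * θ) * t0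
      - a ^ 2 * hθ
  have n3 : z3 * s3 = (C : O) ^ 3 := by
    apply mul_left_cancel₀ h4
    rw [hCO]
    linear_combination (2 * s3) * r3 + ((a * d ^ 2 - 3 * b * c * d + 2 * c ^ 3) + d * θ) * t3
      - d ^ 2 * hθ
  have n1 : (z0 + 3 * z1 + 3 * z2 + z3) * (s0 + 3 * s1 + 3 * s2 + s3) = ((A : O) - B + C) ^ 3 := by
    apply mul_left_cancel₀ h4
    rw [hAO, hBO, hCO]
    have u1 : 2 * (z0 + 3 * z1 + 3 * z2 + z3) = (-(a ^ 2 * d - 3 * a * b * c + 2 * b ^ 3)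
      + 3 * -(a * b * d - 2 * a * c ^ 2 + b ^ 2 * c) + 3 * (a * c * d - 2 * b ^ 2 * d + b * c ^ 2)
      + (a * d ^ 2 - 3 * b * c * d + 2 * c ^ 3)) + (a + 3 * b + 3 * c + d) * θ := by
      linear_combination r0 + 3 * r1 + 3 * r2 + r3
    have u2 : 2 * (s0 + 3 * s1 + 3 * s2 + s3) = (-(a ^ 2 * d - 3 * a * b * c + 2 * b ^ 3)
      + 3 * -(a * b * d - 2 * a * c ^ 2 + b ^ 2 * c) + 3 * (a * c * d - 2 * b ^ 2 * d + b * c ^ 2)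
      + (a * d ^ 2 - 3 * b * c * d + 2 * c ^ 3)) - (a + 3 * b + 3 * c + d) * θ := by
      linear_combination t0 + 3 * t1 + 3 * t2 + t3
    have : 4 * ((z0 + 3 * z1 + 3 * z2 + z3) * (s0 + 3 * s1 + 3 * s2 + s3))
      = (2 * (z0 + 3 * z1 + 3 * z2 + z3)) * (2 * (s0 + 3 * s1 + 3 * s2 + s3)) := by ring
    rw [this, u1, u2]
    linear_combination -(a + 3 * b + 3 * c + d) ^ 2 * hθ
  have w0 : θ * z0 = -B * z0 - 2 * A * z1 := by
    apply mul_left_cancel₀ h2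
    rw [hAO, hBO]
    linear_combination (θ + (a * d - b * c)) * r0 + 2 * (b ^ 2 - a * c) * r1 + a * hθ
  have w1 : θ * z1 = 2 * C * z0 + B * z1 := by
    apply mul_left_cancel₀ h2
    rw [hCO, hBO]
    linear_combination (θ - (a * d - b * c)) * r1 - 2 * (c ^ 2 - b * d) * r0 + b * hθ
  refine ⟨Ideal.span {z0, z1}, z0 ^ 2, pow_ne_zero _ hz0ne, ?_, z0, z1, ?_, ?_⟩
  · have hJ : Ideal.span {z0, z1, z2, z3} = ⊤ := by
      by_contra hne
      obtain ⟨P, hP, hle⟩ := Ideal.exists_le_maximal _ hne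
      have hPp := hP.isPrime
      have m0 : z0 ∈ P := hle (Ideal.subset_span (by simp))
      have m1 : z1 ∈ P := hle (Ideal.subset_span (by simp))
      have m2 : z2 ∈ P := hle (Ideal.subset_span (by simp))
      have m3 : z3 ∈ P := hle (Ideal.subset_span (by simp))
      have a1 : (A : O) ∈ P := hPp.mem_of_pow_mem 3 (n0 ▸ P.mul_mem_right _ m0)
      have a2 : (C : O) ∈ P := hPp.mem_of_pow_mem 3 (n3 ▸ P.mul_mem_right _ m3)
      have a3 : (A : O) - B + C ∈ P := hPp.mem_of_pow_mem 3 (n1 ▸ P.mul_mem_right _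
        (P.add_mem (P.add_mem (P.add_mem m0 (P.mul_mem_left _ m1)) (P.mul_mem_left _ m2)) m3))
      have a4 : (B : O) ∈ P := by
        have : (B : O) = A + C - ((A : O) - B + C) := by ring
        rw [this]; exact P.sub_mem (P.add_mem a1 a2) a3
      apply hPp.ne_top
      rw [Ideal.eq_top_iff_one, ← hxO]
      exact P.add_mem (P.add_mem (P.mul_mem_left _ a1) (P.mul_mem_left _ a4)) (P.mul_mem_left _ a2)
    have i0 : z0 ∈ Ideal.span {z0, z1} := Ideal.subset_span (by simp)
    have i1 : z1 ∈ Ideal.span {z0, z1} := Ideal.subset_span (by simp)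
    have hmm : ∀ x y z, x ∈ Ideal.span {z0, z1} → y ∈ Ideal.span {z0, z1} → z ∈ Ideal.span {z0, z1} →
        x * y * z ∈ Ideal.span {z0, z1} ^ 3 := by
      intro x y z hx hy hz
      rw [pow_succ, pow_two]; exact Ideal.mul_mem_mul (Ideal.mul_mem_mul hx hy) hz
    apply le_antisymm
    · rw [pow_succ, pow_two, Ideal.span_mul_span', Ideal.span_mul_span', Ideal.span_le]
      rintro _ ⟨_, ⟨u, hu, v, hv, rfl⟩, w, hw, rfl⟩
      simp only [Set.mem_insert_iff, Set.mem_singleton_iff] at hu hv hw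
      rw [SetLike.mem_coe, Ideal.mem_span_singleton]
      have k3 : z1 * z1 * z1 = z0 ^ 2 * z3 := by linear_combination z1 * p1 + z0 * p2
      rcases hu with hu | hu <;> rcases hv with hv | hv <;> rcases hw with hw | hw <;> rw [hu, hv, hw]
      · exact ⟨z0, by ring⟩
      · exact ⟨z1, by ring⟩
      · exact ⟨z1, by ring⟩
      · exact ⟨z2, by linear_combination z0 * p1⟩
      · exact ⟨z1, by ring⟩
      · exact ⟨z2, by linear_combination z0 * p1⟩
      · exact ⟨z2, by linear_combination z0 * p1⟩
      · exact ⟨z3, k3⟩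
    · rw [Ideal.span_singleton_le_iff_mem]
      have : (1 : O) ∈ Ideal.span {z0, z1, z2, z3} := by rw [hJ]; trivial
      simp only [Ideal.mem_span_insert, Ideal.mem_span_singleton'] at this
      obtain ⟨c0, _, ⟨c1, _, ⟨c2, _, ⟨c3, rfl⟩, rfl⟩, rfl⟩, hc⟩ := this
      have : z0 ^ 2 = c0 * (z0 * z0 * z0) + c1 * (z0 * z0 * z1) + c2 * (z0 * z1 * z1)
          + c3 * (z1 * z1 * z1) := by
        linear_combination z0 ^ 2 * hc - c2 * z0 * p1 - c3 * (z1 * p1 + z0 * p2)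
      rw [this]
      exact Ideal.add_mem _ (Ideal.add_mem _ (Ideal.add_mem _ (Ideal.mul_mem_left _ _ (hmm _ _ _ i0 i0 i0))
        (Ideal.mul_mem_left _ _ (hmm _ _ _ i0 i0 i1))) (Ideal.mul_mem_left _ _ (hmm _ _ _ i0 i1 i1)))
        (Ideal.mul_mem_left _ _ (hmm _ _ _ i1 i1 i1))
  · have v0 : q.ω * z0 = ((e - 2 * A * C : ℤ) : O) * z0 + ((-A : ℤ) : O) * z1 := by
      apply mul_left_cancel₀ h2
      push_cast
      linear_combination z0 * hωθ + w0 + z0 * hΔO + z0 * heO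
    have v1 : q.ω * z1 = ((C : ℤ) : O) * z0 + ((e + B - 2 * A * C : ℤ) : O) * z1 := by
      apply mul_left_cancel₀ h2
      push_cast
      linear_combination z1 * hωθ + w1 + z1 * hΔO + z1 * heO
    intro x
    rw [Ideal.mem_span_pair]
    constructor
    · rintro ⟨s, t, rfl⟩
      have hs := q.rep s
      have ht := q.rep t
      generalize q.b.repr s 0 = i1 at *
      generalize q.b.repr s 1 = i2 at *
      generalize q.b.repr t 0 = j1 at *
      generalize q.b.repr t 1 = j2 at *
      refine ⟨i1 + i2 * (e - 2 * A * C) + j2 * C, j1 - i2 * A + j2 * (e + B - 2 * A * C), ?_⟩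
      rw [hs, ht]
      push_cast at *
      linear_combination i2 * v0 + j2 * v1
    · rintro ⟨m, n, rfl⟩
      exact ⟨m, n, rfl⟩
  · rw [hθq, ← hz 0, ← hz 1, ← hz 2, ← hz 3, hz0, hz1, hz2, hz3]
    refine ⟨by ring, by ring, ?_, ?_⟩
    · linear_combination 2 * z0 * p1
    · linear_combination 2 * z1 * p1 + 2 * z0 * p2
end QO
end NH

namespace NH

namespace QO

variable {O : Type*} [CommRing O] {Δ : ℤ} (q : QO O Δ)

theorem rep_scale {f : Fin 4 → ℤ} {I : Ideal O} {δ : O} (h : q.Rep f I δ) (x : O) :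
    q.Rep f (Ideal.span {x} * I) (x ^ 3 * δ) := by
  obtain ⟨α, β, hab, e0, e1, e2, e3⟩ := h
  refine ⟨x * α, x * β, ?_, ?_, ?_, ?_, ?_⟩
  · intro z
    rw [Ideal.mem_span_singleton_mul]
    constructor
    · rintro ⟨y, hy, rfl⟩
      obtain ⟨m, n, rfl⟩ := (hab y).1 hy
      exact ⟨m, n, by ring⟩
    · rintro ⟨m, n, rfl⟩
      exact ⟨m * α + n * β, (hab _).2 ⟨m, n, rfl⟩, by ring⟩
  · linear_combination x ^ 3 * e0
  · linear_combination x ^ 3 * e1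
  · linear_combination x ^ 3 * e2
  · linear_combination x ^ 3 * e3

variable [IsDomain O]

theorem eqv_of_scale {f g : Fin 4 → ℤ} {I J : Ideal O} {δ ε x y : O} (hδ : δ ≠ 0) (hx : x ≠ 0)
    (hI : I ≠ ⊥)
    (hf : D4 f ≠ 0) (h1 : q.Rep f I δ) (h2 : q.Rep g J ε)
    (h3 : Ideal.span {x} * I = Ideal.span {y} * J) (h4 : x ^ 3 * δ = y ^ 3 * ε) : Eqv f g := by
  have a1 := q.rep_scale h1 x
  have a2 := q.rep_scale h2 y
  rw [← h3, ← h4] at a2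
  have hI2 : Ideal.span {x} * I ≠ ⊥ := by
    rw [Ne, Ideal.mul_eq_bot]
    rintro (h | h)
    · exact hx (by simpa using h)
    · exact hI h
  exact q.rep_eqv (mul_ne_zero (pow_ne_zero 3 hx) hδ) hf a1 a2 (fun α β h m n => q.indep hI2 α β h m n)

theorem classes (q : QO O Δ) [IsDedekindDomain O] (hΔ : IsFundamentalDiscriminant Δ) (hΔ0 : Δ ≠ 0) (ε : Oˣ)
    (E1 : ∀ u : Oˣ, ∃ (j : Fin 3) (κ : Oˣ), u = ε ^ (j : ℕ) * κ ^ 3)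
    (E2 : ∀ (j j' : Fin 3) (κ : Oˣ), ε ^ (j : ℕ) * κ ^ 3 = ε ^ (j' : ℕ) → j = j') :
    ∃ F : {x : ClassGroup O // x ^ 3 = 1} × Fin 3 → (Fin 4 → ℤ), (∀ i, D4 (F i) = Δ) ∧
      (∀ i j, Eqv (F i) (F j) → i = j) ∧ (∀ f, D4 f = Δ → ∃ i, Eqv (F i) f) := by
  have h0 : ∀ c : {x : ClassGroup O // x ^ 3 = 1}, ∃ I : nonZeroDivisors (Ideal O), ∃ δ : O,
      ClassGroup.mk0 I = c.1 ∧ δ ≠ 0 ∧ (I : Ideal O) ^ 3 = Ideal.span {δ} := by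
    rintro ⟨c, hc⟩
    obtain ⟨I, rfl⟩ := ClassGroup.mk0_surjective c
    rw [← map_pow, ClassGroup.mk0_eq_one_iff] at hc
    obtain ⟨δ, hδ⟩ := hc.principal
    refine ⟨I, δ, rfl, ?_, by simpa using hδ⟩
    rintro rfl
    have : ((I ^ 3 : nonZeroDivisors (Ideal O)) : Ideal O) = 0 := by rw [hδ]; simp
    exact nonZeroDivisors.coe_ne_zero _ this
  choose I δ hI hδ hIδ using h0
  have hδ' : ∀ i : {x : ClassGroup O // x ^ 3 = 1} × Fin 3, δ i.1 * (ε : O) ^ (i.2 : ℕ) ≠ 0 :=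
    fun i => mul_ne_zero (hδ _) (pow_ne_zero _ ε.ne_zero)
  have h1 : ∀ i : {x : ClassGroup O // x ^ 3 = 1} × Fin 3, ∃ f, D4 f = Δ ∧
      q.Rep f (I i.1) (δ i.1 * (ε : O) ^ (i.2 : ℕ)) := by
    rintro ⟨c, j⟩
    apply q.exists_form hΔ0 (hδ' (c, j))
    rw [hIδ]
    apply Ideal.span_singleton_eq_span_singleton.2
    exact ⟨ε ^ (j : ℕ), by simp⟩
  choose F hF hR using h1
  refine ⟨F, hF, ?_, ?_⟩
  · rintro ⟨c, j⟩ ⟨c', j'⟩ h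
    have a1 := q.rep_of_eqv h (hR (c, j))
    have hD : D4 (F (c', j')) ≠ 0 := by rw [hF]; exact hΔ0
    obtain ⟨x, y, hx, hy, hxy, hxy'⟩ := q.rep_rep (hδ' _) (hδ' _) hD a1 (hR (c', j'))
    have hc : c = c' := by
      apply Subtype.ext
      rw [← hI, ← hI]
      rw [ClassGroup.mk0_eq_mk0_iff]
      exact ⟨x, y, hx, hy, hxy⟩
    subst hc
    have hxy2 : Ideal.span {x} = Ideal.span {y} := by
      exact mul_right_cancel₀ (nonZeroDivisors.coe_ne_zero (I c)) hxy
    obtain ⟨κ, hκ⟩ := Ideal.span_singleton_eq_span_singleton.1 hxy2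
    have : j' = j := by
      apply E2 j' j κ
      apply Units.ext
      simp only [Units.val_mul, Units.val_pow_eq_pow_val]
      have h2 : (x ^ 3 * δ c) * ((ε : O) ^ (j' : ℕ) * (κ : O) ^ 3) = (x ^ 3 * δ c) * (ε : O) ^ (j : ℕ) := by
        simp only at hxy'
        rw [← hκ] at hxy'
        linear_combination -hxy'
      exact mul_left_cancel₀ (mul_ne_zero (pow_ne_zero 3 hx) (hδ c)) h2
    rw [this]
  · intro f hf
    obtain ⟨J, η, hη, hJ, hRf⟩ := q.exists_pair hΔ f hf
    have hJ0 : J ≠ 0 := by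
      rintro rfl
      apply hη
      have : Ideal.span {η} = 0 := by rw [← hJ]; simp
      simpa using this
    let J' : nonZeroDivisors (Ideal O) := ⟨J, mem_nonZeroDivisors_of_ne_zero hJ0⟩
    have hcl : (ClassGroup.mk0 J') ^ 3 = 1 := by
      rw [← map_pow, ClassGroup.mk0_eq_one_iff]
      refine ⟨η, ?_⟩
      simpa [J'] using hJ
    set c : {x : ClassGroup O // x ^ 3 = 1} := ⟨_, hcl⟩ with hc
    have h2 : ClassGroup.mk0 (I c) = ClassGroup.mk0 J' := by rw [hI]
    obtain ⟨x, y, hx, hy, hxy⟩ := ClassGroup.mk0_eq_mk0_iff.1 h2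
    have hxy1 : Ideal.span {x} * (I c : Ideal O) = Ideal.span {y} * J := hxy
    have h3 : Ideal.span {x ^ 3 * δ c} = Ideal.span {y ^ 3 * η} := by
      rw [← Ideal.span_singleton_mul_span_singleton, ← Ideal.span_singleton_mul_span_singleton,
        ← Ideal.span_singleton_pow, ← Ideal.span_singleton_pow, ← hJ, ← hIδ, ← mul_pow, ← mul_pow, hxy1]
    obtain ⟨u, hu⟩ := Ideal.span_singleton_eq_span_singleton.1 h3
    obtain ⟨j, κ, rfl⟩ := E1 u
    refine ⟨(c, j), ?_⟩
    refine q.eqv_of_scale (x := x * κ) (y := y) (hδ' (c, j)) (mul_ne_zero hx κ.ne_zero)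
      (nonZeroDivisors.coe_ne_zero (I c)) (by rw [hF]; exact hΔ0) (hR (c, j)) hRf ?_ ?_
    · rw [← hxy1]
      congr 1
      exact Ideal.span_singleton_eq_span_singleton.2 ⟨κ⁻¹, by simp [mul_assoc]⟩
    · rw [← hu]
      simp only [Units.val_mul, Units.val_pow_eq_pow_val]
      ring

end QO

end NH

namespace NH

theorem sqfree_rat {m : ℤ} (hm : Squarefree m) {w : ℚ} {n : ℤ} (h : (m : ℚ) * w ^ 2 = n) :
    ∃ z : ℤ, w = z := by
  have h1 : m * w.num ^ 2 = n * (w.den : ℤ) ^ 2 := by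
    have hd : (w.den : ℚ) ≠ 0 := by exact_mod_cast w.den_ne_zero
    have h2 : w = w.num / w.den := (Rat.num_div_den w).symm
    have : (m : ℚ) * (w.num : ℚ) ^ 2 = n * (w.den : ℚ) ^ 2 := by
      rw [h2] at h
      field_simp at h
      linarith
    exact_mod_cast this
  have hc : IsCoprime ((w.den : ℤ) ^ 2) (w.num ^ 2) := by
    apply IsCoprime.pow
    rw [Int.isCoprime_iff_gcd_eq_one, Int.gcd_comm]
    simpa [Int.gcd] using w.reduced
  have h3 : (w.den : ℤ) ^ 2 ∣ m := hc.dvd_of_dvd_mul_right ⟨n, by rw [h1]; ring⟩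
  have h4 := hm (w.den : ℤ) (by rwa [← sq])
  have h5 : w.den = 1 := by
    have := Int.isUnit_iff.1 h4
    omega
  exact ⟨w.num, ((Rat.den_eq_one_iff w).1 h5).symm⟩

theorem fund_not_sq {Δ : ℤ} (hΔ : IsFundamentalDiscriminant Δ) (u : ℚ) : u ^ 2 ≠ Δ := by
  intro h
  have h1 : IsSquare (Δ : ℚ) := ⟨u, by rw [← h]; ring⟩
  rw [Rat.isSquare_intCast_iff] at h1
  obtain ⟨n, rfl⟩ := h1
  rcases hΔ with ⟨h0, ⟨h2, h3⟩ | ⟨m, h2, h3, h4⟩⟩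
  · have := Int.isUnit_iff.1 (h2 n dvd_rfl)
    rcases this with rfl | rfl <;> simp at h0
  · have he : n % 2 = 0 := by
      by_contra hne
      have : n % 2 = 1 := by omega
      have : n * n % 2 = 1 := by rw [Int.mul_emod, this]; norm_num
      omega
    obtain ⟨t, rfl⟩ : ∃ t, n = 2 * t := ⟨n / 2, by omega⟩
    have : m = t * t := by linarith
    subst this
    rcases Int.isUnit_iff.1 (h3 t dvd_rfl) with rfl | rfl <;> omega

theorem fund_int {Δ : ℤ} (hΔ : IsFundamentalDiscriminant Δ) {w : ℚ} {A n : ℤ}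
    (h : (A : ℚ) ^ 2 - Δ * w ^ 2 = 4 * n) : ∃ z k : ℤ, w = z ∧ A - z * Δ = 2 * k := by
  rcases hΔ with ⟨h0, ⟨h2, h3⟩ | ⟨m, rfl, h3, h4⟩⟩
  · obtain ⟨z, rfl⟩ := sqfree_rat h2 (w := w) (n := A ^ 2 - 4 * n) (by push_cast; linarith)
    have h5 : A ^ 2 - Δ * z ^ 2 = 4 * n := by exact_mod_cast h
    refine ⟨z, (A - z * Δ) / 2, rfl, ?_⟩
    have : (A - z * Δ) % 2 = 0 := by
      have e : (A ^ 2 - Δ * z ^ 2) % 2 = 0 := by omega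
      have : Δ % 2 = 1 := by omega
      have hA := Int.emod_two_eq_zero_or_one A
      have hz := Int.emod_two_eq_zero_or_one z
      rcases hA with hA | hA <;> rcases hz with hz | hz <;>
        simp [Int.sub_emod, Int.mul_emod, pow_two, this, hA, hz] at e ⊢
    omega
  · obtain ⟨t, ht⟩ := sqfree_rat h3 (w := 2 * w) (n := A ^ 2 - 4 * n) (by push_cast at h ⊢; linarith)
    have hw : w = t / 2 := by linarith
    subst hw
    have h5 : A ^ 2 - m * t ^ 2 = 4 * n := by
      push_cast at h
      have : (A : ℚ) ^ 2 - m * t ^ 2 = 4 * n := by linear_combination h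
      exact_mod_cast this
    have e : (A ^ 2 - m * t ^ 2) % 4 = 0 := by omega
    have hA : A % 4 = 0 ∨ A % 4 = 1 ∨ A % 4 = 2 ∨ A % 4 = 3 := by omega
    have ht : t % 4 = 0 ∨ t % 4 = 1 ∨ t % 4 = 2 ∨ t % 4 = 3 := by omega
    have h6 : A % 2 = 0 ∧ t % 2 = 0 := by
      rcases h4 with h4 | h4 <;> rcases hA with hA | hA | hA | hA <;> rcases ht with ht | ht | ht | ht <;>
        simp [Int.sub_emod, Int.mul_emod, pow_two, h4, hA, ht] at e ⊢ <;> omega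
    obtain ⟨s, rfl⟩ : ∃ s, t = 2 * s := ⟨t / 2, by omega⟩
    obtain ⟨B, rfl⟩ : ∃ s, A = 2 * s := ⟨A / 2, by omega⟩
    exact ⟨s, B - 2 * s * m, by push_cast; ring, by ring⟩

theorem fund_k {Δ : ℤ} (hΔ : IsFundamentalDiscriminant Δ) : ∃ k, Δ ^ 2 - Δ = 4 * k := by
  rcases hΔ with ⟨h0, ⟨h2, h3⟩ | ⟨m, rfl, h3, h4⟩⟩
  · obtain ⟨t, rfl⟩ : ∃ t, Δ = 4 * t + 1 := ⟨Δ / 4, by omega⟩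
    exact ⟨4 * t ^ 2 + t, by ring⟩
  · exact ⟨4 * m ^ 2 - m, by ring⟩

open NumberField in
theorem exists_QO {K : Type*} [Field K] [NumberField K] {Δ : ℤ} (hΔ : IsFundamentalDiscriminant Δ)
    (θ : K) (hθ : θ ^ 2 = Δ) (hsp : ∀ x : K, ∃ u v : ℚ, x = u + v * θ) :
    Nonempty (QO (𝓞 K) Δ) := by
  have huniq : ∀ {u v u' v' : ℚ}, (u : K) + v * θ = u' + v' * θ → u = u' ∧ v = v' := by
    intro u v u' v' h
    have hv : v = v' := by
      by_contra hne
      have h1 : θ = ((u' - u) / (v - v') : ℚ) := by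
        push_cast
        have : (v : K) - v' ≠ 0 := by
          rw [sub_ne_zero]; exact_mod_cast hne
        rw [eq_div_iff this]
        linear_combination h
      rw [h1] at hθ
      exact fund_not_sq hΔ _ (by exact_mod_cast hθ)
    subst hv
    exact ⟨by exact_mod_cast (add_right_cancel h), rfl⟩
  choose u v huv using hsp
  have hu : ∀ (a b : ℚ), u (a + b * θ) = a ∧ v (a + b * θ) = b := fun a b =>
    huniq (huv (a + b * θ)).symm
  let σ : K →+* K :=
    { toFun := fun x => u x - v x * θ
      map_one' := by
        have h := hu 1 0
        simp at h
        simp [h]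
      map_zero' := by
        have h := hu 0 0
        simp at h
        simp [h]
      map_mul' := by
        intro x y
        have h : x * y = ((u x * u y + v x * v y * Δ : ℚ) : K) + ((u x * v y + v x * u y : ℚ) : K) * θ := by
          conv_lhs => rw [huv x, huv y]
          push_cast
          linear_combination (v x : K) * v y * hθ
        have h2 := hu (u x * u y + v x * v y * Δ) (u x * v y + v x * u y)
        rw [← h] at h2
        simp only [h2]
        push_cast
        linear_combination - (v x : K) * v y * hθ
      map_add' := by
        intro x y
        have h : x + y = ((u x + u y : ℚ) : K) + ((v x + v y : ℚ) : K) * θ := by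
          conv_lhs => rw [huv x, huv y]
          push_cast
          ring
        have h2 := hu (u x + u y) (v x + v y)
        rw [← h] at h2
        simp only [h2]
        push_cast
        ring }
  have hσ : ∀ x, σ x = u x - v x * θ := fun x => rfl
  have hint : ∀ x : K, IsIntegral ℤ x → ∃ m z : ℤ, 2 * x = 2 * m + z * (Δ + θ) := by
    intro x hx
    have hx2 : IsIntegral ℤ (σ x) := hx.map σ.toIntAlgHom
    have h1 : x + σ x = algebraMap ℚ K (2 * u x) := by
      rw [hσ]; nth_rewrite 1 [huv x]; simp; ring
    have h2 : x * σ x = algebraMap ℚ K (u x ^ 2 - Δ * v x ^ 2) := by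
      rw [hσ]; nth_rewrite 1 [huv x]; simp; linear_combination -(v x : K) ^ 2 * hθ
    have h3 := hx.add hx2
    have h4 := hx.mul hx2
    rw [h1, isIntegral_algebraMap_iff (algebraMap ℚ K).injective] at h3
    rw [h2, isIntegral_algebraMap_iff (algebraMap ℚ K).injective] at h4
    obtain ⟨A, hA⟩ := IsIntegrallyClosed.isIntegral_iff.1 h3
    obtain ⟨n, hn⟩ := IsIntegrallyClosed.isIntegral_iff.1 h4
    simp at hA hn
    obtain ⟨z, k, hz, hk⟩ := fund_int hΔ (w := 2 * v x) (A := A) (n := n) (by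
      rw [hA, hn]; ring)
    refine ⟨k, z, ?_⟩
    have e1 : (2 : K) * u x = A := by rw [← Rat.cast_ofNat, ← Rat.cast_mul, ← hA]; simp
    have e2 : (2 : K) * v x = z := by rw [← Rat.cast_ofNat, ← Rat.cast_mul, hz]; simp
    have e3 : (A : K) - z * Δ = 2 * k := by exact_mod_cast congrArg (Int.cast : ℤ → K) hk
    rw [huv x]
    linear_combination e1 + θ * e2 + e3
  obtain ⟨k, hk⟩ := fund_k hΔ
  have hkK : (Δ : K) ^ 2 - Δ = 4 * k := by exact_mod_cast congrArg (Int.cast : ℤ → K) hk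
  let ωK : K := (Δ + θ) / 2
  have hωK : ωK ^ 2 = Δ * ωK - k := by
    show ((Δ + θ) / 2) ^ 2 = Δ * ((Δ + θ) / 2) - k
    linear_combination hθ / 4 - hkK / 4
  have hωint : IsIntegral ℤ ωK := by
    refine ⟨Polynomial.X ^ 2 - Polynomial.C Δ * Polynomial.X + Polynomial.C k, ?_, ?_⟩
    · monicity!
    · rw [Polynomial.eval₂_add, Polynomial.eval₂_sub, Polynomial.eval₂_mul, Polynomial.eval₂_C, Polynomial.eval₂_C,
        Polynomial.eval₂_pow, Polynomial.eval₂_X, hωK]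
      simp
  obtain ⟨ω, hωv⟩ : ∃ ω : 𝓞 K, (ω : K) = ωK := ⟨⟨ωK, hωint⟩, rfl⟩
  have hω : ω ^ 2 = Δ * ω - k := by
    apply RingOfIntegers.ext
    simpa [hωv] using hωK
  have hli : LinearIndependent ℤ ![(1 : 𝓞 K), ω] := by
    rw [LinearIndependent.pair_iff]
    intro s t h
    have h1 : (s : K) + t * ωK = 0 := by
      have := congrArg (fun x : 𝓞 K => (x : K)) h
      simpa [hωv] using this
    have h2 := huniq (u := s + t * Δ / 2) (v := t / 2) (u' := 0) (v' := 0) (by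
      push_cast
      have : ωK = (Δ + θ) / 2 := rfl
      rw [this] at h1
      linear_combination h1)
    have ht : t = 0 := by
      have : (t : ℚ) = 0 := by linarith [h2.2]
      exact_mod_cast this
    subst ht
    have hs : (s : ℚ) = 0 := by simpa using h2.1
    exact ⟨by exact_mod_cast hs, rfl⟩
  have hspan : ⊤ ≤ Submodule.span ℤ (Set.range ![(1 : 𝓞 K), ω]) := by
    rintro x -
    obtain ⟨m, z, h⟩ := hint x x.2
    have : x = m • 1 + z • ω := by
      apply RingOfIntegers.ext
      simp [hωv]
      show (x : K) = m + z * ((Δ + θ) / 2)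
      linear_combination h / 2
    rw [this]
    apply Submodule.add_mem
    · exact Submodule.smul_mem _ _ (Submodule.subset_span ⟨0, rfl⟩)
    · exact Submodule.smul_mem _ _ (Submodule.subset_span ⟨1, rfl⟩)
  let b := Module.Basis.mk hli hspan
  refine ⟨{ ω := ω, b := b, b0 := by simp [b], b1 := by simp [b], k := k, hk := hk, hω := hω, σ := RingOfIntegers.mapRingHom σ, hσ := ?_ }⟩
  apply RingOfIntegers.ext
  have e0 : ((RingOfIntegers.mapRingHom σ ω : 𝓞 K) : K) = σ ωK := by rw [← hωv]; rfl
  rw [e0]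
  simp only [map_sub, map_intCast, hωv]
  have h := hu (Δ / 2) (1 / 2)
  have e : ((Δ / 2 : ℚ) : K) + ((1 / 2 : ℚ) : K) * θ = ωK := by
    push_cast
    show _ = (Δ + θ) / 2
    ring
  rw [e] at h
  rw [hσ, h.1, h.2]
  show _ = Δ - (Δ + θ) / 2
  push_cast
  ring

end NH

namespace NH

open NumberField NumberField.Units in
theorem units_mod_cubes {K : Type*} [Field K] [NumberField K] [IsTotallyReal K]
    (h2 : Module.finrank ℚ K = 2) :
    ∃ ε : (𝓞 K)ˣ, (∀ u : (𝓞 K)ˣ, ∃ (j : Fin 3) (κ : (𝓞 K)ˣ), u = ε ^ (j : ℕ) * κ ^ 3) ∧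
      (∀ (j j' : Fin 3) (κ : (𝓞 K)ˣ), ε ^ (j : ℕ) * κ ^ 3 = ε ^ (j' : ℕ) → j = j') := by
  have hrank : rank K = 1 := by
    unfold rank
    have h3 := IsTotallyReal.finrank (K := K)
    have h4 := InfinitePlace.card_eq_nrRealPlaces_add_nrComplexPlaces K
    have h5 := IsTotallyReal.nrComplexPlaces_eq_zero (K := K)
    omega
  have htors : ∀ ζ : (𝓞 K)ˣ, ζ ∈ torsion K → ζ = 1 ∨ ζ = -1 := by
    intro ζ hζ
    obtain ⟨n, hn, hz⟩ := isOfFinOrder_iff_pow_eq_one.1 ((CommGroup.mem_torsion _).1 hζ)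
    obtain ⟨φ⟩ : Nonempty (K →+* ℂ) := inferInstance
    have hreal := IsTotallyReal.complexEmbedding_isReal φ
    have h3 : (φ (ζ : 𝓞 K)) ^ n = 1 := by
      rw [← map_pow, ← map_one φ]
      congr 1
      have := congrArg (fun x : (𝓞 K)ˣ => ((x : 𝓞 K) : K)) hz
      try simpa using this
    have h4 : (starRingEnd ℂ) (φ (ζ : 𝓞 K)) = φ (ζ : 𝓞 K) := by
      have := RingHom.congr_fun hreal ((ζ : 𝓞 K) : K)
      simpa [ComplexEmbedding.conjugate_coe_eq] using this
    obtain ⟨r, hr⟩ := Complex.conj_eq_iff_real.1 h4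
    have h5 : r ^ n = 1 := by
      rw [hr] at h3
      exact_mod_cast h3
    have h6 : r = 1 ∨ r = -1 := by
      have := (pow_eq_one_iff_of_ne_zero (by omega)).1 h5
      rcases this with h | h
      · left; exact h
      · right; exact h.1
    rcases h6 with rfl | rfl
    · left
      apply Units.ext
      apply RingOfIntegers.ext
      apply φ.injective
      rw [hr]; simp
    · right
      apply Units.ext
      apply RingOfIntegers.ext
      apply φ.injective
      rw [hr]; simp
  obtain ⟨i0, hi0⟩ : ∃ i0 : Fin (rank K), ∀ i, i = i0 := by
    rw [hrank]; exact ⟨0, fun i => Subsingleton.elim _ _⟩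
  haveI : Unique (Fin (rank K)) := ⟨⟨i0⟩, hi0⟩
  set ε := fundSystem K i0 with hε
  have hcube : ∀ ζ : (𝓞 K)ˣ, ζ ∈ torsion K → ζ ^ 3 = ζ := by
    intro ζ hζ
    rcases htors ζ hζ with rfl | rfl
    · simp
    · rw [pow_succ]; simp
  have hdef : (default : Fin (rank K)) = i0 := hi0 _
  have hex : ∀ x : (𝓞 K)ˣ, ∃ ζ ∈ torsion K, ∃ e : ℤ, x = ζ * ε ^ e := by
    intro x
    obtain ⟨⟨ζ, e⟩, h, -⟩ := exist_unique_eq_mul_prod K x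
    refine ⟨ζ, ζ.2, e i0, ?_⟩
    simpa [hdef] using h
  have hun : ∀ (ζ : (𝓞 K)ˣ) (e e' : ℤ), ζ ∈ torsion K → ζ * ε ^ e = ε ^ e' → e = e' := by
    intro ζ e e' hζ h
    obtain ⟨_, -, hu⟩ := exist_unique_eq_mul_prod K (ε ^ e')
    have a1 := hu (⟨ζ, hζ⟩, fun _ => e) (by simp [hdef, ← hε, h])
    have a2 := hu (1, fun _ => e') (by simp [hdef, ← hε])
    have := a1.trans a2.symm
    have := congrFun (congrArg Prod.snd this) i0
    exact this
  refine ⟨ε, ?_, ?_⟩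
  · intro u
    obtain ⟨ζ, hζ, e, rfl⟩ := hex u
    refine ⟨⟨(e % 3).toNat, by omega⟩, ζ * ε ^ (e / 3), ?_⟩
    rw [mul_pow, hcube ζ hζ, mul_left_comm]
    congr 1
    rw [← zpow_natCast, ← zpow_natCast, ← zpow_mul, ← zpow_add]
    congr 1
    simp only
    push_cast
    omega
  · intro j j' κ h
    obtain ⟨ζ, hζ, e, rfl⟩ := hex κ
    rw [mul_pow, hcube ζ hζ, mul_left_comm, ← zpow_natCast, ← zpow_natCast, ← zpow_natCast,
      ← zpow_mul, ← zpow_add] at h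
    have := hun _ _ _ hζ h
    apply Fin.ext
    push_cast at this
    omega

theorem sqrtC_sq (Δ : ℤ) : sqrtC Δ ^ 2 = Δ := by
  unfold sqrtC
  rw [← Complex.cpow_mul_nat]
  norm_num

theorem quad_span (Δ : ℤ) (x : quadField Δ) : ∃ u v : ℚ,
    x = u + v * (⟨sqrtC Δ, mem_adjoin_simple_self ℚ _⟩ : quadField Δ) := by
  have hi : IsIntegral ℚ (sqrtC Δ) := by
    refine ⟨Polynomial.X ^ 2 - Polynomial.C (Δ : ℚ), by monicity!, ?_⟩
    rw [Polynomial.eval₂_sub, Polynomial.eval₂_C, Polynomial.eval₂_pow, Polynomial.eval₂_X, sqrtC_sq]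
    simp
  have hx : (x : ℂ) ∈ (quadField Δ).toSubalgebra := x.2
  have h0 : (quadField Δ).toSubalgebra = Algebra.adjoin ℚ {sqrtC Δ} :=
    adjoin_simple_toSubalgebra_of_isAlgebraic hi.isAlgebraic
  rw [h0] at hx
  have h1 : ∃ u v : ℚ, (x : ℂ) = u + v * sqrtC Δ := by
    generalize (x : ℂ) = x at hx
    induction hx using Algebra.adjoin_induction with
    | mem y hy => exact ⟨0, 1, by simp at hy; simp [hy]⟩
    | algebraMap r => exact ⟨r, 0, by simp⟩
    | add y z _ _ h1 h2 =>
      obtain ⟨u, v, rfl⟩ := h1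
      obtain ⟨u', v', rfl⟩ := h2
      exact ⟨u + u', v + v', by push_cast; ring⟩
    | mul y z _ _ h1 h2 =>
      obtain ⟨u, v, rfl⟩ := h1
      obtain ⟨u', v', rfl⟩ := h2
      refine ⟨u * u' + v * v' * Δ, u * v' + v * u', ?_⟩
      push_cast
      linear_combination (v * v' : ℂ) * sqrtC_sq Δ
  obtain ⟨u, v, h⟩ := h1
  refine ⟨u, v, ?_⟩
  apply Subtype.ext
  rw [h]
  simp

theorem quad_numberField (Δ : ℤ) : NumberField (quadField Δ) := by
  have hi : IsIntegral ℚ (sqrtC Δ) := by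
    refine ⟨Polynomial.X ^ 2 - Polynomial.C (Δ : ℚ), by monicity!, ?_⟩
    rw [Polynomial.eval₂_sub, Polynomial.eval₂_C, Polynomial.eval₂_pow, Polynomial.eval₂_X, sqrtC_sq]
    simp
  have := adjoin.finiteDimensional hi
  exact { to_charZero := inferInstance, to_finiteDimensional := this }

open NumberField in
theorem field_classes {Δ : ℤ} (hΔ : IsFundamentalDiscriminant Δ) (h0 : 0 < Δ) :
    Finite {x : ClassGroup (RingOfIntegers (quadField Δ)) // x ^ 3 = 1} ∧
    ∃ F : {x : ClassGroup (RingOfIntegers (quadField Δ)) // x ^ 3 = 1} × Fin 3 → (Fin 4 → ℤ),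
      (∀ i, D4 (F i) = Δ) ∧
      (∀ i j, Eqv (F i) (F j) → i = j) ∧ (∀ f, D4 f = Δ → ∃ i, Eqv (F i) f) := by
  haveI := quad_numberField Δ
  set θ : quadField Δ := ⟨sqrtC Δ, mem_adjoin_simple_self ℚ _⟩ with hθ
  have hθ2 : θ ^ 2 = Δ := by
    apply Subtype.ext
    simp [hθ, sqrtC_sq]
  obtain ⟨q⟩ := exists_QO hΔ θ hθ2 (quad_span Δ)
  have hfr : Module.finrank ℚ (quadField Δ) = 2 := by
    rw [← RingOfIntegers.rank, Module.finrank_eq_card_basis q.b]; simp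
  haveI : IsTotallyReal (quadField Δ) := by
    constructor
    intro w
    rw [InfinitePlace.isReal_iff, ComplexEmbedding.isReal_iff]
    set φ := w.embedding
    have h1 : (φ θ) ^ 2 = (Δ : ℂ) := by rw [← map_pow, hθ2]; simp
    have h2 : (φ θ).im = 0 := by
      have e1 := congrArg Complex.im h1
      have e2 := congrArg Complex.re h1
      simp [pow_two] at e1 e2
      have h0' : (0 : ℝ) < Δ := by exact_mod_cast h0
      have : (φ θ).re * (φ θ).im = 0 := by linarith
      rcases mul_eq_zero.1 this with h | h
      · rw [h] at e2
        nlinarith [sq_nonneg (φ θ).im]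
      · exact h
    ext x
    obtain ⟨u, v, h⟩ := quad_span Δ x
    rw [h, ← hθ]
    simp [ComplexEmbedding.conjugate_coe_eq, Complex.conj_eq_iff_im.2 h2]
  obtain ⟨ε, E1, E2⟩ := units_mod_cubes hfr
  exact ⟨inferInstance, q.classes hΔ h0.ne' ε E1 E2⟩

end NH

namespace NH

theorem Red.neg {f : Fin 4 → ℤ} (h : Red f) : Red (-f) := by
  obtain ⟨v, h1, h2, h3⟩ := h
  refine ⟨![-v 0, -v 1, v 2, v 3], by simpa using h1, by simpa using h2, ?_⟩
  funext i
  have := congrFun h3 i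
  fin_cases i <;> simp [Phi] at this ⊢ <;> rw [this] <;> ring

theorem fund_mod4 {Δ : ℤ} (hΔ : IsFundamentalDiscriminant Δ) : Δ % 4 = 0 ∨ Δ % 4 = 1 := by
  rcases hΔ with ⟨h0, ⟨h2, h3⟩ | ⟨m, rfl, h3, h4⟩⟩
  · right; exact h3
  · left; omega

theorem zero_b {Δ : ℤ} (hΔ : IsFundamentalDiscriminant Δ) {f : Fin 4 → ℤ} (hf : D4 f = Δ)
    (h0 : f 0 = 0) : f 1 = 1 ∨ f 1 = -1 := by
  have h1 : f 1 ^ 2 * (4 * f 1 * f 3 - 3 * f 2 ^ 2) = Δ := by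
    rw [← hf]; simp [D4, h0]; ring
  rcases hΔ with ⟨_, ⟨h2, h3⟩ | ⟨m, rfl, h3, h4⟩⟩
  · exact Int.isUnit_iff.1 (h2 (f 1) ⟨4 * f 1 * f 3 - 3 * f 2 ^ 2, by rw [← h1]; ring⟩)
  · rcases Int.even_or_odd' (f 1) with ⟨t, ht | ht⟩
    · exfalso
      have h5 : t ^ 2 * (8 * t * f 3 - 3 * f 2 ^ 2) = m := by
        rw [ht] at h1; nlinarith
      have h6 := Int.isUnit_iff.1 (h3 t ⟨8 * t * f 3 - 3 * f 2 ^ 2, by rw [← h5]; ring⟩)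
      have h7 : t ^ 2 = 1 := by rcases h6 with rfl | rfl <;> norm_num
      rw [h7, one_mul] at h5
      have hc : f 2 ^ 2 % 4 = 0 ∨ f 2 ^ 2 % 4 = 1 := by
        rcases Int.even_or_odd' (f 2) with ⟨u, hu | hu⟩ <;> rw [hu]
        · left; ring_nf; omega
        · right; ring_nf; omega
      have h8 : 8 * t * f 3 = 4 * (2 * (t * f 3)) := by ring
      omega
    · have hc : IsCoprime ((f 1) ^ 2) 4 := by
        have : IsCoprime (f 1) 2 := ⟨1, -t, by rw [ht]; ring⟩
        have h := IsCoprime.pow (m := 2) (n := 2) this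
        norm_num at h
        exact h
      have hd : (f 1) ^ 2 ∣ m := by
        apply hc.dvd_of_dvd_mul_left
        exact ⟨_, h1.symm⟩
      exact Int.isUnit_iff.1 (h3 (f 1) (by rwa [← sq]))

theorem zero_eqv_aux {f g : Fin 4 → ℤ} (hD : D4 f = D4 g) (hf0 : f 0 = 0) (hg0 : g 0 = 0)
    (hf1 : f 1 = 1) (hg1 : g 1 = 1) : Eqv f g := by
  simp [D4, hf0, hg0, hf1, hg1] at hD
  have hp : (g 2 - f 2) % 2 = 0 := by
    have h : ∀ x : ℤ, x ^ 2 % 2 = x % 2 := by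
      intro x
      rcases Int.even_or_odd' x with ⟨u, hu | hu⟩ <;> rw [hu] <;> ring_nf <;> omega
    have e1 := h (f 2)
    have e2 := h (g 2)
    omega
  obtain ⟨t, ht⟩ : ∃ t, g 2 = f 2 + 2 * t := ⟨(g 2 - f 2) / 2, by omega⟩
  refine ⟨1, t, 0, 1, by ring, ?_⟩
  apply ext4 <;> simp [act, hf0, hg0, hf1, hg1]
  · rw [ht]; ring
  · rw [ht] at hD
    nlinarith

theorem zero_eqv {Δ : ℤ} (hΔ : IsFundamentalDiscriminant Δ) {f g : Fin 4 → ℤ} (hf : D4 f = Δ)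
    (hg : D4 g = Δ) (hf0 : f 0 = 0) (hg0 : g 0 = 0) : Eqv f g := by
  have key : ∀ {f : Fin 4 → ℤ}, D4 f = Δ → f 0 = 0 → ∃ f', Eqv f f' ∧ f' 0 = 0 ∧ f' 1 = 1 := by
    intro f hf h0
    rcases zero_b hΔ hf h0 with h | h
    · exact ⟨f, Eqv.refl f, h0, h⟩
    · exact ⟨-f, Eqv.neg f, by simp [h0], by simp [h]⟩
  obtain ⟨f', e1, a1, b1⟩ := key hf hf0
  obtain ⟨g', e2, a2, b2⟩ := key hg hg0
  have := zero_eqv_aux (f := f') (g := g') (by rw [e1.D4_eq, e2.D4_eq, hf, hg]) a1 a2 b1 b2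
  exact (e1.trans this).trans e2.symm

theorem triv_form {Δ : ℤ} (hΔ : IsFundamentalDiscriminant Δ) (h0 : 24 ≤ Δ) :
    ∃ g : Fin 4 → ℤ, g 0 = 0 ∧ D4 g = Δ ∧ ∀ f, Eqv f g → Red f → f 0 = 0 := by
  obtain ⟨c, d, hc, hd⟩ : ∃ c d : ℤ, (c = 0 ∨ c = 1) ∧ 4 * d - 3 * c ^ 2 = Δ := by
    rcases fund_mod4 hΔ with h | h
    · exact ⟨0, Δ / 4, Or.inl rfl, by omega⟩
    · exact ⟨1, (Δ + 3) / 4, Or.inr rfl, by omega⟩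
  have hg : D4 ![0, 1, c, d] = Δ := by
    simp [D4]; linarith
  refine ⟨![0, 1, c, d], rfl, hg, ?_⟩
  have hd6 : (6 : ℝ) ≤ d := by
    have : 6 ≤ d := by rcases hc with rfl | rfl <;> omega
    exact_mod_cast this
  have hw : RedBy ![0, 1, c, d] ![0, 3, (c : ℝ), (d : ℝ) / 3] := by
    refine ⟨?_, ?_, ?_⟩
    · rcases hc with rfl | rfl <;> simp
    · simp; linarith
    · funext i
      fin_cases i <;> simp [Phi]
      ring
  intro f hf hr
  obtain ⟨p, q, r, s, hdet, rfl⟩ := hf.symm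
  obtain ⟨v, hv⟩ := hr
  have h1 := (Qv_le_one_of_red (by rw [hg]; omega) hw hdet hv).1
  have hr0 : r = 0 := by
    by_contra hne
    have h2 : Qv ![0, 3, (c : ℝ), (d : ℝ) / 3] p r = (p : ℝ) ^ 2 + c * p * r + (d : ℝ) / 3 * r ^ 2 := by
      simp [Qv]
    rw [h2] at h1
    have h3 : (1 : ℝ) ≤ r ^ 2 := by
      have : 1 ≤ r ^ 2 := by have := sq_pos_of_ne_zero hne; omega
      exact_mod_cast this
    rcases hc with rfl | rfl
    · simp at h1; nlinarith [sq_nonneg (p : ℝ)]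
    · simp at h1; nlinarith [sq_nonneg ((p : ℝ) + r / 2)]
  subst hr0
  simp [act]

/-- the main counting identity -/
theorem card_red {Δ : ℤ} (hΔ : IsFundamentalDiscriminant Δ) (h0 : 24 ≤ Δ) :
    {f : Fin 4 → ℤ | Red f ∧ f 0 ≠ 0 ∧ D4 f = Δ}.Finite ∧
    Set.ncard {f : Fin 4 → ℤ | Red f ∧ f 0 ≠ 0 ∧ D4 f = Δ} + 2 = 6 * h3 Δ := by
  obtain ⟨hfin, F, hF, hinj, hsurj⟩ := field_classes hΔ (by omega)
  obtain ⟨g, g0, gD, gr⟩ := triv_form hΔ h0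
  obtain ⟨i0, hi0⟩ := hsurj g gD
  have hpos : ∀ i, 0 < D4 (F i) := fun i => by rw [hF]; omega
  choose R hR1 hR2 using fun i => exists_red _ (hpos i)
  have hRD : ∀ i, D4 (R i) = Δ := fun i => by rw [(hR1 i).D4_eq, hF]
  have hnt : ∀ i, i ≠ i0 → ¬ Triv (R i) := by
    rintro i hi ⟨k, hk, hk0⟩
    apply hi
    apply hinj
    have := zero_eqv hΔ (by rw [hk.D4_eq, hRD]) gD hk0 g0
    exact ((hR1 i).trans (hk.trans this)).trans hi0.symm
  have hR0 : ∀ i, i ≠ i0 → R i 0 ≠ 0 := fun i hi h => hnt i hi ⟨R i, Eqv.refl _, h⟩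
  let Ψ : {i // i ≠ i0} × Bool → (Fin 4 → ℤ) := fun z => if z.2 then R z.1 else - R z.1
  have hΨe : ∀ z, Eqv (F z.1) (Ψ z) := by
    rintro ⟨i, b⟩
    cases b
    · exact (hR1 i).trans (Eqv.neg _)
    · exact hR1 i
  have hΨ : Function.Injective Ψ := by
    rintro ⟨i, b⟩ ⟨j, c⟩ h
    have hij : i = j := by
      apply Subtype.ext
      apply hinj
      have e1 := hΨe (i, b)
      rw [h] at e1
      exact e1.trans (hΨe (j, c)).symm
    subst hij
    have hne := hR0 i i.2
    have h' := congrFun h 0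
    cases b <;> cases c <;> simp [Ψ] at h' ⊢ <;> omega
  have hrange : Set.range Ψ = {f : Fin 4 → ℤ | Red f ∧ f 0 ≠ 0 ∧ D4 f = Δ} := by
    apply Set.Subset.antisymm
    · rintro _ ⟨⟨i, b⟩, rfl⟩
      have hne := hR0 i i.2
      cases b
      · exact ⟨(hR2 i).neg, by simpa [Ψ] using hne, by simp [Ψ, D4_neg, hRD]⟩
      · exact ⟨hR2 i, by simpa [Ψ] using hne, by simp [Ψ, hRD]⟩
    · rintro f ⟨f1, f2, f3⟩
      obtain ⟨i, hi⟩ := hsurj f f3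
      have hne : i ≠ i0 := by
        rintro rfl
        exact f2 (gr f (hi.symm.trans hi0) f1)
      have := red_unique (f := R i) (g := f) (by rw [hRD]; omega) (hR2 i) f1 ((hR1 i).symm.trans hi) (hnt i hne)
      rcases this with h | h
      · exact ⟨(⟨i, hne⟩, true), by simp [Ψ, h]⟩
      · exact ⟨(⟨i, hne⟩, false), by simp [Ψ, h]⟩
  rw [← hrange]
  refine ⟨Set.finite_range Ψ, ?_⟩
  rw [← Nat.card_coe_set_eq, ← Nat.card_congr (Equiv.ofInjective Ψ hΨ), Nat.card_prod]
  have h1 : Nat.card {i // i ≠ i0} + 1 = h3 Δ * 3 := by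
    unfold h3
    classical
    haveI := Fintype.ofFinite {x : ClassGroup (NumberField.RingOfIntegers (quadField Δ)) // x ^ 3 = 1}
    have := Fintype.card_subtype_compl (fun i => i = i0)
    rw [Nat.card_eq_fintype_card, Nat.card_eq_fintype_card, this]
    simp
    have : 0 < Fintype.card {x : ClassGroup (NumberField.RingOfIntegers (quadField Δ)) // x ^ 3 = 1} :=
      Fintype.card_pos_iff.2 ⟨i0.1⟩
    omega
  rw [Nat.card_eq_fintype_card (α := Bool), Fintype.card_bool]
  omega

end NH

namespace NH

/-- number of forms mod `M` of discriminant `D0` -/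
noncomputable def cnt (M : ℕ) (D0 : ℤ) : ℕ := Nat.card {f : Fin 4 → ZMod M // D4 f = (D0 : ZMod M)}

theorem D4_map {R S : Type*} [CommRing R] [CommRing S] (φ : R →+* S) (f : Fin 4 → R) :
    D4 (fun i => φ (f i)) = φ (D4 f) := by
  simp [D4, map_ofNat]

theorem cnt_mul {m n : ℕ} (h : m.Coprime n) (D0 : ℤ) : cnt (m * n) D0 = cnt m D0 * cnt n D0 := by
  unfold cnt
  rw [← Nat.card_prod]
  let e := ZMod.chineseRemainder h
  have e1 : ∀ f : Fin 4 → ZMod (m * n), D4 f = (D0 : ZMod (m * n)) ↔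
      D4 (fun i => (e (f i)).1) = (D0 : ZMod m) ∧ D4 (fun i => (e (f i)).2) = (D0 : ZMod n) := by
    intro f
    have a1 := D4_map ((RingHom.fst _ _).comp (e : ZMod (m * n) →+* ZMod m × ZMod n)) f
    have a2 := D4_map ((RingHom.snd _ _).comp (e : ZMod (m * n) →+* ZMod m × ZMod n)) f
    simp at a1 a2
    rw [a1, a2, ← e.injective.eq_iff, Prod.ext_iff]
    simp
  refine Nat.card_congr ?_
  refine Equiv.trans ?_ (Equiv.subtypeProdEquivProd (p := fun f => D4 f = (D0 : ZMod m)) (q := fun f => D4 f = (D0 : ZMod n)))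
  refine Equiv.subtypeEquiv ((Equiv.piCongrRight fun _ => e.toEquiv).trans (Equiv.arrowProdEquivProdArrow (Fin 4) (fun _ => ZMod m) (fun _ => ZMod n))) ?_
  intro f
  exact e1 f

theorem card_pre {G H : Type*} [AddGroup G] [AddGroup H] [Finite G] [Finite H] (φ : G →+ H)
    (hφ : Function.Surjective φ) (P : H → Prop) :
    Nat.card {g // P (φ g)} * Nat.card H = Nat.card {h // P h} * Nat.card G := by
  classical
  haveI := Fintype.ofFinite G
  haveI := Fintype.ofFinite H
  have hfib : ∀ h : H, (Finset.univ.filter fun g => φ g = h).card = (Finset.univ.filter fun g => φ g = 0).card :=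
    fun h => AddMonoidHom.card_fiber_eq_of_mem_range φ (hφ h) (hφ 0)
  set c := (Finset.univ.filter fun g => φ g = 0).card
  have h1 : Nat.card {g // P (φ g)} = Nat.card {h // P h} * c := by
    rw [Nat.card_eq_fintype_card, Nat.card_eq_fintype_card, Fintype.card_subtype, Fintype.card_subtype]
    rw [Finset.card_eq_sum_card_fiberwise (f := φ) (t := Finset.univ.filter P)]
    · rw [Finset.sum_congr rfl (g := fun _ => c), Finset.sum_const, smul_eq_mul]
      intro x hx
      rw [← hfib x, Finset.filter_filter]
      congr 1
      ext g
      simp at hx ⊢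
      rintro rfl; exact hx
    · intro g hg
      simpa using hg
  have h2 : Nat.card G = Nat.card H * c := by
    rw [Nat.card_eq_fintype_card, Nat.card_eq_fintype_card, ← Finset.card_univ, ← Finset.card_univ]
    rw [Finset.card_eq_sum_card_fiberwise (f := φ) (t := Finset.univ)]
    · rw [Finset.sum_congr rfl (g := fun _ => c), Finset.sum_const, smul_eq_mul]
      intro x hx
      rw [← hfib x]
    · intro g hg; simp
  rw [h1, h2]; ring

/-- forms mod `m'` satisfying a condition mod `m` -/
theorem card_pre_zmod {m m' : ℕ} [NeZero m] [NeZero m'] (hm : m ∣ m') (P : (Fin 4 → ZMod m) → Prop) :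
    Nat.card {f : Fin 4 → ZMod m' // P (fun i => ZMod.castHom hm (ZMod m) (f i))} * m ^ 4
      = Nat.card {f : Fin 4 → ZMod m // P f} * m' ^ 4 := by
  let φ : (Fin 4 → ZMod m') →+ (Fin 4 → ZMod m) := (ZMod.castHom hm (ZMod m)).toAddMonoidHom.compLeft (Fin 4)
  have hφ : Function.Surjective φ := by
    intro g
    choose r hr using fun i => ZMod.castHom_surjective hm (g i)
    exact ⟨r, funext hr⟩
  have := card_pre φ hφ P
  rw [Nat.card_eq_fintype_card (α := Fin 4 → ZMod m), Nat.card_eq_fintype_card (α := Fin 4 → ZMod m'),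
    Fintype.card_fun, Fintype.card_fun, ZMod.card, ZMod.card, Fintype.card_fin] at this
  exact this

theorem cnt_congr {M : ℕ} {D D' : ℤ} (h : (D : ZMod M) = D') : cnt M D = cnt M D' := by
  unfold cnt; rw [h]

/-- if all lifts of `D0` have equally many forms, we can lift the count -/
theorem cnt_lift {p k : ℕ} (hp : 0 < p) {D0 : ℤ}
    (h : ∀ t : ℕ, cnt (p ^ (k + 1)) (D0 + p ^ k * t) = cnt (p ^ (k + 1)) D0) :
    cnt (p ^ (k + 1)) D0 = p ^ 3 * cnt (p ^ k) D0 := by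
  haveI : NeZero p := ⟨hp.ne'⟩
  haveI : NeZero (p ^ k) := ⟨pow_ne_zero _ hp.ne'⟩
  haveI : NeZero (p ^ (k + 1)) := ⟨pow_ne_zero _ hp.ne'⟩
  have hd : p ^ k ∣ p ^ (k + 1) := pow_dvd_pow p (Nat.le_succ k)
  have h1 := card_pre_zmod hd (fun f => D4 f = (D0 : ZMod (p ^ k)))
  have h2 : Nat.card {f : Fin 4 → ZMod (p ^ (k + 1)) //
      D4 (fun i => ZMod.castHom hd (ZMod (p ^ k)) (f i)) = (D0 : ZMod (p ^ k))} = p * cnt (p ^ (k + 1)) D0 := by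
    classical
    rw [Nat.card_eq_fintype_card, Fintype.card_subtype]
    have e : Finset.univ.filter (fun f : Fin 4 → ZMod (p ^ (k + 1)) =>
        D4 (fun i => ZMod.castHom hd (ZMod (p ^ k)) (f i)) = (D0 : ZMod (p ^ k)))
        = (Finset.range p).biUnion (fun t => Finset.univ.filter (fun f : Fin 4 → ZMod (p ^ (k + 1)) =>
          D4 f = ((D0 + p ^ k * t : ℤ) : ZMod (p ^ (k + 1))))) := by
      ext f
      simp only [Finset.mem_filter, Finset.mem_univ, true_and, Finset.mem_biUnion, Finset.mem_range]
      rw [D4_map]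
      obtain ⟨z, hz⟩ := ZMod.intCast_surjective (D4 f)
      rw [← hz]
      rw [map_intCast]
      constructor
      · intro h
        rw [ZMod.intCast_eq_intCast_iff_dvd_sub] at h
        obtain ⟨c, hc⟩ := h
        refine ⟨((-c) % p).toNat, ?_, ?_⟩
        · have := Int.emod_lt_of_pos (-c) (by exact_mod_cast hp : (0 : ℤ) < p)
          omega
        · rw [ZMod.intCast_eq_intCast_iff_dvd_sub]
          have h0 := Int.emod_nonneg (-c) (by exact_mod_cast hp.ne' : (p : ℤ) ≠ 0)
          rw [Int.toNat_of_nonneg h0]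
          have h3 := Int.emod_add_mul_ediv (-c) p
          refine ⟨-((-c) / p), ?_⟩
          push_cast at hc ⊢
          have : (-c) % (p : ℤ) = -c - p * ((-c) / p) := by linarith
          rw [this]
          rw [pow_succ]
          linear_combination hc
      · rintro ⟨t, -, h⟩
        have := congrArg (ZMod.castHom hd (ZMod (p ^ k))) h
        rw [map_intCast, map_intCast] at this
        rw [this]
        have : ((p : ZMod (p ^ k)) ^ k) = 0 := by exact_mod_cast ZMod.natCast_self (p ^ k)
        push_cast
        rw [this]; ring
    rw [e, Finset.card_biUnion]
    · rw [Finset.sum_congr rfl (g := fun _ => cnt (p ^ (k + 1)) D0)]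
      · simp
      · intro t _
        rw [← h t]
        unfold cnt
        rw [Nat.card_eq_fintype_card, Fintype.card_subtype]
    · intro s hs t ht hst
      rw [Function.onFun, Finset.disjoint_left]
      intro f h1 h2
      simp only [Finset.mem_filter, Finset.mem_univ, true_and] at h1 h2
      rw [h1, ZMod.intCast_eq_intCast_iff_dvd_sub] at h2
      obtain ⟨c, hc⟩ := h2
      apply hst
      have hpk : (p : ℤ) ^ k ≠ 0 := pow_ne_zero _ (by exact_mod_cast hp.ne')
      have h3 : (t : ℤ) - s = p * c := by
        apply mul_left_cancel₀ hpk
        push_cast at hc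
        rw [pow_succ] at hc
        linear_combination hc
      have h4 : (s : ℤ) % p = t % p := (Int.modEq_iff_dvd.2 ⟨c, h3⟩ : (s:ℤ) ≡ t [ZMOD p])
      simp only [Finset.coe_range, Set.mem_Iio] at hs ht
      have h5 : s % p = t % p := by exact_mod_cast h4
      rwa [Nat.mod_eq_of_lt hs, Nat.mod_eq_of_lt ht] at h5
  rw [h2] at h1
  have hpp : 0 < (p ^ k) ^ 4 * p := by positivity
  apply Nat.eq_of_mul_eq_mul_left hpp
  have : Nat.card {f : Fin 4 → ZMod (p ^ k) // D4 f = (D0 : ZMod (p ^ k))} = cnt (p ^ k) D0 := rfl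
  rw [this] at h1
  calc _ = p * cnt (p ^ (k + 1)) D0 * (p ^ k) ^ 4 := by ring
    _ = _ := by rw [h1]; ring

end NH

namespace NH

theorem card_split {α : Type*} [Finite α] (P Q : α → Prop) :
    Nat.card {x // P x} = Nat.card {x // P x ∧ Q x} + Nat.card {x // P x ∧ ¬ Q x} := by
  classical
  haveI := Fintype.ofFinite α
  simp only [Nat.card_eq_fintype_card, Fintype.card_subtype]
  rw [← Finset.card_filter_add_card_filter_not (s := Finset.univ.filter P) Q, Finset.filter_filter, Finset.filter_filter]

theorem D4_syz {R : Type*} [CommRing R] (f : Fin 4 → R) :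
    (f 0 ^ 2 * f 3 - 3 * f 0 * f 1 * f 2 + 2 * f 1 ^ 3) ^ 2 + 4 * (f 0 * f 2 - f 1 ^ 2) ^ 3 = f 0 ^ 2 * D4 f := by
  simp only [D4]; ring

theorem cg1 {G : Type*} [CommGroup G] (H a : G) : H ^ 3 * a⁻¹ ^ 2 * (a * H⁻¹) ^ 2 = H := by
  rw [mul_pow]
  have : H ^ 3 * a⁻¹ ^ 2 * (a ^ 2 * H⁻¹ ^ 2) = (H ^ 3 * H⁻¹ ^ 2) * (a⁻¹ ^ 2 * a ^ 2) := by ac_rfl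
  rw [this]; group

theorem cg2 {G : Type*} [CommGroup G] (t v w : G) :
    t * (v * t⁻¹ * w ^ 2) ^ 3 * (v * t⁻¹ * w ^ 3)⁻¹ ^ 2 = v := by
  simp only [mul_pow, mul_inv, inv_inv]
  have : t * (v ^ 3 * t⁻¹ ^ 3 * (w ^ 2) ^ 3) * (v⁻¹ ^ 2 * t ^ 2 * (w ^ 3)⁻¹ ^ 2) = (v ^ 3 * v⁻¹ ^ 2) * (t * t⁻¹ ^ 3 * t ^ 2) * ((w ^ 2) ^ 3 * (w ^ 3)⁻¹ ^ 2) := by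
    ac_rfl
  rw [this]; group

section
variable {R : Type*} [CommRing R] [Finite R]

theorem blockA (D : R) (P : R → Prop) :
    Nat.card {f : Fin 4 → R // (D4 f = D ∧ IsUnit (f 0)) ∧ P (f 0 * f 2 - f 1 ^ 2)}
     = Nat.card R * Nat.card {x : Rˣ × R × R // x.2.2 ^ 2 + 4 * x.2.1 ^ 3 * (↑x.1⁻¹ : R) ^ 2 = D ∧ P x.2.1} := by
  rw [← Nat.card_prod]
  let F : {f : Fin 4 → R // (D4 f = D ∧ IsUnit (f 0)) ∧ P (f 0 * f 2 - f 1 ^ 2)} →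
      R × {x : Rˣ × R × R // x.2.2 ^ 2 + 4 * x.2.1 ^ 3 * (↑x.1⁻¹ : R) ^ 2 = D ∧ P x.2.1} := fun f =>
    (f.1 1, ⟨(f.2.1.2.unit, f.1 0 * f.1 2 - f.1 1 ^ 2, (↑f.2.1.2.unit⁻¹ : R) *
      (f.1 0 ^ 2 * f.1 3 - 3 * f.1 0 * f.1 1 * f.1 2 + 2 * f.1 1 ^ 3)), by
        refine ⟨?_, f.2.2⟩
        have h1 := D4_syz f.1
        have h2 : (↑f.2.1.2.unit⁻¹ : R) * f.1 0 = 1 := IsUnit.val_inv_mul f.2.1.2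
        rw [f.2.1.1] at h1
        set a' := (↑f.2.1.2.unit⁻¹ : R)
        dsimp only
        linear_combination a' ^ 2 * h1 + D * (a' * f.1 0 + 1) * h2⟩)
  refine Nat.card_congr (Equiv.ofBijective F ⟨?_, ?_⟩)
  · rintro ⟨f, hf⟩ ⟨g, hg⟩ h
    simp only [F, Prod.mk.injEq, Subtype.mk.injEq] at h
    obtain ⟨hb, ha, hH, hγ⟩ := h
    have ha' : f 0 = g 0 := by
      have := congrArg Units.val ha
      simpa using this
    rw [ha] at hγ
    have hγ := (Units.mul_right_inj _).1 hγ
    have hu := hg.1.2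
    rw [ha', hb] at hH hγ
    have hc : f 2 = g 2 := by
      apply hu.mul_left_cancel
      linear_combination hH
    rw [hc] at hγ
    have hd : f 3 = g 3 := by
      apply (hu.pow 2).mul_left_cancel
      linear_combination hγ
    exact Subtype.ext (ext4 ha' hb hc hd)
  · rintro ⟨b, ⟨⟨a, H, γ⟩, hx, hP⟩⟩
    dsimp only at hx hP
    have haa : (a : R) * (↑a⁻¹ : R) = 1 := a.mul_inv
    set a' := (↑a⁻¹ : R) with ha'
    have e1 : (a : R) * ((H + b ^ 2) * a') - b ^ 2 = H := by linear_combination (H + b ^ 2) * haa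
    have e2 : (a : R) ^ 2 * ((a * γ + 3 * a * b * ((H + b ^ 2) * a') - 2 * b ^ 3) * a' ^ 2) -
        3 * a * b * ((H + b ^ 2) * a') + 2 * b ^ 3 = a * γ := by
      linear_combination (a * γ + 3 * a * b * ((H + b ^ 2) * a') - 2 * b ^ 3) * (a * a' + 1) * haa
    refine ⟨⟨![a, b, (H + b ^ 2) * a', (a * γ + 3 * a * b * ((H + b ^ 2) * a') - 2 * b ^ 3) * a' ^ 2], ⟨?_, ?_⟩, ?_⟩, ?_⟩
    · have := D4_syz ![(a : R), b, (H + b ^ 2) * a', (a * γ + 3 * a * b * ((H + b ^ 2) * a') - 2 * b ^ 3) * a' ^ 2]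
      simp only [Matrix.cons_val] at this
      rw [e1, e2] at this
      apply (a.isUnit.pow 2).mul_left_cancel
      rw [← this, ← hx]
      linear_combination (-4) * H ^ 3 * (a * a' + 1) * haa
    · simp
    · simp only [Matrix.cons_val]
      rw [e1]; exact hP
    · simp only [F, Prod.mk.injEq, Subtype.mk.injEq, Matrix.cons_val]
      have : ∀ h : IsUnit (a : R), h.unit = a := fun h => Units.ext (by simp)
      refine ⟨trivial, this _, e1, ?_⟩
      refine (congrArg₂ (fun (x : Rˣ) (y : R) => (↑x⁻¹ : R) * y) (this _) e2).trans ?_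
      rw [← mul_assoc, Units.inv_mul, one_mul]

theorem blockA_unit (h2 : IsUnit (2 : R)) (D : R) :
    Nat.card {x : Rˣ × R × R // x.2.2 ^ 2 + 4 * x.2.1 ^ 3 * (↑x.1⁻¹ : R) ^ 2 = D ∧ IsUnit x.2.1}
     = Nat.card Rˣ * Nat.card {γ : R // IsUnit (D - γ ^ 2)} := by
  rw [← Nat.card_prod]
  have h4 : IsUnit (4 : R) := by
    have := h2.mul h2
    norm_num at this; exact this
  let F : {x : Rˣ × R × R // x.2.2 ^ 2 + 4 * x.2.1 ^ 3 * (↑x.1⁻¹ : R) ^ 2 = D ∧ IsUnit x.2.1} →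
     Rˣ × {γ : R // IsUnit (D - γ ^ 2)} := fun x =>
     (x.1.1 * x.2.2.unit⁻¹, ⟨x.1.2.2, by
      have := (h4.mul (x.2.2.pow 3)).mul ((Units.isUnit x.1.1⁻¹).pow 2)
      convert this using 1
      linear_combination (-1) * x.2.1⟩)
  refine Nat.card_congr (Equiv.ofBijective F ⟨?_, ?_⟩)
  · rintro ⟨⟨a, H, γ⟩, hx, hu⟩ ⟨⟨b, K, δ⟩, hy, hv⟩ h
    simp only [F, Prod.mk.injEq, Subtype.mk.injEq] at h
    dsimp only at hu hv hx hy
    obtain ⟨hw, rfl⟩ := h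
    obtain ⟨H, rfl⟩ := hu
    obtain ⟨K, rfl⟩ := hv
    have : ∀ (a : Rˣ) (h : IsUnit (a : R)), h.unit = a := fun a h => Units.ext (by simp)
    rw [this, this] at hw
    have e : (4 : R) * (H : R) ^ 3 * (↑a⁻¹ : R) ^ 2 = 4 * (K : R) ^ 3 * (↑b⁻¹ : R) ^ 2 := by linear_combination hx - hy
    have e2 : H ^ 3 * a⁻¹ ^ 2 = K ^ 3 * b⁻¹ ^ 2 := by
      apply Units.ext
      apply h4.mul_left_cancel
      push_cast
      linear_combination e
    have hHK : H = K := by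
      rw [← cg1 H a, e2, hw, cg1]
    subst hHK
    have : a = b := mul_right_cancel hw
    subst this; rfl
  · rintro ⟨w, γ, hu⟩
    obtain ⟨v, hv⟩ := hu
    obtain ⟨t, ht⟩ := h4
    refine ⟨⟨(v * t⁻¹ * w ^ 3, ((v * t⁻¹ * w ^ 2 : Rˣ) : R), γ), ?_, Units.isUnit _⟩, ?_⟩
    · dsimp only
      have : t * (v * t⁻¹ * w ^ 2) ^ 3 * (v * t⁻¹ * w ^ 3)⁻¹ ^ 2 = v := cg2 t v w
      have := congrArg Units.val this
      rw [← ht]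
      push_cast at this hv ⊢
      rw [this, hv]; ring
    · simp only [F, Prod.mk.injEq, and_true]
      have : ∀ (a : Rˣ) (h : IsUnit (a : R)), h.unit = a := fun a h => Units.ext (by simp)
      refine (congrArg (fun x : Rˣ => v * t⁻¹ * w ^ 3 * x⁻¹) (this (v * t⁻¹ * w ^ 2) _)).trans ?_
      rw [mul_inv]
      have : v * t⁻¹ * w ^ 3 * ((v * t⁻¹)⁻¹ * (w ^ 2)⁻¹) = (v * t⁻¹ * (v * t⁻¹)⁻¹) * (w ^ 3 * (w ^ 2)⁻¹) := by
        ac_rfl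
      rw [this]
      group

theorem card_isUnit : Nat.card {x : R // IsUnit x} = Nat.card Rˣ := by
  refine (Nat.card_congr (Equiv.ofBijective (fun u : Rˣ => (⟨u, u.isUnit⟩ : {x : R // IsUnit x})) ⟨?_, ?_⟩)).symm
  · intro a b h
    simpa [Units.ext_iff] using h
  · rintro ⟨x, u, rfl⟩
    exact ⟨u, rfl⟩

/-- `a` nonunit, `b` unit -/
theorem blockB (h2 : IsUnit (2 : R)) (hm : ∀ x y : R, ¬ IsUnit x → ¬ IsUnit y → x * y = 0) (D : R) :
    Nat.card {f : Fin 4 → R // (D4 f = D ∧ ¬ IsUnit (f 0)) ∧ IsUnit (f 1)} =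
      Nat.card {x : R // ¬ IsUnit x} * (Nat.card Rˣ * Nat.card R) := by
  rw [← card_isUnit, ← Nat.card_prod, ← Nat.card_prod]
  have hu : ∀ a b c : R, ¬ IsUnit a → IsUnit b → IsUnit (4 * b ^ 3 - 6 * a * b * c) := by
    intro a b c ha hb
    have h4 : IsUnit (4 : R) := by
      have := h2.mul h2
      norm_num at this; exact this
    have hn : IsNilpotent (- (6 * a * b * c)) := ⟨2, by
      have := hm a a ha ha
      linear_combination 36 * b ^ 2 * c ^ 2 * this⟩
    rw [sub_eq_add_neg]
    exact IsNilpotent.isUnit_add_left_of_commute hn (h4.mul (hb.pow 3)) (Commute.all _ _)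
  let F : {f : Fin 4 → R // (D4 f = D ∧ ¬ IsUnit (f 0)) ∧ IsUnit (f 1)} →
    {x : R // ¬ IsUnit x} × ({x : R // IsUnit x} × R) := fun f => (⟨f.1 0, f.2.1.2⟩, ⟨f.1 1, f.2.2⟩, f.1 2)
  have hD : ∀ f : Fin 4 → R, ¬ IsUnit (f 0) → D4 f = (4 * f 1 ^ 3 - 6 * f 0 * f 1 * f 2) * f 3 + (4 * f 0 * f 2 ^ 3 - 3 * f 1 ^ 2 * f 2 ^ 2) := by
    intro f hf
    have := hm _ _ hf hf
    simp only [D4]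
    linear_combination f 3 ^ 2 * this
  refine Nat.card_congr (Equiv.ofBijective F ⟨?_, ?_⟩)
  · rintro ⟨f, hf⟩ ⟨g, hg⟩ h
    simp only [F, Prod.mk.injEq, Subtype.mk.injEq] at h
    obtain ⟨ha, hb, hc⟩ := h
    have e := hf.1.1.trans hg.1.1.symm
    rw [hD f hf.1.2, hD g hg.1.2, ha, hb, hc] at e
    refine Subtype.ext (ext4 ha hb hc ?_)
    apply (hu _ _ (g 2) hg.1.2 hg.2).mul_left_cancel
    linear_combination e
  · rintro ⟨⟨a, ha⟩, ⟨b, hb⟩, c⟩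
    obtain ⟨v, hv⟩ := hu a b c ha hb
    refine ⟨⟨![a, b, c, ↑v⁻¹ * (D - (4 * a * c ^ 3 - 3 * b ^ 2 * c ^ 2))], ⟨?_, ?_⟩, ?_⟩, ?_⟩
    · rw [hD _ (by simpa using ha)]
      simp only [Matrix.cons_val]
      rw [← hv, ← mul_assoc, v.mul_inv]; ring
    · simpa using ha
    · simpa using hb
    · simp [F]
end

/-- scaling invariance -/
theorem cnt_scale {M : ℕ} {D D' : ℤ} (s : (ZMod M)ˣ) (h : (D' : ZMod M) = (s : ZMod M) ^ 4 * D) : cnt M D' = cnt M D := by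
  unfold cnt
  symm
  refine Nat.card_congr (Equiv.subtypeEquiv (MulAction.toPerm s) ?_)
  intro f
  have : D4 (s • f) = (s : ZMod M) ^ 4 * D4 f := by
    simp only [D4, Pi.smul_apply, Units.smul_def, smul_eq_mul]; ring
  simp only [MulAction.toPerm_apply]
  rw [this, h]
  constructor
  · intro h; rw [h]
  · intro h; exact (s.isUnit.pow 4).mul_left_cancel h

end NH

namespace NH

theorem card_split' {α : Type*} [Finite α] (Q : α → Prop) :
    Nat.card α = Nat.card {x // Q x} + Nat.card {x // ¬ Q x} := by
  have := card_split (fun _ : α => True) Q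
  simp only [true_and] at this
  rw [← this]
  exact (Nat.card_congr (Equiv.subtypeUnivEquiv fun _ => trivial)).symm

theorem cnt_field {p : ℕ} (hp : p.Prime) (hp2 : p ≠ 2) {D0 : ℤ} (hD : ¬ (p : ℤ) ∣ D0) :
    cnt p D0 = p * ((p - 1) * (p + 1)) := by
  haveI : Fact p.Prime := ⟨hp⟩
  set D : ZMod p := (D0 : ZMod p) with hDD
  have hD0 : D ≠ 0 := by
    rw [hDD, Ne, ZMod.intCast_zmod_eq_zero_iff_dvd]; exact hD
  have h2 : IsUnit (2 : ZMod p) := by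
    rw [isUnit_iff_ne_zero]
    intro h
    have : ((2 : ℕ) : ZMod p) = 0 := by exact_mod_cast h
    rw [ZMod.natCast_eq_zero_iff] at this
    exact hp2 ((Nat.prime_dvd_prime_iff_eq hp Nat.prime_two).1 this)
  have hm : ∀ x y : ZMod p, ¬ IsUnit x → ¬ IsUnit y → x * y = 0 := by
    intro x y hx _
    simp [isUnit_iff_ne_zero] at hx
    rw [hx, zero_mul]
  unfold cnt
  rw [card_split _ (fun f => IsUnit (f 0)), card_split _ (fun f => IsUnit (f 0 * f 2 - f 1 ^ 2)),
    card_split (fun f : Fin 4 → ZMod p => D4 f = (D0 : ZMod p) ∧ ¬ IsUnit (f 0)) (fun f => IsUnit (f 1)),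
    blockB h2 hm, blockA D IsUnit, blockA D (fun x => ¬ IsUnit x), blockA_unit h2]
  have e1 : Nat.card {x : (ZMod p)ˣ × ZMod p × ZMod p // x.2.2 ^ 2 + 4 * x.2.1 ^ 3 * (↑x.1⁻¹ : ZMod p) ^ 2 = D ∧ ¬ IsUnit x.2.1}
      = Nat.card (ZMod p)ˣ * Nat.card {γ : ZMod p // ¬ IsUnit (D - γ ^ 2)} := by
    rw [← Nat.card_prod]
    let F : {x : (ZMod p)ˣ × ZMod p × ZMod p // x.2.2 ^ 2 + 4 * x.2.1 ^ 3 * (↑x.1⁻¹ : ZMod p) ^ 2 = D ∧ ¬ IsUnit x.2.1} →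
       (ZMod p)ˣ × {γ : ZMod p // ¬ IsUnit (D - γ ^ 2)} := fun x => (x.1.1, ⟨x.1.2.2, by
        have h1 := x.2.1
        have h2 := x.2.2
        simp only [isUnit_iff_ne_zero, not_not] at h2 ⊢
        rw [h2] at h1
        linear_combination -h1⟩)
    refine Nat.card_congr (Equiv.ofBijective F ⟨?_, ?_⟩)
    · rintro ⟨⟨a, H, γ⟩, h⟩ ⟨⟨b, K, δ⟩, h'⟩ e
      simp only [F, Prod.mk.injEq, Subtype.mk.injEq] at e
      simp only [isUnit_iff_ne_zero, not_not] at h h'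
      simp only [Subtype.mk.injEq, Prod.mk.injEq]
      exact ⟨e.1, h.2.trans h'.2.symm, e.2⟩
    · rintro ⟨a, γ, h⟩
      refine ⟨⟨(a, 0, γ), ?_⟩, rfl⟩
      simp only [isUnit_iff_ne_zero, not_not] at h ⊢
      refine ⟨?_, trivial⟩
      linear_combination -h
  have e2 : Nat.card {f : Fin 4 → ZMod p // (D4 f = (D0 : ZMod p) ∧ ¬ IsUnit (f 0)) ∧ ¬ IsUnit (f 1)} = 0 := by
    haveI : IsEmpty {f : Fin 4 → ZMod p // (D4 f = (D0 : ZMod p) ∧ ¬ IsUnit (f 0)) ∧ ¬ IsUnit (f 1)} := by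
      refine ⟨fun ⟨f, h⟩ => hD0 ?_⟩
      simp only [isUnit_iff_ne_zero, not_not] at h
      rw [hDD, ← h.1.1]
      simp [D4, h.1.2, h.2]
    exact Nat.card_of_isEmpty
  have e3 := card_split' (fun γ : ZMod p => IsUnit (D - γ ^ 2))
  have e4 : Nat.card {x : ZMod p // ¬ IsUnit x} = 1 := by
    rw [Nat.card_eq_one_iff_unique]
    refine ⟨⟨fun a b => Subtype.ext ?_⟩, ⟨0, by simp⟩⟩
    have ha := a.2
    have hb := b.2
    simp only [isUnit_iff_ne_zero, not_not] at ha hb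
    rw [ha, hb]
  have e5 : Nat.card (ZMod p)ˣ = p - 1 := by rw [Nat.card_eq_fintype_card, ZMod.card_units]
  have e6 : Nat.card (ZMod p) = p := by rw [Nat.card_eq_fintype_card, ZMod.card]
  rw [e1, e2, e4, e5, e6]
  rw [e6] at e3
  rw [← mul_add, ← mul_add, ← e3]
  ring

theorem cnt_sq {p : ℕ} (hp : p.Prime) (hp2 : p ≠ 2) {D0 : ℤ} (hD : (p : ℤ) ∣ D0) (hD2 : ¬ (p : ℤ) ^ 2 ∣ D0) :
    cnt (p ^ 2) D0 = p ^ 4 * ((p - 1) * (p + 1)) := by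
  haveI : Fact p.Prime := ⟨hp⟩
  haveI : NeZero (p ^ 2) := ⟨pow_ne_zero _ hp.ne_zero⟩
  set D : ZMod (p ^ 2) := (D0 : ZMod (p ^ 2)) with hDD
  have hD0 : D ≠ 0 := by
    rw [hDD, Ne, ZMod.intCast_zmod_eq_zero_iff_dvd]; exact_mod_cast hD2
  have h2 : IsUnit (2 : ZMod (p ^ 2)) := by
    have := (ZMod.isUnit_iff_coprime 2 (p ^ 2)).2 (Nat.Coprime.pow_right 2 ((Nat.coprime_primes Nat.prime_two hp).2 hp2.symm))
    exact_mod_cast this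
  have hN : ∀ x : ZMod (p ^ 2), ¬ IsUnit x → ∃ y : ZMod (p ^ 2), x = (p : ZMod (p ^ 2)) * y := by
    intro x hx
    rw [← ZMod.natCast_zmod_val x, ZMod.isUnit_iff_coprime, Nat.coprime_pow_right_iff (by norm_num), Nat.coprime_comm,
      hp.coprime_iff_not_dvd, not_not] at hx
    obtain ⟨c, hc⟩ := hx
    refine ⟨c, ?_⟩
    rw [← ZMod.natCast_zmod_val x, hc]; push_cast; rfl
  have hpp : (p : ZMod (p ^ 2)) ^ 2 = 0 := by exact_mod_cast ZMod.natCast_self (p ^ 2)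
  have hm : ∀ x y : ZMod (p ^ 2), ¬ IsUnit x → ¬ IsUnit y → x * y = 0 := by
    intro x y hx hy
    obtain ⟨x, rfl⟩ := hN x hx
    obtain ⟨y, rfl⟩ := hN y hy
    linear_combination x * y * hpp
  have hDn : ¬ IsUnit D := by
    obtain ⟨c, rfl⟩ := hD
    intro h
    apply hD0
    have : D * (p * c) = 0 := by rw [hDD]; push_cast; linear_combination (c : ZMod (p ^ 2)) ^ 2 * hpp
    rw [hDD]
    push_cast
    rwa [h.mul_right_eq_zero] at this
  have hDD2 : D * D = 0 := hm _ _ hDn hDn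
  have h4 : IsUnit (4 : ZMod (p ^ 2)) := by
    have := h2.mul h2
    norm_num at this; exact this
  unfold cnt
  rw [card_split _ (fun f => IsUnit (f 0)), card_split _ (fun f => IsUnit (f 0 * f 2 - f 1 ^ 2)),
    card_split (fun f : Fin 4 → ZMod (p ^ 2) => D4 f = (D0 : ZMod (p ^ 2)) ∧ ¬ IsUnit (f 0)) (fun f => IsUnit (f 1)),
    blockB h2 hm, blockA D IsUnit, blockA D (fun x => ¬ IsUnit x), blockA_unit h2]
  have e1 : Nat.card {x : (ZMod (p ^ 2))ˣ × ZMod (p ^ 2) × ZMod (p ^ 2) // x.2.2 ^ 2 + 4 * x.2.1 ^ 3 * (↑x.1⁻¹ : ZMod (p ^ 2)) ^ 2 = D ∧ ¬ IsUnit x.2.1}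
      = 0 := by
    haveI : IsEmpty {x : (ZMod (p ^ 2))ˣ × ZMod (p ^ 2) × ZMod (p ^ 2) // x.2.2 ^ 2 + 4 * x.2.1 ^ 3 * (↑x.1⁻¹ : ZMod (p ^ 2)) ^ 2 = D ∧ ¬ IsUnit x.2.1} := by
      refine ⟨fun ⟨⟨a, H, γ⟩, h, hu⟩ => ?_⟩
      dsimp only at h hu
      have hH := hm _ _ hu hu
      have h' : γ ^ 2 = D := by linear_combination h - 4 * H * (↑a⁻¹ : ZMod (p ^ 2)) ^ 2 * hH
      have hγ : ¬ IsUnit γ := by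
        intro h
        apply hDn; rw [← h']; exact h.pow 2
      apply hD0
      rw [← h', sq γ]; exact hm _ _ hγ hγ
    exact Nat.card_of_isEmpty
  have e5 : Nat.card (ZMod (p ^ 2))ˣ = p * (p - 1) := by
    rw [Nat.card_eq_fintype_card, ZMod.card_units_eq_totient, Nat.totient_prime_pow hp (by norm_num)]
    norm_num
  have e6 : Nat.card (ZMod (p ^ 2)) = p ^ 2 := by rw [Nat.card_eq_fintype_card, ZMod.card]
  have e4 : Nat.card {x : ZMod (p ^ 2) // ¬ IsUnit x} = p := by
    have := card_split' (fun x : ZMod (p ^ 2) => IsUnit x)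
    rw [card_isUnit, e5, e6] at this
    have h1 := hp.one_le
    zify [h1] at this ⊢
    linear_combination -this
  have e2 : Nat.card {f : Fin 4 → ZMod (p ^ 2) // (D4 f = (D0 : ZMod (p ^ 2)) ∧ ¬ IsUnit (f 0)) ∧ ¬ IsUnit (f 1)} =
      Nat.card {x : ZMod (p ^ 2) // IsUnit x} * (Nat.card {x : ZMod (p ^ 2) // ¬ IsUnit x} * Nat.card (ZMod (p ^ 2))) := by
    rw [← Nat.card_prod, ← Nat.card_prod]
    have hf4 : ∀ f : Fin 4 → ZMod (p ^ 2), ¬ IsUnit (f 0) → ¬ IsUnit (f 1) → D4 f = 4 * f 2 ^ 3 * f 0 := by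
      intro f h0 h1
      have a1 := hm _ _ h0 h0
      have a2 := hm _ _ h0 h1
      have a3 := hm _ _ h1 h1
      simp only [D4]
      linear_combination f 3 ^ 2 * a1 - 6 * f 2 * f 3 * a2 + (4 * f 1 * f 3 - 3 * f 2 ^ 2) * a3
    let F : {f : Fin 4 → ZMod (p ^ 2) // (D4 f = (D0 : ZMod (p ^ 2)) ∧ ¬ IsUnit (f 0)) ∧ ¬ IsUnit (f 1)} →
       {x : ZMod (p ^ 2) // IsUnit x} × ({x : ZMod (p ^ 2) // ¬ IsUnit x} × ZMod (p ^ 2)) := fun f =>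
       (⟨f.1 2, by
          by_contra hc
          have := hf4 _ f.2.1.2 f.2.2
          rw [f.2.1.1] at this
          apply hD0
          rw [hDD, this]
          linear_combination 4 * f.1 2 ^ 2 * hm _ _ hc f.2.1.2⟩, ⟨f.1 1, f.2.2⟩, f.1 3)
    refine Nat.card_congr (Equiv.ofBijective F ⟨?_, ?_⟩)
    · rintro ⟨f, h⟩ ⟨g, h'⟩ e
      have hu := (F ⟨g, h'⟩).1.2
      simp only [F, Prod.mk.injEq, Subtype.mk.injEq] at e hu
      have e1 := hf4 _ h.1.2 h.2
      have e2 := hf4 _ h'.1.2 h'.2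
      rw [h.1.1, e.1] at e1
      rw [h'.1.1] at e2
      refine Subtype.ext (ext4 ?_ e.2.1 e.1 e.2.2)
      apply (h4.mul (hu.pow 3)).mul_left_cancel
      rw [← e1, ← e2]
    · rintro ⟨⟨c, hc⟩, ⟨b, hb⟩, d⟩
      obtain ⟨v, hv⟩ := h4.mul (hc.pow 3)
      have ha : ¬ IsUnit ((↑v⁻¹ : ZMod (p ^ 2)) * D) := by
        intro h
        exact hDn (isUnit_of_mul_isUnit_right h)
      refine ⟨⟨![↑v⁻¹ * D, b, c, d], ⟨?_, by simpa using ha⟩, by simpa using hb⟩, by simp [F]⟩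
      rw [hf4 _ (by simpa using ha) (by simpa using hb)]
      simp only [Matrix.cons_val]
      rw [← hv, ← mul_assoc, v.mul_inv, one_mul]
  have e3 : Nat.card {γ : ZMod (p ^ 2) // IsUnit (D - γ ^ 2)} = p * (p - 1) := by
    rw [← e5, ← card_isUnit]
    refine Nat.card_congr (Equiv.subtypeEquivRight fun γ => ?_)
    constructor
    · intro h
      by_contra hγ
      have := hm _ _ hγ hγ
      rw [sq γ, this, sub_zero] at h
      exact hDn h
    · intro h
      have hn : IsNilpotent D := ⟨2, by rw [sq D, hDD2]⟩
      rw [sub_eq_neg_add]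
      exact IsNilpotent.isUnit_add_left_of_commute hn (h.pow 2).neg (Commute.all _ _)
  rw [e1, e2, e4, e3, card_isUnit, e5, e6]
  have h1 := hp.one_le
  zify [h1]
  ring

theorem cnt_step {p : ℕ} (hp : p.Prime) (hp2 : p ≠ 2) {e : ℤ} (he : ¬ (p : ℤ) ∣ e) (i j : ℕ) (hj : 1 ≤ j) :
    cnt (p ^ (i + j + 1)) (p ^ i * e) = p ^ 3 * cnt (p ^ (i + j)) (p ^ i * e) := by
  apply cnt_lift hp.pos
  intro t
  have hc : IsCoprime (4 * e) (p : ℤ) := by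
    rw [IsCoprime.mul_left_iff]
    constructor
    · have : Nat.Coprime 4 p := Nat.Coprime.pow_left 2 ((Nat.coprime_primes Nat.prime_two hp).2 hp2.symm)
      exact_mod_cast Nat.isCoprime_iff_coprime.2 this
    · rw [isCoprime_comm, (Nat.prime_iff_prime_int.1 hp).coprime_iff_not_dvd]; exact he
  obtain ⟨u, v, huv⟩ := hc
  have hs : IsUnit (((1 + p ^ j * (u * t) : ℤ)) : ZMod (p ^ (i + j + 1))) := by
    rw [ZMod.coe_int_isUnit_iff_isCoprime]
    push_cast
    apply IsCoprime.pow_left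
    refine ⟨-(p ^ (j - 1) * (u * t)), 1, ?_⟩
    obtain ⟨j, rfl⟩ := Nat.exists_eq_add_of_le' hj
    simp; ring
  refine cnt_scale hs.unit ?_
  rw [IsUnit.unit_spec]
  have hz : ((p : ZMod (p ^ (i + j + 1))) ^ (i + j + 1)) = 0 := by exact_mod_cast ZMod.natCast_self (p ^ (i + j + 1))
  obtain ⟨j, rfl⟩ := Nat.exists_eq_add_of_le' hj
  have huv' : (u : ZMod (p ^ (i + (j + 1) + 1))) * (4 * e) + v * p = 1 := by exact_mod_cast congrArg (Int.cast (R := ZMod (p ^ (i + (j + 1) + 1)))) huv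
  push_cast
  set P : ZMod (p ^ (i + (j + 1) + 1)) := (p : ZMod (p ^ (i + (j + 1) + 1)))
  set U : ZMod (p ^ (i + (j + 1) + 1)) := (u : ZMod (p ^ (i + (j + 1) + 1)))
  set E : ZMod (p ^ (i + (j + 1) + 1)) := (e : ZMod (p ^ (i + (j + 1) + 1)))
  set T : ZMod (p ^ (i + (j + 1) + 1)) := (t : ZMod (p ^ (i + (j + 1) + 1)))
  set V : ZMod (p ^ (i + (j + 1) + 1)) := (v : ZMod (p ^ (i + (j + 1) + 1)))
  linear_combination (V * T - P ^ j * (U * T) ^ 2 * E * (6 + 4 * P ^ (j + 1) * (U * T) + P ^ (2 * j + 2) * (U * T) ^ 2)) * hz - P ^ (i + j + 1) * T * huv'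

theorem cnt_odd {p : ℕ} (hp : p.Prime) (hp2 : p ≠ 2) {D0 : ℤ} (hD : ¬ (p : ℤ) ^ 2 ∣ D0) (k : ℕ) (hk : 2 ≤ k) :
    cnt (p ^ k) D0 * p ^ 2 = (p ^ k) ^ 3 * ((p - 1) * (p + 1)) := by
  by_cases h : (p : ℤ) ∣ D0
  · have h2 := cnt_sq hp hp2 h hD
    obtain ⟨e, he⟩ := h
    have hpe : ¬ (p : ℤ) ∣ e := by
      rintro ⟨c, rfl⟩
      exact hD ⟨c, by rw [he]; ring⟩
    induction k, hk using Nat.le_induction with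
    | base => rw [h2]; ring
    | succ k hk ih =>
      have := cnt_step hp hp2 hpe 1 (k - 1) (by omega)
      rw [pow_one, ← he, show 1 + (k - 1) = k by omega] at this
      rw [this]
      calc _ = p ^ 3 * (cnt (p ^ k) D0 * p ^ 2) := by ring
        _ = _ := by rw [ih]; ring
  · have h2 : cnt (p ^ 1) D0 * p ^ 2 = (p ^ 1) ^ 3 * ((p - 1) * (p + 1)) := by
      rw [pow_one, cnt_field hp hp2 h]; ring
    have : 1 ≤ k := by omega
    induction k, this using Nat.le_induction with
    | base => exact h2
    | succ k hk' ih =>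
      have := cnt_step hp hp2 h 0 k hk'
      rw [pow_zero, one_mul, zero_add] at this
      rw [this]
      by_cases hk2 : 2 ≤ k
      · calc _ = p ^ 3 * (cnt (p ^ k) D0 * p ^ 2) := by ring
          _ = _ := by rw [ih hk2]; ring
      · have : k = 1 := by omega
        subst this
        calc _ = p ^ 3 * (cnt (p ^ 1) D0 * p ^ 2) := by ring
          _ = _ := by rw [h2]; ring

end NH

namespace NH

/-- gradient of `D4` -/
def grad {R : Type*} [CommRing R] (f : Fin 4 → R) : Fin 4 → R :=
  ![2 * f 0 * f 3 ^ 2 - 6 * f 1 * f 2 * f 3 + 4 * f 2 ^ 3,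
    -6 * f 0 * f 2 * f 3 - 6 * f 1 * f 2 ^ 2 + 12 * f 1 ^ 2 * f 3,
    -6 * f 0 * f 1 * f 3 - 6 * f 1 ^ 2 * f 2 + 12 * f 0 * f 2 ^ 2,
    2 * f 0 ^ 2 * f 3 - 6 * f 0 * f 1 * f 2 + 4 * f 1 ^ 3]

theorem grad_map {R S : Type*} [CommRing R] [CommRing S] (φ : R →+* S) (f : Fin 4 → R) (i : Fin 4) :
    grad (fun i => φ (f i)) i = φ (grad f i) := by
  fin_cases i <;> simp [grad, map_ofNat]

theorem D4_shift {R : Type*} [CommRing R] (f : Fin 4 → R) (i : Fin 4) (x : R) :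
    ∃ q, D4 (f + Pi.single i x) = D4 f + x * grad f i + x ^ 2 * q := by
  fin_cases i
  · refine ⟨f 3 ^ 2, ?_⟩
    simp [D4, grad]; ring
  · refine ⟨-3 * f 2 ^ 2 + 12 * f 1 * f 3 + 4 * f 3 * x, ?_⟩
    simp [D4, grad]; ring
  · refine ⟨-3 * f 1 ^ 2 + 12 * f 0 * f 2 + 4 * f 0 * x, ?_⟩
    simp [D4, grad]; ring
  · refine ⟨f 0 ^ 2, ?_⟩
    simp [D4, grad]; ring

theorem D4_emod (f g : Fin 4 → ℤ) (m : ℤ) (h : ∀ i, f i ≡ g i [ZMOD m]) : D4 f ≡ D4 g [ZMOD m] := by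
  have h0 := h 0
  have h1 := h 1
  have h2 := h 2
  have h3 := h 3
  unfold D4
  gcongr

theorem grad_emod (f g : Fin 4 → ℤ) (m : ℤ) (h : ∀ i, f i ≡ g i [ZMOD m]) (i : Fin 4) : grad f i ≡ grad g i [ZMOD m] := by
  have h0 := h 0
  have h1 := h 1
  have h2 := h 2
  have h3 := h 3
  fin_cases i <;> simp only [grad, Fin.zero_eta, Fin.mk_one, Fin.reduceFinMk, Matrix.cons_val] <;> gcongr

theorem grad_even (f : Fin 4 → ℤ) (i : Fin 4) : (2 : ℤ) ∣ grad f i := by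
  fin_cases i <;> simp only [grad, Fin.zero_eta, Fin.mk_one, Fin.reduceFinMk, Matrix.cons_val]
  · exact ⟨f 0 * f 3 ^ 2 - 3 * f 1 * f 2 * f 3 + 2 * f 2 ^ 3, by ring⟩
  · exact ⟨-3 * f 0 * f 2 * f 3 - 3 * f 1 * f 2 ^ 2 + 6 * f 1 ^ 2 * f 3, by ring⟩
  · exact ⟨-3 * f 0 * f 1 * f 3 - 3 * f 1 ^ 2 * f 2 + 6 * f 0 * f 2 ^ 2, by ring⟩
  · exact ⟨f 0 ^ 2 * f 3 - 3 * f 0 * f 1 * f 2 + 2 * f 1 ^ 3, by ring⟩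

theorem D4_val {n : ℕ} [NeZero n] (g : Fin 4 → ZMod n) : ((D4 (fun i => ((g i).val : ℤ)) : ℤ) : ZMod n) = D4 g := by
  simp [D4]

theorem D4_single_mod16 (f : Fin 4 → ℤ) (i : Fin 4) (x : ℤ) : D4 (f + Pi.single i (8 * x)) % 16 = D4 f % 16 := by
  obtain ⟨q, hq⟩ := D4_shift f i (8 * x)
  obtain ⟨c, hc⟩ := grad_even f i
  rw [hq, hc]
  have : D4 f + 8 * x * (2 * c) + (8 * x) ^ 2 * q = D4 f + 16 * (x * c + 4 * x ^ 2 * q) := by ring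
  rw [this]; omega

theorem split_single {f g : Fin 4 → ℤ} (h : ∀ i, f i ≡ g i [ZMOD 8]) :
    ∃ x : Fin 4 → ℤ, f = g + Pi.single 0 (8 * x 0) + Pi.single 1 (8 * x 1) + Pi.single 2 (8 * x 2) + Pi.single 3 (8 * x 3) := by
  have : ∀ i, ∃ x, f i = g i + 8 * x := by
    intro i
    obtain ⟨c, hc⟩ := (Int.modEq_iff_dvd.1 (h i).symm)
    exact ⟨c, by linarith⟩
  choose x hx using this
  refine ⟨x, ?_⟩
  apply ext4 <;> simp [hx]

theorem D4_mod16 {f g : Fin 4 → ℤ} (h : ∀ i, f i ≡ g i [ZMOD 8]) : D4 f % 16 = D4 g % 16 := by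
  obtain ⟨x, rfl⟩ := split_single h
  simp only [D4_single_mod16]

set_option maxRecDepth 100000 in
theorem dec_grad : ∀ a b c d : Fin 8, ((a.1 ^ 2 * d.1 ^ 2 + 10 * a.1 * b.1 * c.1 * d.1 + 13 * b.1 ^ 2 * c.1 ^ 2 + 4 * a.1 * c.1 ^ 3 + 4 * b.1 ^ 3 * d.1) % 16 = 8 ∨
    (a.1 ^ 2 * d.1 ^ 2 + 10 * a.1 * b.1 * c.1 * d.1 + 13 * b.1 ^ 2 * c.1 ^ 2 + 4 * a.1 * c.1 ^ 3 + 4 * b.1 ^ 3 * d.1) % 16 = 12) →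
    ((2 * a.1 * d.1 ^ 2 + 2 * b.1 * c.1 * d.1 + 4 * c.1 ^ 3) % 4 = 0 ∧
     (2 * a.1 * c.1 * d.1 + 2 * b.1 * c.1 ^ 2 + 4 * b.1 ^ 2 * d.1) % 4 = 0 ∧
     (2 * a.1 * b.1 * d.1 + 2 * b.1 ^ 2 * c.1 + 4 * a.1 * c.1 ^ 2) % 4 = 0 ∧
     (2 * a.1 ^ 2 * d.1 + 2 * a.1 * b.1 * c.1 + 4 * b.1 ^ 3) % 4 = 0) ∧
    ((2 * a.1 * d.1 ^ 2 + 2 * b.1 * c.1 * d.1 + 4 * c.1 ^ 3) % 8 = 4 ∨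
     (2 * a.1 * c.1 * d.1 + 2 * b.1 * c.1 ^ 2 + 4 * b.1 ^ 2 * d.1) % 8 = 4 ∨
     (2 * a.1 * b.1 * d.1 + 2 * b.1 ^ 2 * c.1 + 4 * a.1 * c.1 ^ 2) % 8 = 4 ∨
     (2 * a.1 ^ 2 * d.1 + 2 * a.1 * b.1 * c.1 + 4 * b.1 ^ 3) % 8 = 4) := by decide +kernel

theorem grad_dec {f : Fin 4 → ℤ} (h : D4 f % 16 = 8 ∨ D4 f % 16 = 12) :
    (∀ i, grad f i % 4 = 0) ∧ ∃ i, grad f i % 8 = 4 := by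
  have hz : ∀ i, ∃ n : Fin 8, f i ≡ (n.1 : ℤ) [ZMOD 8] := by
    intro i
    refine ⟨⟨(f i % 8).toNat, by omega⟩, ?_⟩
    have : ((f i % 8).toNat : ℤ) = f i % 8 := Int.toNat_of_nonneg (by omega)
    simp only [this]
    exact (Int.mod_modEq _ _).symm
  choose n hn using hz
  have hD := D4_mod16 (f := f) (g := fun i => ((n i).1 : ℤ)) hn
  rw [hD] at h
  have hg := grad_emod f (fun i => ((n i).1 : ℤ)) 8 hn
  have key := dec_grad (n 0) (n 1) (n 2) (n 3)
  zify at key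
  have e : ∀ a b c d : ℤ, (a ^ 2 * d ^ 2 + 10 * a * b * c * d + 13 * b ^ 2 * c ^ 2 + 4 * a * c ^ 3 + 4 * b ^ 3 * d) % 16
     = (a ^ 2 * d ^ 2 - 6 * a * b * c * d - 3 * b ^ 2 * c ^ 2 + 4 * a * c ^ 3 + 4 * b ^ 3 * d) % 16 := by
    intro a b c d
    have : a ^ 2 * d ^ 2 + 10 * a * b * c * d + 13 * b ^ 2 * c ^ 2 + 4 * a * c ^ 3 + 4 * b ^ 3 * d = (a ^ 2 * d ^ 2 - 6 * a * b * c * d - 3 * b ^ 2 * c ^ 2 + 4 * a * c ^ 3 + 4 * b ^ 3 * d) + 16 * (a * b * c * d + b ^ 2 * c ^ 2) := by ring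
    rw [this]; omega
  rw [e] at key
  have key := key (by simpa [D4] using h)
  have g0 := hg 0
  have g1 := hg 1
  have g2 := hg 2
  have g3 := hg 3
  simp only [grad, Matrix.cons_val, Int.ModEq] at g0 g1 g2 g3
  have r0 : ∀ a b c d : ℤ, (2 * a * d ^ 2 - 6 * b * c * d + 4 * c ^ 3) = (2 * a * d ^ 2 + 2 * b * c * d + 4 * c ^ 3) + 8 * (-b * c * d) := by intros; ring
  have r1 : ∀ a b c d : ℤ, (-6 * a * c * d - 6 * b * c ^ 2 + 12 * b ^ 2 * d) = (2 * a * c * d + 2 * b * c ^ 2 + 4 * b ^ 2 * d) + 8 * (- a * c * d - b * c ^ 2 + b ^ 2 * d) := by intros; ring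
  have r2 : ∀ a b c d : ℤ, (-6 * a * b * d - 6 * b ^ 2 * c + 12 * a * c ^ 2) = (2 * a * b * d + 2 * b ^ 2 * c + 4 * a * c ^ 2) + 8 * (- a * b * d - b ^ 2 * c + a * c ^ 2) := by intros; ring
  have r3 : ∀ a b c d : ℤ, (2 * a ^ 2 * d - 6 * a * b * c + 4 * b ^ 3) = (2 * a ^ 2 * d + 2 * a * b * c + 4 * b ^ 3) + 8 * (-a * b * c) := by intros; ring
  rw [r0 (n 0)] at g0
  rw [r1 (n 0)] at g1
  rw [r2 (n 0)] at g2
  rw [r3 (n 0)] at g3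
  obtain ⟨⟨k0, k1, k2, k3⟩, k⟩ := key
  refine ⟨?_, ?_⟩
  · intro i
    fin_cases i <;> simp only [grad, Fin.zero_eta, Fin.mk_one, Fin.reduceFinMk, Matrix.cons_val] <;> omega
  · rcases k with k | k | k | k
    · exact ⟨0, by simp only [grad, Matrix.cons_val]; omega⟩
    · exact ⟨1, by simp only [grad, Matrix.cons_val]; omega⟩
    · exact ⟨2, by simp only [grad, Matrix.cons_val]; omega⟩
    · exact ⟨3, by simp only [grad, Matrix.cons_val]; omega⟩

theorem D4_single_mod32 {f : Fin 4 → ℤ} {r : ℤ} (hr : r % 16 = 8 ∨ r % 16 = 12) (h : D4 f % 32 = r) (i : Fin 4) (x : ℤ) :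
    D4 (f + Pi.single i (8 * x)) % 32 = r := by
  obtain ⟨q, hq⟩ := D4_shift f i (8 * x)
  have h1 := (grad_dec (f := f) (by omega)).1 i
  obtain ⟨c, hc⟩ := Int.dvd_of_emod_eq_zero h1
  rw [hq, hc]
  have : D4 f + 8 * x * (4 * c) + (8 * x) ^ 2 * q = D4 f + 32 * (x * c + 2 * x ^ 2 * q) := by ring
  rw [this]; omega

theorem D4_mod32 {f g : Fin 4 → ℤ} {r : ℤ} (hr : r % 16 = 8 ∨ r % 16 = 12) (h : ∀ i, f i ≡ g i [ZMOD 8]) (hg : D4 g % 32 = r) :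
    D4 f % 32 = r := by
  obtain ⟨x, rfl⟩ := split_single h
  exact D4_single_mod32 hr (D4_single_mod32 hr (D4_single_mod32 hr (D4_single_mod32 hr hg _ _) _ _) _ _) _ _

/-- count of quadruples -/
def T8 (r M : ℕ) : ℕ := ((Finset.univ : Finset (Fin 8 × Fin 8 × Fin 8 × Fin 8)).filter (fun x =>
  (x.1.1 ^ 2 * x.2.2.2.1 ^ 2 + 26 * x.1.1 * x.2.1.1 * x.2.2.1.1 * x.2.2.2.1 + 29 * x.2.1.1 ^ 2 * x.2.2.1.1 ^ 2
    + 4 * x.1.1 * x.2.2.1.1 ^ 3 + 4 * x.2.1.1 ^ 3 * x.2.2.2.1) % M = r)).card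

set_option maxRecDepth 100000 in
theorem T8_vals : T8 8 32 = 192 ∧ T8 24 32 = 192 ∧ T8 12 32 = 192 ∧ T8 28 32 = 192 ∧ T8 1 8 = 768 ∧ T8 5 8 = 768 := by
  decide +kernel

theorem T8_eq {r M : ℕ} (hM : M ∣ 32) (hM0 : 0 < M) : Nat.card {g : Fin 4 → ZMod 8 // D4 (fun i => ((g i).val : ℤ)) % M = r} = T8 r M := by
  have : Nat.card {x : Fin 8 × Fin 8 × Fin 8 × Fin 8 // (x.1.1 ^ 2 * x.2.2.2.1 ^ 2 + 26 * x.1.1 * x.2.1.1 * x.2.2.1.1 * x.2.2.2.1 + 29 * x.2.1.1 ^ 2 * x.2.2.1.1 ^ 2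
    + 4 * x.1.1 * x.2.2.1.1 ^ 3 + 4 * x.2.1.1 ^ 3 * x.2.2.2.1) % M = r} = T8 r M := by
    unfold T8
    rw [Nat.card_eq_fintype_card, Fintype.card_subtype]
  rw [← this]
  refine Nat.card_congr (Equiv.subtypeEquiv ⟨fun g => (g 0, g 1, g 2, g 3), fun x => ![x.1, x.2.1, x.2.2.1, x.2.2.2], ?_, ?_⟩ ?_)
  · intro g
    apply ext4 <;> simp
  · rintro ⟨a, b, c, d⟩; simp
  · intro g
    simp only [Equiv.coe_fn_mk]
    have hv : ∀ x : ZMod 8, x.val = Fin.val (n := 8) x := fun x => rfl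
    simp only [← hv]
    zify
    obtain ⟨c, hc⟩ := hM
    have : ∀ a b c d : ℤ, ((a ^ 2 * d ^ 2 + 26 * a * b * c * d + 29 * b ^ 2 * c ^ 2 + 4 * a * c ^ 3 + 4 * b ^ 3 * d)) % M =
        (a ^ 2 * d ^ 2 - 6 * a * b * c * d - 3 * b ^ 2 * c ^ 2 + 4 * a * c ^ 3 + 4 * b ^ 3 * d) % M := by
      intro a b c' d
      refine Int.ModEq.symm (Int.modEq_iff_dvd.2 ⟨c * (a * b * c' * d + b ^ 2 * c' ^ 2), ?_⟩)
      have hc' : (32 : ℤ) = M * c := by exact_mod_cast hc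
      linear_combination (a * b * c' * d + b ^ 2 * c' ^ 2) * hc'
    rw [this]
    rfl

theorem cnt_8 {D0 : ℤ} (h : D0 % 4 = 1) : cnt (2 ^ 3) D0 = 768 := by
  have e : cnt 8 D0 = T8 (D0 % 8).toNat 8 := by
    rw [← T8_eq (by norm_num) (by norm_num)]
    unfold cnt
    refine Nat.card_congr (Equiv.subtypeEquivRight fun g => ?_)
    have h1 : ((D4 (fun i => ((g i).val : ℤ)) : ℤ) : ZMod 8) = D4 g := D4_val g
    rw [← h1, ZMod.intCast_eq_intCast_iff]
    have : ((D0 % 8).toNat : ℤ) = D0 % 8 := Int.toNat_of_nonneg (by omega)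
    rw [this]
    rfl
  norm_num
  rw [e]
  have : D0 % 8 = 1 ∨ D0 % 8 = 5 := by omega
  rcases this with h | h <;> rw [h]
  · exact T8_vals.2.2.2.2.1
  · exact T8_vals.2.2.2.2.2

theorem cnt_32 {D0 : ℤ} (h : D0 % 16 = 8 ∨ D0 % 16 = 12) : cnt (2 ^ 5) D0 = 49152 := by
  have e : Nat.card {g : Fin 4 → ZMod 8 // D4 (fun i => ((g i).val : ℤ)) % (32 : ℕ) = ((D0 % 32).toNat : ℤ)} = 192 := by
    have h0 : (D0 % 32).toNat = 8 ∨ (D0 % 32).toNat = 24 ∨ (D0 % 32).toNat = 12 ∨ (D0 % 32).toNat = 28 := by omega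
    have h1 := @T8_eq ((D0 % 32).toNat) 32 (by norm_num) (by norm_num)
    rw [h1]
    obtain ⟨t1, t2, t3, t4, -⟩ := T8_vals
    rcases h0 with h | h | h | h
    · exact (congrArg (T8 · 32) h).trans t1
    · exact (congrArg (T8 · 32) h).trans t2
    · exact (congrArg (T8 · 32) h).trans t3
    · exact (congrArg (T8 · 32) h).trans t4
  have hd : 8 ∣ 32 := by norm_num
  have h2 := card_pre_zmod hd (fun g => D4 (fun i => ((g i).val : ℤ)) % (32 : ℕ) = ((D0 % 32).toNat : ℤ))
  rw [e] at h2
  have h3 : Nat.card {f : Fin 4 → ZMod 32 // D4 (fun i => ((ZMod.castHom hd (ZMod 8) (f i)).val : ℤ)) % (32 : ℕ) = ((D0 % 32).toNat : ℤ)}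
      = cnt 32 D0 := by
    unfold cnt
    refine Nat.card_congr (Equiv.subtypeEquivRight fun g => ?_)
    have h1 : ((D4 (fun i => ((g i).val : ℤ)) : ℤ) : ZMod 32) = D4 g := D4_val g
    rw [← h1, ZMod.intCast_eq_intCast_iff]
    have hto : ((D0 % 32).toNat : ℤ) = D0 % 32 := Int.toNat_of_nonneg (by omega)
    rw [hto]
    have hc : ∀ i, ((g i).val : ℤ) ≡ ((ZMod.castHom hd (ZMod 8) (g i)).val : ℤ) [ZMOD 8] := by
      intro i
      rw [ZMod.castHom_apply, ZMod.cast_eq_val, ZMod.val_natCast]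
      push_cast
      exact (Int.mod_modEq _ _).symm
    constructor
    · intro hh
      exact D4_mod32 (r := D0 % 32) (by omega) hc hh
    · intro hh
      exact D4_mod32 (r := D0 % 32) (by omega) (fun i => (hc i).symm) hh
  rw [h3] at h2
  norm_num
  omega

end NH

namespace NH

theorem cnt_twist {M : ℕ} {D D' : ℤ} (s : (ZMod M)ˣ) (h : (D' : ZMod M) = (s : ZMod M) ^ 2 * D) : cnt M D' = cnt M D := by
  unfold cnt
  symm
  have hs : (s : ZMod M) * (↑s⁻¹ : ZMod M) = 1 := s.mul_inv
  have hs' : (↑s⁻¹ : ZMod M) * (s : ZMod M) = 1 := s.inv_mul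
  refine Nat.card_congr (Equiv.subtypeEquiv ⟨fun f => ![s ^ 2 * f 0, s * f 1, f 2, ↑s⁻¹ * f 3],
    fun f => ![(↑s⁻¹) ^ 2 * f 0, ↑s⁻¹ * f 1, f 2, s * f 3], ?_, ?_⟩ ?_)
  · intro f
    apply ext4 <;> simp [← mul_assoc, ← mul_pow]
  · intro f
    apply ext4 <;> simp [← mul_assoc, ← mul_pow]
  · intro f
    have : D4 ![(s : ZMod M) ^ 2 * f 0, s * f 1, f 2, ↑s⁻¹ * f 3] = (s : ZMod M) ^ 2 * D4 f := by
      simp only [D4, Matrix.cons_val]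
      linear_combination (f 0 ^ 2 * f 3 ^ 2 * s ^ 2 * (s * (↑s⁻¹ : ZMod M) + 1) - 6 * f 0 * f 1 * f 2 * f 3 * s ^ 2 + 4 * f 1 ^ 3 * f 3 * s ^ 2) * hs
    simp only [Equiv.coe_fn_mk]
    rw [this, h]
    constructor
    · intro h; rw [h]
    · intro h; exact (s.isUnit.pow 2).mul_left_cancel h

theorem cnt_two_odd_step {D0 : ℤ} (h : D0 % 4 = 1) (k : ℕ) (hk : 3 ≤ k) :
    cnt (2 ^ (k + 1)) D0 = 2 ^ 3 * cnt (2 ^ k) D0 := by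
  apply cnt_lift (by norm_num)
  intro t
  obtain ⟨j, rfl⟩ := Nat.exists_eq_add_of_le' hk
  have hs : IsUnit (((1 + 2 ^ (j + 2) * t : ℤ)) : ZMod (2 ^ (j + 3 + 1))) := by
    rw [ZMod.coe_int_isUnit_iff_isCoprime]
    push_cast
    apply IsCoprime.pow_left
    refine ⟨-(2 ^ (j + 1) * t), 1, ?_⟩
    ring
  refine cnt_twist hs.unit ?_
  rw [IsUnit.unit_spec]
  have hz : ((2 : ZMod (2 ^ (j + 3 + 1))) ^ (j + 3 + 1)) = 0 := by exact_mod_cast ZMod.natCast_self (2 ^ (j + 3 + 1))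
  obtain ⟨e, he⟩ : ∃ e : ℤ, D0 = 1 + 2 * e := ⟨D0 / 2, by omega⟩
  rw [he]
  push_cast
  set E : ZMod (2 ^ (j + 3 + 1)) := (e : ZMod (2 ^ (j + 3 + 1)))
  set T : ZMod (2 ^ (j + 3 + 1)) := (t : ZMod (2 ^ (j + 3 + 1)))
  linear_combination (- E * T - 2 ^ j * T ^ 2 * (1 + 2 * E)) * hz

theorem grad_cast (R : Type*) [CommRing R] (F : Fin 4 → ℤ) (i : Fin 4) :
    grad (fun k => ((F k : ℤ) : R)) i = ((grad F i : ℤ) : R) := by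
  fin_cases i <;> simp [grad]

/-- least coordinate with gradient `4` mod 8 -/
noncomputable def idx (g : Fin 4 → ZMod 8) : Fin 4 := by
  classical exact if h : ∃ i, grad g i = 4 then h.choose else 0

theorem cnt_two_even_le {D0 : ℤ} (h : D0 % 16 = 8 ∨ D0 % 16 = 12) (j : ℕ) :
    cnt (2 ^ (j + 6)) D0 ≤ cnt (2 ^ (j + 6)) (D0 + 2 ^ (j + 5)) := by
  haveI : NeZero (2 ^ (j + 6)) := ⟨by positivity⟩
  have hd : 8 ∣ 2 ^ (j + 6) := ⟨2 ^ (j + 3), by ring⟩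
  let c : (Fin 4 → ZMod (2 ^ (j + 6))) → (Fin 4 → ZMod 8) := fun f i => ZMod.castHom hd (ZMod 8) (f i)
  let sh : (Fin 4 → ZMod (2 ^ (j + 6))) → (Fin 4 → ZMod (2 ^ (j + 6))) := fun f => f + Pi.single (idx (c f)) (2 ^ (j + 3))
  have hc : ∀ f, c (sh f) = c f := by
    intro f
    funext i
    simp only [c, sh, Pi.add_apply, map_add]
    have : ZMod.castHom hd (ZMod 8) ((Pi.single (idx (c f)) (2 ^ (j + 3)) : Fin 4 → ZMod (2 ^ (j + 6))) i) = 0 := by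
      by_cases hi : i = idx (c f)
      · rw [hi, Pi.single_eq_same, map_pow, map_ofNat, pow_add]
        have : (2 : ZMod 8) ^ 3 = 0 := by decide
        rw [this, mul_zero]
      · rw [Pi.single_eq_of_ne hi, map_zero]
    simp only [c] at this
    rw [this, add_zero]
  have hinj : Function.Injective sh := by
    intro f g hfg
    have e1 : c f = c g := by rw [← hc f, hfg, hc g]
    simp only [sh, e1] at hfg
    exact add_right_cancel hfg
  unfold cnt
  have hz : ((2 : ZMod (2 ^ (j + 6))) ^ (j + 6)) = 0 := by exact_mod_cast ZMod.natCast_self (2 ^ (j + 6))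
  have hD : ∀ f : Fin 4 → ZMod (2 ^ (j + 6)), D4 f = (D0 : ZMod (2 ^ (j + 6))) → D4 (sh f) = ((D0 + 2 ^ (j + 5) : ℤ) : ZMod (2 ^ (j + 6))) := by
    intro f hf
    have hF := D4_val f
    set F : Fin 4 → ℤ := fun i => ((f i).val : ℤ) with hFF
    have hcast : (fun i => ((F i : ℤ) : ZMod (2 ^ (j + 6)))) = f := by funext i; simp [F]
    rw [hf, ZMod.intCast_eq_intCast_iff_dvd_sub] at hF
    have h16 : (16 : ℤ) ∣ D0 - D4 F := by
      refine dvd_trans ⟨2 ^ (j + 2), ?_⟩ hF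
      push_cast; ring
    obtain ⟨i0, hi0⟩ := (grad_dec (f := F) (by omega)).2
    have hg : ∀ i, grad (c f) i = ((grad F i : ℤ) : ZMod 8) := by
      intro i
      rw [← grad_cast (ZMod 8) F i]
      congr 1
      funext k
      simp [c, F]
    have hex : ∃ i, grad (c f) i = 4 := by
      refine ⟨i0, ?_⟩
      rw [hg]
      have := (ZMod.intCast_eq_intCast_iff (grad F i0) 4 8).2 hi0
      rw [this]; rfl
    have hidx : grad (c f) (idx (c f)) = 4 := by
      unfold idx
      rw [dif_pos hex]
      exact hex.choose_spec
    set i := idx (c f) with hi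
    obtain ⟨q, hq⟩ := D4_shift f i (2 ^ (j + 3))
    have : D4 (sh f) = D4 f + 2 ^ (j + 3) * grad f i + (2 ^ (j + 3)) ^ 2 * q := hq
    rw [this, hf]
    rw [hg] at hidx
    have h8 : ((grad F i : ℤ) : ZMod 8) = ((4 : ℤ) : ZMod 8) := by rw [hidx]; rfl
    rw [ZMod.intCast_eq_intCast_iff_dvd_sub] at h8
    obtain ⟨n, hn⟩ := h8
    have hgf : grad f i = ((grad F i : ℤ) : ZMod (2 ^ (j + 6))) := by
      rw [← grad_cast (ZMod (2 ^ (j + 6))) F i, hcast]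
    have hgi : grad F i = 4 - 8 * n := by push_cast at hn; linarith
    rw [hgf, hgi]
    push_cast
    linear_combination (-n + 2 ^ j * q) * hz
  refine Nat.card_le_card_of_injective (fun f : {f : Fin 4 → ZMod (2 ^ (j + 6)) // D4 f = (D0 : ZMod (2 ^ (j + 6)))} =>
    (⟨sh f.1, hD f.1 f.2⟩ : {f : Fin 4 → ZMod (2 ^ (j + 6)) // D4 f = ((D0 + 2 ^ (j + 5) : ℤ) : ZMod (2 ^ (j + 6)))})) ?_
  intro f g hfg
  simp only [Subtype.mk.injEq] at hfg
  exact Subtype.ext (hinj hfg)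

theorem cnt_two_even_step {D0 : ℤ} (h : D0 % 16 = 8 ∨ D0 % 16 = 12) (k : ℕ) (hk : 5 ≤ k) :
    cnt (2 ^ (k + 1)) D0 = 2 ^ 3 * cnt (2 ^ k) D0 := by
  apply cnt_lift (by norm_num)
  intro t
  obtain ⟨j, rfl⟩ := Nat.exists_eq_add_of_le' hk
  have hz : ((2 : ZMod (2 ^ (j + 5 + 1))) ^ (j + 6)) = 0 := by exact_mod_cast ZMod.natCast_self (2 ^ (j + 6))
  have key : cnt (2 ^ (j + 6)) (D0 + 2 ^ (j + 5)) = cnt (2 ^ (j + 6)) D0 := by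
    apply le_antisymm _ (cnt_two_even_le h j)
    have h2 : (D0 + 2 ^ (j + 5)) % 16 = 8 ∨ (D0 + 2 ^ (j + 5)) % 16 = 12 := by
      have : D0 + 2 ^ (j + 5) = D0 + 16 * 2 ^ (j + 1) := by ring
      rw [this]; omega
    refine (cnt_two_even_le h2 j).trans (le_of_eq ?_)
    apply cnt_congr
    push_cast
    linear_combination hz
  obtain ⟨s, rfl | rfl⟩ := Nat.even_or_odd' t
  · apply cnt_congr
    push_cast
    linear_combination s * hz
  · rw [← key]
    apply cnt_congr
    push_cast
    linear_combination s * hz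

theorem cnt_two {D0 : ℤ} (h : D0 % 4 = 1 ∨ D0 % 16 = 8 ∨ D0 % 16 = 12) (k : ℕ) (hk : 5 ≤ k) :
    cnt (2 ^ k) D0 * 2 = (2 ^ k) ^ 3 * 3 := by
  rcases h with h | h
  · have : 3 ≤ k := by omega
    clear hk
    induction k, this using Nat.le_induction with
    | base => rw [cnt_8 h]; norm_num
    | succ k hk ih =>
      rw [cnt_two_odd_step h k hk]
      calc _ = 8 * (cnt (2 ^ k) D0 * 2) := by ring
        _ = _ := by rw [ih]; ring
  · induction k, hk using Nat.le_induction with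
    | base => rw [cnt_32 h]; norm_num
    | succ k hk ih =>
      rw [cnt_two_even_step h k hk]
      calc _ = 8 * (cnt (2 ^ k) D0 * 2) := by ring
        _ = _ := by rw [ih]; ring

/-- local densities -/
noncomputable def rho (p : ℕ) : ℝ := if p = 2 then 3 / 2 else 1 - 1 / (p : ℝ) ^ 2

def Good (M : ℕ) (D0 : ℤ) : Prop :=
  (∀ p : ℕ, p.Prime → p ∣ M → p ≠ 2 → p ^ 2 ∣ M ∧ ¬ (p : ℤ) ^ 2 ∣ D0) ∧
    (2 ∣ M → 2 ^ 5 ∣ M ∧ (D0 % 4 = 1 ∨ D0 % 16 = 8 ∨ D0 % 16 = 12))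

theorem cnt_formula {M : ℕ} (hM : M ≠ 0) {D0 : ℤ} (h : Good M D0) :
    (cnt M D0 : ℝ) = (M : ℝ) ^ 3 * ∏ p ∈ M.primeFactors, rho p := by
  have h1 := Nat.multiplicative_factorization (fun M => cnt M D0) (fun x y hxy => cnt_mul hxy D0)
    (by
      show cnt 1 D0 = 1
      unfold cnt
      rw [Nat.card_eq_one_iff_unique]
      refine ⟨⟨fun a b => Subtype.ext (Subsingleton.elim _ _)⟩, ⟨0, Subsingleton.elim _ _⟩⟩) hM
  simp only [Finsupp.prod, Nat.support_factorization] at h1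
  have h2 : (M : ℝ) = ∏ p ∈ M.primeFactors, (p : ℝ) ^ M.factorization p := by
    conv_lhs => rw [← Nat.prod_factorization_pow_eq_self hM]
    simp [Finsupp.prod]
  rw [h1]
  conv_rhs => rw [h2]
  rw [← Finset.prod_pow, ← Finset.prod_mul_distrib]
  push_cast
  apply Finset.prod_congr rfl
  intro p hp
  have hpp := Nat.prime_of_mem_primeFactors hp
  have hpd := Nat.dvd_of_mem_primeFactors hp
  by_cases hp2 : p = 2
  · subst hp2
    obtain ⟨h3, h4⟩ := h.2 hpd
    have := cnt_two h4 (M.factorization 2) ((Nat.prime_two.pow_dvd_iff_le_factorization hM).1 h3)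
    have : (cnt (2 ^ M.factorization 2) D0 : ℝ) * 2 = (2 ^ M.factorization 2) ^ 3 * 3 := by exact_mod_cast this
    simp only [rho, if_true]
    push_cast
    linarith
  · obtain ⟨h3, h4⟩ := h.1 p hpp hpd hp2
    have := cnt_odd hpp hp2 h4 (M.factorization p) ((hpp.pow_dvd_iff_le_factorization hM).1 h3)
    have h1 := hpp.one_le
    zify [h1] at this
    have : (cnt (p ^ M.factorization p) D0 : ℝ) * p ^ 2 = (p ^ M.factorization p) ^ 3 * ((p - 1) * (p + 1)) := by exact_mod_cast this
    simp only [rho, if_neg hp2]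
    have hp0 : (p : ℝ) ≠ 0 := by exact_mod_cast hpp.ne_zero
    field_simp
    linear_combination this

end NH

namespace NH
open MeasureTheory Topology

noncomputable def rnd (M : ℕ) (f0 : Fin 4 → ℤ) (t : ℝ) (x : Fin 4 → ℝ) (i : Fin 4) : ℤ :=
  f0 i + M * ⌊(x i * t - f0 i) / M⌋

theorem rnd_spec {M : ℕ} (hM : 0 < M) (f0 : Fin 4 → ℤ) {t : ℝ} (ht : 0 < t) (x : Fin 4 → ℝ) (i : Fin 4) :
    (rnd M f0 t x i : ℝ) / t ≤ x i ∧ x i < ((rnd M f0 t x i : ℝ) + M) / t := by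
  have hM' : (0 : ℝ) < M := by exact_mod_cast hM
  have h1 := Int.floor_le ((x i * t - f0 i) / M)
  have h2 := Int.lt_floor_add_one ((x i * t - f0 i) / M)
  rw [le_div_iff₀ hM'] at h1
  rw [div_lt_iff₀ hM'] at h2
  unfold rnd
  push_cast
  constructor
  · rw [div_le_iff₀ ht]; linarith
  · rw [lt_div_iff₀ ht]; linarith

theorem rnd_eq_iff {M : ℕ} (hM : 0 < M) (f0 : Fin 4 → ℤ) {t : ℝ} (ht : 0 < t) (x : Fin 4 → ℝ) (f : Fin 4 → ℤ)
    (hf : ∀ i, f i ≡ f0 i [ZMOD M]) :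
    rnd M f0 t x = f ↔ x ∈ Set.pi Set.univ (fun i => Set.Ico ((f i : ℝ) / t) (((f i : ℝ) + M) / t)) := by
  constructor
  · rintro rfl i -
    exact rnd_spec hM f0 ht x i
  · intro h
    funext i
    have hi := h i trivial
    have hM' : (0 : ℝ) < M := by exact_mod_cast hM
    obtain ⟨c, hc⟩ := Int.modEq_iff_dvd.1 (hf i).symm
    have hfc : f i = f0 i + M * c := by linarith
    unfold rnd
    have : ⌊(x i * t - f0 i) / M⌋ = c := by
      rw [Int.floor_eq_iff, le_div_iff₀ hM', div_lt_iff₀ hM']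
      obtain ⟨h1, h2⟩ := hi
      rw [div_le_iff₀ ht] at h1
      rw [lt_div_iff₀ ht] at h2
      rw [hfc] at h1 h2
      push_cast at h1 h2
      constructor <;> linarith
    rw [this, hfc]

theorem rnd_mod (M : ℕ) (f0 : Fin 4 → ℤ) (t : ℝ) (x : Fin 4 → ℝ) (i : Fin 4) : rnd M f0 t x i ≡ f0 i [ZMOD M] := by
  unfold rnd
  exact (Int.modEq_iff_dvd.2 ⟨⌊(x i * t - f0 i) / M⌋, by ring⟩).symm

theorem rnd_tendsto {M : ℕ} (hM : 0 < M) (f0 : Fin 4 → ℤ) (x : Fin 4 → ℝ) :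
    Tendsto (fun t : ℝ => (fun i => (rnd M f0 t x i : ℝ) / t)) atTop (𝓝 x) := by
  rw [tendsto_pi_nhds]
  intro i
  have h1 : Tendsto (fun t : ℝ => x i - M / t) atTop (𝓝 (x i)) := by
    have : Tendsto (fun t : ℝ => (M : ℝ) / t) atTop (𝓝 0) := tendsto_const_nhds.div_atTop tendsto_id
    simpa using tendsto_const_nhds.sub this
  refine tendsto_of_tendsto_of_tendsto_of_le_of_le' h1 tendsto_const_nhds ?_ ?_
  · filter_upwards [eventually_gt_atTop 0] with t ht
    have := (rnd_spec hM f0 ht x i).2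
    rw [add_div] at this
    linarith
  · filter_upwards [eventually_gt_atTop 0] with t ht
    exact (rnd_spec hM f0 ht x i).1

/-- the set of lattice points -/
def lpts (M : ℕ) (f0 : Fin 4 → ℤ) (S : Set (Fin 4 → ℝ)) (t : ℝ) : Set (Fin 4 → ℤ) :=
  {f | (∀ i, f i ≡ f0 i [ZMOD M]) ∧ (fun i => (f i : ℝ) / t) ∈ S}

theorem finite_box (Z : ℝ) : {f : Fin 4 → ℤ | ∀ i, |(f i : ℝ)| ≤ Z}.Finite := by
  refine Set.Finite.subset (Set.finite_Icc (fun _ : Fin 4 => ⌈-Z⌉) (fun _ => ⌊Z⌋)) ?_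
  intro f hf
  constructor
  · intro i
    exact Int.ceil_le.2 (abs_le.1 (hf i)).1
  · intro i
    exact Int.le_floor.2 (abs_le.1 (hf i)).2

theorem lpts_finite {M : ℕ} {f0 : Fin 4 → ℤ} {S : Set (Fin 4 → ℝ)} (hS : Bornology.IsBounded S) {t : ℝ} (ht : 0 < t) :
    (lpts M f0 S t).Finite := by
  obtain ⟨R, hR⟩ := hS.subset_closedBall 0
  refine (finite_box (R * t)).subset ?_
  rintro f ⟨-, h⟩ i
  have := hR h
  rw [Metric.mem_closedBall, dist_zero_right] at this
  have h2 := (norm_le_pi_norm (fun i => (f i : ℝ) / t) i).trans this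
  rw [Real.norm_eq_abs, abs_div, abs_of_pos ht, div_le_iff₀ ht] at h2
  exact h2

theorem lattice_count {S U K : Set (Fin 4 → ℝ)} (hU : IsOpen U) (hK : IsClosed K) (hKb : Bornology.IsBounded K)
    (hUS : U ⊆ S) (hSK : S ⊆ K) (h0 : volume (K \ U) = 0) {M : ℕ} (hM : 0 < M) (f0 : Fin 4 → ℤ) :
    Tendsto (fun t : ℝ => ((lpts M f0 S t).ncard : ℝ) / t ^ 4) atTop (𝓝 ((volume U).toReal / M ^ 4)) := by
  have hM' : (0 : ℝ) < M := by exact_mod_cast hM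
  have hSb := hKb.subset hSK
  let A : ℝ → Set (Fin 4 → ℝ) := fun t => ⋃ f ∈ lpts M f0 S t, Set.pi Set.univ (fun i => Set.Ico ((f i : ℝ) / t) (((f i : ℝ) + M) / t))
  have hAm : ∀ t, MeasurableSet (A t) := by
    intro t
    refine MeasurableSet.biUnion (Set.to_countable _) fun f _ => ?_
    exact MeasurableSet.univ_pi fun i => measurableSet_Ico
  have hA : ∀ t, 0 < t → ∀ x, x ∈ A t ↔ (fun i => (rnd M f0 t x i : ℝ) / t) ∈ S := by
    intro t ht x
    simp only [A, Set.mem_iUnion]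
    constructor
    · rintro ⟨f, hf, hx⟩
      rw [← rnd_eq_iff hM f0 ht x f hf.1] at hx
      rw [hx]; exact hf.2
    · intro h
      refine ⟨rnd M f0 t x, ⟨rnd_mod M f0 t x, h⟩, ?_⟩
      exact (rnd_eq_iff hM f0 ht x _ (rnd_mod M f0 t x)).1 rfl
  have hvol : ∀ t, 0 < t → volume (A t) = (lpts M f0 S t).ncard * ENNReal.ofReal ((M / t) ^ 4) := by
    intro t ht
    have hfin := lpts_finite (M := M) (f0 := f0) hSb ht
    simp only [A]
    rw [measure_biUnion (Set.to_countable _)]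
    · have : ∀ f : Fin 4 → ℤ, volume (Set.pi Set.univ (fun i => Set.Ico ((f i : ℝ) / t) (((f i : ℝ) + M) / t))) = ENNReal.ofReal ((M / t) ^ 4) := by
        intro f
        rw [volume_pi_pi]
        have e : ∀ i, ((f i : ℝ) + M) / t - f i / t = M / t := by intro i; ring
        simp only [Real.volume_Ico, e, Finset.prod_const, Finset.card_univ, Fintype.card_fin]
        rw [← ENNReal.ofReal_pow (by positivity)]
      simp only [this]
      rw [ENNReal.tsum_const, ENat.card_coe_set_eq, ← hfin.cast_ncard_eq]
      simp
    · intro f hf g hg hfg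
      rw [Function.onFun, Set.disjoint_left]
      intro x hx hx'
      rw [← rnd_eq_iff hM f0 ht x f hf.1] at hx
      rw [← rnd_eq_iff hM f0 ht x g hg.1] at hx'
      exact hfg (hx.symm.trans hx')
    · intro f _
      exact MeasurableSet.univ_pi fun i => measurableSet_Ico
  obtain ⟨R, hR⟩ := hSb.subset_closedBall 0
  have hlim : Tendsto (fun t => volume (A t)) atTop (𝓝 (volume U)) := by
    refine tendsto_measure_of_ae_tendsto_indicator (B := Metric.closedBall 0 (R + M)) atTop hU.measurableSet hAm Metric.isClosed_closedBall.measurableSet ?_ ?_ ?_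
    · exact (measure_closedBall_lt_top).ne
    · filter_upwards [eventually_ge_atTop 1] with t ht x hx
      have ht0 : 0 < t := by linarith
      rw [hA t ht0] at hx
      have h1 := hR hx
      rw [Metric.mem_closedBall, dist_zero_right] at h1 ⊢
      have hR0 : 0 ≤ R := (norm_nonneg _).trans h1
      rw [pi_norm_le_iff_of_nonneg (by positivity)]
      intro i
      have h2 := (norm_le_pi_norm _ i).trans h1
      rw [Real.norm_eq_abs, abs_le] at h2 ⊢
      have h3 := rnd_spec hM f0 ht0 x i
      have h4 : (M : ℝ) / t ≤ M := div_le_self hM'.le ht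
      rw [add_div] at h3
      constructor <;> linarith
    · have : ∀ᵐ x, x ∉ K \ U := measure_eq_zero_iff_ae_notMem.1 h0
      filter_upwards [this] with x hx
      have ht := rnd_tendsto hM f0 x
      by_cases hxU : x ∈ U
      · filter_upwards [ht (hU.mem_nhds hxU), eventually_gt_atTop 0] with t h1 ht0
        rw [hA t ht0]
        exact ⟨fun _ => hxU, fun _ => hUS h1⟩
      · have hxK : x ∉ K := fun h => hx ⟨h, hxU⟩
        filter_upwards [ht (hK.isOpen_compl.mem_nhds hxK), eventually_gt_atTop 0] with t h1 ht0
        rw [hA t ht0]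
        exact ⟨fun h => absurd (hSK h) h1, fun h => absurd h hxU⟩
  have hUfin : volume U ≠ ⊤ := ((measure_mono (hUS.trans hR)).trans_lt measure_closedBall_lt_top).ne
  have h2 := ((ENNReal.tendsto_toReal hUfin).comp hlim).div_const ((M : ℝ) ^ 4)
  refine h2.congr' ?_
  filter_upwards [eventually_gt_atTop 0] with t ht
  simp only [Function.comp]
  rw [hvol t ht, ENNReal.toReal_mul, ENNReal.toReal_natCast, ENNReal.toReal_ofReal (by positivity)]
  field_simp

end NH

namespace NH
open MeasureTheory Topology

noncomputable def DM (v : Fin 4 → ℝ) : Matrix (Fin 4) (Fin 4) ℝ :=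
  !![1, 0, 0, 0; v 2 / 3, 1 / 3, v 0 / 3, 0; v 3 / 3, v 2 / 3, v 1 / 3, v 0 / 3; 0, v 3, 0, v 1]

theorem DM_det (v : Fin 4 → ℝ) : (DM v).det = Res v / 9 := by
  simp [DM, Matrix.det_succ_row_zero, Fin.sum_univ_succ, Fin.succAbove, Res]
  ring

noncomputable def DPhi (v : Fin 4 → ℝ) : (Fin 4 → ℝ) →L[ℝ] (Fin 4 → ℝ) :=
  LinearMap.toContinuousLinearMap (Matrix.toLin' (DM v))

theorem DPhi_det (v : Fin 4 → ℝ) : (DPhi v).det = Res v / 9 := by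
  rw [← DM_det]
  simp [DPhi, ContinuousLinearMap.det]

theorem hasDeriv_Phi (v : Fin 4 → ℝ) : HasStrictFDerivAt Phi (DPhi v) v := by
  rw [hasStrictFDerivAt_pi']
  have h : ∀ i : Fin 4, HasStrictFDerivAt (fun x : Fin 4 → ℝ => x i) (ContinuousLinearMap.proj (R := ℝ) (φ := fun _ : Fin 4 => ℝ) i) v :=
    fun i => (ContinuousLinearMap.proj (R := ℝ) (φ := fun _ : Fin 4 => ℝ) i).hasStrictFDerivAt
  intro i
  fin_cases i
  · refine (h 0).congr_fderiv ?_ 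
    ext w
    simp [DPhi, DM, Matrix.mulVec, dotProduct, Fin.sum_univ_succ, Pi.single_apply]
  · have := ((((h 0).mul (h 2)).add (h 1)).mul_const (3⁻¹ : ℝ))
    refine (this.congr_fderiv ?_)
    ext w
    simp [DPhi, DM, Matrix.mulVec, dotProduct, Fin.sum_univ_succ, Pi.single_apply]
    ring
  · have := ((((h 0).mul (h 3)).add ((h 1).mul (h 2))).mul_const (3⁻¹ : ℝ))
    refine (this.congr_fderiv ?_)
    ext w
    simp [DPhi, DM, Matrix.mulVec, dotProduct, Fin.sum_univ_succ, Pi.single_apply]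
    ring
  · have := ((h 1).mul (h 3))
    refine (this.congr_fderiv ?_)
    ext w
    simp [DPhi, DM, Matrix.mulVec, dotProduct, Fin.sum_univ_succ, Pi.single_apply]
    ring

theorem Res_ge {v : Fin 4 → ℝ} (h2 : |v 2| ≤ 1) (h3 : 1 ≤ v 3) : (v 0 ^ 2 * v 3 + v 1 ^ 2) / 2 ≤ Res v := by
  unfold Res
  have h := abs_le.1 (show |v 0 * v 1 * v 2| ≤ |v 0 * v 1| by
    rw [abs_mul]; exact mul_le_of_le_one_right (abs_nonneg _) h2)
  have h4 : |v 0 * v 1| ≤ (v 0 ^ 2 + v 1 ^ 2) / 2 := by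
    rw [abs_le]; constructor <;> nlinarith [sq_nonneg (v 0 + v 1), sq_nonneg (v 0 - v 1)]
  nlinarith [sq_nonneg (v 0)]

def KK (T : ℝ) : Set (Fin 4 → ℝ) :=
  {v | |v 2| ≤ 1 ∧ 1 ≤ v 3 ∧ v 3 ≤ T ∧ (4 * v 3 - v 2 ^ 2) * Res v ^ 2 ≤ 27}
def KO (T : ℝ) : Set (Fin 4 → ℝ) :=
  {v | |v 2| < 1 ∧ 1 < v 3 ∧ v 3 < T ∧ (4 * v 3 - v 2 ^ 2) * Res v ^ 2 < 27 ∧ v 0 ≠ 0}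
def SS (T : ℝ) : Set (Fin 4 → ℝ) :=
  {x | x 0 ≠ 0 ∧ D4 x < 1 ∧ ∃ v, |v 2| ≤ 1 ∧ 1 ≤ v 3 ∧ v 3 ≤ T ∧ x = Phi v}

theorem Phi_cont : Continuous Phi := continuous_iff_continuousAt.2 fun v => (hasDeriv_Phi v).hasFDerivAt.continuousAt

theorem Res_cont : Continuous Res := by unfold Res; fun_prop

theorem KK_compact (T : ℝ) : IsCompact (KK T) := by
  refine Metric.isCompact_of_isClosed_isBounded ?_ ?_
  · have := Res_cont
    simp only [KK, Set.ofPred_and]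
    refine IsClosed.inter (isClosed_le (by fun_prop) (by fun_prop)) (IsClosed.inter (isClosed_le (by fun_prop) (by fun_prop)) (IsClosed.inter (isClosed_le (by fun_prop) (by fun_prop)) (isClosed_le (by fun_prop) (by fun_prop))))
  · refine (Metric.isBounded_closedBall (x := (0 : Fin 4 → ℝ)) (r := |T| + 3)).subset ?_
    rintro v ⟨h2, h3, hT, hD⟩
    have hr := Res_ge h2 h3
    have h2' := abs_le.1 h2
    have hB : v 2 ^ 2 ≤ 1 := by nlinarith
    have hR : Res v ≤ 3 := by
      have h9 : 3 * Res v ^ 2 ≤ 27 := by nlinarith [sq_nonneg (Res v)]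
      nlinarith
    have h0 : v 0 ^ 2 ≤ 6 := by nlinarith [sq_nonneg (v 0), sq_nonneg (v 1)]
    have h1 : v 1 ^ 2 ≤ 6 := by nlinarith [sq_nonneg (v 0), sq_nonneg (v 1)]
    have hTT := le_abs_self T
    have hTT' := abs_nonneg T
    rw [Metric.mem_closedBall, dist_zero_right, pi_norm_le_iff_of_nonneg (by positivity)]
    intro i
    rw [Real.norm_eq_abs, abs_le]
    fin_cases i <;> simp <;> constructor <;> nlinarith

theorem KO_open (T : ℝ) : IsOpen (KO T) := by
  have := Res_cont
  simp only [KO, Set.ofPred_and]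
  refine IsOpen.inter (isOpen_lt (by fun_prop) (by fun_prop)) (IsOpen.inter (isOpen_lt (by fun_prop) (by fun_prop)) (IsOpen.inter (isOpen_lt (by fun_prop) (by fun_prop)) (IsOpen.inter (isOpen_lt (by fun_prop) (by fun_prop)) (isOpen_ne_fun (by fun_prop) (by fun_prop)))))

theorem KO_res {T : ℝ} {v : Fin 4 → ℝ} (h : v ∈ KO T) : 0 < Res v := by
  obtain ⟨h2, h3, hT, hD, h0⟩ := h
  have := Res_ge h2.le h3.le
  have : 0 < v 0 ^ 2 := by positivity
  nlinarith [sq_nonneg (v 1)]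

theorem Phi_KO_open (T : ℝ) : IsOpen (Phi '' KO T) := by
  rw [isOpen_iff_mem_nhds]
  rintro _ ⟨v, hv, rfl⟩
  have hd : (DPhi v).det ≠ 0 := by rw [DPhi_det]; have := KO_res hv; positivity
  have hs : HasStrictFDerivAt Phi (((DPhi v).toContinuousLinearEquivOfDetNeZero hd : (Fin 4 → ℝ) ≃L[ℝ] (Fin 4 → ℝ)) : (Fin 4 → ℝ) →L[ℝ] (Fin 4 → ℝ)) v := by
    simpa using hasDeriv_Phi v
  rw [← hs.map_nhds_eq_of_equiv]
  exact image_mem_map ((KO_open T).mem_nhds hv)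

theorem sq_lt_of {v : Fin 4 → ℝ} (h2 : |v 2| ≤ 1) (h3 : 1 ≤ v 3) : v 2 ^ 2 < 4 * v 3 := by
  have h2' := abs_le.1 h2
  nlinarith

theorem KO_sub (T : ℝ) : Phi '' KO T ⊆ SS T := by
  rintro _ ⟨v, hv, rfl⟩
  obtain ⟨h2, h3, hT, hD, h0⟩ := hv
  refine ⟨by simpa [Phi] using h0, ?_, v, h2.le, h3.le, hT.le, rfl⟩
  have := D4_Phi v
  linarith

theorem SS_sub (T : ℝ) : SS T ⊆ Phi '' KK T := by
  rintro _ ⟨h0, h1, v, h2, h3, h4, rfl⟩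
  refine ⟨v, ⟨h2, h3, h4, ?_⟩, rfl⟩
  have := D4_Phi v
  linarith

theorem Phi_injOn (T : ℝ) : Set.InjOn Phi (KO T) := by
  intro v hv w hw h
  have hv' := sq_lt_of hv.1.le hv.2.1.le
  have hw' := sq_lt_of hw.1.le hw.2.1.le
  exact Phi_inj hv' hw' (Or.inl hv.2.2.2.2) h

theorem hyper_null (i : Fin 4) (c : ℝ) : volume {x : Fin 4 → ℝ | x i = c} = 0 := by
  rw [volume_pi]
  exact Measure.pi_hyperplane (fun _ => (volume : Measure ℝ)) i c

theorem D4_cont : Continuous (fun x : Fin 4 → ℝ => D4 x) := by unfold D4; fun_prop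

theorem D4_smul (c : ℝ) (x : Fin 4 → ℝ) : D4 (c • x) = c ^ 4 * D4 x := by
  simp [D4]; ring

open scoped Pointwise in
theorem level_null : volume {x : Fin 4 → ℝ | D4 x = 1} = 0 := by
  have hc := Measure.countable_meas_level_set_pos (μ := (volume : Measure (Fin 4 → ℝ))) D4_cont.measurable
  by_contra hne
  have hsub : Set.Ioi (0 : ℝ) ⊆ {t : ℝ | 0 < volume {a : Fin 4 → ℝ | D4 a = t}} := by
    intro t ht
    have ht : 0 < t := ht
    have ht4 : 0 < t ^ (1 / 4 : ℝ) := by positivity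
    have e4 : (t ^ (1 / 4 : ℝ)) ^ 4 = t := by
      rw [← Real.rpow_natCast, ← Real.rpow_mul ht.le]; norm_num
    have : {a : Fin 4 → ℝ | D4 a = t} = t ^ (1 / 4 : ℝ) • {x : Fin 4 → ℝ | D4 x = 1} := by
      ext x
      rw [Set.mem_smul_set_iff_inv_smul_mem₀ ht4.ne']
      simp only [Set.mem_ofPred_eq]
      rw [D4_smul, inv_pow, e4]
      field_simp
    simp only [Set.mem_ofPred_eq]
    rw [this, Measure.addHaar_smul]
    refine pos_iff_ne_zero.2 (mul_ne_zero ?_ hne)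
    rw [ENNReal.ofReal_ne_zero_iff]
    positivity
  have := hc.mono hsub
  have h2 := Cardinal.mk_Ioi_real 0
  rw [← Cardinal.le_aleph0_iff_set_countable, h2] at this
  exact absurd this (not_le.2 Cardinal.aleph0_lt_continuum)

theorem bd_null (T : ℝ) : volume (Phi '' KK T \ Phi '' KO T) = 0 := by
  have hPd : ∀ s, DifferentiableOn ℝ Phi s := fun s v hv => (hasDeriv_Phi v).hasFDerivAt.differentiableAt.differentiableWithinAt
  have hP : ∀ (i : Fin 4) (c : ℝ), volume (Phi '' {x : Fin 4 → ℝ | x i = c}) = 0 := fun i c =>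
    addHaar_image_eq_zero_of_differentiableOn_of_addHaar_eq_zero _ (hPd _) (hyper_null i c)
  refine measure_mono_null (t := {x : Fin 4 → ℝ | D4 x = 1} ∪ ({x | x 0 = 0} ∪ (Phi '' {x | x 2 = 1} ∪ (Phi '' {x | x 2 = -1} ∪ (Phi '' {x | x 3 = 1} ∪ Phi '' {x | x 3 = T}))))) ?_ ?_
  · rintro _ ⟨⟨v, ⟨h2, h3, hT, hD⟩, rfl⟩, hn⟩
    by_contra hcon
    simp only [Set.mem_union, not_or] at hcon
    obtain ⟨c1, c2, c3, c4, c5, c6⟩ := hcon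
    have e := D4_Phi v
    refine hn ⟨v, ⟨?_, ?_, ?_, ?_, ?_⟩, rfl⟩
    · rcases h2.lt_or_eq with h | h
      · exact h
      · rcases (abs_eq zero_le_one).1 h with h | h
        · exact absurd ⟨v, h, rfl⟩ c3
        · exact absurd ⟨v, h, rfl⟩ c4
    · exact lt_of_le_of_ne h3 fun h => c5 ⟨v, h.symm, rfl⟩
    · exact lt_of_le_of_ne hT fun h => c6 ⟨v, h, rfl⟩
    · refine lt_of_le_of_ne hD fun h => c1 ?_
      simp only [Set.mem_ofPred_eq]; linarith
    · intro h; exact c2 (by simpa [Phi] using h)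
  · simp only [measure_union_null_iff]
    exact ⟨level_null, hyper_null 0 0, hP 2 1, hP 2 (-1), hP 3 1, hP 3 T⟩

noncomputable def VT (T : ℝ) : ℝ := (volume (Phi '' KO T)).toReal

theorem SS_count (T : ℝ) {M : ℕ} (hM : 0 < M) (f0 : Fin 4 → ℤ) :
    Tendsto (fun t : ℝ => ((lpts M f0 (SS T) t).ncard : ℝ) / t ^ 4) atTop (𝓝 (VT T / M ^ 4)) :=
  lattice_count (Phi_KO_open T) ((KK_compact T).image Phi_cont).isClosed ((KK_compact T).image Phi_cont).isBounded
    (KO_sub T) (SS_sub T) (bd_null T) hM f0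

theorem vol_eq (T : ℝ) : volume (Phi '' KO T) = ∫⁻ v in KO T, ENNReal.ofReal (Res v / 9) := by
  rw [← lintegral_abs_det_fderiv_eq_addHaar_image volume (KO_open T).measurableSet
    (fun x _ => (hasDeriv_Phi x).hasFDerivAt.hasFDerivWithinAt) (Phi_injOn T)]
  refine setLIntegral_congr_fun (KO_open T).measurableSet ?_
  intro v hv
  simp only
  rw [DPhi_det, abs_of_pos]
  have := KO_res hv
  positivity

end NH

namespace NH
open MeasureTheory Topology

theorem fub_succ {n : ℕ} (F : (Fin (n + 1) → ℝ) → ENNReal) (hF : Measurable F) :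
    ∫⁻ v, F v = ∫⁻ x : ℝ, ∫⁻ w : Fin n → ℝ, F (Fin.insertNth (Fin.last n) x w) := by
  have h := (volume_preserving_piFinSuccAbove (fun _ : Fin (n + 1) => ℝ) (Fin.last n)).symm
  rw [← h.lintegral_comp hF, Measure.volume_eq_prod, lintegral_prod]
  · rfl
  · exact (hF.comp h.measurable).aemeasurable

theorem fub4 (F : (Fin 4 → ℝ) → ENNReal) (hF : Measurable F) :
    ∫⁻ v, F v = ∫⁻ C : ℝ, ∫⁻ B : ℝ, ∫⁻ r : ℝ, ∫⁻ s : ℝ, F ![s, r, B, C] := by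
  have m0 : ∀ (n : ℕ) (x : ℝ), Measurable fun w : Fin n → ℝ => (Fin.insertNth (Fin.last n) x w : Fin (n + 1) → ℝ) := by
    intro n x
    refine measurable_pi_iff.2 fun i => ?_
    refine Fin.lastCases ?_ (fun j => ?_) i
    · simp
    · simp only [Fin.insertNth_last', Fin.snoc_castSucc]; exact measurable_pi_apply j
  rw [fub_succ F hF]
  refine lintegral_congr fun C => ?_
  refine (fub_succ _ (hF.comp (m0 3 C))).trans ?_
  refine lintegral_congr fun B => ?_
  refine (fub_succ _ ((hF.comp (m0 3 C)).comp (m0 2 B))).trans ?_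
  refine lintegral_congr fun r => ?_
  have h := (volume_preserving_funUnique (Fin 1) ℝ).symm
  refine (h.lintegral_comp (((hF.comp (m0 3 C)).comp (m0 2 B)).comp (m0 1 r))).symm.trans ?_
  refine lintegral_congr fun s => ?_
  simp only [Function.comp]
  congr 1
  ext i
  fin_cases i <;> rfl

theorem lint_scale (g : ℝ → ENNReal) (hg : Measurable g) {a : ℝ} (ha : 0 < a) :
    ∫⁻ x, g (a * x) = ENNReal.ofReal a⁻¹ * ∫⁻ x, g x := by
  have h := Real.map_volume_mul_left ha.ne'
  rw [← lintegral_map (μ := volume) hg (measurable_const_mul a), h, lintegral_smul_measure, abs_of_pos (inv_pos.2 ha)]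
  rfl

/-- inner double integral -/
theorem inner_quad (g : ℝ → ENNReal) (hg : Measurable g) {B C : ℝ} (hC : 0 < C) (hD : 0 < 4 * C - B ^ 2) :
    ∫⁻ r : ℝ, ∫⁻ s : ℝ, g (s ^ 2 * C - s * r * B + r ^ 2) =
      ENNReal.ofReal (2 / √(4 * C - B ^ 2)) * ∫⁻ r : ℝ, ∫⁻ s : ℝ, g (s ^ 2 + r ^ 2) := by
  set D := 4 * C - B ^ 2 with hDd
  have e1 : ∀ r : ℝ, ∫⁻ s : ℝ, g (s ^ 2 * C - s * r * B + r ^ 2) =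
      ENNReal.ofReal (√C)⁻¹ * ∫⁻ s : ℝ, g (s ^ 2 + (√D / (2 * √C) * r) ^ 2) := by
    intro r
    have hm : Measurable fun s : ℝ => g (s ^ 2 + (√D / (2 * √C) * r) ^ 2) := by fun_prop
    rw [← lint_scale _ hm (Real.sqrt_pos.2 hC)]
    rw [← lintegral_sub_right_eq_self (fun s => g ((√C * s) ^ 2 + (√D / (2 * √C) * r) ^ 2)) (r * B / (2 * C))]
    refine lintegral_congr fun s => ?_
    congr 1
    rw [mul_pow, mul_pow, div_pow, mul_pow, Real.sq_sqrt hC.le, Real.sq_sqrt hD.le, hDd]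
    field_simp
    ring
  simp_rw [e1]
  have hm2 : Measurable fun r : ℝ => ∫⁻ s : ℝ, g (s ^ 2 + r ^ 2) := by
    refine Measurable.lintegral_prod_right' (f := fun p : ℝ × ℝ => g (p.2 ^ 2 + p.1 ^ 2)) ?_
    fun_prop
  have hk : 0 < √D / (2 * √C) := by have := Real.sqrt_pos.2 hC; have := Real.sqrt_pos.2 hD; positivity
  rw [lintegral_const_mul' _ _ ENNReal.ofReal_ne_top, lint_scale (fun r => ∫⁻ s : ℝ, g (s ^ 2 + r ^ 2)) hm2 hk, ← mul_assoc,
    ← ENNReal.ofReal_mul (by positivity)]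
  congr 2
  have := Real.sqrt_pos.2 hC; have := Real.sqrt_pos.2 hD
  field_simp

theorem polar_int (g : ℝ → ENNReal) (hg : Measurable g) :
    ∫⁻ r : ℝ, ∫⁻ s : ℝ, g (s ^ 2 + r ^ 2) = ENNReal.ofReal (2 * Real.pi) * ∫⁻ x in Set.Ioi (0 : ℝ), ENNReal.ofReal x * g (x ^ 2) := by
  have h := lintegral_comp_polarCoord_symm (fun p : ℝ × ℝ => g (p.2 ^ 2 + p.1 ^ 2))
  rw [Measure.volume_eq_prod, lintegral_prod _ (by fun_prop)] at h
  rw [← h, polarCoord_target]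
  simp only [polarCoord_symm_apply, smul_eq_mul]
  rw [← Measure.prod_restrict, lintegral_prod _ (by fun_prop), ← lintegral_const_mul' _ _ ENNReal.ofReal_ne_top]
  refine lintegral_congr fun x => ?_
  have : ∀ y : ℝ, (x * Real.sin y) ^ 2 + (x * Real.cos y) ^ 2 = x ^ 2 := fun y => by
    rw [mul_pow, mul_pow, ← mul_add, Real.sin_sq_add_cos_sq, mul_one]
  simp only [this]
  rw [lintegral_const, Measure.restrict_apply MeasurableSet.univ, Set.univ_inter, Real.volume_Ioo, mul_comm]
  congr 2
  ring

end NH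

namespace NH
open MeasureTheory Topology

theorem lint_Ioo {f : ℝ → ℝ} {a b : ℝ} (hab : a ≤ b) (hc : ContinuousOn f (Set.Icc a b)) (h0 : ∀ x ∈ Set.Icc a b, 0 ≤ f x) :
    ∫⁻ x in Set.Ioo a b, ENNReal.ofReal (f x) = ENNReal.ofReal (∫ x in a..b, f x) := by
  rw [intervalIntegral.integral_of_le hab, integral_Ioc_eq_integral_Ioo]
  rw [ofReal_integral_eq_lintegral_ofReal]
  · exact (hc.integrableOn_Icc).mono_set Set.Ioo_subset_Icc_self
  · exact (ae_restrict_iff' measurableSet_Ioo).2 (ae_of_all _ fun x hx => h0 x (Set.Ioo_subset_Icc_self hx))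

noncomputable def gD (D q : ℝ) : ENNReal := if D * q ^ 2 < 27 then ENNReal.ofReal (q / 9) else 0

theorem gD_meas (D : ℝ) : Measurable (gD D) := by
  unfold gD
  refine Measurable.ite (measurableSet_lt (by fun_prop) (by fun_prop)) (by fun_prop) (by fun_prop)

theorem gD_int {D : ℝ} (hD : 0 < D) : ∫⁻ x in Set.Ioi (0 : ℝ), ENNReal.ofReal x * gD D (x ^ 2) = ENNReal.ofReal (3 / (4 * D)) := by
  set ρ := √√(27 / D) with hρ
  have hρ0 : 0 < ρ := by positivity
  have hρ4 : ρ ^ 4 = 27 / D := by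
    rw [show ρ ^ 4 = (ρ ^ 2) ^ 2 by ring, hρ, Real.sq_sqrt (by positivity), Real.sq_sqrt (by positivity)]
  have h1 : ∀ x ∈ Set.Ioi (0 : ℝ), ENNReal.ofReal x * gD D (x ^ 2) = (Set.Iio ρ).indicator (fun x => ENNReal.ofReal (x ^ 3 / 9)) x := by
    intro x hx
    have hx : 0 < x := hx
    have : D * (x ^ 2) ^ 2 < 27 ↔ x < ρ := by
      rw [← pow_lt_pow_iff_left₀ hx.le hρ0.le (n := 4) (by norm_num), hρ4, lt_div_iff₀ hD]
      ring_nf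
    simp only [gD, this, Set.indicator_apply, Set.mem_Iio]
    split_ifs
    · rw [← ENNReal.ofReal_mul hx.le]; congr 1; ring
    · simp
  rw [setLIntegral_congr_fun measurableSet_Ioi h1, lintegral_indicator measurableSet_Iio, Measure.restrict_restrict measurableSet_Iio,
    Set.inter_comm, Set.Ioi_inter_Iio, lint_Ioo hρ0.le (by fun_prop)]
  · congr 1
    rw [intervalIntegral.integral_div, integral_pow]
    norm_num
    rw [hρ4]; field_simp; norm_num
  · intro x hx
    have := hx.1
    positivity

theorem inner_val {B C : ℝ} (hC : 0 < C) (hD : 0 < 4 * C - B ^ 2) :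
    ∫⁻ r : ℝ, ∫⁻ s : ℝ, gD (4 * C - B ^ 2) (s ^ 2 * C - s * r * B + r ^ 2) =
      ENNReal.ofReal (3 * Real.pi * ((4 * C - B ^ 2) * √(4 * C - B ^ 2))⁻¹) := by
  rw [inner_quad _ (gD_meas _) hC hD, polar_int _ (gD_meas _), gD_int hD, ← ENNReal.ofReal_mul (by positivity), ← ENNReal.ofReal_mul (by positivity)]
  congr 1
  have := Real.sqrt_pos.2 hD
  field_simp
  ring

theorem KO_int (T : ℝ) : volume (Phi '' KO T) =
    ∫⁻ C in Set.Ioo 1 T, ∫⁻ B in Set.Ioo (-1) 1, ENNReal.ofReal (3 * Real.pi * ((4 * C - B ^ 2) * √(4 * C - B ^ 2))⁻¹) := by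
  have hR : Measurable Res := Res_cont.measurable
  rw [vol_eq, ← lintegral_indicator (KO_open T).measurableSet,
    fub4 _ (Measurable.indicator (by fun_prop) (KO_open T).measurableSet), ← lintegral_indicator measurableSet_Ioo]
  refine lintegral_congr fun C => ?_
  by_cases hC : C ∈ Set.Ioo 1 T
  swap
  · rw [Set.indicator_of_notMem hC]
    have : ∀ B r s : ℝ, ((KO T).indicator (fun v => ENNReal.ofReal (Res v / 9)) ![s, r, B, C]) = 0 := by
      intro B r s
      refine Set.indicator_of_notMem ?_ _
      rintro ⟨-, h1, h2, -⟩
      exact hC ⟨by simpa using h1, by simpa using h2⟩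
    simp [this]
  rw [Set.indicator_of_mem hC, ← lintegral_indicator measurableSet_Ioo]
  refine lintegral_congr fun B => ?_
  by_cases hB : B ∈ Set.Ioo (-1 : ℝ) 1
  swap
  · rw [Set.indicator_of_notMem hB]
    have : ∀ r s : ℝ, ((KO T).indicator (fun v => ENNReal.ofReal (Res v / 9)) ![s, r, B, C]) = 0 := by
      intro r s
      refine Set.indicator_of_notMem ?_ _
      rintro ⟨h1, -⟩
      exact hB (abs_lt.1 (by simpa using h1))
    simp [this]
  have hC1 := hC.1
  have hC2 := hC.2
  have hB1 := hB.1
  have hB2 := hB.2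
  rw [Set.indicator_of_mem hB, ← inner_val (by linarith) (by nlinarith)]
  refine lintegral_congr fun r => lintegral_congr_ae ?_
  have : ∀ᵐ s : ℝ, s ≠ 0 := by simp [ae_iff]
  filter_upwards [this] with s hs
  have hBa : |B| < 1 := abs_lt.2 hB
  have e : Res ![s, r, B, C] = s ^ 2 * C - s * r * B + r ^ 2 := by simp [Res]
  classical
  rw [Set.indicator_apply]
  have : ![s, r, B, C] ∈ KO T ↔ (4 * C - B ^ 2) * (s ^ 2 * C - s * r * B + r ^ 2) ^ 2 < 27 := by
    simp [KO, e, hBa, hC1, hC2, hs]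
  simp only [this, e, gD]

theorem cint {B : ℝ} (hB : B ^ 2 ≤ 1) {T : ℝ} (hT : 1 ≤ T) : ∫ C in (1 : ℝ)..T, 3 * Real.pi * ((4 * C - B ^ 2) * √(4 * C - B ^ 2))⁻¹ =
    3 * Real.pi / 2 * ((√(4 - B ^ 2))⁻¹ - (√(4 * T - B ^ 2))⁻¹) := by
  have hpos : ∀ C ∈ Set.uIcc 1 T, 0 < 4 * C - B ^ 2 := by
    intro C hC
    rw [Set.uIcc_of_le hT] at hC
    linarith [hC.1]
  rw [intervalIntegral.integral_eq_sub_of_hasDerivAt (f := fun C => - (3 * Real.pi / 2) * (√(4 * C - B ^ 2))⁻¹)]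
  · rw [mul_one]; ring
  · intro C hC
    have h := hpos C hC
    have hs := Real.sqrt_pos.2 h
    have h1 : HasDerivAt (fun C : ℝ => 4 * C - B ^ 2) 4 C := by
      simpa using ((hasDerivAt_id C).const_mul 4).sub_const (B ^ 2)
    have h2 := ((h1.sqrt h.ne').inv hs.ne').const_mul (- (3 * Real.pi / 2))
    refine h2.congr_deriv ?_
    rw [Real.sq_sqrt h.le]
    field_simp
    ring
  · refine ContinuousOn.intervalIntegrable ?_
    refine ContinuousOn.mul (by fun_prop) (ContinuousOn.inv₀ (by fun_prop) ?_)
    intro C hC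
    have := Real.sqrt_pos.2 (hpos C hC)
    have := hpos C hC
    positivity

theorem VT_formula {T : ℝ} (hT : 1 ≤ T) : VT T = ∫ B in (-1 : ℝ)..1, 3 * Real.pi / 2 * ((√(4 - B ^ 2))⁻¹ - (√(4 * T - B ^ 2))⁻¹) := by
  have hn : ∀ B ∈ Set.Icc (-1 : ℝ) 1, 0 < 4 - B ^ 2 ∧ 0 < 4 * T - B ^ 2 ∧ B ^ 2 ≤ 1 := by
    intro B hB
    have := hB.1
    have := hB.2
    have : B ^ 2 ≤ 1 := by nlinarith
    exact ⟨by linarith, by linarith, this⟩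
  have hnn : ∀ B ∈ Set.Icc (-1 : ℝ) 1, 0 ≤ 3 * Real.pi / 2 * ((√(4 - B ^ 2))⁻¹ - (√(4 * T - B ^ 2))⁻¹) := by
    intro B hB
    obtain ⟨h1, h2, h3⟩ := hn B hB
    refine mul_nonneg (by positivity) (sub_nonneg.2 ?_)
    have := Real.sqrt_pos.2 h1
    refine inv_anti₀ this (Real.sqrt_le_sqrt (by linarith))
  have hcont : ContinuousOn (fun B : ℝ => 3 * Real.pi / 2 * ((√(4 - B ^ 2))⁻¹ - (√(4 * T - B ^ 2))⁻¹)) (Set.Icc (-1) 1) := by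
    refine ContinuousOn.mul (by fun_prop) (ContinuousOn.sub (ContinuousOn.inv₀ (by fun_prop) ?_) (ContinuousOn.inv₀ (by fun_prop) ?_))
    · intro B hB
      exact (Real.sqrt_pos.2 (hn B hB).1).ne'
    · intro B hB
      exact (Real.sqrt_pos.2 (hn B hB).2.1).ne'
  rw [VT, KO_int, lintegral_lintegral_swap (by unfold Function.uncurry; fun_prop)]
  rw [setLIntegral_congr_fun (g := fun B => ENNReal.ofReal (3 * Real.pi / 2 * ((√(4 - B ^ 2))⁻¹ - (√(4 * T - B ^ 2))⁻¹))) measurableSet_Ioo]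
  · rw [lint_Ioo (by norm_num) hcont hnn, ENNReal.toReal_ofReal]
    exact intervalIntegral.integral_nonneg (by norm_num) hnn
  · intro B hB
    obtain ⟨h1, h2, h3⟩ := hn B (Set.Ioo_subset_Icc_self hB)
    simp only
    rw [← cint h3 hT, lint_Ioo hT]
    · refine ContinuousOn.mul (by fun_prop) (ContinuousOn.inv₀ (by fun_prop) ?_)
      intro C hC
      have hp : 0 < 4 * C - B ^ 2 := by linarith [hC.1]
      have := Real.sqrt_pos.2 hp
      positivity
    · intro C hC
      have hp : 0 < 4 * C - B ^ 2 := by linarith [hC.1]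
      positivity

theorem VT_eq {T : ℝ} (hT : 1 ≤ T) : VT T = Real.pi ^ 2 / 2 - 3 * Real.pi / 2 * ∫ B in (-1 : ℝ)..1, (√(4 * T - B ^ 2))⁻¹ := by
  have hcont : ∀ T : ℝ, 1 ≤ T → ContinuousOn (fun B : ℝ => (√(4 * T - B ^ 2))⁻¹) (Set.uIcc (-1) 1) := by
    intro T hT
    refine ContinuousOn.inv₀ (by fun_prop) ?_
    intro B hB
    rw [Set.uIcc_of_le (by norm_num)] at hB
    have := hB.1
    have := hB.2
    exact (Real.sqrt_pos.2 (by nlinarith)).ne'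
  have h1 : ∫ B in (-1 : ℝ)..1, (√(4 - B ^ 2))⁻¹ = Real.pi / 3 := by
    have hI := (hcont 1 le_rfl).intervalIntegrable (μ := volume)
    simp only [mul_one] at hI
    rw [intervalIntegral.integral_eq_sub_of_hasDerivAt (f := fun B => Real.arcsin (B / 2)) _ hI]
    · have : Real.arcsin (1 / 2) = Real.pi / 6 := by
        rw [← Real.sin_pi_div_six, Real.arcsin_sin] <;> linarith [Real.pi_pos]
      rw [neg_div, Real.arcsin_neg, this]; ring
    · intro B hB
      rw [Set.uIcc_of_le (by norm_num)] at hB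
      have := hB.1
      have := hB.2
      have h := (Real.hasDerivAt_arcsin (x := B / 2) (by linarith) (by linarith)).comp B ((hasDerivAt_id B).div_const 2)
      refine h.congr_deriv ?_
      have : 1 - (B / 2) ^ 2 = (4 - B ^ 2) / 2 ^ 2 := by ring
      rw [this, Real.sqrt_div' _ (by positivity), Real.sqrt_sq (by norm_num)]
      have hp : 0 < √(4 - B ^ 2) := Real.sqrt_pos.2 (by nlinarith)
      field_simp
  rw [VT_formula hT, intervalIntegral.integral_const_mul, intervalIntegral.integral_sub, h1]
  · ring
  · have := (hcont 1 le_rfl).intervalIntegrable (μ := volume); simpa using this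
  · exact (hcont T hT).intervalIntegrable

theorem VT_le {T : ℝ} (hT : 1 ≤ T) : VT T ≤ Real.pi ^ 2 / 2 := by
  rw [VT_eq hT]
  have : 0 ≤ ∫ B in (-1 : ℝ)..1, (√(4 * T - B ^ 2))⁻¹ := intervalIntegral.integral_nonneg (by norm_num) fun _ _ => by positivity
  have := mul_nonneg (show 0 ≤ 3 * Real.pi / 2 by positivity) this
  linarith

theorem VT_ge {T : ℝ} (hT : 1 ≤ T) : Real.pi ^ 2 / 2 - 3 * Real.pi * (√(3 * T))⁻¹ ≤ VT T := by
  rw [VT_eq hT]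
  have h := intervalIntegral.norm_integral_le_of_norm_le_const (a := -1) (b := 1) (f := fun B : ℝ => (√(4 * T - B ^ 2))⁻¹) (C := (√(3 * T))⁻¹) (by
    intro B hB
    rw [Set.uIoc_of_le (by norm_num)] at hB
    have := hB.1
    have := hB.2
    rw [Real.norm_of_nonneg (by positivity)]
    exact inv_anti₀ (Real.sqrt_pos.2 (by linarith)) (Real.sqrt_le_sqrt (by nlinarith)))
  have h2 := (le_abs_self _).trans h
  rw [show |(1 : ℝ) - -1| = 2 by norm_num] at h2
  nlinarith [Real.pi_pos]

theorem VT_tendsto : Tendsto VT atTop (𝓝 (Real.pi ^ 2 / 2)) := by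
  have h : Tendsto (fun T : ℝ => Real.pi ^ 2 / 2 - 3 * Real.pi * (√(3 * T))⁻¹) atTop (𝓝 (Real.pi ^ 2 / 2 - 3 * Real.pi * 0)) := by
    refine tendsto_const_nhds.sub (Tendsto.const_mul _ (tendsto_inv_atTop_zero.comp (Real.tendsto_sqrt_atTop.comp ?_)))
    exact tendsto_id.const_mul_atTop (by norm_num)
  rw [mul_zero, sub_zero] at h
  refine tendsto_of_tendsto_of_tendsto_of_le_of_le' h tendsto_const_nhds ?_ ?_
  · filter_upwards [eventually_ge_atTop 1] with T hT using VT_ge hT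
  · filter_upwards [eventually_ge_atTop 1] with T hT using VT_le hT

end NH

namespace NH

/-- leading Hessian coefficient -/
def Pf (f : Fin 4 → ℤ) : ℤ := f 0 * f 2 - f 1 ^ 2
def Qf (f : Fin 4 → ℤ) : ℤ := f 0 ^ 2 * f 3 - 3 * f 0 * f 1 * f 2 + 2 * f 1 ^ 3

theorem Q_syz (f : Fin 4 → ℤ) : f 0 ^ 2 * D4 f = Qf f ^ 2 + 4 * Pf f ^ 3 := by
  simp [D4, Qf, Pf]; ring

theorem red_bounds {f : Fin 4 → ℤ} {v : Fin 4 → ℝ} (hf : RedBy f v) {w t : ℝ} (hw : 0 ≤ w) (ht : 1 ≤ t) (h0 : f 0 ≠ 0)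
    (hD : ((D4 f : ℤ) : ℝ) < w ^ 4) (hC : t ^ 4 ≤ v 3) :
    0 < D4 f ∧ |(f 0 : ℝ)| * t ^ 3 ≤ 3 * w ∧ |(Pf f : ℝ)| * t ^ 2 ≤ 3 * w ^ 2 := by
  obtain ⟨e0, e1, e2, e3⟩ := hf.eqs
  have hd := hf.disc
  have hr := Res_ge hf.1 hf.2.1
  have hB := abs_le.1 hf.1
  have hC1 := hf.2.1
  have hB2 : v 2 ^ 2 ≤ 1 := by nlinarith
  have h0' : v 0 ≠ 0 := by rw [← e0]; exact_mod_cast h0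
  have hv0 : 0 < v 0 ^ 2 := by positivity
  have hR : 0 < Res v := by nlinarith [sq_nonneg (v 1)]
  have hp : 0 < D4 f := by
    have : 0 < 27 * ((D4 f : ℤ) : ℝ) := by rw [hd]; exact mul_pos (by linarith) (by positivity)
    have : (0 : ℝ) < ((D4 f : ℤ) : ℝ) := by linarith
    exact_mod_cast this
  have h1 : v 3 * Res v ^ 2 ≤ 9 * w ^ 4 := by
    have : 3 * v 3 * Res v ^ 2 ≤ (4 * v 3 - v 2 ^ 2) * Res v ^ 2 :=
      mul_le_mul_of_nonneg_right (by linarith) (by positivity)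
    linarith
  have h2 : t ^ 2 * Res v ≤ 3 * w ^ 2 := by
    have : (t ^ 2 * Res v) ^ 2 ≤ (3 * w ^ 2) ^ 2 := by
      have := mul_le_mul_of_nonneg_right hC (sq_nonneg (Res v))
      nlinarith
    exact le_of_sq_le_sq this (by positivity)
  have ht2 : 0 < t ^ 2 := by positivity
  refine ⟨hp, ?_, ?_⟩
  · rw [e0]
    refine le_of_sq_le_sq ?_ (by positivity)
    rw [mul_pow, sq_abs]
    have : v 0 ^ 2 * t ^ 4 ≤ 2 * Res v := by nlinarith [mul_le_mul_of_nonneg_left hC hv0.le, sq_nonneg (v 1)]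
    have := mul_le_mul_of_nonneg_left this ht2.le
    nlinarith
  · have e : 9 * (Pf f : ℝ) = 3 * v 0 ^ 2 * v 3 + v 0 * v 1 * v 2 - v 0 ^ 2 * v 2 ^ 2 - v 1 ^ 2 := by
      have : 9 * (Pf f : ℝ) = 3 * (f 0 : ℝ) * (3 * (f 2 : ℝ)) - (3 * (f 1 : ℝ)) ^ 2 := by
        simp only [Pf]; push_cast; ring
      rw [this, e0, e1, e2]; ring
    have h := abs_le.1 (show |v 0 * v 1 * v 2| ≤ |v 0 * v 1| by
      rw [abs_mul]; exact mul_le_of_le_one_right (abs_nonneg _) hf.1)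
    have h4 : |v 0 * v 1| ≤ (v 0 ^ 2 + v 1 ^ 2) / 2 := by
      rw [abs_le]; constructor <;> nlinarith [sq_nonneg (v 0 + v 1), sq_nonneg (v 0 - v 1)]
    have h5 : v 0 ^ 2 * v 2 ^ 2 ≤ v 0 ^ 2 * v 3 := mul_le_mul_of_nonneg_left (by linarith) hv0.le
    have h6 : v 0 ^ 2 ≤ v 0 ^ 2 * v 3 := by nlinarith
    have h7 : 0 ≤ v 0 ^ 2 * v 2 ^ 2 := by positivity
    have h8 : |9 * (Pf f : ℝ)| ≤ 7 * Res v := by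
      rw [e, abs_le]; constructor <;> linarith [sq_nonneg (v 1)]
    rw [abs_mul, abs_of_pos (by norm_num : (0 : ℝ) < 9)] at h8
    have h9 := mul_le_mul_of_nonneg_right h8 ht2.le
    have h10 := sq_nonneg w
    linarith

theorem card_le_sum_fib {α β : Type*} [DecidableEq β] (S : Finset α) (T : Finset β) (g : α → β) (hg : ∀ x ∈ S, g x ∈ T)
    (B : β → ℝ) (hB : ∀ y ∈ T, ((S.filter fun x => g x = y).card : ℝ) ≤ B y) : (S.card : ℝ) ≤ ∑ y ∈ T, B y := by
  rw [Finset.card_eq_sum_card_fiberwise (f := g) (t := T) hg]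
  push_cast
  exact Finset.sum_le_sum hB

/-- integers in a closed real interval -/
theorem int_card_le (S : Finset ℤ) {x y : ℝ} (hxy : x ≤ y) (h : ∀ n ∈ S, x ≤ n ∧ (n : ℝ) ≤ y) : (S.card : ℝ) ≤ y - x + 1 := by
  have hs : S ⊆ Finset.Icc ⌈x⌉ ⌊y⌋ := fun n hn => Finset.mem_Icc.2 ⟨Int.ceil_le.2 (h n hn).1, Int.le_floor.2 (h n hn).2⟩
  have h1 := Finset.card_le_card hs
  rw [Int.card_Icc] at h1
  have h2 : (S.card : ℝ) ≤ ((⌊y⌋ + 1 - ⌈x⌉).toNat : ℝ) := by exact_mod_cast h1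
  have h3 : (((⌊y⌋ + 1 - ⌈x⌉).toNat : ℤ) : ℝ) ≤ y - x + 1 := by
    rw [Int.toNat_eq_max]
    push_cast
    refine max_le ?_ (by linarith)
    linarith [Int.floor_le y, Int.le_ceil x]
  push_cast at h3
  linarith

theorem dcount (S : Finset ℤ) {q κ U V : ℝ} (hq : 0 < q) (hU : 0 ≤ U) (hV : 0 ≤ V)
    (h : ∀ d ∈ S, U ≤ (q * d + κ) ^ 2 ∧ (q * d + κ) ^ 2 ≤ U + V) :
    (S.card : ℝ) ≤ 2 + 2 * ((√(U + V) - √U) / q) := by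
  have hle : √U ≤ √(U + V) := Real.sqrt_le_sqrt (by linarith)
  rw [← Finset.card_filter_add_card_filter_not (s := S) (fun d : ℤ => 0 ≤ q * d + κ)]
  have h1 : ((S.filter fun d : ℤ => 0 ≤ q * d + κ).card : ℝ) ≤ (√(U + V) - κ) / q - (√U - κ) / q + 1 := by
    refine int_card_le _ (by gcongr) ?_
    intro d hd
    rw [Finset.mem_filter] at hd
    obtain ⟨h3, h4⟩ := h d hd.1
    have h5 := Real.sqrt_le_sqrt h3
    have h6 := Real.sqrt_le_sqrt h4
    rw [Real.sqrt_sq hd.2] at h5 h6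
    rw [div_le_iff₀ hq, le_div_iff₀ hq]
    constructor <;> linarith
  have h2 : ((S.filter fun d : ℤ => ¬ 0 ≤ q * d + κ).card : ℝ) ≤ (-√U - κ) / q - (-√(U + V) - κ) / q + 1 := by
    refine int_card_le _ (by gcongr) ?_
    intro d hd
    rw [Finset.mem_filter, not_le] at hd
    obtain ⟨h3, h4⟩ := h d hd.1
    have h5 := Real.sqrt_le_sqrt h3
    have h6 := Real.sqrt_le_sqrt h4
    rw [Real.sqrt_sq_eq_abs, abs_of_neg hd.2] at h5 h6
    rw [div_le_iff₀ hq, le_div_iff₀ hq]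
    constructor <;> linarith
  push_cast
  have : (√(U + V) - κ) / q - (√U - κ) / q + 1 + ((-√U - κ) / q - (-√(U + V) - κ) / q + 1) = 2 + 2 * ((√(U + V) - √U) / q) := by
    field_simp; ring
  linarith

theorem sqrt_sub_le {U V : ℝ} (hU : 0 < U) (hV : 0 ≤ V) : √(U + V) - √U ≤ V / (2 * √U) := by
  have h1 := Real.sqrt_pos.2 hU
  have h2 := Real.sq_sqrt hU.le
  have h3 := Real.sq_sqrt (show 0 ≤ U + V by linarith)
  have hle : √U ≤ √(U + V) := Real.sqrt_le_sqrt (by linarith)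
  rw [le_div_iff₀ (by positivity)]
  nlinarith

/-- number of `d` for given `a, b, c` -/
theorem dcount_form (S : Finset (Fin 4 → ℤ)) {a b c : ℤ} (ha : a ≠ 0) {w : ℝ} (hw : 1 ≤ w)
    (h : ∀ f ∈ S, f 0 = a ∧ f 1 = b ∧ f 2 = c ∧ 0 < D4 f ∧ ((D4 f : ℤ) : ℝ) < w ^ 4) :
    (S.card : ℝ) ≤ 2 + 2 * (w ^ 2 / |(a : ℝ)|) ∧
      (a * c - b ^ 2 ≠ 0 → (S.card : ℝ) ≤ 2 + w ^ 4 / (|(a * c - b ^ 2 : ℝ)| * √|(a * c - b ^ 2 : ℝ)|)) := by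
  have hinj : Set.InjOn (fun f : Fin 4 → ℤ => f 3) S := by
    intro f hf g hg hfg
    obtain ⟨f0, f1, f2, -⟩ := h f hf
    obtain ⟨g0, g1, g2, -⟩ := h g hg
    exact ext4 (f0.trans g0.symm) (f1.trans g1.symm) (f2.trans g2.symm) hfg
  have hcard : (S.image fun f : Fin 4 → ℤ => f 3).card = S.card := Finset.card_image_of_injOn hinj
  set q : ℝ := (a : ℝ) ^ 2 with hq
  have ha' : (a : ℝ) ≠ 0 := by exact_mod_cast ha
  have hq0 : 0 < q := by positivity
  set P : ℝ := a * c - b ^ 2 with hP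
  set κ : ℝ := -3 * a * b * c + 2 * b ^ 3 with hκ
  have key : ∀ d ∈ S.image fun f : Fin 4 → ℤ => f 3, 0 < (q * d + κ) ^ 2 + 4 * P ^ 3 ∧ (q * d + κ) ^ 2 + 4 * P ^ 3 < q * w ^ 4 := by
    intro d hd
    obtain ⟨f, hf, rfl⟩ := Finset.mem_image.1 hd
    obtain ⟨f0, f1, f2, hD, hX⟩ := h f hf
    have e := Q_syz f
    have e' : (f 0 : ℝ) ^ 2 * ((D4 f : ℤ) : ℝ) = (Qf f : ℝ) ^ 2 + 4 * (Pf f : ℝ) ^ 3 := by exact_mod_cast e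
    have e2 : (Qf f : ℝ) = q * (f 3 : ℝ) + κ := by
      simp only [Qf, f0, f1, f2, hq, hκ]; push_cast; ring
    have e3 : (Pf f : ℝ) = P := by
      simp only [Pf, f0, f1, f2, hP]; push_cast; ring
    rw [e2, e3, f0] at e'
    rw [← e']
    have hD' : (0 : ℝ) < ((D4 f : ℤ) : ℝ) := by exact_mod_cast hD
    exact ⟨by positivity, mul_lt_mul_of_pos_left hX hq0⟩
  have hqw : √(q * w ^ 4) = |(a : ℝ)| * w ^ 2 := by
    rw [hq, show (a : ℝ) ^ 2 * w ^ 4 = (a * w ^ 2) ^ 2 by ring, Real.sqrt_sq_eq_abs, abs_mul, abs_of_pos (by positivity : 0 < w ^ 2)]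
  have habs : 0 < |(a : ℝ)| := abs_pos.2 ha'
  have hqq : q = |(a : ℝ)| ^ 2 := (sq_abs _).symm
  have hc : (S.card : ℝ) = ((S.image fun f : Fin 4 → ℤ => f 3).card : ℝ) := by rw [hcard]
  rw [hc]
  by_cases hPs : 0 ≤ P
  · have h1 := dcount (S.image fun f : Fin 4 → ℤ => f 3) (U := 0) (V := q * w ^ 4) (κ := κ) hq0 le_rfl (by positivity) (by
      intro d hd
      obtain ⟨k1, k2⟩ := key d hd
      have : 0 ≤ P ^ 3 := by positivity
      exact ⟨by positivity, by linarith⟩)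
    rw [zero_add, hqw, Real.sqrt_zero, sub_zero, hqq, show |(a : ℝ)| * w ^ 2 / |(a : ℝ)| ^ 2 = w ^ 2 / |(a : ℝ)| by field_simp] at h1
    refine ⟨h1, fun hne => ?_⟩
    rcases (S.image fun f : Fin 4 → ℤ => f 3).eq_empty_or_nonempty with he | ⟨d, hd⟩
    · rw [he]; simp; positivity
    · obtain ⟨k1, k2⟩ := key d hd
      have hP0 : 0 < P := lt_of_le_of_ne hPs fun h => hne (by
        have h' : (a * c - b ^ 2 : ℝ) = 0 := h.symm
        exact_mod_cast h')
      refine h1.trans (add_le_add le_rfl ?_)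
      rw [abs_of_pos hP0]
      have hs := Real.sqrt_pos.2 hP0
      have h4 : 2 * (P * √P) ≤ |(a : ℝ)| * w ^ 2 := by
        refine le_of_sq_le_sq ?_ (by positivity)
        rw [mul_pow, mul_pow, Real.sq_sqrt hP0.le, mul_pow, sq_abs]
        nlinarith [sq_nonneg (q * d + κ)]
      rw [← mul_div_assoc, div_le_div_iff₀ habs (by positivity)]
      nlinarith [mul_le_mul_of_nonneg_left h4 (by positivity : 0 ≤ w ^ 2)]
  · push Not at hPs
    have hP3 : 0 < -(4 * P ^ 3) := by
      have : P ^ 3 < 0 := Odd.pow_neg (by decide) hPs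
      linarith
    have h1 := dcount (S.image fun f : Fin 4 → ℤ => f 3) (U := -(4 * P ^ 3)) (V := q * w ^ 4) (κ := κ) hq0 hP3.le (by positivity) (by
      intro d hd
      obtain ⟨k1, k2⟩ := key d hd
      exact ⟨by linarith, by linarith⟩)
    constructor
    · refine h1.trans ?_
      have : √(-(4 * P ^ 3) + q * w ^ 4) ≤ √(-(4 * P ^ 3)) + √(q * w ^ 4) := by
        rw [Real.sqrt_le_left (by positivity), add_sq, Real.sq_sqrt hP3.le, Real.sq_sqrt (by positivity)]
        have : 0 ≤ 2 * √(-(4 * P ^ 3)) * √(q * w ^ 4) := by positivity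
        linarith 
      have h2 : (√(-(4 * P ^ 3) + q * w ^ 4) - √(-(4 * P ^ 3))) / q ≤ |(a : ℝ)| * w ^ 2 / |(a : ℝ)| ^ 2 := by
        rw [← hqq]
        gcongr
        linarith
      rw [show |(a : ℝ)| * w ^ 2 / |(a : ℝ)| ^ 2 = w ^ 2 / |(a : ℝ)| by field_simp] at h2
      linarith
    · intro hne
      refine h1.trans (add_le_add le_rfl ?_)
      have h2 := sqrt_sub_le hP3 (V := q * w ^ 4) (by positivity)
      have h3 : √(-(4 * P ^ 3)) = 2 * (|P| * √|P|) := by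
        rw [Real.sqrt_eq_iff_mul_self_eq hP3.le (by positivity)]
        have : √|P| * √|P| = |P| := Real.mul_self_sqrt (abs_nonneg _)
        rw [show 2 * (|P| * √|P|) * (2 * (|P| * √|P|)) = 4 * |P| ^ 2 * (√|P| * √|P|) by ring, this, abs_of_neg hPs]; ring
      rw [h3] at h2
      have hPp : 0 < |P| := abs_pos.2 hPs.ne
      have hs := Real.sqrt_pos.2 hPp
      calc 2 * ((√(-(4 * P ^ 3) + q * w ^ 4) - √(-(4 * P ^ 3))) / q) ≤ 2 * (q * w ^ 4 / (2 * (2 * (|P| * √|P|))) / q) := by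
            rw [h3]; gcongr
        _ = w ^ 4 / (|P| * √|P|) / 2 := by field_simp; 
        _ ≤ _ := by
          have : 0 ≤ w ^ 4 / (|P| * √|P|) := by positivity
          linarith

end NH

namespace NH

theorem pow32_step {x y : ℝ} (hx : 1 ≤ x) (hxy : x ≤ y) (h : y ^ 2 = x ^ 2 + 1) : 1 / (x ^ 2 * x) ≤ 4 / x - 4 / y := by
  have hx0 : 0 < x := by linarith
  have hy0 : 0 < y := by linarith
  have e : 4 / x - 4 / y = 4 / (x * y * (x + y)) := by
    field_simp; nlinarith
  rw [e, div_le_div_iff₀ (by positivity) (by positivity)]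
  have : y * (x + y) ≤ 4 * x ^ 2 := by nlinarith [sq_nonneg (x - y)]
  nlinarith

theorem sum32 (n0 n : ℕ) (h0 : 1 ≤ n0) (hn : n0 ≤ n) :
    ∑ j ∈ Finset.Ico n0 n, 1 / ((j : ℝ) * √j) ≤ 4 / √n0 - 4 / √n := by
  induction n, hn using Nat.le_induction with
  | base => simp
  | succ n hn ih =>
    rw [Finset.sum_Ico_succ_top hn]
    have hn1 : (1 : ℝ) ≤ n := by exact_mod_cast h0.trans hn
    have h1 := pow32_step (x := √n) (y := √((n : ℝ) + 1)) (by rw [Real.one_le_sqrt]; exact hn1) (Real.sqrt_le_sqrt (by linarith))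
      (by rw [Real.sq_sqrt (by linarith), Real.sq_sqrt (by linarith)])
    rw [Real.sq_sqrt (by linarith)] at h1
    push_cast
    linarith

theorem far_one (S : Finset ℤ) {θ w : ℝ} (hw : 1 ≤ w) (h : ∀ c ∈ S, w < c - θ) :
    ∑ c ∈ S, 1 / (((c : ℝ) - θ) * √((c : ℝ) - θ)) ≤ 6 / √w := by
  have hfl : ∀ c ∈ S, ⌊w⌋₊ ≤ ⌊(c : ℝ) - θ⌋₊ := fun c hc => Nat.floor_le_floor (h c hc).le
  have hn0 : 1 ≤ ⌊w⌋₊ := by rwa [Nat.one_le_floor_iff]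
  have hinj : Set.InjOn (fun c : ℤ => ⌊(c : ℝ) - θ⌋₊) S := by
    intro c hc d hd hcd
    simp only at hcd
    have c1 := Nat.floor_le (by linarith [h c hc] : 0 ≤ (c : ℝ) - θ)
    have d1 := Nat.floor_le (by linarith [h d hd] : 0 ≤ (d : ℝ) - θ)
    have c2 := Nat.lt_floor_add_one ((c : ℝ) - θ)
    have d2 := Nat.lt_floor_add_one ((d : ℝ) - θ)
    rw [hcd] at c1 c2
    have h1 : (c : ℝ) < d + 1 := by linarith
    have h2 : (d : ℝ) < c + 1 := by linarith
    have h1' : c < d + 1 := by exact_mod_cast h1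
    have h2' : d < c + 1 := by exact_mod_cast h2
    omega
  have h1 : ∑ c ∈ S, 1 / (((c : ℝ) - θ) * √((c : ℝ) - θ)) ≤ ∑ c ∈ S, (fun j : ℕ => 1 / ((j : ℝ) * √j)) ⌊(c : ℝ) - θ⌋₊ := by
    refine Finset.sum_le_sum fun c hc => ?_
    have c1 := Nat.floor_le (by linarith [h c hc] : 0 ≤ (c : ℝ) - θ)
    have c2 : (1 : ℝ) ≤ ⌊(c : ℝ) - θ⌋₊ := by exact_mod_cast hn0.trans (hfl c hc)
    have c3 : 0 < √(⌊(c : ℝ) - θ⌋₊ : ℝ) := Real.sqrt_pos.2 (by linarith)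
    simp only
    gcongr
    linarith [h c hc]
  have hsi := Finset.sum_image (f := fun j : ℕ => 1 / ((j : ℝ) * √j)) hinj
  rw [← hsi] at h1
  obtain ⟨n, hn⟩ : ∃ n, ∀ j ∈ S.image (fun c : ℤ => ⌊(c : ℝ) - θ⌋₊), j < n := by
    refine ⟨(S.image (fun c : ℤ => ⌊(c : ℝ) - θ⌋₊)).sup id + 1, fun j hj => ?_⟩
    exact Nat.lt_succ_of_le (Finset.le_sup (f := id) hj)
  have hsub : S.image (fun c : ℤ => ⌊(c : ℝ) - θ⌋₊) ⊆ Finset.Ico ⌊w⌋₊ (max n ⌊w⌋₊) := by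
    intro j hj
    obtain ⟨c, hc, rfl⟩ := Finset.mem_image.1 hj
    exact Finset.mem_Ico.2 ⟨hfl c hc, lt_max_of_lt_left (hn _ hj)⟩
  have h2 := Finset.sum_le_sum_of_subset_of_nonneg (f := fun j : ℕ => 1 / ((j : ℝ) * √j)) hsub (fun _ _ _ => by positivity)
  have h3 := sum32 ⌊w⌋₊ (max n ⌊w⌋₊) hn0 (le_max_right _ _)
  have h4 : 0 ≤ 4 / √((max n ⌊w⌋₊ : ℕ) : ℝ) := by positivity
  have h5 : 4 / √(⌊w⌋₊ : ℝ) ≤ 6 / √w := by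
    have hn1 : (1 : ℝ) ≤ ⌊w⌋₊ := by exact_mod_cast hn0
    have hw0 : 0 < √w := Real.sqrt_pos.2 (by linarith)
    have hf0 : 0 < √(⌊w⌋₊ : ℝ) := Real.sqrt_pos.2 (by linarith)
    rw [div_le_div_iff₀ hf0 hw0]
    refine le_of_sq_le_sq ?_ (by positivity)
    rw [mul_pow, mul_pow, Real.sq_sqrt (by linarith), Real.sq_sqrt (by linarith)]
    have := Nat.lt_floor_add_one w
    linarith
  linarith

theorem far_sum (S : Finset ℤ) {θ w : ℝ} (hw : 1 ≤ w) (h : ∀ c ∈ S, w < |(c : ℝ) - θ|) :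
    ∑ c ∈ S, 1 / (|(c : ℝ) - θ| * √|(c : ℝ) - θ|) ≤ 12 / √w := by
  rw [← Finset.sum_filter_add_sum_filter_not S (fun c : ℤ => 0 ≤ (c : ℝ) - θ)]
  have h1 := far_one (S.filter fun c : ℤ => 0 ≤ (c : ℝ) - θ) (θ := θ) hw (by
    intro c hc
    rw [Finset.mem_filter] at hc
    have := h c hc.1
    rwa [abs_of_nonneg hc.2] at this)
  have h2 := far_one ((S.filter fun c : ℤ => ¬ 0 ≤ (c : ℝ) - θ).image fun c => -c) (θ := -θ) hw (by
    intro c hc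
    obtain ⟨d, hd, rfl⟩ := Finset.mem_image.1 hc
    rw [Finset.mem_filter, not_le] at hd
    have := h d hd.1
    rw [abs_of_neg hd.2] at this
    push_cast
    linarith)
  rw [Finset.sum_image (fun _ _ _ _ => neg_inj.1)] at h2
  have e1 : ∑ c ∈ S.filter (fun c : ℤ => 0 ≤ (c : ℝ) - θ), 1 / (|(c : ℝ) - θ| * √|(c : ℝ) - θ|) = ∑ c ∈ S.filter (fun c : ℤ => 0 ≤ (c : ℝ) - θ), 1 / (((c : ℝ) - θ) * √((c : ℝ) - θ)) := by
    refine Finset.sum_congr rfl fun c hc => ?_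
    rw [Finset.mem_filter] at hc
    rw [abs_of_nonneg hc.2]
  have e2 : ∑ c ∈ S.filter (fun c : ℤ => ¬ 0 ≤ (c : ℝ) - θ), 1 / (|(c : ℝ) - θ| * √|(c : ℝ) - θ|) = ∑ c ∈ S.filter (fun c : ℤ => ¬ 0 ≤ (c : ℝ) - θ), 1 / ((((-c : ℤ) : ℝ) - -θ) * √(((-c : ℤ) : ℝ) - -θ)) := by
    refine Finset.sum_congr rfl fun c hc => ?_
    rw [Finset.mem_filter, not_le] at hc
    rw [abs_of_neg hc.2]
    push_cast
    rw [show -((c : ℝ) - θ) = -(c : ℝ) - -θ by ring]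
  rw [e1, e2]
  have : 12 / √w = 6 / √w + 6 / √w := by ring
  linarith

theorem cd_count (S : Finset (Fin 4 → ℤ)) {a b : ℤ} (ha : a ≠ 0) {w H : ℝ} (hw : 1 ≤ w) (hH : 0 ≤ H)
    (h : ∀ f ∈ S, f 0 = a ∧ f 1 = b ∧ 0 < D4 f ∧ ((D4 f : ℤ) : ℝ) < w ^ 4 ∧ |(Pf f : ℝ)| ≤ H) :
    (S.card : ℝ) ≤ 4 * H / |(a : ℝ)| + 2 + 6 * w ^ 3 / |(a : ℝ)| + 12 * w ^ 4 / (|(a : ℝ)| * √|(a : ℝ)| * √w) := by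
  have ha' : (a : ℝ) ≠ 0 := by exact_mod_cast ha
  have hA : 0 < |(a : ℝ)| := abs_pos.2 ha'
  have hsA : 0 < √|(a : ℝ)| := Real.sqrt_pos.2 hA
  set θ : ℝ := (b : ℝ) ^ 2 / a with hθ
  have hP : ∀ c : ℤ, |(a * c - b ^ 2 : ℝ)| = |(a : ℝ)| * |(c : ℝ) - θ| := by
    intro c
    rw [← abs_mul, hθ]; congr 1; field_simp
  set T := S.image fun f : Fin 4 → ℤ => f 2 with hT
  have hTb : ∀ c ∈ T, |(a : ℝ)| * |(c : ℝ) - θ| ≤ H := by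
    intro c hc
    obtain ⟨f, hf, rfl⟩ := Finset.mem_image.1 hc
    obtain ⟨f0, f1, -, -, h5⟩ := h f hf
    rw [← hP]
    simp only [Pf, f0, f1] at h5
    push_cast at h5
    exact h5
  classical
  have h1 := card_le_sum_fib S T (fun f => f 2) (fun f hf => Finset.mem_image_of_mem _ hf)
    (fun c => 2 + if |(c : ℝ) - θ| ≤ w then 2 * (w ^ 2 / |(a : ℝ)|) else w ^ 4 / (|(a : ℝ)| * √|(a : ℝ)|) * (1 / (|(c : ℝ) - θ| * √|(c : ℝ) - θ|))) (by
      intro c hc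
      obtain ⟨k1, k2⟩ := dcount_form (S.filter fun f => f 2 = c) (a := a) (b := b) (c := c) ha hw (by
        intro f hf
        rw [Finset.mem_filter] at hf
        obtain ⟨f0, f1, h3, h4, -⟩ := h f hf.1
        exact ⟨f0, f1, hf.2, h3, h4⟩)
      split_ifs with hcw
      · exact k1
      · have hpos : 0 < |(c : ℝ) - θ| := by linarith
        have hne : a * c - b ^ 2 ≠ 0 := by
          intro h0
          have h0' : (a * c - b ^ 2 : ℝ) = 0 := by exact_mod_cast h0
          have := hP c
          rw [h0', abs_zero] at this
          have := mul_pos hA hpos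
          linarith
        refine (k2 hne).trans (le_of_eq ?_)
        rw [hP, Real.sqrt_mul (abs_nonneg _)]
        have := Real.sqrt_pos.2 hpos
        field_simp)
  rw [Finset.sum_add_distrib, Finset.sum_const, nsmul_eq_mul, Finset.sum_ite, Finset.sum_const, nsmul_eq_mul, ← Finset.mul_sum] at h1
  have c1 : (T.card : ℝ) ≤ 2 * H / |(a : ℝ)| + 1 := by
    have hHa : 0 ≤ H / |(a : ℝ)| := by positivity
    have := int_card_le T (x := θ - H / |(a : ℝ)|) (y := θ + H / |(a : ℝ)|) (by linarith) (by
      intro c hc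
      have := hTb c hc
      rw [mul_comm, ← le_div_iff₀ hA, abs_le] at this
      constructor <;> linarith)
    refine this.trans (le_of_eq ?_); ring
  have c2 : ((T.filter fun c : ℤ => |(c : ℝ) - θ| ≤ w).card : ℝ) ≤ 2 * w + 1 := by
    have := int_card_le (T.filter fun c : ℤ => |(c : ℝ) - θ| ≤ w) (x := θ - w) (y := θ + w) (by linarith) (by
      intro c hc
      have := (Finset.mem_filter.1 hc).2
      rw [abs_le] at this
      constructor <;> linarith)
    refine this.trans (le_of_eq ?_); ring
  have c3 := far_sum (T.filter fun c : ℤ => ¬ |(c : ℝ) - θ| ≤ w) (θ := θ) hw (by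
    intro c hc
    exact not_le.1 (Finset.mem_filter.1 hc).2)
  have d2 : ((T.filter fun c : ℤ => |(c : ℝ) - θ| ≤ w).card : ℝ) * (2 * (w ^ 2 / |(a : ℝ)|)) ≤ 6 * w ^ 3 / |(a : ℝ)| := by
    calc _ ≤ (3 * w) * (2 * (w ^ 2 / |(a : ℝ)|)) := by gcongr; linarith
      _ = _ := by ring
  have d3 : w ^ 4 / (|(a : ℝ)| * √|(a : ℝ)|) * ∑ c ∈ T.filter (fun c : ℤ => ¬ |(c : ℝ) - θ| ≤ w), 1 / (|(c : ℝ) - θ| * √|(c : ℝ) - θ|) ≤ 12 * w ^ 4 / (|(a : ℝ)| * √|(a : ℝ)| * √w) := by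
    calc _ ≤ w ^ 4 / (|(a : ℝ)| * √|(a : ℝ)|) * (12 / √w) := by gcongr
      _ = _ := by
        have : 0 < √w := Real.sqrt_pos.2 (by linarith)
        field_simp
  have d1 : 4 * H / |(a : ℝ)| = 2 * (2 * H / |(a : ℝ)|) := by ring
  rw [d1]
  linarith

theorem int_sum_le (T : Finset ℤ) (n : ℕ) (hT : ∀ a ∈ T, a ≠ 0 ∧ a.natAbs ≤ n) (φ : ℕ → ℝ) (hφ : ∀ k, 0 ≤ φ k) :
    ∑ a ∈ T, φ a.natAbs ≤ 2 * ∑ k ∈ Finset.Icc 1 n, φ k := by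
  rw [← Finset.sum_fiberwise_of_maps_to (s := T) (t := Finset.Icc 1 n) (g := Int.natAbs) (fun a ha => by
    have := hT a ha
    rw [Finset.mem_Icc]; omega), Finset.mul_sum]
  refine Finset.sum_le_sum fun k hk => ?_
  rw [Finset.sum_congr rfl (g := fun _ => φ k) (fun a ha => by rw [(Finset.mem_filter.1 ha).2]), Finset.sum_const, nsmul_eq_mul]
  refine mul_le_mul_of_nonneg_right ?_ (hφ k)
  have : (T.filter fun a : ℤ => a.natAbs = k) ⊆ {(k : ℤ), -(k : ℤ)} := by
    intro a ha
    have := (Finset.mem_filter.1 ha).2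
    rw [Finset.mem_insert, Finset.mem_singleton]; omega
  exact_mod_cast (Finset.card_le_card this).trans Finset.card_le_two

theorem sum_inv_sqrt (n : ℕ) : ∑ k ∈ Finset.Icc 1 n, 1 / √(k : ℝ) ≤ 2 * √(n : ℝ) := by
  induction n with
  | zero => simp
  | succ n ih =>
    rw [Finset.sum_Icc_succ_top (by omega)]
    push_cast
    have h0 : 0 ≤ √(n : ℝ) := Real.sqrt_nonneg _
    have h1 : 0 < √((n : ℝ) + 1) := Real.sqrt_pos.2 (by positivity)
    have h2 := Real.sq_sqrt (show (0 : ℝ) ≤ n by positivity)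
    have h3 := Real.sq_sqrt (show (0 : ℝ) ≤ (n : ℝ) + 1 by positivity)
    have h4 : 1 / √((n : ℝ) + 1) ≤ 2 * √((n : ℝ) + 1) - 2 * √(n : ℝ) := by
      rw [div_le_iff₀ h1]
      nlinarith [sq_nonneg (√((n : ℝ) + 1) - √(n : ℝ))]
    linarith

/-- count of translation-normalized forms -/
theorem norm_count (S : Finset (Fin 4 → ℤ)) {w t : ℝ} (hw : 1 ≤ w) (ht : 1 ≤ t)
    (h : ∀ f ∈ S, f 0 ≠ 0 ∧ 0 ≤ f 1 ∧ f 1 < |f 0| ∧ 0 < D4 f ∧ ((D4 f : ℤ) : ℝ) < w ^ 4 ∧ |(f 0 : ℝ)| * t ^ 3 ≤ 3 * w ∧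
      |(Pf f : ℝ)| * t ^ 2 ≤ 3 * w ^ 2) : (S.card : ℝ) ≤ 300 * w ^ 4 / t := by
  classical
  have ht0 : 0 < t := by linarith
  have hw0 : 0 < w := by linarith
  set H := 3 * w ^ 2 / t ^ 2 with hH
  set A0 := 3 * w / t ^ 3 with hA0
  have hA0p : 0 ≤ A0 := by positivity
  set T := S.image fun f : Fin 4 → ℤ => f 0 with hT
  have hTb : ∀ a ∈ T, a ≠ 0 ∧ |(a : ℝ)| ≤ A0 := by
    intro a ha
    obtain ⟨f, hf, rfl⟩ := Finset.mem_image.1 ha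
    obtain ⟨f0, -, -, -, -, h6, -⟩ := h f hf
    exact ⟨f0, by rw [hA0, le_div_iff₀ (by positivity)]; exact h6⟩
  have hsw : 0 < √w := Real.sqrt_pos.2 hw0
  set E : ℝ := 4 * H + 2 * A0 + 6 * w ^ 3 with hE
  have h1 := card_le_sum_fib S T (fun f => f 0) (fun f hf => Finset.mem_image_of_mem _ hf)
    (fun a => E + 12 * w ^ 4 / √w * (1 / √((a.natAbs : ℕ) : ℝ))) (by
      intro a ha
      obtain ⟨ha0, haA⟩ := hTb a ha
      have ha' : (a : ℝ) ≠ 0 := by exact_mod_cast ha0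
      have hA : 0 < |(a : ℝ)| := abs_pos.2 ha'
      have hsA : 0 < √|(a : ℝ)| := Real.sqrt_pos.2 hA
      have h2 := card_le_sum_fib (S.filter fun f => f 0 = a) (Finset.Ico 0 |a|) (fun f => f 1) (by
        intro f hf
        rw [Finset.mem_filter] at hf
        obtain ⟨-, h2, h3, -⟩ := h f hf.1
        rw [hf.2] at h3
        exact Finset.mem_Ico.2 ⟨h2, h3⟩) (fun _ => 4 * H / |(a : ℝ)| + 2 + 6 * w ^ 3 / |(a : ℝ)| + 12 * w ^ 4 / (|(a : ℝ)| * √|(a : ℝ)| * √w)) (by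
        intro b hb
        refine cd_count _ ha0 hw (by positivity) (b := b) ?_
        intro f hf
        rw [Finset.mem_filter, Finset.mem_filter] at hf
        obtain ⟨-, -, -, h4, h5, -, h7⟩ := h f hf.1.1
        exact ⟨hf.1.2, hf.2, h4, h5, by rw [hH, le_div_iff₀ (by positivity)]; exact h7⟩)
      rw [Finset.sum_const, nsmul_eq_mul, Int.card_Ico, sub_zero] at h2
      have e : (((|a|).toNat : ℕ) : ℝ) = |(a : ℝ)| := by
        have : (((|a|).toNat : ℤ) : ℝ) = |(a : ℝ)| := by
          rw [Int.toNat_of_nonneg (abs_nonneg a)]; push_cast; rfl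
        exact_mod_cast this
      have e2 : ((a.natAbs : ℕ) : ℝ) = |(a : ℝ)| := by
        rw [Nat.cast_natAbs]; push_cast; rfl
      rw [e] at h2
      rw [e2]
      refine h2.trans ?_
      have : |(a : ℝ)| * (4 * H / |(a : ℝ)| + 2 + 6 * w ^ 3 / |(a : ℝ)| + 12 * w ^ 4 / (|(a : ℝ)| * √|(a : ℝ)| * √w)) =
        4 * H + 2 * |(a : ℝ)| + 6 * w ^ 3 + 12 * w ^ 4 / √w * (1 / √|(a : ℝ)|) := by
          field_simp
      rw [this, hE]
      linarith)
  rw [Finset.sum_add_distrib, Finset.sum_const, nsmul_eq_mul, ← Finset.mul_sum] at h1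
  have hfl : (⌊A0⌋₊ : ℝ) ≤ A0 := Nat.floor_le hA0p
  have hTn : ∀ a ∈ T, a ≠ 0 ∧ a.natAbs ≤ ⌊A0⌋₊ := by
    intro a ha
    obtain ⟨h2, h3⟩ := hTb a ha
    refine ⟨h2, Nat.le_floor ?_⟩
    rw [Nat.cast_natAbs]; push_cast; exact h3
  have h2 : (T.card : ℝ) ≤ 2 * A0 := by
    have := int_sum_le T ⌊A0⌋₊ hTn (fun _ => 1) (fun _ => zero_le_one)
    simp at this
    linarith
  have h3 : ∑ a ∈ T, 1 / √((a.natAbs : ℕ) : ℝ) ≤ 4 * √A0 := by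
    have h4 := int_sum_le T ⌊A0⌋₊ hTn (fun k => 1 / √(k : ℝ)) (fun _ => by positivity)
    have h5 := sum_inv_sqrt ⌊A0⌋₊
    have h6 := Real.sqrt_le_sqrt hfl
    linarith
  have ht2 : t ≤ t ^ 2 := by nlinarith
  have ht3 : t ≤ t ^ 3 := by nlinarith
  have hA1 : A0 ≤ 3 * w / t := by rw [hA0]; gcongr
  have hA2 : A0 ≤ 3 * w := hA1.trans (div_le_self (by positivity) ht)
  have hHb : H ≤ 3 * w ^ 2 := div_le_self (by positivity) (by nlinarith)
  have h4 : 12 * w ^ 4 / √w * (4 * √A0) ≤ 96 * w ^ 4 / t := by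
    have h5 : √A0 ≤ √w * (2 / t) := by
      refine le_of_sq_le_sq ?_ (by positivity)
      rw [Real.sq_sqrt hA0p, mul_pow, Real.sq_sqrt hw0.le, hA0, div_pow, ← mul_div_assoc, div_le_div_iff₀ (by positivity) (by positivity)]
      have : w * t ^ 2 * t ≥ w * t ^ 2 := le_mul_of_one_le_right (by positivity) ht
      nlinarith
    calc 12 * w ^ 4 / √w * (4 * √A0) ≤ 12 * w ^ 4 / √w * (4 * (√w * (2 / t))) := by gcongr
      _ = _ := by field_simp; norm_num
  have hw2 : w ≤ w ^ 3 := by nlinarith [sq_nonneg w]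
  have hw3 : w ^ 2 ≤ w ^ 3 := by nlinarith [sq_nonneg w]
  have hEb : E ≤ 24 * w ^ 3 := by rw [hE]; linarith
  have h5 : (T.card : ℝ) * E ≤ 2 * (3 * w / t) * (24 * w ^ 3) := by
    have : 0 ≤ E := by positivity
    gcongr
    linarith
  have h6 : 12 * w ^ 4 / √w * ∑ a ∈ T, 1 / √((a.natAbs : ℕ) : ℝ) ≤ 12 * w ^ 4 / √w * (4 * √A0) := by gcongr
  have e7 : 2 * (3 * w / t) * (24 * w ^ 3) = 144 * (w ^ 4 / t) := by ring
  have e8 : 96 * w ^ 4 / t = 96 * (w ^ 4 / t) := by ring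
  have e9 : 300 * w ^ 4 / t = 300 * (w ^ 4 / t) := by ring
  have : 0 ≤ w ^ 4 / t := by positivity
  linarith

end NH

namespace NH

theorem tail_bound (S : Finset (Fin 4 → ℤ)) {w t : ℝ} (hw : 1 ≤ w) (ht : 1 ≤ t)
    (h : ∀ f ∈ S, f 0 ≠ 0 ∧ ((D4 f : ℤ) : ℝ) < w ^ 4 ∧ ∃ v, RedBy f v ∧ t ^ 4 ≤ v 3) :
    (S.card : ℝ) ≤ 187500 * w ^ 4 / t := by
  classical
  set φ : (Fin 4 → ℤ) → (Fin 4 → ℤ) := fun f => act 1 (-(f 1 / f 0)) 0 1 f with hφ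
  have hE : ∀ f, Eqv f (φ f) := fun f => ⟨1, -(f 1 / f 0), 0, 1, by ring, rfl⟩
  have h1 : S.card ≤ 625 * (S.image φ).card := by
    refine Finset.card_le_mul_card_image _ _ fun g hg => ?_
    refine red_class_card _ ?_ ?_ ?_
    · intro f hf
      obtain ⟨h0, hD, v, hv, hC⟩ := h f (Finset.mem_filter.1 hf).1
      exact (red_bounds hv (by linarith) ht h0 hD hC).1
    · intro f hf
      obtain ⟨h0, hD, v, hv, hC⟩ := h f (Finset.mem_filter.1 hf).1
      exact ⟨v, hv⟩
    · intro f hf f' hf'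
      rw [Finset.mem_filter] at hf hf'
      have e1 := hE f
      have e2 := hE f'
      rw [hf.2] at e1
      rw [hf'.2] at e2
      exact e1.trans e2.symm
  have h2 := norm_count (S.image φ) hw ht (by
    intro g hg
    obtain ⟨f, hf, rfl⟩ := Finset.mem_image.1 hg
    obtain ⟨h0, hD, v, hv, hC⟩ := h f hf
    obtain ⟨k1, k2, k3⟩ := red_bounds hv (by linarith) ht h0 hD hC
    have e0 : φ f 0 = f 0 := by simp [hφ, act]
    have e1 : φ f 1 = f 1 % f 0 := by
      simp [hφ, act]
      have := Int.emod_add_mul_ediv (f 1) (f 0)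
      linarith
    have eD : D4 (φ f) = D4 f := ((hE f).D4_eq)
    have eP : Pf (φ f) = Pf f := by simp [Pf, hφ, act]; ring
    rw [e0, e1, eD, eP]
    exact ⟨h0, Int.emod_nonneg _ h0, Int.emod_lt_abs _ h0, k1, hD, k2, k3⟩)
  have h3 : (S.card : ℝ) ≤ 625 * ((S.image φ).card : ℝ) := by exact_mod_cast h1
  have e9 : 187500 * w ^ 4 / t = 625 * (300 * w ^ 4 / t) := by ring
  linarith

theorem sum_inv_sq_le (n : ℕ) : ∑ k ∈ Finset.Icc 1 n, 1 / (k : ℝ) ^ 2 ≤ (2 : ℝ) := by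
  have : ∀ n : ℕ, 1 ≤ n → ∑ k ∈ Finset.Icc 1 n, 1 / (k : ℝ) ^ 2 ≤ (2 : ℝ) - 1 / (n : ℝ) := by
    intro n hn
    induction n, hn using Nat.le_induction with
    | base => norm_num
    | succ n hn ih =>
      rw [Finset.sum_Icc_succ_top (by omega)]
      have hn' : (1 : ℝ) ≤ n := by exact_mod_cast hn
      push_cast
      have : 1 / ((n : ℝ) + 1) ^ 2 ≤ 1 / n - 1 / (n + 1) := by
        rw [div_sub_div _ _ (by positivity) (by positivity), div_le_div_iff₀ (by positivity) (by positivity)]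
        nlinarith
      linarith
  rcases Nat.eq_zero_or_pos n with rfl | hn
  · simp
  · have := this n hn
    have : 0 ≤ 1 / (n : ℝ) := by positivity
    linarith

theorem zero_count (S : Finset (Fin 4 → ℤ)) {Z : ℝ}
    (h : ∀ f ∈ S, f 0 = 0 ∧ Red f ∧ 0 < D4 f ∧ ((D4 f : ℤ) : ℝ) < Z) : (S.card : ℝ) ≤ 16 * |Z| := by
  classical
  have key : ∀ f ∈ S, f 1 ≠ 0 ∧ |f 2| ≤ |f 1| ∧ (f 1 : ℝ) ^ 4 ≤ |Z| := by
    intro f hf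
    obtain ⟨h0, ⟨v, hv⟩, hD, hZ⟩ := h f hf
    obtain ⟨e0, e1, e2, e3⟩ := hv.eqs
    have hv0 : v 0 = 0 := by rw [← e0, h0]; simp
    rw [hv0] at e1 e2
    have hb : f 1 ≠ 0 := by
      intro h1
      simp [D4, h0, h1] at hD
    have e1' : v 1 = 3 * f 1 := by linarith
    have hc : (f 2 : ℝ) = f 1 * v 2 := by rw [e1'] at e2; linarith
    refine ⟨hb, ?_, ?_⟩
    · have : |(f 2 : ℝ)| ≤ |(f 1 : ℝ)| := by
        rw [hc, abs_mul]; exact mul_le_of_le_one_right (abs_nonneg _) hv.1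
      exact_mod_cast this
    · have hD' : ((D4 f : ℤ) : ℝ) = 4 * (f 1 : ℝ) ^ 3 * f 3 - 3 * (f 1 : ℝ) ^ 2 * (f 2 : ℝ) ^ 2 := by
        simp [D4, h0]; ring
      rw [hc, e3, e1'] at hD'
      have hb2 := abs_le.1 hv.1
      have hb3 : v 2 ^ 2 ≤ 1 := by nlinarith
      have h4 : 0 ≤ (f 1 : ℝ) ^ 4 := by positivity
      have h5 := mul_le_mul_of_nonneg_left hb3 h4
      have h6 := mul_le_mul_of_nonneg_left hv.2.1 h4
      have h7 := le_abs_self Z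
      nlinarith
  set T := S.image fun f : Fin 4 → ℤ => f 1 with hT
  have h1 := card_le_sum_fib S T (fun f => f 1) (fun f hf => Finset.mem_image_of_mem _ hf)
    (fun b => 4 * |Z| * (1 / ((b.natAbs : ℕ) : ℝ) ^ 2)) (by
    intro b hb
    obtain ⟨f', hf', hb'⟩ := Finset.mem_image.1 hb
    obtain ⟨hb0, -, hb4⟩ := key f' hf'
    rw [hb'] at hb0 hb4
    have hbR : (b : ℝ) ≠ 0 := by exact_mod_cast hb0
    have hA : 0 < |(b : ℝ)| := abs_pos.2 hbR
    have hA1 : 1 ≤ |(b : ℝ)| := by exact_mod_cast Int.one_le_abs hb0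
    have h2 := card_le_sum_fib (S.filter fun f => f 1 = b) (Finset.Icc (-|b|) |b|) (fun f => f 2) (by
      intro f hf
      rw [Finset.mem_filter] at hf
      have := (key f hf.1).2.1
      rw [hf.2, abs_le] at this
      exact Finset.mem_Icc.2 this) (fun _ => |Z| / (4 * |(b : ℝ)| ^ 3) + 1) (by
      intro c hc
      have hinj : Set.InjOn (fun f : Fin 4 → ℤ => (if 0 < b then f 3 else - f 3)) ((S.filter fun f => f 1 = b).filter fun f => f 2 = c) := by
        intro f hf g hg hfg
        rw [Finset.mem_coe, Finset.mem_filter, Finset.mem_filter] at hf hg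
        obtain ⟨f0, -⟩ := h f hf.1.1
        obtain ⟨g0, -⟩ := h g hg.1.1
        have : f 3 = g 3 := by
          simp only at hfg
          split_ifs at hfg <;> linarith
        exact ext4 (f0.trans g0.symm) (hf.1.2.trans hg.1.2.symm) (hf.2.trans hg.2.symm) this
      rw [← Finset.card_image_of_injOn hinj]
      have e : |Z| / (4 * |(b : ℝ)| ^ 3) + 1 = (3 * (b : ℝ) ^ 2 * (c : ℝ) ^ 2 + |Z|) / (4 * |(b : ℝ)| ^ 3) - (3 * (b : ℝ) ^ 2 * (c : ℝ) ^ 2) / (4 * |(b : ℝ)| ^ 3) + 1 := by ring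
      rw [e]
      refine int_card_le _ (by gcongr; linarith [abs_nonneg Z]) ?_
      intro n hn
      obtain ⟨f, hf, rfl⟩ := Finset.mem_image.1 hn
      rw [Finset.mem_filter, Finset.mem_filter] at hf
      obtain ⟨h0, -, hD, hZ⟩ := h f hf.1.1
      have hD' : ((D4 f : ℤ) : ℝ) = 4 * (b : ℝ) ^ 3 * f 3 - 3 * (b : ℝ) ^ 2 * (c : ℝ) ^ 2 := by
        rw [← hf.1.2, ← hf.2]
        simp [D4, h0]; ring
      have hD0 : (0 : ℝ) < ((D4 f : ℤ) : ℝ) := by exact_mod_cast hD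
      rw [hD'] at hD0 hZ
      have e2 : (((if 0 < b then f 3 else - f 3) : ℤ) : ℝ) * (4 * |(b : ℝ)| ^ 3) = 4 * (b : ℝ) ^ 3 * f 3 := by
        split_ifs with hb
        · rw [abs_of_pos (by exact_mod_cast hb)]; ring
        · rw [abs_of_neg (by exact_mod_cast lt_of_le_of_ne (not_lt.1 hb) hb0)]; push_cast; ring
      rw [div_le_iff₀ (by positivity), le_div_iff₀ (by positivity), e2]
      have := le_abs_self Z
      constructor <;> linarith)
    rw [Finset.sum_const, nsmul_eq_mul, Int.card_Icc] at h2
    have e : (((|b| + 1 - -|b|).toNat : ℕ) : ℝ) = 2 * |(b : ℝ)| + 1 := by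
      have : (((|b| + 1 - -|b|).toNat : ℤ) : ℝ) = 2 * |(b : ℝ)| + 1 := by
        rw [Int.toNat_of_nonneg (by have := abs_nonneg b; omega)]; push_cast; ring
      exact_mod_cast this
    have e2 : ((b.natAbs : ℕ) : ℝ) = |(b : ℝ)| := by
      rw [Nat.cast_natAbs]; push_cast; rfl
    rw [e] at h2
    rw [e2]
    refine h2.trans ?_
    have hb4' : |(b : ℝ)| ^ 4 ≤ |Z| := by
      have : |(b : ℝ)| ^ 4 = (b : ℝ) ^ 4 := by rw [← abs_pow, abs_of_nonneg (by positivity)]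
      linarith
    calc (2 * |(b : ℝ)| + 1) * (|Z| / (4 * |(b : ℝ)| ^ 3) + 1) ≤ (3 * |(b : ℝ)|) * (|Z| / (4 * |(b : ℝ)| ^ 3) + 1) := by
          gcongr; linarith
      _ = (3 / 4 * |Z| + 3 * |(b : ℝ)| ^ 3) / |(b : ℝ)| ^ 2 := by field_simp
      _ ≤ (4 * |Z|) / |(b : ℝ)| ^ 2 := by
          have : |(b : ℝ)| ^ 3 ≤ |(b : ℝ)| ^ 4 := pow_le_pow_right₀ hA1 (by norm_num)
          gcongr; linarith [abs_nonneg Z]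
      _ = _ := by ring)
  rw [← Finset.mul_sum] at h1
  have h2 := int_sum_le T (T.sup Int.natAbs) (by
    intro a ha
    obtain ⟨f, hf, hfa⟩ := Finset.mem_image.1 ha
    exact ⟨hfa ▸ (key f hf).1, Finset.le_sup ha⟩) (fun k => 1 / (k : ℝ) ^ 2) (fun k => by positivity)
  have h3 := sum_inv_sq_le (T.sup Int.natAbs)
  have h4 : ∑ a ∈ T, 1 / ((a.natAbs : ℕ) : ℝ) ^ 2 ≤ 4 := by linarith
  have := mul_le_mul_of_nonneg_left h4 (show 0 ≤ 4 * |Z| by positivity)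
  linarith

theorem red_count (S : Finset (Fin 4 → ℤ)) {Z : ℝ} (hZ0 : 0 ≤ Z)
    (h : ∀ f ∈ S, Red f ∧ 0 < D4 f ∧ ((D4 f : ℤ) : ℝ) < Z) : (S.card : ℝ) ≤ 200000 * Z := by
  classical
  rcases le_or_gt Z 1 with hZ | hZ
  · have : S = ∅ := by
      rw [Finset.eq_empty_iff_forall_notMem]
      intro f hf
      obtain ⟨-, h1, h2⟩ := h f hf
      have h3 : (1 : ℝ) ≤ ((D4 f : ℤ) : ℝ) := by exact_mod_cast h1
      linarith
    rw [this]; simp; linarith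
  · have hw4 : (√(√Z)) ^ 4 = Z := by
      rw [show (4 : ℕ) = 2 * 2 by norm_num, pow_mul, Real.sq_sqrt (Real.sqrt_nonneg _), Real.sq_sqrt hZ0]
    have hw1 : 1 ≤ √(√Z) := by rw [Real.one_le_sqrt, Real.one_le_sqrt]; exact hZ.le
    rw [← Finset.card_filter_add_card_filter_not (s := S) (fun f => f 0 ≠ 0)]
    have h1 := tail_bound (S.filter fun f => f 0 ≠ 0) hw1 (le_refl 1) (by
      intro f hf
      rw [Finset.mem_filter] at hf
      obtain ⟨⟨v, hv⟩, -, h2⟩ := h f hf.1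
      exact ⟨hf.2, by rw [hw4]; exact h2, v, hv, by rw [one_pow]; exact hv.2.1⟩)
    have h2 := zero_count (S.filter fun f => ¬ f 0 ≠ 0) (Z := Z) (by
      intro f hf
      rw [Finset.mem_filter, not_not] at hf
      exact ⟨hf.2, h f hf.1⟩)
    rw [hw4, div_one] at h1
    rw [abs_of_nonneg hZ0] at h2
    push_cast
    linarith

end NH

namespace NH

theorem resid_card (S : Finset ℤ) {Z : ℝ} (hZ : 0 ≤ Z) {q : ℕ} (hq : 0 < q) (h : ∀ n ∈ S, |(n : ℝ)| ≤ Z)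
    (hd : ∀ n ∈ S, ∀ n' ∈ S, (q : ℤ) ∣ n - n') : (S.card : ℝ) ≤ 2 * Z / q + 1 := by
  rcases S.eq_empty_or_nonempty with rfl | ⟨n0, h0⟩
  · simp; positivity
  have hqR : (0 : ℝ) < q := by exact_mod_cast hq
  have hinj : Set.InjOn (fun n : ℤ => (n - n0) / q) S := by
    intro a ha b hb hab
    have h1 := Int.ediv_mul_cancel (hd a ha n0 h0)
    have h2 := Int.ediv_mul_cancel (hd b hb n0 h0)
    simp only at hab
    rw [hab] at h1
    linarith
  rw [← Finset.card_image_of_injOn hinj]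
  refine (int_card_le _ (x := (-Z - n0) / q) (y := (Z - n0) / q) (by gcongr; linarith) ?_).trans (le_of_eq (by ring))
  intro k hk
  obtain ⟨n, hn, rfl⟩ := Finset.mem_image.1 hk
  have h1 := Int.ediv_mul_cancel (hd n hn n0 h0)
  have h1' : (((n - n0) / q : ℤ) : ℝ) * q = n - n0 := by exact_mod_cast h1
  rw [div_le_iff₀ hqR, le_div_iff₀ hqR, h1']
  have := abs_le.1 (h n hn)
  constructor <;> linarith

theorem fib1 {α : Type*} (S : Finset α) (g : α → ℤ) {A B : ℝ} (hB0 : 0 ≤ B) (hA : ((S.image g).card : ℝ) ≤ A)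
    (hB : ∀ y, ((S.filter fun x => g x = y).card : ℝ) ≤ B) : (S.card : ℝ) ≤ A * B := by
  have := card_le_sum_fib S (S.image g) g (fun x hx => Finset.mem_image_of_mem _ hx) (fun _ => B) (fun y _ => hB y)
  rw [Finset.sum_const, nsmul_eq_mul] at this
  exact this.trans (mul_le_mul_of_nonneg_right hA hB0)

theorem card4 (S : Finset (Fin 4 → ℤ)) {Z : ℝ} (hZ : 0 ≤ Z) {m0 m1 m2 m3 : ℕ} (h0 : 0 < m0) (h1 : 0 < m1) (h2 : 0 < m2) (h3 : 0 < m3)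
    (h : ∀ f ∈ S, ∀ i, |(f i : ℝ)| ≤ Z) (k0 : ∀ f ∈ S, ∀ g ∈ S, (m0 : ℤ) ∣ f 0 - g 0)
    (k1 : ∀ f ∈ S, ∀ g ∈ S, f 0 = g 0 → (m1 : ℤ) ∣ f 1 - g 1)
    (k2 : ∀ f ∈ S, ∀ g ∈ S, f 0 = g 0 → f 1 = g 1 → (m2 : ℤ) ∣ f 2 - g 2)
    (k3 : ∀ f ∈ S, ∀ g ∈ S, f 0 = g 0 → f 1 = g 1 → f 2 = g 2 → (m3 : ℤ) ∣ f 3 - g 3) :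
    (S.card : ℝ) ≤ (2 * Z / m0 + 1) * ((2 * Z / m1 + 1) * ((2 * Z / m2 + 1) * (2 * Z / m3 + 1))) := by
  refine fib1 S (fun f => f 0) (by positivity) (resid_card _ hZ h0 ?_ ?_) fun a => ?_
  · intro n hn
    obtain ⟨f, hf, rfl⟩ := Finset.mem_image.1 hn
    exact h f hf 0
  · intro n hn n' hn'
    obtain ⟨f, hf, rfl⟩ := Finset.mem_image.1 hn
    obtain ⟨g, hg, rfl⟩ := Finset.mem_image.1 hn'
    exact k0 f hf g hg
  refine fib1 _ (fun f => f 1) (by positivity) (resid_card _ hZ h1 ?_ ?_) fun b => ?_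
  · intro n hn
    obtain ⟨f, hf, rfl⟩ := Finset.mem_image.1 hn
    exact h f (Finset.mem_filter.1 hf).1 1
  · intro n hn n' hn'
    obtain ⟨f, hf, rfl⟩ := Finset.mem_image.1 hn
    obtain ⟨g, hg, rfl⟩ := Finset.mem_image.1 hn'
    rw [Finset.mem_filter] at hf hg
    exact k1 f hf.1 g hg.1 (hf.2.trans hg.2.symm)
  refine fib1 _ (fun f => f 2) (by positivity) (resid_card _ hZ h2 ?_ ?_) fun c => ?_
  · intro n hn
    obtain ⟨f, hf, rfl⟩ := Finset.mem_image.1 hn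
    exact h f (Finset.mem_filter.1 (Finset.mem_filter.1 hf).1).1 2
  · intro n hn n' hn'
    obtain ⟨f, hf, rfl⟩ := Finset.mem_image.1 hn
    obtain ⟨g, hg, rfl⟩ := Finset.mem_image.1 hn'
    simp only [Finset.mem_filter] at hf hg
    exact k2 f hf.1.1 g hg.1.1 (hf.1.2.trans hg.1.2.symm) (hf.2.trans hg.2.symm)
  have hinj : Set.InjOn (fun f : Fin 4 → ℤ => f 3) (((S.filter fun f => f 0 = a).filter fun f => f 1 = b).filter fun f => f 2 = c) := by
    intro f hf g hg hfg
    simp only [Finset.mem_coe, Finset.mem_filter] at hf hg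
    exact ext4 (hf.1.1.2.trans hg.1.1.2.symm) (hf.1.2.trans hg.1.2.symm) (hf.2.trans hg.2.symm) hfg
  rw [← Finset.card_image_of_injOn hinj]
  refine resid_card _ hZ h3 ?_ ?_
  · intro n hn
    obtain ⟨f, hf, rfl⟩ := Finset.mem_image.1 hn
    simp only [Finset.mem_filter] at hf
    exact h f hf.1.1.1 3
  · intro n hn n' hn'
    obtain ⟨f, hf, rfl⟩ := Finset.mem_image.1 hn
    obtain ⟨g, hg, rfl⟩ := Finset.mem_image.1 hn'
    simp only [Finset.mem_filter] at hf hg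
    exact k3 f hf.1.1.1 g hg.1.1.1 (hf.1.1.2.trans hg.1.1.2.symm) (hf.1.2.trans hg.1.2.symm) (hf.2.trans hg.2.symm)

/-- all Hessian coefficients are divisible by `p` -/
def HessDvd (p : ℕ) (f : Fin 4 → ℤ) : Prop :=
  (p : ℤ) ∣ f 0 * f 2 - f 1 ^ 2 ∧ (p : ℤ) ∣ f 0 * f 3 - f 1 * f 2 ∧ (p : ℤ) ∣ f 1 * f 3 - f 2 ^ 2

theorem two_div_add_one_le {Z : ℝ} {q : ℕ} (hq : 0 < q) (h : (q : ℝ) ≤ Z) : 2 * Z / q + 1 ≤ 3 * Z / q := by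
  have : 1 ≤ Z / q := by rw [le_div_iff₀ (by exact_mod_cast hq)]; linarith
  have e : 3 * Z / q = 2 * Z / q + Z / q := by ring
  linarith

theorem hess_small (S : Finset (Fin 4 → ℤ)) {Z : ℝ} {p : ℕ} (hp : p.Prime) (hpZ : (p : ℝ) ≤ Z)
    (h : ∀ f ∈ S, ∀ i, |(f i : ℝ)| ≤ Z) (hH : ∀ f ∈ S, HessDvd p f) : (S.card : ℝ) ≤ 162 * Z ^ 4 * (1 / (p : ℝ) ^ 2) := by
  classical
  have hp1 : (1 : ℝ) ≤ p := by exact_mod_cast hp.one_le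
  have hZ1 : 1 ≤ Z := hp1.trans hpZ
  have hZ0 : 0 ≤ Z := by linarith
  have hpp : Prime (p : ℤ) := Nat.prime_iff_prime_int.1 hp
  have one_dvd' : ∀ x : ℤ, ((1 : ℕ) : ℤ) ∣ x := fun x => by simp
  have e3 : 2 * Z / (1 : ℕ) + 1 ≤ 3 * Z := by
    have := two_div_add_one_le (Z := Z) (q := 1) one_pos (by simpa using hZ1)
    simpa using this
  have ep := two_div_add_one_le hp.pos hpZ
  rw [← Finset.card_filter_add_card_filter_not (s := S) (fun f => (p : ℤ) ∣ f 0)]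
  have h1 := card4 (S.filter fun f => (p : ℤ) ∣ f 0) hZ0 hp.pos hp.pos hp.pos one_pos
    (fun f hf => h f (Finset.mem_filter.1 hf).1)
    (fun f hf g hg => dvd_sub (Finset.mem_filter.1 hf).2 (Finset.mem_filter.1 hg).2)
    (by
      have : ∀ f ∈ S.filter (fun f => (p : ℤ) ∣ f 0), (p : ℤ) ∣ f 1 := by
        intro f hf
        rw [Finset.mem_filter] at hf
        have h1 := (hH f hf.1).1
        exact hpp.dvd_of_dvd_pow ((dvd_sub_right (hf.2.mul_right _)).1 h1)
      intro f hf g hg _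
      exact dvd_sub (this f hf) (this g hg))
    (by
      have : ∀ f ∈ S.filter (fun f => (p : ℤ) ∣ f 0), (p : ℤ) ∣ f 2 := by
        intro f hf
        rw [Finset.mem_filter] at hf
        have h1 := (hH f hf.1).1
        have h2 := hpp.dvd_of_dvd_pow ((dvd_sub_right (hf.2.mul_right _)).1 h1)
        exact hpp.dvd_of_dvd_pow ((dvd_sub_right (h2.mul_right _)).1 (hH f hf.1).2.2)
      intro f hf g hg _ _
      exact dvd_sub (this f hf) (this g hg))
    (fun _ _ _ _ _ _ _ => one_dvd' _)
  have h2 := card4 (S.filter fun f => ¬ (p : ℤ) ∣ f 0) hZ0 one_pos one_pos hp.pos hp.pos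
    (fun f hf => h f (Finset.mem_filter.1 hf).1)
    (fun _ _ _ _ => one_dvd' _) (fun _ _ _ _ _ => one_dvd' _)
    (by
      intro f hf g hg e0 e1
      rw [Finset.mem_filter] at hf hg
      have := dvd_sub (hH f hf.1).1 (hH g hg.1).1
      rw [← e0, ← e1, show f 0 * f 2 - f 1 ^ 2 - (f 0 * g 2 - f 1 ^ 2) = f 0 * (f 2 - g 2) by ring] at this
      exact (hpp.dvd_or_dvd this).resolve_left hf.2)
    (by
      intro f hf g hg e0 e1 e2
      rw [Finset.mem_filter] at hf hg
      have := dvd_sub (hH f hf.1).2.1 (hH g hg.1).2.1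
      rw [← e0, ← e1, ← e2, show f 0 * f 3 - f 1 * f 2 - (f 0 * g 3 - f 1 * f 2) = f 0 * (f 3 - g 3) by ring] at this
      exact (hpp.dvd_or_dvd this).resolve_left hf.2)
  have b1 : (2 * Z / p + 1) * ((2 * Z / p + 1) * ((2 * Z / p + 1) * (2 * Z / (1 : ℕ) + 1))) ≤ 81 * Z ^ 4 * (1 / (p : ℝ) ^ 2) := by
    calc _ ≤ (3 * Z / p) * ((3 * Z / p) * ((3 * Z / p) * (3 * Z))) := by gcongr
      _ = 81 * Z ^ 4 * (1 / (p : ℝ) ^ 2) * (1 / p) := by field_simp; norm_num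
      _ ≤ 81 * Z ^ 4 * (1 / (p : ℝ) ^ 2) := mul_le_of_le_one_right (by positivity) (by rw [div_le_one (by linarith)]; exact hp1)
  have b2 : (2 * Z / (1 : ℕ) + 1) * ((2 * Z / (1 : ℕ) + 1) * ((2 * Z / p + 1) * (2 * Z / p + 1))) ≤ 81 * Z ^ 4 * (1 / (p : ℝ) ^ 2) := by
    calc _ ≤ (3 * Z) * ((3 * Z) * ((3 * Z / p) * (3 * Z / p))) := by gcongr
      _ = 81 * Z ^ 4 * (1 / (p : ℝ) ^ 2) := by field_simp; norm_num
  push_cast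
  linarith

theorem big_primes {n : ℤ} (hn : n ≠ 0) {Z : ℕ} (hZ : 1 ≤ Z) (h : |n| ≤ 2 * Z ^ 2) :
    (n.natAbs.primeFactors.filter fun p => Z < p).card ≤ 2 := by
  by_contra hc
  push Not at hc
  set s := n.natAbs.primeFactors.filter fun p => Z < p with hs
  have h1 : ∏ p ∈ s, p ≤ n.natAbs := by
    refine Nat.le_of_dvd (Int.natAbs_pos.2 hn) ?_
    exact (Finset.prod_dvd_prod_of_subset _ _ _ (Finset.filter_subset _ _)).trans (Nat.prod_primeFactors_dvd _)
  have h2 : (Z + 1) ^ s.card ≤ ∏ p ∈ s, p := by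
    refine Finset.pow_card_le_prod _ _ _ fun p hp => ?_
    exact (Finset.mem_filter.1 hp).2
  have h3 : (Z + 1) ^ 3 ≤ (Z + 1) ^ s.card := Nat.pow_le_pow_right (by omega) hc
  have h4 : n.natAbs ≤ 2 * Z ^ 2 := by zify; exact h
  nlinarith

theorem hess_big (S : Finset (Fin 4 → ℤ)) {Z : ℕ} (hZ : 1 ≤ Z)
    (h : ∀ f ∈ S, ∀ i, |(f i : ℝ)| ≤ Z) (hH : ∀ f ∈ S, f 0 ≠ 0 ∧ ∃ p : ℕ, p.Prime ∧ Z < p ∧ HessDvd p f) :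
    (S.card : ℝ) ≤ 14000 * (Z : ℝ) ^ 3 := by
  classical
  have hZ1 : (1 : ℝ) ≤ Z := by exact_mod_cast hZ
  have hZ0 : (0 : ℝ) ≤ Z := by linarith
  have one_dvd' : ∀ x : ℤ, ((1 : ℕ) : ℤ) ∣ x := fun x => by simp
  have e3 : 2 * (Z : ℝ) / (1 : ℕ) + 1 ≤ 3 * Z := by push_cast; linarith
  have eb : ∀ q : ℕ, Z < q → 2 * (Z : ℝ) / q + 1 ≤ 3 := by
    intro q hq
    have hq' : (Z : ℝ) ≤ q := by exact_mod_cast hq.le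
    have : 2 * (Z : ℝ) / q ≤ 2 := by rw [div_le_iff₀ (by linarith)]; linarith
    linarith
  have eb1 := eb (Z + 1) (by omega)
  have hS1 := card4 (S.filter fun f => f 0 * f 2 - f 1 ^ 2 = 0) hZ0 one_pos one_pos (show 0 < Z + 1 by omega) one_pos
    (fun f hf => h f (Finset.mem_filter.1 hf).1)
    (fun _ _ _ _ => one_dvd' _) (fun _ _ _ _ _ => one_dvd' _)
    (by
      intro f hf g hg e0 e1
      rw [Finset.mem_filter] at hf hg
      have h1 := hf.2
      have h2 := hg.2
      rw [← e0, ← e1] at h2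
      have : f 2 = g 2 := mul_left_cancel₀ (hH f hf.1).1 (by linarith)
      rw [this, sub_self]; exact dvd_zero _)
    (fun _ _ _ _ _ _ _ => one_dvd' _)
  have hS2 : ((S.filter fun f => ¬ f 0 * f 2 - f 1 ^ 2 = 0).card : ℝ) ≤ 81 * (Z : ℝ) ^ 3 * 162 := by
    set S2 := S.filter fun f => ¬ f 0 * f 2 - f 1 ^ 2 = 0 with hS2
    set φ : (Fin 4 → ℤ) → (Fin 4 → ℤ) := fun f => ![f 0, f 1, f 2, 0] with hφ
    have hf1 := card_le_sum_fib S2 (S2.image φ) φ (fun x hx => Finset.mem_image_of_mem _ hx) (fun _ => 162) (by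
      intro y hy
      obtain ⟨f0, hf0, rfl⟩ := Finset.mem_image.1 hy
      have hf0' := Finset.mem_filter.1 hf0
      have hfe : ∀ f : Fin 4 → ℤ, φ f = φ f0 → f 0 = f0 0 ∧ f 1 = f0 1 ∧ f 2 = f0 2 := fun f hf =>
        ⟨congrFun hf 0, congrFun hf 1, congrFun hf 2⟩
      set n := f0 0 * f0 2 - f0 1 ^ 2 with hn
      have hcard := big_primes hf0'.2 hZ (by
        have a0 : |f0 0| ≤ Z := by exact_mod_cast h f0 hf0'.1 0
        have a1 : |f0 1| ≤ Z := by exact_mod_cast h f0 hf0'.1 1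
        have a2 : |f0 2| ≤ Z := by exact_mod_cast h f0 hf0'.1 2
        calc |f0 0 * f0 2 - f0 1 ^ 2| ≤ |f0 0 * f0 2| + |f0 1 ^ 2| := abs_sub _ _
          _ = |f0 0| * |f0 2| + |f0 1| ^ 2 := by rw [abs_mul, abs_pow]
          _ ≤ Z * Z + Z ^ 2 := by gcongr
          _ = 2 * Z ^ 2 := by ring)
      have hex : ∀ f : Fin 4 → ℤ, ∃ p : ℕ, f ∈ S → p.Prime ∧ Z < p ∧ HessDvd p f := by
        intro f
        by_cases hf : f ∈ S
        · obtain ⟨p, hp⟩ := (hH f hf).2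
          exact ⟨p, fun _ => hp⟩
        · exact ⟨0, fun h => absurd h hf⟩
      choose P hP using hex
      have h2 := card_le_sum_fib (S2.filter fun f => φ f = φ f0) (n.natAbs.primeFactors.filter fun p => Z < p) P (by
        intro f hf
        rw [Finset.mem_filter, Finset.mem_filter] at hf
        obtain ⟨p1, p2, p3⟩ := hP f hf.1.1
        obtain ⟨e0, e1, e2⟩ := hfe f hf.2
        rw [Finset.mem_filter, Nat.mem_primeFactors]
        refine ⟨⟨p1, ?_, Int.natAbs_ne_zero.2 hf0'.2⟩, p2⟩
        have := p3.1
        rw [e0, e1, e2] at this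
        exact Int.natCast_dvd.1 this) (fun _ => 27 * 3) (by
        intro p hp
        have hpZ := (Finset.mem_filter.1 hp).2
        have hpp := (Nat.mem_primeFactors.1 (Finset.mem_filter.1 hp).1).1
        have hZp : 0 < Z + 1 := by omega
        have := card4 ((S2.filter fun f => φ f = φ f0).filter fun f => P f = p) hZ0 hZp hZp hZp hpp.pos
          (fun f hf => h f (by simp only [hS2, Finset.mem_filter] at hf; exact hf.1.1.1))
          (by
            intro f hf g hg
            rw [(hfe f (Finset.mem_filter.1 (Finset.mem_filter.1 hf).1).2).1, (hfe g (Finset.mem_filter.1 (Finset.mem_filter.1 hg).1).2).1, sub_self]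
            exact dvd_zero _)
          (by
            intro f hf g hg _
            rw [(hfe f (Finset.mem_filter.1 (Finset.mem_filter.1 hf).1).2).2.1, (hfe g (Finset.mem_filter.1 (Finset.mem_filter.1 hg).1).2).2.1, sub_self]
            exact dvd_zero _)
          (by
            intro f hf g hg _ _
            rw [(hfe f (Finset.mem_filter.1 (Finset.mem_filter.1 hf).1).2).2.2, (hfe g (Finset.mem_filter.1 (Finset.mem_filter.1 hg).1).2).2.2, sub_self]
            exact dvd_zero _)
          (by
            intro f hf g hg e0 e1 e2
            simp only [hS2, Finset.mem_filter] at hf hg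
            have q1 := (hP f hf.1.1.1).2.2.2.1
            have q2 := (hP g hg.1.1.1).2.2.2.1
            rw [hf.2] at q1
            rw [hg.2] at q2
            have := dvd_sub q1 q2
            rw [← e0, ← e1, ← e2, show f 0 * f 3 - f 1 * f 2 - (f 0 * g 3 - f 1 * f 2) = f 0 * (f 3 - g 3) by ring] at this
            refine ((Nat.prime_iff_prime_int.1 hpp).dvd_or_dvd this).resolve_left ?_
            intro hd
            have l1 := Int.le_of_dvd (abs_pos.2 (hH f hf.1.1.1).1) ((dvd_abs _ _).2 hd)
            have a0 : |f 0| ≤ Z := by exact_mod_cast h f hf.1.1.1 0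
            have : (Z : ℤ) < p := by exact_mod_cast hpZ
            omega)
        refine this.trans ?_
        have ep := eb p hpZ
        calc _ ≤ (3 : ℝ) * (3 * (3 * 3)) := by gcongr
          _ = _ := by norm_num)
      rw [Finset.sum_const, nsmul_eq_mul] at h2
      have : ((n.natAbs.primeFactors.filter fun p => Z < p).card : ℝ) ≤ 2 := by exact_mod_cast hcard
      linarith)
    rw [Finset.sum_const, nsmul_eq_mul] at hf1
    have hf2 := card4 (S2.image φ) hZ0 one_pos one_pos one_pos (show 0 < Z + 1 by omega)
      (by
        intro g hg i
        obtain ⟨f, hf, rfl⟩ := Finset.mem_image.1 hg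
        have hfS := (Finset.mem_filter.1 hf).1
        fin_cases i
        · exact h f hfS 0
        · exact h f hfS 1
        · exact h f hfS 2
        · simp [hφ])
      (fun _ _ _ _ => one_dvd' _) (fun _ _ _ _ _ => one_dvd' _) (fun _ _ _ _ _ _ => one_dvd' _)
      (by
        intro g hg g' hg' _ _ _
        obtain ⟨f, hf, rfl⟩ := Finset.mem_image.1 hg
        obtain ⟨f', hf', rfl⟩ := Finset.mem_image.1 hg'
        simp [hφ])
    have hf3 : ((S2.image φ).card : ℝ) ≤ 81 * (Z : ℝ) ^ 3 := by
      refine hf2.trans ?_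
      calc _ ≤ (3 * (Z : ℝ)) * ((3 * Z) * ((3 * Z) * 3)) := by gcongr
        _ = _ := by ring
    linarith
  have hS1' : ((S.filter fun f => f 0 * f 2 - f 1 ^ 2 = 0).card : ℝ) ≤ 81 * (Z : ℝ) ^ 3 := by
    refine hS1.trans ?_
    calc _ ≤ (3 * (Z : ℝ)) * ((3 * Z) * (3 * (3 * Z))) := by gcongr
      _ = _ := by ring
  rw [← Finset.card_filter_add_card_filter_not (s := S) (fun f => f 0 * f 2 - f 1 ^ 2 = 0)]
  push_cast
  have : 0 ≤ (Z : ℝ) ^ 3 := by positivity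
  linarith

theorem sum_tail_sq (Y n : ℕ) (hY : 1 ≤ Y) : ∑ k ∈ Finset.Ioc Y n, 1 / (k : ℝ) ^ 2 ≤ 1 / (Y : ℝ) := by
  rcases le_or_gt Y n with h | h
  · have := sum_Ioc_inv_sq_le_sub (α := ℝ) (k := Y) (n := n) (by omega) h
    have h2 : (0 : ℝ) ≤ (n : ℝ)⁻¹ := by positivity
    simp only [one_div]
    linarith
  · rw [Finset.Ioc_eq_empty (by omega)]; simp

theorem hess_count (S : Finset (Fin 4 → ℤ)) {Z Y : ℕ} (hZ : 1 ≤ Z) (hY : 1 ≤ Y)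
    (h : ∀ f ∈ S, ∀ i, |(f i : ℝ)| ≤ Z) (hH : ∀ f ∈ S, f 0 ≠ 0 ∧ ∃ p : ℕ, p.Prime ∧ Y < p ∧ HessDvd p f) :
    (S.card : ℝ) ≤ 162 * (Z : ℝ) ^ 4 / Y + 14000 * (Z : ℝ) ^ 3 := by
  classical
  have hZ1 : (1 : ℝ) ≤ Z := by exact_mod_cast hZ
  rw [← Finset.card_filter_add_card_filter_not (s := S) (fun f => ∃ p : ℕ, p.Prime ∧ Z < p ∧ HessDvd p f)]
  have h1 := hess_big (S.filter fun f => ∃ p : ℕ, p.Prime ∧ Z < p ∧ HessDvd p f) hZ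
    (fun f hf => h f (Finset.mem_filter.1 hf).1)
    (fun f hf => ⟨(hH f (Finset.mem_filter.1 hf).1).1, (Finset.mem_filter.1 hf).2⟩)
  set S' := S.filter fun f => ¬ ∃ p : ℕ, p.Prime ∧ Z < p ∧ HessDvd p f with hS'
  have hex : ∀ f : Fin 4 → ℤ, ∃ p : ℕ, f ∈ S' → p.Prime ∧ Y < p ∧ p ≤ Z ∧ HessDvd p f := by
    intro f
    by_cases hf : f ∈ S'
    · rw [hS', Finset.mem_filter] at hf
      obtain ⟨p, hp, hY, hd⟩ := (hH f hf.1).2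
      exact ⟨p, fun _ => ⟨hp, hY, not_lt.1 fun hl => hf.2 ⟨p, hp, hl, hd⟩, hd⟩⟩
    · exact ⟨0, fun h => absurd h hf⟩
  choose P hP using hex
  have h2 := card_le_sum_fib S' (Finset.Ioc Y Z) P (fun f hf => Finset.mem_Ioc.2 ⟨(hP f hf).2.1, (hP f hf).2.2.1⟩)
    (fun p => 162 * (Z : ℝ) ^ 4 * (1 / (p : ℝ) ^ 2)) (by
    intro p hp
    rw [Finset.mem_Ioc] at hp
    by_cases hpp : p.Prime
    · refine hess_small _ hpp (by exact_mod_cast hp.2) (fun f hf => h f ?_) ?_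
      · exact (Finset.mem_filter.1 (Finset.mem_filter.1 hf).1).1
      · intro f hf
        rw [Finset.mem_filter] at hf
        exact hf.2 ▸ (hP f hf.1).2.2.2
    · have : S'.filter (fun f => P f = p) = ∅ := by
        rw [Finset.filter_eq_empty_iff]
        intro f hf hfp
        exact hpp (hfp ▸ (hP f hf).1)
      rw [this]; simp; positivity)
  rw [← Finset.mul_sum] at h2
  have h3 := mul_le_mul_of_nonneg_left (sum_tail_sq Y Z hY) (show 0 ≤ 162 * (Z : ℝ) ^ 4 by positivity)
  push_cast
  have e : 162 * (Z : ℝ) ^ 4 * (1 / Y) = 162 * (Z : ℝ) ^ 4 / Y := by ring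
  linarith

end NH

namespace NH

theorem D4_hess (f : Fin 4 → ℤ) : D4 f = (f 0 * f 3 - f 1 * f 2) ^ 2 - 4 * (f 0 * f 2 - f 1 ^ 2) * (f 1 * f 3 - f 2 ^ 2) := by
  simp [D4]; ring

theorem HessDvd.act {p : ℕ} {f : Fin 4 → ℤ} (h : HessDvd p f) (x y z w : ℤ) : HessDvd p (act x y z w f) := by
  obtain ⟨⟨a, ha⟩, ⟨b, hb⟩, ⟨c, hc⟩⟩ := h
  refine ⟨⟨(x * w - y * z) ^ 2 * (a * x ^ 2 + b * x * z + c * z ^ 2), ?_⟩, ⟨(x * w - y * z) ^ 2 * (2 * a * x * y + b * (x * w + y * z) + 2 * c * z * w), ?_⟩,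
    ⟨(x * w - y * z) ^ 2 * (a * y ^ 2 + b * y * w + c * w ^ 2), ?_⟩⟩
  · simp only [NH.act, Matrix.cons_val_zero, Matrix.cons_val_one, Matrix.cons_val]
    linear_combination (x * w - y * z) ^ 2 * (x ^ 2 * ha + x * z * hb + z ^ 2 * hc)
  · simp only [NH.act, Matrix.cons_val_zero, Matrix.cons_val_one, Matrix.cons_val]
    linear_combination (x * w - y * z) ^ 2 * (2 * x * y * ha + (x * w + y * z) * hb + 2 * z * w * hc)
  · simp only [NH.act, Matrix.cons_val_zero, Matrix.cons_val_one, Matrix.cons_val]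
    linear_combination (x * w - y * z) ^ 2 * (y ^ 2 * ha + y * w * hb + w ^ 2 * hc)

theorem double_root_aux {p : ℕ} (hp : p.Prime) {g : Fin 4 → ℤ} (hD : (p : ℤ) ^ 2 ∣ D4 g) (h2 : p ≠ 2)
    (hH : ¬ HessDvd p g) (hR : (p : ℤ) ∣ g 1 * g 3 - g 2 ^ 2) :
    (p : ℤ) ∣ g 2 ∧ (p : ℤ) ^ 2 ∣ g 3 ∧ ¬ (p : ℤ) ∣ g 1 := by
  have hpp : Prime (p : ℤ) := Nat.prime_iff_prime_int.1 hp
  have hD1 : (p : ℤ) ∣ D4 g := (dvd_pow_self _ two_ne_zero).trans hD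
  have hQ : (p : ℤ) ∣ g 0 * g 3 - g 1 * g 2 := by
    rw [D4_hess] at hD1
    exact hpp.dvd_of_dvd_pow ((dvd_sub_left (hR.mul_left _)).1 hD1)
  have hP : ¬ (p : ℤ) ∣ g 0 * g 2 - g 1 ^ 2 := fun h => hH ⟨h, hQ, hR⟩
  have hd : (p : ℤ) ∣ g 3 := by
    have : (p : ℤ) ∣ g 3 * (g 0 * g 2 - g 1 ^ 2) := by
      rw [show g 3 * (g 0 * g 2 - g 1 ^ 2) = g 2 * (g 0 * g 3 - g 1 * g 2) - g 1 * (g 1 * g 3 - g 2 ^ 2) by ring]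
      exact dvd_sub (hQ.mul_left _) (hR.mul_left _)
    exact (hpp.dvd_or_dvd this).resolve_right hP
  have hc : (p : ℤ) ∣ g 2 := hpp.dvd_of_dvd_pow ((dvd_sub_right (hd.mul_left _)).1 hR)
  have hb : ¬ (p : ℤ) ∣ g 1 := fun h => hP (dvd_sub (hc.mul_left _) (dvd_pow h two_ne_zero))
  refine ⟨hc, ?_, hb⟩
  obtain ⟨c, hc⟩ := hc
  obtain ⟨d, hd⟩ := hd
  have h4 : ¬ (p : ℤ) ∣ 4 * g 1 ^ 3 := by
    intro h
    rcases hpp.dvd_or_dvd h with h | h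
    · have : (p : ℤ) ∣ 2 ^ 2 := by norm_num; exact h
      have := hpp.dvd_of_dvd_pow this
      have : p ∣ 2 := by exact_mod_cast this
      exact h2 ((Nat.prime_dvd_prime_iff_eq hp Nat.prime_two).1 this)
    · exact hb (hpp.dvd_of_dvd_pow h)
  have h5 : (p : ℤ) ^ 2 ∣ 4 * g 1 ^ 3 * g 3 := by
    have e : 4 * g 1 ^ 3 * g 3 = D4 g - (p : ℤ) ^ 2 * (g 0 ^ 2 * d ^ 2 - 6 * g 0 * g 1 * c * d - 3 * g 1 ^ 2 * c ^ 2 + 4 * g 0 * p * c ^ 3) := by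
      simp only [D4, hc, hd]; ring
    rw [e]
    exact dvd_sub hD (dvd_mul_right _ _)
  exact (((Prime.coprime_iff_not_dvd hpp).2 h4).pow_left).dvd_of_dvd_mul_left h5

theorem double_root {p : ℕ} (hp : p.Prime) (h2 : p ≠ 2) {f : Fin 4 → ℤ} (hD : (p : ℤ) ^ 2 ∣ D4 f) (hH : ¬ HessDvd p f) :
    ∃ g, Eqv f g ∧ (p : ℤ) ∣ g 2 ∧ (p : ℤ) ^ 2 ∣ g 3 ∧ ¬ (p : ℤ) ∣ g 1 := by
  have hpp : Prime (p : ℤ) := Nat.prime_iff_prime_int.1 hp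
  by_cases hR : (p : ℤ) ∣ f 1 * f 3 - f 2 ^ 2
  · exact ⟨f, Eqv.refl f, double_root_aux hp hD h2 hH hR⟩
  set R := f 1 * f 3 - f 2 ^ 2 with hRd
  set Q := f 0 * f 3 - f 1 * f 2 with hQd
  have h2R : ¬ (p : ℤ) ∣ 2 * R := by
    intro h
    rcases hpp.dvd_or_dvd h with h | h
    · have : p ∣ 2 := by exact_mod_cast h
      exact h2 ((Nat.prime_dvd_prime_iff_eq hp Nat.prime_two).1 this)
    · exact hR h
  obtain ⟨u, v, huv⟩ := (Prime.coprime_iff_not_dvd hpp).2 h2R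
  set s := - Q * v with hs
  have hE : Eqv f (act 0 1 (-1) s f) := ⟨0, 1, -1, s, by ring, rfl⟩
  refine ⟨_, hE, double_root_aux hp (by rw [hE.D4_eq] at *; exact hD) h2 ?_ ?_⟩
  · intro h
    have := h.act s (-1) 1 0
    rw [act_act] at this
    have e : act (0 * s + 1 * 1) (0 * -1 + 1 * 0) (-1 * s + s * 1) (-1 * -1 + s * 0) f = f := by
      have : act (0 * s + 1 * 1) (0 * -1 + 1 * 0) (-1 * s + s * 1) (-1 * -1 + s * 0) f = act 1 0 0 1 f := by
        congr 1 <;> ring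
      rw [this, act_one]
    rw [e] at this
    exact hH this
  · have hk : (p : ℤ) ∣ 2 * R * s + Q := ⟨Q * u, by rw [hs]; linear_combination (-Q) * huv⟩
    have h3 : (p : ℤ) ∣ (2 * R) * (2 * ((act 0 1 (-1) s f) 1 * (act 0 1 (-1) s f) 3 - (act 0 1 (-1) s f) 2 ^ 2)) := by
      have e : (2 * R) * (2 * ((act 0 1 (-1) s f) 1 * (act 0 1 (-1) s f) 3 - (act 0 1 (-1) s f) 2 ^ 2)) = (2 * R * s + Q) ^ 2 - D4 f := by
        rw [D4_hess, hRd, hQd]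
        simp only [NH.act, Matrix.cons_val_zero, Matrix.cons_val_one, Matrix.cons_val]
        ring
      rw [e]
      exact dvd_sub (dvd_pow hk two_ne_zero) ((dvd_pow_self _ two_ne_zero).trans hD)
    have h4 := (hpp.dvd_or_dvd h3).resolve_left h2R
    rcases hpp.dvd_or_dvd h4 with h | h
    · exact absurd (h.mul_right R) h2R
    · exact h

/-- `f` is obtained from `h` at the point `(x : z)` -/
def Dat (p : ℕ) (f h : Fin 4 → ℤ) (x z : ℤ) : Prop :=
  ∃ y w a b c d : ℤ, x * w - y * z = 1 ∧ act x y z w h = ![p * a, b, c, d] ∧ Eqv f ![a, b, p * c, p ^ 2 * d]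

theorem dat_unique {p : ℕ} (hp : p.Prime) {f f2 h : Fin 4 → ℤ} {x z x2 z2 : ℤ} (h1 : Dat p f h x z) (h2 : Dat p f2 h x2 z2)
    (hd : (p : ℤ) ∣ x * z2 - z * x2) : Eqv f f2 := by
  obtain ⟨y, w, a, b, c, d, hdet, he, hE⟩ := h1
  obtain ⟨y2, w2, a2, b2, c2, d2, hdet2, he2, hE2⟩ := h2
  obtain ⟨k, hk⟩ := hd
  have hp0 : (p : ℤ) ≠ 0 := by exact_mod_cast hp.ne_zero
  refine hE.trans (Eqv.trans ?_ hE2.symm)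
  set α := w * x2 - y * z2 with hα
  set β := w * y2 - y * w2 with hβ
  set δ := -z * y2 + x * w2 with hδ
  have e1 : ![(p : ℤ) * a2, b2, c2, d2] = act α β (p * k) δ ![(p : ℤ) * a, b, c, d] := by
    rw [← he2, ← he, act_act, ← hk]
    congr 1
    · rw [hα]; linear_combination (-x2) * hdet
    · rw [hβ]; linear_combination (-y2) * hdet
    · rw [hα]; linear_combination (-z2) * hdet
    · rw [hβ, hδ]; linear_combination (-w2) * hdet
  have k0 := congrFun e1 0
  have k1 := congrFun e1 1
  have k2 := congrFun e1 2
  have k3 := congrFun e1 3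
  simp only [NH.act, Matrix.cons_val_zero, Matrix.cons_val_one, Matrix.cons_val] at k0 k1 k2 k3
  refine ⟨α, p * β, k, δ, ?_, ext4 ?_ ?_ ?_ ?_⟩
  · have : α * δ - p * β * k = α * δ - β * (x * z2 - z * x2) := by rw [hk]; ring
    rw [this, hα, hβ, hδ]
    linear_combination (x * w - y * z) * hdet2 + hdet
  · apply mul_left_cancel₀ hp0
    simp only [NH.act, Matrix.cons_val_zero, Matrix.cons_val_one, Matrix.cons_val]
    linear_combination k0
  · simp only [NH.act, Matrix.cons_val_zero, Matrix.cons_val_one, Matrix.cons_val]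
    linear_combination k1
  · simp only [NH.act, Matrix.cons_val_zero, Matrix.cons_val_one, Matrix.cons_val]
    linear_combination p * k2
  · simp only [NH.act, Matrix.cons_val_zero, Matrix.cons_val_one, Matrix.cons_val]
    linear_combination p ^ 2 * k3

theorem exists_dat {p : ℕ} (hp : p.Prime) (h2 : p ≠ 2) {f : Fin 4 → ℤ} (hD : (p : ℤ) ^ 2 ∣ D4 f) (hD0 : 0 < D4 f) (hH : ¬ HessDvd p f) :
    ∃ h x z, Red h ∧ 0 < D4 h ∧ (p : ℤ) ^ 2 * D4 h = D4 f ∧ Dat p f h x z ∧ ¬ (∀ i, (p : ℤ) ∣ h i) := by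
  obtain ⟨g, hE, ⟨c, hc⟩, ⟨d, hd⟩, hb⟩ := double_root hp h2 hD hH
  have hp0 : (0 : ℤ) < p := by exact_mod_cast hp.pos
  have e : g = ![g 0, g 1, p * c, p ^ 2 * d] := ext4 rfl rfl hc hd
  have hD' : (p : ℤ) ^ 2 * D4 ![(p : ℤ) * g 0, g 1, c, d] = D4 f := by
    rw [← hE.D4_eq, e]
    simp only [D4, Matrix.cons_val_zero, Matrix.cons_val_one, Matrix.cons_val]
    ring
  have hpos : 0 < D4 ![(p : ℤ) * g 0, g 1, c, d] := by
    rw [← hD'] at hD0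
    exact pos_of_mul_pos_right hD0 (by positivity)
  obtain ⟨h, hh, hr⟩ := exists_red _ hpos
  obtain ⟨x, y, z, w, hdet, hact⟩ := hh.symm
  refine ⟨h, x, z, hr, ?_, ?_, ⟨y, w, g 0, g 1, c, d, hdet, hact.symm, e ▸ hE⟩, ?_⟩
  · rw [hh.D4_eq]; exact hpos
  · rw [hh.D4_eq]; exact hD'
  · intro hall
    apply hb
    have k1 := congrFun hact 1
    simp only [NH.act, Matrix.cons_val_zero, Matrix.cons_val_one, Matrix.cons_val] at k1
    rw [k1]
    exact dvd_add (dvd_add (dvd_add (((hall 0).mul_right _).mul_right _) ((hall 1).mul_right _)) ((hall 2).mul_right _)) (((hall 3).mul_right _).mul_right _)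

end NH

namespace NH

theorem exists_rootset {p : ℕ} (hp : p.Prime) (h3 : p ≠ 3) (h : Fin 4 → ℤ) (hh : ¬ ∀ i, (p : ℤ) ∣ h i) :
    ∃ T : Finset (ZMod p), T.card ≤ 3 ∧ ∀ x : ZMod p, (h 0 : ZMod p) * x ^ 3 + 3 * h 1 * x ^ 2 + 3 * h 2 * x + h 3 = 0 → x ∈ T := by
  haveI := Fact.mk hp
  classical
  open Polynomial in
  let P : (ZMod p)[X] := C (h 0 : ZMod p) * X ^ 3 + C (3 * h 1 : ZMod p) * X ^ 2 + C (3 * h 2 : ZMod p) * X + C (h 3 : ZMod p)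
  have hdeg : P.natDegree ≤ 3 := Polynomial.natDegree_cubic_le
  have h3' : (3 : ZMod p) ≠ 0 := by
    intro h
    have : ((3 : ℕ) : ZMod p) = 0 := by exact_mod_cast h
    rw [ZMod.natCast_eq_zero_iff] at this
    exact h3 ((Nat.prime_dvd_prime_iff_eq hp Nat.prime_three).1 this)
  have hP : P ≠ 0 := by
    intro h0
    apply hh
    have c0 : P.coeff 3 = (h 0 : ZMod p) := Cubic.coeff_eq_a (P := ⟨_, _, _, _⟩)
    have c1 : P.coeff 2 = (3 * h 1 : ZMod p) := Cubic.coeff_eq_b (P := ⟨_, _, _, _⟩)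
    have c2 : P.coeff 1 = (3 * h 2 : ZMod p) := Cubic.coeff_eq_c (P := ⟨_, _, _, _⟩)
    have c3 : P.coeff 0 = (h 3 : ZMod p) := Cubic.coeff_eq_d (P := ⟨_, _, _, _⟩)
    rw [h0, Polynomial.coeff_zero] at c0 c1 c2 c3
    intro i
    rw [← ZMod.intCast_zmod_eq_zero_iff_dvd]
    fin_cases i
    · exact c0.symm
    · exact (mul_eq_zero.1 c1.symm).resolve_left h3'
    · exact (mul_eq_zero.1 c2.symm).resolve_left h3'
    · exact c3.symm
  refine ⟨P.roots.toFinset, (Multiset.toFinset_card_le _).trans ((Polynomial.card_roots' P).trans hdeg), ?_⟩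
  intro x hx
  rw [Multiset.mem_toFinset, Polynomial.mem_roots hP, Polynomial.IsRoot.def]
  simpa [P] using hx

theorem nonhess_one (S : Finset (Fin 4 → ℤ)) {X : ℝ} {p : ℕ} (hp : p.Prime) (h3 : 3 < p)
    (h : ∀ f ∈ S, Red f ∧ 0 < D4 f ∧ ((D4 f : ℤ) : ℝ) < X ∧ (p : ℤ) ^ 2 ∣ D4 f ∧ ¬ HessDvd p f) :
    (S.card : ℝ) ≤ 500000000 * |X| * (1 / (p : ℝ) ^ 2) := by
  classical
  haveI := Fact.mk hp
  have hp0 : (0 : ℝ) < p := by exact_mod_cast hp.pos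
  have hex : ∀ f : Fin 4 → ℤ, ∃ (g : Fin 4 → ℤ) (x z : ℤ), f ∈ S → Red g ∧ 0 < D4 g ∧ (p : ℤ) ^ 2 * D4 g = D4 f ∧ Dat p f g x z ∧ ¬ (∀ i, (p : ℤ) ∣ g i) := by
    intro f
    by_cases hf : f ∈ S
    · obtain ⟨-, h1, -, h4, h5⟩ := h f hf
      obtain ⟨g, x, z, hh⟩ := exists_dat hp (by omega) h4 h1 h5
      exact ⟨g, x, z, fun _ => hh⟩
    · exact ⟨0, 0, 0, fun h => absurd h hf⟩
  choose G x z hG using hex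
  have hc := red_count (S.image G) (Z := |X| / (p : ℝ) ^ 2) (by positivity) (by
    intro g hg
    obtain ⟨f, hf, rfl⟩ := Finset.mem_image.1 hg
    obtain ⟨k1, k2, k3, -⟩ := hG f hf
    refine ⟨k1, k2, ?_⟩
    rw [lt_div_iff₀ (by positivity)]
    have e : ((D4 (G f) : ℤ) : ℝ) * (p : ℝ) ^ 2 = ((D4 f : ℤ) : ℝ) := by rw [← k3]; push_cast; ring
    rw [e]
    exact (h f hf).2.2.1.trans_le (le_abs_self X))
  have h1 := card_le_sum_fib S (S.image G) G (fun f hf => Finset.mem_image_of_mem _ hf) (fun _ => 2500) (by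
    intro g hg
    obtain ⟨f0, hf0, hg0⟩ := Finset.mem_image.1 hg
    obtain ⟨T, hT3, hT⟩ := exists_rootset hp (by omega) g (hg0 ▸ (hG f0 hf0).2.2.2.2)
    let φ : (Fin 4 → ℤ) → Option (ZMod p) := fun f => if (z f : ZMod p) = 0 then none else some ((x f : ZMod p) / (z f : ZMod p))
    have h2 := card_le_sum_fib (S.filter fun f => G f = g) (insert none (T.image some)) φ (by
      intro f hf
      rw [Finset.mem_filter] at hf
      obtain ⟨-, -, -, ⟨y, w, a, b, c, d, hdet, he, hE⟩, -⟩ := hG f hf.1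
      simp only [φ]
      split_ifs with hz
      · exact Finset.mem_insert_self _ _
      · refine Finset.mem_insert_of_mem (Finset.mem_image_of_mem _ (hT _ ?_))
        have k0 := congrFun he 0
        rw [hf.2] at k0
        simp only [NH.act, Matrix.cons_val_zero, Matrix.cons_val_one, Matrix.cons_val] at k0
        have k0' := congrArg (fun n : ℤ => (n : ZMod p)) k0
        push_cast at k0'
        rw [ZMod.natCast_self, zero_mul] at k0'
        field_simp
        linear_combination k0') (fun _ => 625) (by
      intro o ho
      have : (((S.filter fun f => G f = g).filter fun f => φ f = o).card) ≤ 625 := by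
        refine red_class_card _ ?_ ?_ ?_
        · intro f hf
          simp only [Finset.mem_filter] at hf
          exact (h f hf.1.1).2.1
        · intro f hf
          simp only [Finset.mem_filter] at hf
          exact (h f hf.1.1).1
        · intro f hf f' hf'
          simp only [Finset.mem_filter] at hf hf'
          have d1 := (hG f hf.1.1).2.2.2.1
          have d2 := (hG f' hf'.1.1).2.2.2.1
          rw [hf.1.2] at d1
          rw [hf'.1.2] at d2
          refine dat_unique hp d1 d2 ?_
          rw [← ZMod.intCast_zmod_eq_zero_iff_dvd]
          push_cast
          have e := hf.2.trans hf'.2.symm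
          simp only [φ] at e
          split_ifs at e with z1 z2 z2
          · rw [z1, z2]; ring
          · rw [Option.some.injEq] at e
            rw [div_eq_div_iff z1 z2] at e
            linear_combination e
      exact_mod_cast this)
    rw [Finset.sum_const, nsmul_eq_mul] at h2
    have h4 : ((insert none (T.image some) : Finset (Option (ZMod p))).card : ℝ) ≤ 4 := by
      have := (Finset.card_insert_le (none : Option (ZMod p)) (T.image some)).trans (Nat.add_le_add_right (Finset.card_image_le.trans hT3) 1)
      exact_mod_cast this
    linarith)
  rw [Finset.sum_const, nsmul_eq_mul] at h1
  have e : 500000000 * |X| * (1 / (p : ℝ) ^ 2) = 200000 * (|X| / (p : ℝ) ^ 2) * 2500 := by ring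
  rw [e]
  linarith

theorem nonhess_count (S : Finset (Fin 4 → ℤ)) {X : ℝ} {Y : ℕ} (hY : 3 ≤ Y)
    (h : ∀ f ∈ S, Red f ∧ 0 < D4 f ∧ ((D4 f : ℤ) : ℝ) < X ∧ ∃ p : ℕ, p.Prime ∧ Y < p ∧ (p : ℤ) ^ 2 ∣ D4 f ∧ ¬ HessDvd p f) :
    (S.card : ℝ) ≤ 500000000 * |X| / Y := by
  classical
  have hex : ∀ f : Fin 4 → ℤ, ∃ p : ℕ, f ∈ S → p.Prime ∧ Y < p ∧ (p : ℤ) ^ 2 ∣ D4 f ∧ ¬ HessDvd p f := by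
    intro f
    by_cases hf : f ∈ S
    · obtain ⟨p, hp⟩ := (h f hf).2.2.2
      exact ⟨p, fun _ => hp⟩
    · exact ⟨0, fun h => absurd h hf⟩
  choose P hP using hex
  have h2 := card_le_sum_fib S (Finset.Ioc Y (S.sup P)) P (fun f hf => Finset.mem_Ioc.2 ⟨(hP f hf).2.1, Finset.le_sup hf⟩)
    (fun p => 500000000 * |X| * (1 / (p : ℝ) ^ 2)) (by
    intro p hp
    rw [Finset.mem_Ioc] at hp
    by_cases hpp : p.Prime
    · refine nonhess_one _ hpp (by omega) ?_
      intro f hf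
      rw [Finset.mem_filter] at hf
      obtain ⟨-, -, k1, k2⟩ := hP f hf.1
      obtain ⟨j1, j2, j3, -⟩ := h f hf.1
      rw [hf.2] at k1 k2
      exact ⟨j1, j2, j3, k1, k2⟩
    · have : S.filter (fun f => P f = p) = ∅ := by
        rw [Finset.filter_eq_empty_iff]
        intro f hf hfp
        exact hpp (hfp ▸ (hP f hf).1)
      rw [this]; simp; positivity)
  rw [← Finset.mul_sum] at h2
  have h3 := mul_le_mul_of_nonneg_left (sum_tail_sq Y (S.sup P) (by omega)) (show 0 ≤ 500000000 * |X| by positivity)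
  have e : 500000000 * |X| * (1 / (Y : ℝ)) = 500000000 * |X| / Y := by ring
  linarith

end NH

namespace NH

/-- integers in `(0, X)` -/
noncomputable def DI (X : ℝ) : Finset ℤ := Finset.Ioc 0 (⌈X⌉ - 1)

theorem mem_DI {X : ℝ} {D : ℤ} : D ∈ DI X ↔ 0 < D ∧ (D : ℝ) < X := by
  rw [DI, Finset.mem_Ioc, Int.le_sub_one_iff, Int.lt_ceil]

theorem resid_count {X : ℝ} (hX : 1 ≤ X) (v : ℤ) {r : ℕ} (hr : 0 < r) :
    |(((DI X).filter fun D => D ≡ v [ZMOD r]).card : ℝ) - X / r| ≤ 2 := by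
  have h1 := Int.Ioc_filter_modEq_card 0 (⌈X⌉ - 1) (r := (r : ℤ)) (by exact_mod_cast hr) v
  rw [← DI] at h1
  set c := ((DI X).filter fun D => D ≡ v [ZMOD r]).card with hc
  have hrR : (0 : ℝ) < r := by exact_mod_cast hr
  have hr1 : (1 : ℝ) ≤ r := by exact_mod_cast hr
  have hrQ : (0 : ℚ) < r := by exact_mod_cast hr
  have hce : 1 ≤ ⌈X⌉ := by
    rw [Int.one_le_ceil_iff]; linarith
  set u : ℤ := ⌊(((⌈X⌉ - 1 : ℤ) : ℚ) - v) / (((r : ℕ) : ℤ) : ℚ)⌋ with hu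
  set w : ℤ := ⌊(((0 : ℤ) : ℚ) - v) / (((r : ℕ) : ℤ) : ℚ)⌋ with hw
  have hwu : w ≤ u := by
    apply Int.floor_le_floor
    push_cast
    gcongr
    have : (1 : ℚ) ≤ ⌈X⌉ := by exact_mod_cast hce
    linarith
  rw [max_eq_left (by linarith)] at h1
  have hcR : (c : ℝ) = u - w := by exact_mod_cast h1
  have u1 : (u : ℝ) * r ≤ ⌈X⌉ - 1 - v := by
    have := Int.floor_le ((((⌈X⌉ - 1 : ℤ) : ℚ) - v) / (((r : ℕ) : ℤ) : ℚ))
    rw [← hu, Int.cast_natCast, le_div_iff₀ hrQ] at this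
    have h2 : u * r ≤ ⌈X⌉ - 1 - v := by exact_mod_cast this
    exact_mod_cast h2
  have u2 : (⌈X⌉ - 1 - v : ℝ) < (u + 1) * r := by
    have := Int.lt_floor_add_one ((((⌈X⌉ - 1 : ℤ) : ℚ) - v) / (((r : ℕ) : ℤ) : ℚ))
    rw [← hu, Int.cast_natCast, div_lt_iff₀ hrQ] at this
    have h2 : ⌈X⌉ - 1 - v < (u + 1) * r := by exact_mod_cast this
    exact_mod_cast h2
  have w1 : (w : ℝ) * r ≤ - v := by
    have := Int.floor_le ((((0 : ℤ) : ℚ) - v) / (((r : ℕ) : ℤ) : ℚ))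
    rw [← hw, Int.cast_natCast, le_div_iff₀ hrQ] at this
    have h2 : w * r ≤ 0 - v := by exact_mod_cast this
    have h3 : (w : ℝ) * r ≤ 0 - v := by exact_mod_cast h2
    linarith
  have w2 : (- v : ℝ) < (w + 1) * r := by
    have := Int.lt_floor_add_one ((((0 : ℤ) : ℚ) - v) / (((r : ℕ) : ℤ) : ℚ))
    rw [← hw, Int.cast_natCast, div_lt_iff₀ hrQ] at this
    have h2 : 0 - v < (w + 1) * r := by exact_mod_cast this
    have h3 : (0 - v : ℝ) < (w + 1) * r := by exact_mod_cast h2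
    linarith
  have c1 := Int.le_ceil X
  have c2 := Int.ceil_lt_add_one X
  have e : ((c : ℝ) - X / r) = ((u - w) * r - X) / r := by rw [hcR]; field_simp
  rw [e, abs_le, le_div_iff₀ hrR, div_le_iff₀ hrR]
  constructor <;> nlinarith

theorem sq_count {X : ℝ} (hX : 0 ≤ X) {q : ℕ} (hq : 0 < q) :
    (((DI X).filter fun D => (q : ℤ) ^ 2 ∣ D).card : ℝ) ≤ X * (1 / (q : ℝ) ^ 2) := by
  have hqZ : (q : ℤ) ^ 2 ≠ 0 := by positivity
  have hinj : Set.InjOn (fun D : ℤ => D / (q : ℤ) ^ 2) ((DI X).filter fun D => (q : ℤ) ^ 2 ∣ D) := by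
    intro a ha b hb hab
    rw [Finset.mem_coe, Finset.mem_filter] at ha hb
    have h1 := Int.ediv_mul_cancel ha.2
    have h2 := Int.ediv_mul_cancel hb.2
    simp only at hab
    rw [← h1, ← h2, hab]
  rw [← Finset.card_image_of_injOn hinj]
  have hsub : ((DI X).filter fun D => (q : ℤ) ^ 2 ∣ D).image (fun D : ℤ => D / (q : ℤ) ^ 2) ⊆ Finset.Ioc 0 ⌊X * (1 / (q : ℝ) ^ 2)⌋ := by
    intro k hk
    obtain ⟨D, hD, rfl⟩ := Finset.mem_image.1 hk
    rw [Finset.mem_filter, mem_DI] at hD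
    obtain ⟨⟨h1, h2⟩, h3⟩ := hD
    obtain ⟨j, rfl⟩ := h3
    rw [Int.mul_ediv_cancel_left _ hqZ, Finset.mem_Ioc, Int.le_floor]
    refine ⟨pos_of_mul_pos_right h1 (by positivity), ?_⟩
    rw [mul_one_div, le_div_iff₀ (by positivity)]
    push_cast at h2
    linarith
  have h1 := Finset.card_le_card hsub
  rw [Int.card_Ioc] at h1
  have h2 : ((((DI X).filter fun D => (q : ℤ) ^ 2 ∣ D).image (fun D : ℤ => D / (q : ℤ) ^ 2)).card : ℝ) ≤ ((⌊X * (1 / (q : ℝ) ^ 2)⌋ - 0).toNat : ℝ) := by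
    exact_mod_cast h1
  have h3 : (((⌊X * (1 / (q : ℝ) ^ 2)⌋ - 0).toNat : ℤ) : ℝ) ≤ X * (1 / (q : ℝ) ^ 2) := by
    rw [Int.toNat_of_nonneg (by rw [sub_zero]; exact Int.floor_nonneg.2 (by positivity)), sub_zero]
    exact Int.floor_le _
  push_cast at h3 h2
  linarith

theorem nonfund_count {X : ℝ} (hX : 0 ≤ X) {Y : ℕ} (hY : 1 ≤ Y) (S : Finset ℤ) (hS : S ⊆ DI X)
    (h : ∀ D ∈ S, ∃ p : ℕ, Y < p ∧ (p : ℤ) ^ 2 ∣ D) : (S.card : ℝ) ≤ X / Y := by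
  classical
  have hex : ∀ D : ℤ, ∃ p : ℕ, D ∈ S → Y < p ∧ (p : ℤ) ^ 2 ∣ D := by
    intro D
    by_cases hD : D ∈ S
    · obtain ⟨p, hp⟩ := h D hD
      exact ⟨p, fun _ => hp⟩
    · exact ⟨0, fun h => absurd h hD⟩
  choose P hP using hex
  have h2 := card_le_sum_fib S (Finset.Ioc Y (S.sup P)) P (fun f hf => Finset.mem_Ioc.2 ⟨(hP f hf).1, Finset.le_sup hf⟩)
    (fun p => X * (1 / (p : ℝ) ^ 2)) (by
    intro p hp
    rw [Finset.mem_Ioc] at hp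
    refine le_trans ?_ (sq_count hX (q := p) (by omega))
    have : S.filter (fun D => P D = p) ⊆ (DI X).filter fun D => (p : ℤ) ^ 2 ∣ D := by
      intro D hD
      rw [Finset.mem_filter] at hD ⊢
      exact ⟨hS hD.1, hD.2 ▸ (hP D hD.1).2⟩
    exact_mod_cast Finset.card_le_card this)
  rw [← Finset.mul_sum] at h2
  have h3 := mul_le_mul_of_nonneg_left (sum_tail_sq Y (S.sup P) hY) hX
  have e : X * (1 / (Y : ℝ)) = X / Y := by ring
  linarith

/-- admissible discriminants at level `Y` -/
def Adm (m N Y : ℕ) (D : ℤ) : Prop :=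
  D ≡ m [ZMOD N] ∧ (∀ p : ℕ, p.Prime → p ≠ 2 → p ≤ Y → ¬ (p : ℤ) ^ 2 ∣ D) ∧ (D % 4 = 1 ∨ D % 16 = 8 ∨ D % 16 = 12)

/-- the modulus at level `Y` -/
def MM (N Y : ℕ) : ℕ := 2 ^ 5 * N * Y.factorial ^ 2

theorem MM_pos {N Y : ℕ} (hN : 0 < N) : 0 < MM N Y := by
  unfold MM; positivity

theorem sq_dvd_MM {N Y p : ℕ} (hp : 0 < p) (hpY : p ≤ Y) : p ^ 2 ∣ MM N Y := by
  unfold MM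
  exact (pow_dvd_pow_of_dvd (Nat.dvd_factorial hp hpY) 2).mul_left _

theorem MM_primeFactors {N Y : ℕ} (hN : 0 < N) (hY : N ≤ Y) (h2 : 2 ≤ Y) :
    (MM N Y).primeFactors = Nat.primesBelow (Y + 1) := by
  ext p
  rw [Nat.mem_primeFactors, Nat.mem_primesBelow]
  constructor
  · rintro ⟨hp, hd, -⟩
    refine ⟨?_, hp⟩
    unfold MM at hd
    rcases (Nat.Prime.dvd_mul hp).1 hd with h | h
    · rcases (Nat.Prime.dvd_mul hp).1 h with h | h
      · have := Nat.le_of_dvd (by norm_num) (hp.dvd_of_dvd_pow h); omega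
      · have := Nat.le_of_dvd hN h; omega
    · have := (hp.dvd_factorial).1 (hp.dvd_of_dvd_pow h); omega
  · rintro ⟨h, hp⟩
    exact ⟨hp, (dvd_pow_self p two_ne_zero).trans (sq_dvd_MM hp.pos (by omega)), (MM_pos hN).ne'⟩

theorem Adm.congr {m N Y : ℕ} {D D' : ℤ} (h : Adm m N Y D) (e : D' ≡ D [ZMOD MM N Y]) : Adm m N Y D' := by
  obtain ⟨h1, h2, h3⟩ := h
  refine ⟨(e.of_dvd ?_).trans h1, ?_, ?_⟩
  · exact ⟨2 ^ 5 * (Y.factorial : ℤ) ^ 2, by unfold MM; push_cast; ring⟩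
  · intro p hp hp2 hpY hd
    refine h2 p hp hp2 hpY ?_
    have : ((p : ℤ) ^ 2) ∣ (MM N Y : ℤ) := by exact_mod_cast sq_dvd_MM hp.pos hpY
    exact (Int.ModEq.dvd_iff (e.of_dvd this)).1 hd
  · have : (16 : ℤ) ∣ (MM N Y : ℤ) := by
      unfold MM; push_cast; exact ⟨2 * N * (Y.factorial : ℤ) ^ 2, by ring⟩
    have e2 : D' % 16 = D % 16 := e.of_dvd this
    omega

theorem Adm.good {m N Y : ℕ} {D : ℤ} (hN : 0 < N) (hY : N ≤ Y) (hY2 : 2 ≤ Y) (h : Adm m N Y D) : Good (MM N Y) D := by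
  obtain ⟨h1, h2, h3⟩ := h
  refine ⟨?_, fun _ => ⟨by unfold MM; exact ⟨N * Y.factorial ^ 2, by ring⟩, h3⟩⟩
  intro p hp hpM hp2
  have : p ∈ (MM N Y).primeFactors := Nat.mem_primeFactors.2 ⟨hp, hpM, (MM_pos hN).ne'⟩
  rw [MM_primeFactors hN hY hY2, Nat.mem_primesBelow] at this
  exact ⟨sq_dvd_MM hp.pos (by omega), h2 p hp hp2 (by omega)⟩

theorem fund_adm {m N Y : ℕ} {D : ℤ} (hD : IsFundamentalDiscriminant D) (hm : D ≡ m [ZMOD N]) : Adm m N Y D := by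
  refine ⟨hm, ?_, ?_⟩
  · intro p hp hp2 _ hd
    have hpp := Nat.prime_iff_prime_int.1 hp
    rcases hD.2 with ⟨h1, -⟩ | ⟨k, rfl, h1, -⟩
    · exact hpp.not_isUnit (h1 _ (by rw [← pow_two]; exact hd))
    · have h4 : IsCoprime ((p : ℤ) ^ 2) 4 := by
        have : Nat.Coprime (p ^ 2) 4 := by
          rw [show 4 = 2 ^ 2 by norm_num]
          exact Nat.Coprime.pow _ _ ((Nat.coprime_primes hp Nat.prime_two).2 hp2)
        exact_mod_cast Nat.isCoprime_iff_coprime.2 this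
      have := h4.dvd_of_dvd_mul_left hd
      exact hpp.not_isUnit (h1 _ (by rw [← pow_two]; exact this))
  · rcases hD.2 with ⟨-, h1⟩ | ⟨k, rfl, -, h1⟩
    · exact Or.inl h1
    · omega

theorem not_squarefree_prime {n : ℤ} (h : ¬ Squarefree n) : ∃ p : ℕ, p.Prime ∧ (p : ℤ) ^ 2 ∣ n := by
  rw [← Int.squarefree_natAbs, Nat.squarefree_iff_prime_squarefree] at h
  push Not at h
  obtain ⟨p, hp, hd⟩ := h
  refine ⟨p, hp, ?_⟩
  rw [pow_two]
  exact_mod_cast Int.natCast_dvd.2 hd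

theorem adm_nonfund {m N Y : ℕ} {D : ℤ} (h : Adm m N Y D) (h1 : D ≠ 1) (hD : ¬ IsFundamentalDiscriminant D) :
    ∃ p : ℕ, p.Prime ∧ Y < p ∧ (p : ℤ) ^ 2 ∣ D := by
  obtain ⟨-, h2, h3⟩ := h
  suffices ∃ p : ℕ, p.Prime ∧ p ≠ 2 ∧ (p : ℤ) ^ 2 ∣ D by
    obtain ⟨p, hp, hp2, hd⟩ := this
    exact ⟨p, hp, not_le.1 fun hle => h2 p hp hp2 hle hd, hd⟩
  by_cases h4 : D % 4 = 1
  · have : ¬ Squarefree D := fun hs => hD ⟨h1, Or.inl ⟨hs, h4⟩⟩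
    obtain ⟨p, hp, hd⟩ := not_squarefree_prime this
    refine ⟨p, hp, ?_, hd⟩
    rintro rfl
    obtain ⟨k, rfl⟩ := hd
    push_cast at h4; omega
  · obtain ⟨k, rfl⟩ : (4 : ℤ) ∣ D := by omega
    have hk : k % 4 = 2 ∨ k % 4 = 3 := by omega
    have : ¬ Squarefree k := fun hs => hD ⟨h1, Or.inr ⟨k, rfl, hs, hk⟩⟩
    obtain ⟨p, hp, hd⟩ := not_squarefree_prime this
    refine ⟨p, hp, ?_, hd.mul_left _⟩
    rintro rfl
    obtain ⟨j, rfl⟩ := hd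
    push_cast at hk; omega

end NH

namespace NH

open Classical in
/-- number-of-residue-class count for a periodic predicate -/
theorem period_count {X : ℝ} (hX : 1 ≤ X) {M : ℕ} (hM : 0 < M) (P : ℤ → Prop)
    (hP : ∀ D D' : ℤ, P D → D' ≡ D [ZMOD M] → P D') :
    |(((DI X).filter P).card : ℝ) - (((Finset.Ico (0 : ℤ) M).filter P).card : ℝ) / M * X| ≤ 2 * M := by
  have hMZ : (0 : ℤ) < M := by exact_mod_cast hM
  have h1 : ((DI X).filter P).card = ∑ a ∈ (Finset.Ico (0 : ℤ) M).filter P, ((DI X).filter fun D => D ≡ a [ZMOD M]).card := by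
    rw [Finset.card_eq_sum_card_fiberwise (f := fun D : ℤ => D % (M : ℤ)) (t := (Finset.Ico (0 : ℤ) M).filter P)]
    · apply Finset.sum_congr rfl
      intro a ha
      rw [Finset.mem_filter, Finset.mem_Ico] at ha
      congr 1
      ext D
      simp only [Finset.mem_filter]
      have : a % (M : ℤ) = a := Int.emod_eq_of_lt ha.1.1 ha.1.2
      constructor
      · rintro ⟨⟨h1, h2⟩, h3⟩
        exact ⟨h1, by rw [Int.ModEq, this, h3]⟩
      · rintro ⟨h1, h2⟩
        exact ⟨⟨h1, hP _ _ ha.2 h2⟩, by rw [h2, this]⟩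
    · intro D hD
      rw [Finset.mem_coe, Finset.mem_filter] at hD
      rw [Finset.mem_coe, Finset.mem_filter, Finset.mem_Ico]
      exact ⟨⟨Int.emod_nonneg _ hMZ.ne', Int.emod_lt_of_pos _ hMZ⟩, hP _ _ hD.2 (Int.mod_modEq _ _)⟩
  set R := (Finset.Ico (0 : ℤ) M).filter P with hR
  have hRc : (R.card : ℝ) ≤ M := by
    have := Finset.card_filter_le (Finset.Ico (0 : ℤ) M) P
    rw [Int.card_Ico, sub_zero, Int.toNat_natCast] at this
    exact_mod_cast this
  have e : (((DI X).filter P).card : ℝ) - (R.card : ℝ) / M * X =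
      ∑ a ∈ R, ((((DI X).filter fun D => D ≡ a [ZMOD M]).card : ℝ) - X / M) := by
    rw [Finset.sum_sub_distrib, Finset.sum_const, h1, nsmul_eq_mul]
    push_cast
    ring
  rw [e]
  refine (Finset.abs_sum_le_sum_abs _ _).trans ?_
  refine (Finset.sum_le_card_nsmul _ _ 2 fun a _ => resid_count hX a hM).trans ?_
  rw [nsmul_eq_mul]; linarith

open Classical in
/-- `Nplus` as a finset -/
noncomputable def NP (X : ℝ) (m N : ℕ) : Finset ℤ :=
  (DI X).filter fun D => IsFundamentalDiscriminant D ∧ D ≡ m [ZMOD N]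

theorem mem_NP {X : ℝ} {m N : ℕ} {D : ℤ} : D ∈ NP X m N ↔ D ∈ Nplus X m N := by
  classical
  rw [NP, Finset.mem_filter, mem_DI, Nplus, Set.mem_ofPred_eq]; tauto

theorem coe_NP (X : ℝ) (m N : ℕ) : (NP X m N : Set ℤ) = Nplus X m N := by
  ext D; rw [Finset.mem_coe, mem_NP]

open Classical in
/-- admissible residues -/
noncomputable def AR (m N Y : ℕ) : Finset ℤ := (Finset.Ico (0 : ℤ) (MM N Y)).filter (Adm m N Y)

theorem AR_le {m N Y : ℕ} : ((AR m N Y).card : ℝ) ≤ MM N Y := by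
  classical
  have := Finset.card_filter_le (Finset.Ico (0 : ℤ) (MM N Y)) (Adm m N Y)
  rw [Int.card_Ico, sub_zero, Int.toNat_natCast] at this
  unfold AR
  exact_mod_cast this

theorem NP_approx {X : ℝ} (hX : 1 ≤ X) {m N Y : ℕ} (hN : 0 < N) (hY : 1 ≤ Y) :
    |((NP X m N).card : ℝ) - ((AR m N Y).card : ℝ) / MM N Y * X| ≤ 2 * MM N Y + X / Y + 1 := by
  classical
  have h1 := period_count hX (MM_pos (Y := Y) hN) (Adm m N Y) (fun D D' h e => h.congr e)
  have hsub : NP X m N ⊆ (DI X).filter (Adm m N Y) := by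
    intro D hD
    rw [NP, Finset.mem_filter] at hD
    exact Finset.mem_filter.2 ⟨hD.1, fund_adm hD.2.1 hD.2.2⟩
  have h2 := Finset.card_sdiff_add_card_eq_card hsub
  have h3 := nonfund_count (by linarith : 0 ≤ X) hY (((DI X).filter (Adm m N Y) \ NP X m N).erase 1)
    (fun D hD => by
      rw [Finset.mem_erase, Finset.mem_sdiff, Finset.mem_filter] at hD
      exact hD.2.1.1)
    (fun D hD => by
      rw [Finset.mem_erase, Finset.mem_sdiff, Finset.mem_filter] at hD
      obtain ⟨a, ⟨b, c⟩, d⟩ := hD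
      obtain ⟨p, -, hp⟩ := adm_nonfund c a (fun hf => d (by
        rw [NP, Finset.mem_filter]; exact ⟨b, hf, c.1⟩))
      exact ⟨p, hp⟩)
  have h4 := Finset.pred_card_le_card_erase (s := (DI X).filter (Adm m N Y) \ NP X m N) (a := 1)
  have h5 : (((DI X).filter (Adm m N Y) \ NP X m N).card : ℝ) ≤ X / Y + 1 := by
    have : ((DI X).filter (Adm m N Y) \ NP X m N).card ≤ (((DI X).filter (Adm m N Y) \ NP X m N).erase 1).card + 1 := by omega
    have : (((DI X).filter (Adm m N Y) \ NP X m N).card : ℝ) ≤ (((DI X).filter (Adm m N Y) \ NP X m N).erase 1).card + 1 := by exact_mod_cast this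
    linarith
  have h6 : (((DI X).filter (Adm m N Y) \ NP X m N).card : ℝ) + (NP X m N).card = ((DI X).filter (Adm m N Y)).card := by exact_mod_cast h2
  have h7 : (0 : ℝ) ≤ (((DI X).filter (Adm m N Y) \ NP X m N).card : ℝ) := by positivity
  change |(((DI X).filter (Adm m N Y)).card : ℝ) - ((AR m N Y).card : ℝ) / MM N Y * X| ≤ 2 * MM N Y at h1
  rw [abs_le] at h1 ⊢
  have : 0 ≤ X / Y := by positivity
  constructor <;> linarith [h1.1, h1.2]

theorem lift_class {m N : ℕ} (hN : 0 < N) (hss : CondStarStar m N) :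
    ∃ m' N' : ℕ, 0 < N' ∧ ∀ D : ℤ, D ≡ m' [ZMOD N'] → D ≡ m [ZMOD N] ∧
      (D % 4 = 1 ∨ D % 16 = 8 ∨ D % 16 = 12) ∧ ∀ p : ℕ, p.Prime → p ≠ 2 → p ∣ N' → ¬ (p : ℤ) ^ 2 ∣ D := by
  have key : ∀ D : ℤ, D ≡ m [ZMOD N] → ∀ p : ℕ, p.Prime → p ≠ 2 → p ∣ N → ¬ (p : ℤ) ^ 2 ∣ D := by
    intro D hD p hp hp2 hpN hd
    have h1 : (p : ℤ) ∣ m := ((hD.of_dvd (by exact_mod_cast hpN : (p : ℤ) ∣ N)).dvd_iff).1 ((dvd_pow_self _ two_ne_zero).trans hd)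
    obtain ⟨h2, h3⟩ := hss.1 p hp (hp.odd_of_ne_two hp2) (by exact_mod_cast h1) hpN
    have h4 : (p : ℤ) ^ 2 ∣ m := ((hD.of_dvd (by exact_mod_cast h2 : (p : ℤ) ^ 2 ∣ N)).dvd_iff).1 hd
    exact h3 (by exact_mod_cast h4)
  by_cases h2 : 2 ∣ N
  · refine ⟨m, N, hN, fun D hD => ⟨hD, ?_, key D hD⟩⟩
    rcases hss.2 h2 with ⟨a, b⟩ | ⟨a, b⟩
    · have e : D % 4 = m % 4 := hD.of_dvd (by exact_mod_cast a : (4 : ℤ) ∣ N)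
      omega
    · have e : D % 16 = m % 16 := hD.of_dvd (by exact_mod_cast a : (16 : ℤ) ∣ N)
      omega
  · have hc : Nat.Coprime N 16 := by
      rw [show 16 = 2 ^ 4 by norm_num]
      exact ((Nat.Prime.coprime_iff_not_dvd Nat.prime_two).2 h2).symm.pow_right _
    obtain ⟨k, hk1, hk2⟩ := Nat.chineseRemainder hc m 1
    refine ⟨k, N * 16, by positivity, fun D hD => ?_⟩
    have e1 : D ≡ m [ZMOD N] := (hD.of_dvd (by push_cast; exact dvd_mul_right _ _)).trans (by exact_mod_cast Int.natCast_modEq_iff.2 hk1)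
    have e2 : D % 16 = k % 16 := hD.of_dvd (by push_cast; exact dvd_mul_left _ _)
    have e3 : k % 16 = 1 % 16 := hk2
    refine ⟨e1, by omega, fun p hp hp2 hpN => key D e1 p hp hp2 ?_⟩
    rcases (Nat.Prime.dvd_mul hp).1 hpN with h | h
    · exact h
    · rw [show 16 = 2 ^ 4 by norm_num] at h
      exact absurd ((Nat.prime_dvd_prime_iff_eq hp Nat.prime_two).1 (hp.dvd_of_dvd_pow h)) hp2

theorem class_sq_count {X : ℝ} (hX : 1 ≤ X) {m N p : ℕ} (hN : 0 < N) (hp : 0 < p) (hc : Nat.Coprime p N) :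
    (((DI X).filter fun D => D ≡ m [ZMOD N] ∧ (p : ℤ) ^ 2 ∣ D).card : ℝ) ≤ X / N * (1 / (p : ℝ) ^ 2) + 2 := by
  rcases ((DI X).filter fun D => D ≡ m [ZMOD N] ∧ (p : ℤ) ^ 2 ∣ D).eq_empty_or_nonempty with h | ⟨D0, h0⟩
  · rw [h, Finset.card_empty, Nat.cast_zero]; positivity
  rw [Finset.mem_filter] at h0
  have h1 := resid_count hX D0 (r := N * p ^ 2) (by positivity)
  have hsub : ((DI X).filter fun D => D ≡ m [ZMOD N] ∧ (p : ℤ) ^ 2 ∣ D) ⊆ (DI X).filter fun D => D ≡ D0 [ZMOD (N * p ^ 2 : ℕ)] := by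
    intro D hD
    rw [Finset.mem_filter] at hD ⊢
    refine ⟨hD.1, ?_⟩
    push_cast
    rw [← Int.modEq_and_modEq_iff_modEq_mul]
    · exact ⟨hD.2.1.trans h0.2.1.symm, (Int.modEq_zero_iff_dvd.2 hD.2.2).trans (Int.modEq_zero_iff_dvd.2 h0.2.2).symm⟩
    · rw [Int.natAbs_pow, Int.natAbs_natCast, Int.natAbs_natCast]
      exact (hc.pow_left 2).symm
  have h2 : (((DI X).filter fun D => D ≡ m [ZMOD N] ∧ (p : ℤ) ^ 2 ∣ D).card : ℝ) ≤ ((DI X).filter fun D => D ≡ D0 [ZMOD (N * p ^ 2 : ℕ)]).card := by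
    exact_mod_cast Finset.card_le_card hsub
  rw [abs_le] at h1
  have e : X / ((N * p ^ 2 : ℕ) : ℝ) = X / N * (1 / (p : ℝ) ^ 2) := by
    push_cast; rw [div_mul_div_comm, mul_one]
  rw [e] at h1
  linarith [h1.2]

theorem NP_lower {m N : ℕ} (hN : 0 < N) (hss : CondStarStar m N) :
    ∃ c : ℝ, 0 < c ∧ ∀ᶠ X : ℝ in atTop, c * X ≤ (NP X m N).card := by
  classical
  obtain ⟨m', N', hN', hD⟩ := lift_class hN hss
  have hNR : (0 : ℝ) < N' := by exact_mod_cast hN'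
  refine ⟨1 / (8 * N'), by positivity, ?_⟩
  filter_upwards [eventually_ge_atTop (1 : ℝ), eventually_ge_atTop (8 * N' * (3 + 8 * N') : ℝ)] with X hX hX2
  set T := (DI X).filter fun D => D ≡ m' [ZMOD N'] with hT
  have hT1 := resid_count hX m' hN'
  rw [← hT, abs_le] at hT1
  set Y := 4 * N' with hY
  have hcov : T ⊆ NP X m N ∪ ({1} ∪ ((T.filter fun D => ∃ p : ℕ, Y < p ∧ (p : ℤ) ^ 2 ∣ D) ∪
      (Finset.Ioc 2 Y).biUnion fun p => if Nat.Coprime p N' then (DI X).filter (fun D => D ≡ m' [ZMOD N'] ∧ (p : ℤ) ^ 2 ∣ D) else ∅)) := by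
    intro D hDT
    have hDT' := hDT
    rw [hT, Finset.mem_filter] at hDT'
    obtain ⟨a, b, c⟩ := hD D hDT'.2
    by_cases hf : IsFundamentalDiscriminant D
    · apply Finset.mem_union_left
      rw [NP, Finset.mem_filter]; exact ⟨hDT'.1, hf, a⟩
    apply Finset.mem_union_right
    by_cases h1 : D = 1
    · apply Finset.mem_union_left; rw [h1]; exact Finset.mem_singleton_self _
    apply Finset.mem_union_right
    have hA : Adm m N 2 D := ⟨a, fun p hp h2 h3 _ => by have := hp.two_le; omega, b⟩
    obtain ⟨p, hp, hp2, hpd⟩ := adm_nonfund hA h1 hf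
    by_cases hpY : Y < p
    · apply Finset.mem_union_left
      exact Finset.mem_filter.2 ⟨hDT, p, hpY, hpd⟩
    apply Finset.mem_union_right
    rw [Finset.mem_biUnion]
    refine ⟨p, Finset.mem_Ioc.2 ⟨hp2, by omega⟩, ?_⟩
    have : Nat.Coprime p N' := (Nat.Prime.coprime_iff_not_dvd hp).2 fun h => c p hp (by omega) h hpd
    rw [if_pos this, Finset.mem_filter]
    exact ⟨hDT'.1, hDT'.2, hpd⟩
  have c1 := Finset.card_le_card hcov
  have c2 := Finset.card_union_le (NP X m N) ({1} ∪ ((T.filter fun D => ∃ p : ℕ, Y < p ∧ (p : ℤ) ^ 2 ∣ D) ∪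
      (Finset.Ioc 2 Y).biUnion fun p => if Nat.Coprime p N' then (DI X).filter (fun D => D ≡ m' [ZMOD N'] ∧ (p : ℤ) ^ 2 ∣ D) else ∅))
  have c3 := Finset.card_union_le ({1} : Finset ℤ) ((T.filter fun D => ∃ p : ℕ, Y < p ∧ (p : ℤ) ^ 2 ∣ D) ∪
      (Finset.Ioc 2 Y).biUnion fun p => if Nat.Coprime p N' then (DI X).filter (fun D => D ≡ m' [ZMOD N'] ∧ (p : ℤ) ^ 2 ∣ D) else ∅)
  have c4 := Finset.card_union_le (T.filter fun D => ∃ p : ℕ, Y < p ∧ (p : ℤ) ^ 2 ∣ D)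
      ((Finset.Ioc 2 Y).biUnion fun p => if Nat.Coprime p N' then (DI X).filter (fun D => D ≡ m' [ZMOD N'] ∧ (p : ℤ) ^ 2 ∣ D) else ∅)
  have c5 := Finset.card_biUnion_le (s := Finset.Ioc 2 Y) (t := fun p => if Nat.Coprime p N' then (DI X).filter (fun D => D ≡ m' [ZMOD N'] ∧ (p : ℤ) ^ 2 ∣ D) else ∅)
  have c6 : ((∑ p ∈ Finset.Ioc 2 Y, (if Nat.Coprime p N' then (DI X).filter (fun D => D ≡ m' [ZMOD N'] ∧ (p : ℤ) ^ 2 ∣ D) else ∅).card : ℕ) : ℝ)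
      ≤ X / N' * (1 / 2) + 8 * N' := by
    push_cast
    have : ∀ p ∈ Finset.Ioc 2 Y, ((if Nat.Coprime p N' then (DI X).filter (fun D => D ≡ m' [ZMOD N'] ∧ (p : ℤ) ^ 2 ∣ D) else ∅).card : ℝ)
        ≤ X / N' * (1 / (p : ℝ) ^ 2) + 2 := by
      intro p hp
      rw [Finset.mem_Ioc] at hp
      split_ifs with h
      · exact class_sq_count hX hN' (by omega) h
      · rw [Finset.card_empty, Nat.cast_zero]; positivity
    refine (Finset.sum_le_sum this).trans ?_
    rw [Finset.sum_add_distrib, ← Finset.mul_sum, Finset.sum_const, Nat.card_Ioc, nsmul_eq_mul]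
    have s1 := sum_tail_sq 2 Y (by norm_num)
    have s2 := mul_le_mul_of_nonneg_left s1 (by positivity : 0 ≤ X / N')
    have s3 : ((Y - 2 : ℕ) : ℝ) ≤ 4 * N' := by
      have : Y - 2 ≤ 4 * N' := by omega
      exact_mod_cast this
    push_cast at s2 ⊢
    linarith
  have c7 := nonfund_count (by linarith : 0 ≤ X) (Y := Y) (by omega) (T.filter fun D => ∃ p : ℕ, Y < p ∧ (p : ℤ) ^ 2 ∣ D)
    (fun D hD => by
      rw [Finset.mem_filter, hT, Finset.mem_filter] at hD; exact hD.1.1)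
    (fun D hD => (Finset.mem_filter.1 hD).2)
  have c8 : (T.card : ℝ) ≤ (NP X m N).card + (1 + (((T.filter fun D => ∃ p : ℕ, Y < p ∧ (p : ℤ) ^ 2 ∣ D).card : ℝ) +
    ((∑ p ∈ Finset.Ioc 2 Y, (if Nat.Coprime p N' then (DI X).filter (fun D => D ≡ m' [ZMOD N'] ∧ (p : ℤ) ^ 2 ∣ D) else ∅).card : ℕ) : ℝ))) := by
    rw [Finset.card_singleton] at c3
    have := c1.trans (c2.trans (Nat.add_le_add_left (c3.trans (Nat.add_le_add_left (c4.trans (Nat.add_le_add_left c5 _)) _)) _))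
    exact_mod_cast this
  have e1 : X / (Y : ℝ) = X / N' / 4 := by rw [hY]; push_cast; rw [mul_comm, div_div]
  have e2 : 1 / (8 * (N' : ℝ)) * X = X / N' / 8 := by field_simp
  have e3 : 3 + 8 * (N' : ℝ) ≤ X / N' / 8 := by
    rw [div_div, le_div_iff₀ (by positivity)]; linarith
  rw [e2]
  rw [e1] at c7
  linarith [hT1.1]

end NH

namespace NH
open MeasureTheory Topology

theorem SS_bdd (T : ℝ) : Bornology.IsBounded (SS T) :=
  (((KK_compact T).image Phi_cont).isBounded).subset (SS_sub T)

theorem D4_cast (f : Fin 4 → ℤ) : D4 (fun i => (f i : ℝ)) = ((D4 f : ℤ) : ℝ) := by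
  simp [D4]

/-- reduced forms with bounded third parameter -/
def LL (T t : ℝ) : Set (Fin 4 → ℤ) :=
  {f | f 0 ≠ 0 ∧ ((D4 f : ℤ) : ℝ) < t ^ 4 ∧ ∃ v, RedBy f v ∧ v 3 ≤ T}

theorem mem_LL {T t : ℝ} (ht : 0 < t) (f : Fin 4 → ℤ) : f ∈ LL T t ↔ (fun i => (f i : ℝ) / t) ∈ SS T := by
  have e : (fun i => (f i : ℝ) / t) = t⁻¹ • (fun i => (f i : ℝ)) := by
    funext i; simp [div_eq_inv_mul]
  have hD : D4 (fun i => (f i : ℝ) / t) = ((D4 f : ℤ) : ℝ) / t ^ 4 := by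
    rw [e, D4_smul, D4_cast]; field_simp
  have h4 : 0 < t ^ 4 := by positivity
  constructor
  · rintro ⟨h0, h1, v, ⟨h2, h3, h5⟩, hT⟩
    refine ⟨by simp [h0, ht.ne'], by rw [hD, div_lt_one h4]; exact h1,
      ![v 0 / t, v 1 / t, v 2, v 3], h2, h3, hT, ?_⟩
    rw [e, h5]
    apply ext4 <;> simp [Phi] <;> field_simp
  · rintro ⟨h0, h1, v, h2, h3, hT, h5⟩
    refine ⟨fun h => h0 (by simp [h]), by rwa [hD, div_lt_one h4] at h1, ![t * v 0, t * v 1, v 2, v 3], ⟨h2, h3, ?_⟩, hT⟩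
    have : (fun i => (f i : ℝ)) = t • Phi v := by
      rw [← h5]; funext i; simp; field_simp
    rw [this]
    apply ext4 <;> simp [Phi] <;> ring

theorem LL_finite {T t : ℝ} (ht : 0 < t) : (LL T t).Finite := by
  have : LL T t = lpts 1 0 (SS T) t := by
    ext f
    rw [mem_LL ht, lpts, Set.mem_ofPred_eq]
    simp [Int.modEq_one]
  rw [this]
  exact lpts_finite (SS_bdd T) ht

theorem LL_box (T : ℝ) : ∃ K : ℝ, 1 ≤ K ∧ ∀ t : ℝ, 0 < t → ∀ f ∈ LL T t, ∀ i, |(f i : ℝ)| ≤ K * t := by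
  obtain ⟨K, hK⟩ := (SS_bdd T).exists_norm_le
  refine ⟨max K 1, le_max_right _ _, fun t ht f hf i => ?_⟩
  have h1 := hK _ ((mem_LL ht f).1 hf)
  have h2 := (norm_le_pi_norm (fun i => (f i : ℝ) / t) i).trans h1
  rw [Real.norm_eq_abs, abs_div, abs_of_pos ht, div_le_iff₀ ht] at h2
  exact h2.trans (mul_le_mul_of_nonneg_right (le_max_left _ _) ht.le)

/-- standard lift -/
def lft {M : ℕ} (g : Fin 4 → ZMod M) : Fin 4 → ℤ := fun i => ((g i).val : ℤ)

theorem lft_cast {M : ℕ} [NeZero M] (g : Fin 4 → ZMod M) : (fun i => ((lft g i : ℤ) : ZMod M)) = g := by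
  funext i; simp [lft]

theorem D4_lft {M : ℕ} [NeZero M] (g : Fin 4 → ZMod M) : ((D4 (lft g) : ℤ) : ZMod M) = D4 g := by
  have := D4_map (Int.castRingHom (ZMod M)) (lft g)
  rw [eq_intCast] at this
  rw [← this]
  congr 1
  exact lft_cast g

open Classical in
theorem adm_forms_card {m N Y : ℕ} [NeZero (MM N Y)] (hN : 0 < N) (hY : N ≤ Y) (hY2 : 2 ≤ Y) :
    ((Finset.univ.filter fun g : Fin 4 → ZMod (MM N Y) => Adm m N Y (D4 (lft g))).card : ℝ) =
      (AR m N Y).card * ((MM N Y : ℝ) ^ 3 * ∏ p ∈ Nat.primesBelow (Y + 1), rho p) := by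
  have hM := MM_pos (Y := Y) hN
  have hMZ : (0 : ℤ) < MM N Y := by exact_mod_cast hM
  rw [Finset.card_eq_sum_card_fiberwise (f := fun g : Fin 4 → ZMod (MM N Y) => D4 (lft g) % (MM N Y : ℤ)) (t := AR m N Y)]
  · push_cast
    rw [← nsmul_eq_mul, ← Finset.sum_const]
    apply Finset.sum_congr rfl
    intro a ha
    rw [AR, Finset.mem_filter, Finset.mem_Ico] at ha
    have h1 := cnt_formula hM.ne' (ha.2.good hN hY hY2)
    rw [MM_primeFactors hN hY hY2] at h1
    rw [← h1, cnt, Nat.card_eq_fintype_card, Fintype.card_subtype]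
    congr 2
    ext g
    simp only [Finset.mem_filter, Finset.mem_univ, true_and]
    have e : D4 g = (a : ZMod (MM N Y)) ↔ D4 (lft g) ≡ a [ZMOD MM N Y] := by
      rw [← D4_lft g, ZMod.intCast_eq_intCast_iff]
    rw [e, Int.ModEq, Int.emod_eq_of_lt ha.1.1 ha.1.2]
    refine ⟨fun h => h.2, fun h => ⟨ha.2.congr ?_, h⟩⟩
    rw [Int.ModEq, Int.emod_eq_of_lt ha.1.1 ha.1.2, h]
  · intro g hg
    rw [Finset.mem_coe, Finset.mem_filter] at hg
    rw [Finset.mem_coe, AR, Finset.mem_filter, Finset.mem_Ico]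
    exact ⟨⟨Int.emod_nonneg _ hMZ.ne', Int.emod_lt_of_pos _ hMZ⟩, hg.2.congr (Int.mod_modEq _ _)⟩

theorem LLA_eq {m N Y : ℕ} [NeZero (MM N Y)] {T t : ℝ} (ht : 0 < t) :
    {f | f ∈ LL T t ∧ Adm m N Y (D4 f)}.ncard =
     ∑ g ∈ (open Classical in Finset.univ.filter fun g : Fin 4 → ZMod (MM N Y) => Adm m N Y (D4 (lft g))),
       (lpts (MM N Y) (lft g) (SS T) t).ncard := by
  classical
  have hfin : {f | f ∈ LL T t ∧ Adm m N Y (D4 f)}.Finite := (LL_finite ht).subset fun f hf => hf.1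
  rw [Set.ncard_eq_toFinset_card _ hfin]
  have key : ∀ (f : Fin 4 → ℤ) (g : Fin 4 → ZMod (MM N Y)), (fun i => ((f i : ℤ) : ZMod (MM N Y))) = g ↔
      ∀ i, f i ≡ lft g i [ZMOD MM N Y] := by
    intro f g
    rw [funext_iff]
    refine forall_congr' fun i => ?_
    rw [← ZMod.intCast_eq_intCast_iff]
    have := congrFun (lft_cast g) i
    rw [this]
  rw [Finset.card_eq_sum_card_fiberwise (f := fun f : Fin 4 → ℤ => (fun i => ((f i : ℤ) : ZMod (MM N Y))))
    (t := Finset.univ.filter fun g : Fin 4 → ZMod (MM N Y) => Adm m N Y (D4 (lft g)))]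
  · apply Finset.sum_congr rfl
    intro g hg
    rw [Finset.mem_filter] at hg
    rw [← Set.ncard_coe_finset]
    congr 1
    ext f
    rw [Finset.mem_coe, Finset.mem_filter, Set.Finite.mem_toFinset, key, lpts, Set.mem_ofPred_eq, Set.mem_ofPred_eq, mem_LL ht]
    constructor
    · rintro ⟨⟨a, b⟩, c⟩; exact ⟨c, a⟩
    · rintro ⟨c, a⟩; exact ⟨⟨a, hg.2.congr (D4_emod _ _ _ c)⟩, c⟩
  · intro f hf
    rw [Finset.mem_coe, Set.Finite.mem_toFinset] at hf
    rw [Finset.mem_coe, Finset.mem_filter]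
    refine ⟨Finset.mem_univ _, hf.2.congr (D4_emod _ _ _ fun i => ((key f _).1 rfl i).symm)⟩

/-- Euler product partial -/
noncomputable def rY (Y : ℕ) : ℝ := ∏ p ∈ Nat.primesBelow (Y + 1), rho p

theorem LLA_count {m N Y : ℕ} (hN : 0 < N) (hY : N ≤ Y) (hY2 : 2 ≤ Y) (T : ℝ) :
    Tendsto (fun t : ℝ => ({f | f ∈ LL T t ∧ Adm m N Y (D4 f)}.ncard : ℝ) / t ^ 4) atTop
      (𝓝 (VT T * ((AR m N Y).card / MM N Y * rY Y))) := by
  classical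
  have hM := MM_pos (Y := Y) hN
  haveI : NeZero (MM N Y) := ⟨hM.ne'⟩
  have h1 := tendsto_finsetSum (Finset.univ.filter fun g : Fin 4 → ZMod (MM N Y) => Adm m N Y (D4 (lft g)))
    (fun g _ => SS_count T hM (lft g))
  rw [Finset.sum_const, nsmul_eq_mul] at h1
  have h2 := adm_forms_card (m := m) hN hY hY2
  have hMR : (MM N Y : ℝ) ≠ 0 := by exact_mod_cast hM.ne'
  have e : VT T * ((AR m N Y).card / MM N Y * rY Y) =
      ((Finset.univ.filter fun g : Fin 4 → ZMod (MM N Y) => Adm m N Y (D4 (lft g))).card : ℝ) * (VT T / (MM N Y : ℝ) ^ 4) := by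
    rw [h2, rY]; field_simp
  rw [e]
  refine h1.congr' ?_
  filter_upwards [eventually_gt_atTop (0 : ℝ)] with t ht
  rw [LLA_eq ht, Nat.cast_sum, Finset.sum_div]

end NH

namespace NH
open MeasureTheory Topology

/-- reduced forms with large fundamental discriminant -/
def FS (X : ℝ) (m N : ℕ) : Set (Fin 4 → ℤ) :=
  {f | Red f ∧ f 0 ≠ 0 ∧ D4 f ∈ NP X m N ∧ 24 ≤ D4 f}

theorem FS_finite (X : ℝ) (m N : ℕ) : (FS X m N).Finite := by
  have h1 : (⋃ Δ ∈ {Δ : ℤ | Δ ∈ NP X m N ∧ 24 ≤ Δ}, {f : Fin 4 → ℤ | Red f ∧ f 0 ≠ 0 ∧ D4 f = Δ}).Finite := by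
    apply Set.Finite.biUnion
    · exact (NP X m N).finite_toSet.subset fun Δ h => h.1
    · rintro Δ ⟨h1, h2⟩
      rw [mem_NP] at h1
      exact (card_red h1.2.2.1 h2).1
  refine h1.subset fun f hf => ?_
  simp only [Set.mem_iUnion]
  exact ⟨D4 f, ⟨hf.2.2.1, hf.2.2.2⟩, hf.1, hf.2.1, rfl⟩

theorem FS_card (X : ℝ) (m N : ℕ) :
    (FS X m N).ncard + 2 * ((NP X m N).filter fun Δ => 24 ≤ Δ).card = 6 * ∑ Δ ∈ (NP X m N).filter (fun Δ => 24 ≤ Δ), h3 Δ := by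
  classical
  rw [Set.ncard_eq_toFinset_card _ (FS_finite X m N),
    Finset.card_eq_sum_card_fiberwise (f := fun f : Fin 4 → ℤ => D4 f) (t := (NP X m N).filter fun Δ => 24 ≤ Δ)]
  · rw [Finset.mul_sum, mul_comm 2, ← smul_eq_mul, ← Finset.sum_const, ← Finset.sum_add_distrib]
    apply Finset.sum_congr rfl
    intro Δ hΔ
    rw [Finset.mem_filter] at hΔ
    have h1 := mem_NP.1 hΔ.1
    rw [← (card_red h1.2.2.1 hΔ.2).2, ← Set.ncard_coe_finset]
    congr 2
    ext f
    rw [Finset.mem_coe, Finset.mem_filter, Set.Finite.mem_toFinset]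
    constructor
    · rintro ⟨⟨a, b, -, -⟩, c⟩; exact ⟨a, b, c⟩
    · rintro ⟨a, b, c⟩; exact ⟨⟨a, b, c ▸ hΔ.1, c ▸ hΔ.2⟩, c⟩
  · intro f hf
    rw [Finset.mem_coe, Set.Finite.mem_toFinset] at hf
    rw [Finset.mem_coe, Finset.mem_filter]
    exact ⟨hf.2.2.1, hf.2.2.2⟩

theorem compare {m N Y : ℕ} (hY : 3 ≤ Y) {w : ℝ} (hw : 1 ≤ w) {K : ℝ} (hK : 1 ≤ K)
    (hbox : ∀ t : ℝ, 0 < t → ∀ f ∈ LL (w ^ 4) t, ∀ i, |(f i : ℝ)| ≤ K * t) {t : ℝ} (ht : 1 ≤ t) :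
    |((FS (t ^ 4) m N).ncard : ℝ) - ({f | f ∈ LL (w ^ 4) t ∧ Adm m N Y (D4 f)}.ncard : ℝ)| ≤
      187500 * t ^ 4 / w + (2592 * K ^ 4 * t ^ 4 / Y + 112000 * K ^ 3 * t ^ 3) + 500000000 * t ^ 4 / Y + 4800000 := by
  classical
  have ht0 : 0 < t := by linarith
  have hfin : {f | f ∈ LL (w ^ 4) t ∧ Adm m N Y (D4 f)}.Finite := (LL_finite ht0).subset fun f hf => hf.1
  rw [Set.ncard_eq_toFinset_card _ (FS_finite _ _ _), Set.ncard_eq_toFinset_card _ hfin]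
  set A := (FS_finite (t ^ 4) m N).toFinset with hA
  set B := hfin.toFinset with hB
  have mA : ∀ f, f ∈ A ↔ Red f ∧ f 0 ≠ 0 ∧ D4 f ∈ NP (t ^ 4) m N ∧ 24 ≤ D4 f := fun f => by
    rw [hA, Set.Finite.mem_toFinset]; rfl
  have mB : ∀ f, f ∈ B ↔ f ∈ LL (w ^ 4) t ∧ Adm m N Y (D4 f) := fun f => by
    rw [hB, Set.Finite.mem_toFinset]; rfl
  have hNP : ∀ D, D ∈ NP (t ^ 4) m N ↔ (0 < D ∧ (D : ℝ) < t ^ 4) ∧ IsFundamentalDiscriminant D ∧ D ≡ m [ZMOD N] := fun D => by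
    rw [NP, Finset.mem_filter, mem_DI]
  have b1 : ((A \ B).card : ℝ) ≤ 187500 * t ^ 4 / w := by
    apply tail_bound _ ht hw
    intro f hf
    rw [Finset.mem_sdiff, mA, mB] at hf
    obtain ⟨⟨⟨v, hv⟩, h0, hD, h24⟩, hn⟩ := hf
    rw [hNP] at hD
    refine ⟨h0, hD.1.2, v, hv, ?_⟩
    by_contra hlt
    exact hn ⟨⟨h0, hD.1.2, v, hv, (not_le.1 hlt).le⟩, fund_adm hD.2.1 hD.2.2⟩
  have pB : ∀ f ∈ B, Red f ∧ 0 < D4 f ∧ ((D4 f : ℤ) : ℝ) < t ^ 4 := by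
    intro f hf
    rw [mB] at hf
    obtain ⟨⟨h0, hD, v, hv, -⟩, -⟩ := hf
    exact ⟨⟨v, hv⟩, (red_bounds hv ht0.le le_rfl h0 hD (by rw [one_pow]; exact hv.2.1)).1, hD⟩
  have hex : ∀ f ∈ B \ A, 24 ≤ D4 f → ∃ p : ℕ, p.Prime ∧ Y < p ∧ (p : ℤ) ^ 2 ∣ D4 f := by
    intro f hf h24
    rw [Finset.mem_sdiff] at hf
    have hp := pB f hf.1
    have hb := (mB f).1 hf.1
    apply adm_nonfund hb.2 (by omega)
    intro hfu
    apply hf.2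
    rw [mA, hNP]
    exact ⟨hp.1, hb.1.1, ⟨⟨hp.2.1, hp.2.2⟩, hfu, hb.2.1⟩, h24⟩
  set C1 := (B \ A).filter fun f => D4 f < 24 with hC1
  set C2 := (B \ A).filter fun f => ∃ p : ℕ, p.Prime ∧ Y < p ∧ HessDvd p f with hC2
  set C3 := (B \ A).filter fun f => ∃ p : ℕ, p.Prime ∧ Y < p ∧ (p : ℤ) ^ 2 ∣ D4 f ∧ ¬ HessDvd p f with hC3
  have hcov : B \ A ⊆ C1 ∪ (C2 ∪ C3) := by
    intro f hf
    by_cases h24 : 24 ≤ D4 f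
    · obtain ⟨p, hp, hpY, hpd⟩ := hex f hf h24
      apply Finset.mem_union_right
      by_cases hh : HessDvd p f
      · exact Finset.mem_union_left _ (Finset.mem_filter.2 ⟨hf, p, hp, hpY, hh⟩)
      · exact Finset.mem_union_right _ (Finset.mem_filter.2 ⟨hf, p, hp, hpY, hpd, hh⟩)
    · exact Finset.mem_union_left _ (Finset.mem_filter.2 ⟨hf, not_le.1 h24⟩)
  have c1 : (C1.card : ℝ) ≤ 200000 * 24 := by
    apply red_count _ (by norm_num)
    intro f hf
    rw [hC1, Finset.mem_filter, Finset.mem_sdiff] at hf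
    have hp := pB f hf.1.1
    exact ⟨hp.1, hp.2.1, by exact_mod_cast hf.2⟩
  have hKt : 1 ≤ K * t := by nlinarith
  have hZ1 : ((⌈K * t⌉₊ : ℕ) : ℝ) ≤ 2 * (K * t) := by
    have := Nat.ceil_lt_add_one (by linarith : 0 ≤ K * t)
    linarith
  have c2 : (C2.card : ℝ) ≤ 162 * ((⌈K * t⌉₊ : ℕ) : ℝ) ^ 4 / Y + 14000 * ((⌈K * t⌉₊ : ℕ) : ℝ) ^ 3 := by
    apply hess_count _ _ (by omega : 1 ≤ Y)
    · intro f hf i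
      rw [hC2, Finset.mem_filter, Finset.mem_sdiff, mB] at hf
      exact (hbox t ht0 f hf.1.1.1 i).trans (Nat.le_ceil _)
    · intro f hf
      rw [hC2, Finset.mem_filter, Finset.mem_sdiff, mB] at hf
      exact ⟨hf.1.1.1.1, hf.2⟩
    · exact Nat.one_le_ceil_iff.2 (by linarith)
  have c3 : (C3.card : ℝ) ≤ 500000000 * |t ^ 4| / Y := by
    apply nonhess_count _ hY
    intro f hf
    rw [hC3, Finset.mem_filter, Finset.mem_sdiff] at hf
    have hp := pB f hf.1.1
    exact ⟨hp.1, hp.2.1, hp.2.2, hf.2⟩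
  rw [abs_of_pos (by positivity)] at c3
  have hY0 : (0 : ℝ) < Y := by
    have : 0 < Y := by omega
    exact_mod_cast this
  have c2' : (C2.card : ℝ) ≤ 2592 * K ^ 4 * t ^ 4 / Y + 112000 * K ^ 3 * t ^ 3 := by
    have e4 : ((⌈K * t⌉₊ : ℕ) : ℝ) ^ 4 ≤ (2 * (K * t)) ^ 4 := by gcongr
    have e3 : ((⌈K * t⌉₊ : ℕ) : ℝ) ^ 3 ≤ (2 * (K * t)) ^ 3 := by gcongr
    have e5 : 162 * ((⌈K * t⌉₊ : ℕ) : ℝ) ^ 4 / Y ≤ 2592 * K ^ 4 * t ^ 4 / Y := by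
      apply div_le_div_of_nonneg_right _ hY0.le
      nlinarith
    nlinarith
  have d1 : ((B \ A).card : ℝ) ≤ C1.card + (C2.card + C3.card) := by
    have := (Finset.card_le_card hcov).trans ((Finset.card_union_le _ _).trans (Nat.add_le_add_left (Finset.card_union_le _ _) _))
    exact_mod_cast this
  have d2 : (A.card : ℝ) + (B \ A).card = B.card + (A \ B).card := by
    have h1 := Finset.card_sdiff_add_card_inter A B
    have h2 := Finset.card_sdiff_add_card_inter B A
    rw [Finset.inter_comm] at h2
    have : A.card + (B \ A).card = B.card + (A \ B).card := by omega
    exact_mod_cast this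
  have p1 : (0 : ℝ) ≤ ((A \ B).card : ℝ) := by positivity
  have p2 : (0 : ℝ) ≤ ((B \ A).card : ℝ) := by positivity
  have p3 : 0 ≤ 187500 * t ^ 4 / w := by positivity
  have p4 : 0 ≤ 2592 * K ^ 4 * t ^ 4 / Y + 112000 * K ^ 3 * t ^ 3 := by positivity
  have p5 : 0 ≤ 500000000 * t ^ 4 / (Y : ℝ) := by positivity
  rw [abs_le]
  constructor <;> linarith

end NH

namespace NH
open MeasureTheory Topology

theorem euler_two : Tendsto (fun n : ℕ => ∏ p ∈ Nat.primesBelow n, (1 - 1 / (p : ℝ) ^ 2)⁻¹) atTop (𝓝 (Real.pi ^ 2 / 6)) := by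
  let f : ℕ →*₀ ℝ :=
    { toFun := fun n => 1 / (n : ℝ) ^ 2
      map_zero' := by simp
      map_one' := by simp
      map_mul' := fun a b => by push_cast; rw [mul_pow, one_div_mul_one_div] }
  have hf : ∀ n : ℕ, f n = 1 / (n : ℝ) ^ 2 := fun n => rfl
  have hs : Summable (fun n => ‖f n‖) := by
    have := hasSum_zeta_two.summable
    refine this.congr fun n => ?_
    rw [hf, Real.norm_of_nonneg (by positivity)]
  have h := EulerProduct.eulerProduct_completely_multiplicative hs
  have e : ∑' n, f n = Real.pi ^ 2 / 6 := hasSum_zeta_two.tsum_eq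
  rw [e] at h
  exact h

theorem rY_tendsto : Tendsto rY atTop (𝓝 (12 / Real.pi ^ 2)) := by
  have h1 := (euler_two.comp (tendsto_add_atTop_nat 1)).inv₀ (by positivity)
  have h2 := h1.const_mul 2
  have e : 2 * (Real.pi ^ 2 / 6)⁻¹ = 12 / Real.pi ^ 2 := by field_simp; norm_num
  rw [e] at h2
  refine h2.congr' ?_
  filter_upwards [eventually_ge_atTop 2] with Y hY
  have hm : 2 ∈ Nat.primesBelow (Y + 1) := Nat.mem_primesBelow.2 ⟨by omega, Nat.prime_two⟩
  simp only [Function.comp, Finset.prod_inv_distrib, inv_inv, rY]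
  rw [← Finset.mul_prod_erase _ _ hm, ← Finset.mul_prod_erase _ rho hm, ← mul_assoc]
  congr 1
  · simp [rho]; norm_num
  · apply Finset.prod_congr rfl
    intro p hp
    rw [rho, if_neg (Finset.ne_of_mem_erase hp)]

theorem main_t {m N : ℕ} (hN : 0 < N) {ε : ℝ} (hε : 0 < ε) :
    ∀ᶠ t : ℝ in atTop, |((FS (t ^ 4) m N).ncard : ℝ) - 6 * (NP (t ^ 4) m N).card| ≤ ε * t ^ 4 := by
  have hpi := Real.pi_pos
  -- choose w
  have hw4 : Tendsto (fun w : ℝ => w ^ 4) atTop atTop := tendsto_pow_atTop (by norm_num)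
  have hV : Tendsto (fun w : ℝ => 12 / Real.pi ^ 2 * VT (w ^ 4)) atTop (𝓝 6) := by
    have := (VT_tendsto.comp hw4).const_mul (12 / Real.pi ^ 2)
    have e : 12 / Real.pi ^ 2 * (Real.pi ^ 2 / 2) = 6 := by field_simp; norm_num
    rwa [e] at this
  have hw1 : Tendsto (fun w : ℝ => 187500 / w) atTop (𝓝 0) := tendsto_const_nhds.div_atTop tendsto_id
  obtain ⟨w, hw, hwV, hwt⟩ := ((eventually_ge_atTop (1 : ℝ)).and ((hV.eventually (Metric.ball_mem_nhds _ (by positivity : 0 < ε / 8))).and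
    (hw1.eventually (Metric.ball_mem_nhds _ (by positivity : 0 < ε / 8))))).exists
  obtain ⟨K, hK, hbox⟩ := LL_box (w ^ 4)
  -- choose Y
  have hr : Tendsto (fun Y : ℕ => rY Y * VT (w ^ 4)) atTop (𝓝 (12 / Real.pi ^ 2 * VT (w ^ 4))) := rY_tendsto.mul_const _
  have hy1 : Tendsto (fun Y : ℕ => (2592 * K ^ 4 + 500000000 + 6) / (Y : ℝ)) atTop (𝓝 0) := tendsto_const_nhds.div_atTop tendsto_natCast_atTop_atTop
  obtain ⟨Y, hY3, hYN, hYr, hYt⟩ := ((eventually_ge_atTop 3).and ((eventually_ge_atTop N).and ((hr.eventually (Metric.ball_mem_nhds _ (by positivity : 0 < ε / 8))).and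
    (hy1.eventually (Metric.ball_mem_nhds _ (by positivity : 0 < ε / 8)))))).exists
  -- eventual in t
  have hL := LLA_count (m := m) hN hYN (by omega) (w ^ 4)
  have ht1 : Tendsto (fun t : ℝ => 112000 * K ^ 3 / t + (4800000 + 12 * MM N Y + 6) / t ^ 4) atTop (𝓝 (0 + 0)) :=
    (tendsto_const_nhds.div_atTop tendsto_id).add (tendsto_const_nhds.div_atTop hw4)
  rw [add_zero] at ht1
  filter_upwards [eventually_ge_atTop (1 : ℝ), hL.eventually (Metric.ball_mem_nhds _ (by positivity : 0 < ε / 8)),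
    ht1.eventually (Metric.ball_mem_nhds _ (by positivity : 0 < ε / 8))] with t ht htL htt
  have ht4 : 0 < t ^ 4 := by positivity
  have ht41 : 1 ≤ t ^ 4 := one_le_pow₀ ht
  have q1 := compare (m := m) (N := N) hY3 hw hK hbox ht
  have q2 := NP_approx ht41 (m := m) hN (by omega : 1 ≤ Y)
  simp only [Metric.mem_ball, Real.dist_eq, sub_zero] at hwV hwt hYr hYt htL htt
  set a : ℝ := (AR m N Y).card / MM N Y with ha
  have hMR : (0 : ℝ) < MM N Y := by exact_mod_cast MM_pos (Y := Y) hN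
  have ha0 : 0 ≤ a := by positivity
  have ha1 : a ≤ 1 := by rw [ha, div_le_one hMR]; exact AR_le
  set F : ℝ := ((FS (t ^ 4) m N).ncard : ℝ) with hF
  set L : ℝ := ({f | f ∈ LL (w ^ 4) t ∧ Adm m N Y (D4 f)}.ncard : ℝ) with hL'
  set n : ℝ := ((NP (t ^ 4) m N).card : ℝ) with hn
  set V := VT (w ^ 4)
  have hY0 : (0 : ℝ) < Y := by
    have : 0 < Y := by omega
    exact_mod_cast this
  -- rephrase
  have r1 : 187500 * t ^ 4 / w ≤ ε / 8 * t ^ 4 := by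
    have := le_of_lt ((le_abs_self _).trans_lt hwt)
    calc 187500 * t ^ 4 / w = 187500 / w * t ^ 4 := by ring
      _ ≤ _ := by gcongr
  have r2 : (2592 * K ^ 4 * t ^ 4 + 500000000 * t ^ 4 + 6 * t ^ 4) / Y ≤ ε / 8 * t ^ 4 := by
    have := le_of_lt ((le_abs_self _).trans_lt hYt)
    calc (2592 * K ^ 4 * t ^ 4 + 500000000 * t ^ 4 + 6 * t ^ 4) / Y = (2592 * K ^ 4 + 500000000 + 6) / (Y : ℝ) * t ^ 4 := by ring
      _ ≤ _ := by gcongr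
  have r3 : 112000 * K ^ 3 * t ^ 3 + (4800000 + 12 * MM N Y + 6) ≤ ε / 8 * t ^ 4 := by
    have := le_of_lt ((le_abs_self _).trans_lt htt)
    calc 112000 * K ^ 3 * t ^ 3 + (4800000 + 12 * MM N Y + 6) = (112000 * K ^ 3 / t + (4800000 + 12 * MM N Y + 6) / t ^ 4) * t ^ 4 := by
          field_simp
      _ ≤ _ := by gcongr
  have r4 : |L - V * (a * rY Y) * t ^ 4| ≤ ε / 8 * t ^ 4 := by
    have e : L - V * (a * rY Y) * t ^ 4 = (L / t ^ 4 - V * (a * rY Y)) * t ^ 4 := by field_simp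
    rw [e, abs_mul, abs_of_pos ht4]
    gcongr
  have r5 : |V * (a * rY Y) * t ^ 4 - 6 * (a * t ^ 4)| ≤ ε / 4 * t ^ 4 := by
    have e : V * (a * rY Y) * t ^ 4 - 6 * (a * t ^ 4) = a * (rY Y * V - 6) * t ^ 4 := by ring
    rw [e, abs_mul, abs_of_pos ht4, abs_mul, abs_of_nonneg ha0]
    have : |rY Y * V - 6| ≤ ε / 4 := by
      have := abs_sub_le (rY Y * V) (12 / Real.pi ^ 2 * V) 6
      linarith
    gcongr
    nlinarith [abs_nonneg (rY Y * V - 6)]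
  have e2 : (2592 * K ^ 4 * t ^ 4 + 500000000 * t ^ 4 + 6 * t ^ 4) / Y = 2592 * K ^ 4 * t ^ 4 / Y + 500000000 * t ^ 4 / Y + 6 * (t ^ 4 / Y) := by ring
  rw [e2] at r2
  rw [abs_le] at q1 q2 r4 r5 ⊢
  have hεt : 0 < ε * t ^ 4 := by positivity
  constructor <;> linarith [q1.1, q1.2, q2.1, q2.2, r4.1, r4.2, r5.1, r5.2]

theorem main_X {m N : ℕ} (hN : 0 < N) {ε : ℝ} (hε : 0 < ε) :
    ∀ᶠ X : ℝ in atTop, |((FS X m N).ncard : ℝ) - 6 * (NP X m N).card| ≤ ε * X := by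
  have h := (Real.tendsto_sqrt_atTop.comp Real.tendsto_sqrt_atTop).eventually (main_t (m := m) hN hε)
  filter_upwards [h, eventually_ge_atTop (0 : ℝ)] with X hX h0
  have e : (Function.comp Real.sqrt Real.sqrt X) ^ 4 = X := by
    rw [Function.comp, show 4 = 2 * 2 by norm_num, pow_mul, Real.sq_sqrt (Real.sqrt_nonneg _), Real.sq_sqrt h0]
  rwa [e] at hX

/-- the exceptional contribution of small discriminants -/
noncomputable def C0 : ℝ := ∑ Δ ∈ Finset.Ico (0 : ℤ) 24, ((h3 Δ : ℝ) + 1)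

theorem final_bound (X : ℝ) (m N : ℕ) :
    |6 * (∑ Δ ∈ NP X m N, (h3 Δ : ℝ)) - 8 * (NP X m N).card| ≤ |((FS X m N).ncard : ℝ) - 6 * (NP X m N).card| + 8 * C0 := by
  have h1 : ((FS X m N).ncard : ℝ) + 2 * ((NP X m N).filter fun Δ => 24 ≤ Δ).card = 6 * ∑ Δ ∈ (NP X m N).filter (fun Δ => 24 ≤ Δ), (h3 Δ : ℝ) := by
    exact_mod_cast FS_card X m N
  have h2 := Finset.sum_filter_add_sum_filter_not (NP X m N) (fun Δ => 24 ≤ Δ) (fun Δ => (h3 Δ : ℝ))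
  have h3' := Finset.card_filter_add_card_filter_not (s := NP X m N) (fun Δ => 24 ≤ Δ)
  have h4 : (((NP X m N).filter fun Δ => 24 ≤ Δ).card : ℝ) + ((NP X m N).filter fun Δ => ¬ 24 ≤ Δ).card = (NP X m N).card := by exact_mod_cast h3'
  have h5 : (∑ Δ ∈ (NP X m N).filter (fun Δ => ¬ 24 ≤ Δ), (h3 Δ : ℝ)) + ((NP X m N).filter fun Δ => ¬ 24 ≤ Δ).card ≤ C0 := by
    have e : (((NP X m N).filter fun Δ => ¬ 24 ≤ Δ).card : ℝ) = ∑ Δ ∈ (NP X m N).filter (fun Δ => ¬ 24 ≤ Δ), (1 : ℝ) := by simp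
    rw [e, ← Finset.sum_add_distrib, C0]
    apply Finset.sum_le_sum_of_subset_of_nonneg
    · intro Δ hΔ
      rw [Finset.mem_filter, mem_NP] at hΔ
      have := hΔ.1.1
      rw [Finset.mem_Ico]; omega
    · intros; positivity
  have h6 : 0 ≤ ∑ Δ ∈ (NP X m N).filter (fun Δ => ¬ 24 ≤ Δ), (h3 Δ : ℝ) := by positivity
  have h7 : (0 : ℝ) ≤ ((NP X m N).filter fun Δ => ¬ 24 ≤ Δ).card := by positivity
  have h8 := le_abs_self (((FS X m N).ncard : ℝ) - 6 * (NP X m N).card)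
  have h9 := neg_abs_le (((FS X m N).ncard : ℝ) - 6 * (NP X m N).card)
  rw [abs_le]
  constructor <;> linarith

end NH

/-- Theorem 1.3 (Nakagawa–Horie), positive discriminants: if `m, N` are positive integers
satisfying Condition (**), then the average of `h₃(Δ)` over fundamental discriminants
`Δ ∈ N⁺(X, m, N)` tends to `4/3` as `X → ∞`. -/
theorem nakagawa_horie_pos (m N : ℕ) (hm : 0 < m) (hN : 0 < N) (hss : CondStarStar m N) :
    Tendsto (fun X : ℝ =>
      (∑ᶠ Δ ∈ Nplus X m N, (h3 Δ : ℝ)) / (Nat.card (Nplus X m N) : ℝ))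
      atTop (nhds (4 / 3)) := by
  have e1 : ∀ X : ℝ, (∑ᶠ Δ ∈ Nplus X m N, (h3 Δ : ℝ)) = ∑ Δ ∈ NH.NP X m N, (h3 Δ : ℝ) := by
    intro X
    rw [← NH.coe_NP]
    exact finsum_mem_coe_finset _ _
  have e2 : ∀ X : ℝ, Nat.card (Nplus X m N) = (NH.NP X m N).card := by
    intro X
    rw [← NH.coe_NP, Nat.card_coe_set_eq, Set.ncard_coe_finset]
  simp only [e1, e2]
  obtain ⟨c, hc, hlow⟩ := NH.NP_lower hN hss
  rw [Metric.tendsto_nhds]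
  intro ε hε
  have hmain := NH.main_X (m := m) hN (by positivity : 0 < c * ε)
  filter_upwards [hlow, hmain, eventually_gt_atTop (0 : ℝ), eventually_ge_atTop (8 * NH.C0 / (c * ε))] with X h1 h2 hX0 h4
  have h5 := NH.final_bound X m N
  rw [div_le_iff₀ (by positivity)] at h4
  have hn : 0 < ((NH.NP X m N).card : ℝ) := lt_of_lt_of_le (by positivity) h1
  rw [Real.dist_eq]
  have e : (∑ Δ ∈ NH.NP X m N, (h3 Δ : ℝ)) / ((NH.NP X m N).card : ℝ) - 4 / 3 =
      (6 * (∑ Δ ∈ NH.NP X m N, (h3 Δ : ℝ)) - 8 * (NH.NP X m N).card) / (6 * (NH.NP X m N).card) := by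
    field_simp; ring
  rw [e, abs_div, abs_of_pos (by positivity : 0 < 6 * ((NH.NP X m N).card : ℝ)), div_lt_iff₀ (by positivity)]
  have := mul_le_mul_of_nonneg_left h1 hε.le
  have : 0 < ε * (c * X) := by positivity
  nlinarith
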